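/- For every fixed A > 0 there exist constants B = B(A) > 0 and C = C(A) > 0 such that for all real x ≥ 2, taking Q = x^{1/2}·(log x)^{−B}, one has ∑_{q ≤ Q} max_{a : gcd(a,q)=1} max_{2 ≤ y ≤ x} |π(y; q, a) − li y / φ(q)| ≤ C · x · (log x)^{−A}. -/

import Mathlib

/-- The number of primes `p ≤ y` with `p ≡ a (mod q)`, for real `y`. -/
noncomputable def primePiMod (y : ℝ) (q a : ℕ) : ℕ :=
  {p : ℕ | p.Prime ∧ (p : ℝ) ≤ y ∧ p ≡ a [MOD q]}.ncard

/-- The logarithmic integral `li y = ∫₂ʸ dt / log t`. -/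
noncomputable def li (y : ℝ) : ℝ := ∫ t in (2:ℝ)..y, 1 / Real.log t

namespace BombieriVinogradov
open Finset

/-- The additive character `e(x) = exp(2πix)` on the reals. -/
noncomputable def expo (x : ℝ) : ℂ := Complex.exp (2 * Real.pi * Complex.I * x)

lemma expo_add (x y : ℝ) : expo (x + y) = expo x * expo y := by
  rw [expo, expo, expo, ← Complex.exp_add]; push_cast; ring_nf

lemma expo_int (k : ℤ) : expo k = 1 := by
  rw [expo, Complex.exp_eq_one_iff]; exact ⟨k, by push_cast; ring⟩

lemma norm_expo (x : ℝ) : ‖expo x‖ = 1 := by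
  rw [expo, show (2 * Real.pi * Complex.I * x : ℂ) = ((2 * Real.pi * x : ℝ) : ℂ) * Complex.I by
    push_cast; ring, Complex.norm_exp_ofReal_mul_I]

lemma conj_expo (x : ℝ) : (starRingEnd ℂ) (expo x) = expo (-x) := by
  rw [expo, expo, ← Complex.exp_conj]; simp [Complex.conj_ofNat]

lemma expo_nat_mul (n : ℕ) (x : ℝ) : expo (n * x) = expo x ^ n := by
  rw [expo, expo, ← Complex.exp_nat_mul]; push_cast; ring_nf

lemma norm_expo_sub_one (x : ℝ) : ‖expo x - 1‖ = 2 * |Real.sin (Real.pi * x)| := by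
  rw [expo, show (2 * Real.pi * Complex.I * x : ℂ) = Complex.I * ((2 * Real.pi * x : ℝ) : ℂ) by
    push_cast; ring, Complex.norm_exp_I_mul_ofReal_sub_one, Real.norm_eq_abs, abs_mul]
  norm_num
  ring_nf

lemma norm_expo_sub_one_ge {f : ℝ} (h0 : 0 ≤ f) (h1 : f ≤ 1) :
    4 * min f (1 - f) ≤ ‖expo f - 1‖ := by
  have key : ∀ g : ℝ, 0 ≤ g → g ≤ 1 / 2 → 2 * g ≤ Real.sin (Real.pi * g) := by
    intro g hg hg'
    have := Real.mul_le_sin (x := Real.pi * g) (by positivity) (by nlinarith [Real.pi_pos])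
    calc 2 * g = 2 / Real.pi * (Real.pi * g) := by field_simp
      _ ≤ _ := this
  rw [norm_expo_sub_one]
  rcases le_total f (1 / 2) with h | h
  · have := key f h0 h
    have h2 := le_abs_self (Real.sin (Real.pi * f))
    have := min_le_left f (1 - f)
    linarith
  · have := key (1 - f) (by linarith) (by linarith)
    have h2 := le_abs_self (Real.sin (Real.pi * f))
    have h3 := min_le_right f (1 - f)
    rw [show Real.pi * (1 - f) = Real.pi - Real.pi * f by ring, Real.sin_pi_sub] at this
    linarith

lemma norm_geom_expo_le (H : ℕ) {x f : ℝ} (hf : f = Int.fract x) (h0 : 0 < f) :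
    ‖∑ h ∈ range H, expo (h * x)‖ ^ 2 ≤ 1 / 4 * (1 / f ^ 2 + 1 / (1 - f) ^ 2) := by
  have h1 : f < 1 := hf ▸ Int.fract_lt_one x
  have hx : expo x = expo f := by
    have : x = f + (⌊x⌋ : ℤ) := by rw [hf]; exact (Int.fract_add_floor x).symm
    rw [this, expo_add, expo_int, mul_one]
  have hne := norm_expo_sub_one_ge h0.le h1.le
  set m := min f (1 - f) with hm
  have hmpos : 0 < m := lt_min h0 (by linarith)
  have hg : (∑ h ∈ range H, expo (h * x)) * (expo f - 1) = expo f ^ H - 1 := by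
    rw [← geom_sum_mul]; congr 1
    exact sum_congr rfl fun h _ => by rw [expo_nat_mul, hx]
  have hle : ‖∑ h ∈ range H, expo (h * x)‖ * ‖expo f - 1‖ ≤ 2 := by
    rw [← norm_mul, hg]
    calc _ ≤ ‖expo f ^ H‖ + ‖(1 : ℂ)‖ := norm_sub_le _ _
      _ = 2 := by rw [norm_pow, norm_expo]; norm_num
  have h3 : ‖∑ h ∈ range H, expo (h * x)‖ ≤ 1 / (2 * m) := by
    rw [le_div_iff₀ (by positivity)]
    nlinarith [norm_nonneg (∑ h ∈ range H, expo (h * x))]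
  calc _ ≤ (1 / (2 * m)) ^ 2 := by gcongr
    _ = 1 / 4 * (1 / m ^ 2) := by field_simp; norm_num
    _ ≤ _ := by
      gcongr
      rcases min_choice f (1 - f) with h | h
      · rw [hm, h]; have : 0 ≤ 1 / (1 - f) ^ 2 := by positivity
        linarith
      · rw [hm, h]; have : 0 ≤ 1 / f ^ 2 := by positivity
        linarith

lemma sum_inv_sq_le (S : Finset ℕ) (hS : ∀ k ∈ S, 1 ≤ k) : ∑ k ∈ S, 1 / (k : ℝ) ^ 2 ≤ 2 := by
  have h1 : ∀ N : ℕ, 1 ≤ N → ∑ k ∈ Icc 1 N, 1 / (k : ℝ) ^ 2 ≤ 2 - 1 / (N : ℝ) := by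
    intro N hN
    induction N, hN using Nat.le_induction with
    | base => norm_num
    | succ n hn ih =>
      rw [sum_Icc_succ_top (by omega)]
      have hn' : (0 : ℝ) < n := by exact_mod_cast hn
      have : 1 / ((n + 1 : ℕ) : ℝ) ^ 2 ≤ 1 / n - 1 / ((n + 1 : ℕ) : ℝ) := by
        push_cast
        rw [div_sub_div _ _ (by positivity) (by positivity), div_le_div_iff₀ (by positivity) (by positivity)]
        nlinarith
      linarith
  calc _ ≤ ∑ k ∈ Icc 1 (S.sup id + 1), 1 / (k : ℝ) ^ 2 := by
        refine sum_le_sum_of_subset_of_nonneg (fun k hk => ?_) (fun _ _ _ => by positivity)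
        have : k ≤ S.sup id := le_sup (f := id) hk
        simp [hS k hk]; omega
    _ ≤ 2 - 1 / ((S.sup id + 1 : ℕ) : ℝ) := h1 _ (by omega)
    _ ≤ 2 := by have : (0 : ℝ) ≤ 1 / ((S.sup id + 1 : ℕ) : ℝ) := by positivity
                linarith

lemma sum_inv_sq_le_of_spaced {ι : Type*} (S : Finset ι) (f : ι → ℝ) {δ : ℝ} (hδ : 0 < δ)
    (hf : ∀ s ∈ S, δ ≤ f s) (hsp : ∀ s ∈ S, ∀ t ∈ S, s ≠ t → δ ≤ |f s - f t|) :
    ∑ s ∈ S, 1 / f s ^ 2 ≤ 2 / δ ^ 2 := by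
  have hinj : Set.InjOn (fun s => ⌊f s / δ⌋₊) S := by
    intro s hs t ht hst
    by_contra hne
    have h1 := hsp s hs t ht hne
    have hs0 : 0 ≤ f s / δ := div_nonneg (hδ.le.trans (hf s hs)) hδ.le
    have ht0 : 0 ≤ f t / δ := div_nonneg (hδ.le.trans (hf t ht)) hδ.le
    have a1 := Nat.floor_le hs0
    have a2 := Nat.lt_floor_add_one (f s / δ)
    have b1 := Nat.floor_le ht0
    have b2 := Nat.lt_floor_add_one (f t / δ)
    simp only at hst
    rw [hst] at a1 a2
    have : |f s / δ - f t / δ| < 1 := by rw [abs_lt]; constructor <;> linarith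
    rw [← sub_div, abs_div, abs_of_pos hδ, div_lt_one hδ] at this
    linarith
  calc ∑ s ∈ S, 1 / f s ^ 2 ≤ ∑ s ∈ S, 1 / δ ^ 2 * (1 / (⌊f s / δ⌋₊ : ℝ) ^ 2) := by
        refine sum_le_sum fun s hs => ?_
        have hfs := hf s hs
        have h1 : 1 ≤ ⌊f s / δ⌋₊ := by
          rw [Nat.one_le_floor_iff, le_div_iff₀ hδ]; linarith
        have h1' : (1 : ℝ) ≤ (⌊f s / δ⌋₊ : ℝ) := by exact_mod_cast h1
        have h2 := Nat.floor_le (div_nonneg (hδ.le.trans (hf s hs)) hδ.le)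
        rw [le_div_iff₀ hδ] at h2
        rw [one_div_mul_one_div, ← mul_pow]
        have : 0 < δ * (⌊f s / δ⌋₊ : ℝ) := by positivity
        gcongr
        linarith
    _ = 1 / δ ^ 2 * ∑ k ∈ S.image (fun s => ⌊f s / δ⌋₊), 1 / (k : ℝ) ^ 2 := by
        rw [sum_image hinj, mul_sum]
    _ ≤ 1 / δ ^ 2 * 2 := by
        gcongr
        refine sum_inv_sq_le _ fun k hk => ?_
        obtain ⟨s, hs, rfl⟩ := mem_image.1 hk
        rw [Nat.one_le_floor_iff, le_div_iff₀ hδ]; linarith [hf s hs]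
    _ = _ := by ring


lemma sum_double_le_of_schur {ι : Type*} (R : Finset ι) (c : ι → ℂ) (G : ι → ι → ℝ)
    (hG : ∀ r s, 0 ≤ G r s) (hsymm : ∀ r s, G r s = G s r) {K : ℝ}
    (hK : ∀ r ∈ R, ∑ s ∈ R, G r s ≤ K) :
    ∑ r ∈ R, ∑ s ∈ R, ‖c r‖ * ‖c s‖ * G r s ≤ K * ∑ r ∈ R, ‖c r‖ ^ 2 := by
  have h1 : ∑ r ∈ R, ∑ s ∈ R, ‖c r‖ * ‖c s‖ * G r s ≤
      ∑ r ∈ R, ∑ s ∈ R, (‖c r‖ ^ 2 * G r s / 2 + ‖c s‖ ^ 2 * G s r / 2) := by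
    refine sum_le_sum fun r _ => sum_le_sum fun s _ => ?_
    rw [hsymm s r]
    nlinarith [mul_nonneg (hG r s) (sq_nonneg (‖c r‖ - ‖c s‖))]
  have h2 : ∑ r ∈ R, ∑ s ∈ R, ‖c r‖ ^ 2 * G r s / 2 ≤ K / 2 * ∑ r ∈ R, ‖c r‖ ^ 2 := by
    rw [mul_sum]
    refine sum_le_sum fun r hr => ?_
    have := hK r hr
    calc ∑ s ∈ R, ‖c r‖ ^ 2 * G r s / 2 = ‖c r‖ ^ 2 / 2 * ∑ s ∈ R, G r s := by
          rw [mul_sum]; exact sum_congr rfl fun _ _ => by ring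
      _ ≤ ‖c r‖ ^ 2 / 2 * K := by gcongr
      _ = _ := by ring
  have h3 : ∑ r ∈ R, ∑ s ∈ R, (‖c r‖ ^ 2 * G r s / 2 + ‖c s‖ ^ 2 * G s r / 2) =
      ∑ r ∈ R, ∑ s ∈ R, ‖c r‖ ^ 2 * G r s / 2 + ∑ r ∈ R, ∑ s ∈ R, ‖c r‖ ^ 2 * G r s / 2 := by
    simp_rw [sum_add_distrib]
    congr 1
    exact sum_comm
  linarith

/-- Dual form of the additive large sieve. -/
lemma dual_large_sieve {ι : Type*} (R : Finset ι) (α : ι → ℝ) {δ : ℝ} (hδ : 0 < δ)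
    (hsp : ∀ r ∈ R, ∀ s ∈ R, r ≠ s → ∀ k : ℤ, δ ≤ |α r - α s - k|) (N : ℕ) (c : ι → ℂ) :
    ∑ n ∈ range N, ‖∑ r ∈ R, c r * expo (n * α r)‖ ^ 2 ≤
      5 * (N + 1 / δ + 1) * ∑ r ∈ R, ‖c r‖ ^ 2 := by
  classical
  set H₀ : ℕ := N + ⌈1 / δ⌉₊ with hH₀
  set H := H₀ + N with hH
  have hδinv : 1 / δ ≤ H₀ := by
    rw [hH₀]; push_cast; linarith [Nat.le_ceil (1 / δ), Nat.cast_nonneg (α := ℝ) N]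
  have hH₀pos : (0 : ℝ) < H₀ := lt_of_lt_of_le (by positivity) hδinv
  set g : ℤ → ℝ := fun n => ‖∑ r ∈ R, c r * expo (n * α r)‖ ^ 2 with hg
  set D : ℝ → ℂ := fun β => ∑ h ∈ range H, expo (h * β) with hD
  have hDneg : ∀ β, ‖D (-β)‖ = ‖D β‖ := by
    intro β
    rw [← Complex.norm_conj (D β)]
    congr 1
    simp only [hD, map_sum, conj_expo]
    exact sum_congr rfl fun _ _ => by ring_nf
  -- averaging over shifts
  have hshift : (H₀ : ℝ) * ∑ n ∈ range N, g n ≤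
      ∑ h' ∈ range H, ∑ h ∈ range H, g ((h : ℤ) - h') := by
    calc (H₀ : ℝ) * ∑ n ∈ range N, g n = ∑ h' ∈ range H₀, ∑ n ∈ range N, g n := by simp
      _ ≤ ∑ h' ∈ range H₀, ∑ h ∈ range H, g ((h : ℤ) - h') := by
          refine sum_le_sum fun h' hh' => ?_
          rw [mem_range] at hh'
          have : ∑ n ∈ range N, g n = ∑ h ∈ (range N).image (· + h'), g ((h : ℤ) - h') := by
            rw [sum_image (by intro a _ b _ h; simpa using h)]
            refine sum_congr rfl fun n _ => ?_
            congr 1; push_cast; ring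
          rw [this]
          refine sum_le_sum_of_subset_of_nonneg (fun h hh => ?_) (fun _ _ _ => by positivity)
          obtain ⟨n, hn, rfl⟩ := mem_image.1 hh
          rw [mem_range] at hn ⊢; omega
      _ ≤ _ := by
          refine sum_le_sum_of_subset_of_nonneg (range_mono (by omega)) fun _ _ _ =>
            sum_nonneg fun _ _ => by positivity
  have hexp : ((∑ h' ∈ range H, ∑ h ∈ range H, g ((h : ℤ) - h') : ℝ) : ℂ) =
      ∑ r ∈ R, ∑ s ∈ R, c r * (starRingEnd ℂ) (c s) * (‖D (α r - α s)‖ ^ 2 : ℝ) := by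
    have hgexp : ∀ n : ℤ, (g n : ℂ) = ∑ r ∈ R, ∑ s ∈ R,
        c r * (starRingEnd ℂ) (c s) * expo (n * (α r - α s)) := by
      intro n
      have hee : ∀ r s, expo (n * (α r - α s)) = expo (n * α r) * expo (-(n * α s)) := fun r s => by
        rw [← expo_add]; ring_nf
      simp only [hg, hee]
      rw [Complex.ofReal_pow, ← Complex.mul_conj', map_sum, sum_mul_sum]
      refine sum_congr rfl fun r _ => sum_congr rfl fun s _ => ?_
      rw [map_mul, conj_expo]; ring
    push_cast
    simp_rw [hgexp]
    calc _ = ∑ r ∈ R, ∑ s ∈ R, ∑ h' ∈ range H, ∑ h ∈ range H,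
          c r * (starRingEnd ℂ) (c s) * expo (((h : ℤ) - (h' : ℤ) : ℤ) * (α r - α s)) := by
          rw [sum_congr rfl fun h' _ => sum_comm]
          rw [sum_comm]
          refine sum_congr rfl fun r _ => ?_
          rw [sum_congr rfl fun h' _ => sum_comm]
          rw [sum_comm]
      _ = _ := by
          refine sum_congr rfl fun r _ => sum_congr rfl fun s _ => ?_
          rw [← Complex.ofReal_pow, Complex.ofReal_pow, ← Complex.mul_conj']
          simp only [hD, map_sum, conj_expo]
          rw [sum_mul_sum, mul_sum, sum_comm]
          refine sum_congr rfl fun h _ => ?_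
          rw [mul_sum]
          refine sum_congr rfl fun h' _ => ?_
          rw [← expo_add]; push_cast; ring_nf
  have hle : ∑ h' ∈ range H, ∑ h ∈ range H, g ((h : ℤ) - h') ≤
      ∑ r ∈ R, ∑ s ∈ R, ‖c r‖ * ‖c s‖ * ‖D (α r - α s)‖ ^ 2 := by
    have h0 : (0 : ℝ) ≤ ∑ h' ∈ range H, ∑ h ∈ range H, g ((h : ℤ) - h') :=
      sum_nonneg fun _ _ => sum_nonneg fun _ _ => by positivity
    rw [← Complex.norm_of_nonneg h0, hexp]
    refine (norm_sum_le _ _).trans (sum_le_sum fun r _ => (norm_sum_le _ _).trans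
      (sum_le_sum fun s _ => ?_))
    rw [norm_mul, norm_mul, Complex.norm_conj, Complex.norm_of_nonneg (by positivity)]
  have hrow : ∀ r ∈ R, ∑ s ∈ R, ‖D (α r - α s)‖ ^ 2 ≤ (H : ℝ) ^ 2 + 1 / δ ^ 2 := by
    intro r hr
    have hfr : ∀ s ∈ R.erase r, δ ≤ Int.fract (α r - α s) ∧ δ ≤ 1 - Int.fract (α r - α s) := by
      intro s hs
      obtain ⟨hsr, hs⟩ := mem_erase.1 hs
      have h1 := hsp r hr s hs hsr.symm ⌊α r - α s⌋
      have h2 := hsp r hr s hs hsr.symm (⌊α r - α s⌋ + 1)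
      have h3 : α r - α s - ⌊α r - α s⌋ = Int.fract (α r - α s) := rfl
      rw [h3, abs_of_nonneg (Int.fract_nonneg _)] at h1
      rw [show α r - α s - ((⌊α r - α s⌋ + 1 : ℤ) : ℝ) = -(1 - Int.fract (α r - α s)) by
        rw [← h3]; push_cast; ring, abs_neg,
        abs_of_nonneg (by linarith [Int.fract_lt_one (α r - α s)])] at h2
      exact ⟨h1, h2⟩
    have hdist : ∀ s ∈ R.erase r, ∀ t ∈ R.erase r, s ≠ t →
        δ ≤ |Int.fract (α r - α s) - Int.fract (α r - α t)| := by
      intro s hs t ht hst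
      have h1 := hsp t (mem_erase.1 ht).2 s (mem_erase.1 hs).2 hst.symm
        (⌊α r - α s⌋ - ⌊α r - α t⌋)
      convert h1 using 2
      rw [Int.fract, Int.fract]; push_cast; ring
    rw [← add_sum_erase _ _ hr]
    have hdiag : ‖D (α r - α r)‖ ^ 2 ≤ (H : ℝ) ^ 2 := by
      gcongr
      refine (norm_sum_le _ _).trans ?_
      simp [norm_expo]
    have hoff : ∑ s ∈ R.erase r, ‖D (α r - α s)‖ ^ 2 ≤ 1 / δ ^ 2 := by
      calc _ ≤ ∑ s ∈ R.erase r, 1 / 4 * (1 / Int.fract (α r - α s) ^ 2 +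
            1 / (1 - Int.fract (α r - α s)) ^ 2) :=
            sum_le_sum fun s hs => norm_geom_expo_le H rfl (hδ.trans_le (hfr s hs).1)
        _ ≤ 1 / 4 * (2 / δ ^ 2 + 2 / δ ^ 2) := by
            rw [← mul_sum, sum_add_distrib]
            gcongr
            · exact sum_inv_sq_le_of_spaced _ _ hδ (fun s hs => (hfr s hs).1) hdist
            · refine sum_inv_sq_le_of_spaced _ _ hδ (fun s hs => (hfr s hs).2) fun s hs t ht h => ?_
              rw [show ∀ a b : ℝ, (1 - a) - (1 - b) = -(a - b) by intros; ring, abs_neg]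
              exact hdist s hs t ht h
        _ = _ := by ring
    linarith
  have hschur := sum_double_le_of_schur R c (fun r s => ‖D (α r - α s)‖ ^ 2)
    (fun _ _ => by positivity) (fun r s => by
      rw [← neg_sub (α s) (α r), hDneg]) hrow
  have hsum : (0 : ℝ) ≤ ∑ r ∈ R, ‖c r‖ ^ 2 := sum_nonneg fun _ _ => by positivity
  have hN : ∑ n ∈ range N, ‖∑ r ∈ R, c r * expo (n * α r)‖ ^ 2 = ∑ n ∈ range N, g n := by
    simp [hg]
  rw [hN]
  have hfin : (H₀ : ℝ) * ∑ n ∈ range N, g n ≤ H₀ * (5 * H₀ * ∑ r ∈ R, ‖c r‖ ^ 2) := by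
    calc _ ≤ ((H : ℝ) ^ 2 + 1 / δ ^ 2) * ∑ r ∈ R, ‖c r‖ ^ 2 := hshift.trans (hle.trans hschur)
      _ ≤ ((2 * H₀ : ℝ) ^ 2 + (H₀ : ℝ) ^ 2) * ∑ r ∈ R, ‖c r‖ ^ 2 := by
          gcongr
          · rw [hH]; push_cast
            have : (N : ℝ) ≤ H₀ := by exact_mod_cast (by omega : N ≤ H₀)
            linarith
          · rw [← one_div_pow]; gcongr
      _ = _ := by ring
  refine (le_of_mul_le_mul_left hfin hH₀pos).trans ?_
  gcongr
  rw [hH₀]; push_cast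
  linarith [Nat.ceil_lt_add_one (a := 1 / δ) (by positivity)]

lemma duality_principle {ι κ : Type*} (R : Finset ι) (S : Finset κ) (x : ι → κ → ℂ) {K : ℝ}
    (hK : 0 ≤ K)
    (h : ∀ c : ι → ℂ, ∑ n ∈ S, ‖∑ r ∈ R, c r * x r n‖ ^ 2 ≤ K * ∑ r ∈ R, ‖c r‖ ^ 2) (a : κ → ℂ) :
    ∑ r ∈ R, ‖∑ n ∈ S, a n * x r n‖ ^ 2 ≤ K * ∑ n ∈ S, ‖a n‖ ^ 2 := by
  set T : ι → ℂ := fun r => ∑ n ∈ S, a n * x r n with hT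
  set X := ∑ r ∈ R, ‖T r‖ ^ 2 with hX
  set A := ∑ n ∈ S, ‖a n‖ ^ 2 with hA
  have hX0 : 0 ≤ X := sum_nonneg fun _ _ => by positivity
  have hA0 : 0 ≤ A := sum_nonneg fun _ _ => by positivity
  have h1 : (X : ℂ) = ∑ n ∈ S, a n * ∑ r ∈ R, (starRingEnd ℂ) (T r) * x r n := by
    simp_rw [mul_sum]
    rw [sum_comm, hX]
    push_cast
    refine sum_congr rfl fun r _ => ?_
    rw [← Complex.mul_conj']
    conv_lhs => rw [hT]
    rw [sum_mul]
    exact sum_congr rfl fun n _ => by ring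
  have h2 : X ≤ ∑ n ∈ S, ‖a n‖ * ‖∑ r ∈ R, (starRingEnd ℂ) (T r) * x r n‖ := by
    rw [← Complex.norm_of_nonneg hX0, h1]
    refine (norm_sum_le _ _).trans (le_of_eq (sum_congr rfl fun n _ => norm_mul _ _))
  have h3 : X ^ 2 ≤ A * (K * X) := by
    calc X ^ 2 ≤ (∑ n ∈ S, ‖a n‖ * ‖∑ r ∈ R, (starRingEnd ℂ) (T r) * x r n‖) ^ 2 := by gcongr
      _ ≤ A * ∑ n ∈ S, ‖∑ r ∈ R, (starRingEnd ℂ) (T r) * x r n‖ ^ 2 := sum_mul_sq_le_sq_mul_sq _ _ _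
      _ ≤ A * (K * X) := by
          gcongr
          have := h fun r => (starRingEnd ℂ) (T r)
          simpa [Complex.norm_conj] using this
  rcases hX0.eq_or_lt with h0 | h0
  · rw [← h0]; positivity
  · exact le_of_mul_le_mul_right (by nlinarith) h0

lemma additive_large_sieve {ι : Type*} (R : Finset ι) (α : ι → ℝ) {δ : ℝ} (hδ : 0 < δ)
    (hsp : ∀ r ∈ R, ∀ s ∈ R, r ≠ s → ∀ k : ℤ, δ ≤ |α r - α s - k|) (N : ℕ)
    (a : ℕ → ℂ) :
    ∑ r ∈ R, ‖∑ n ∈ range N, a n * expo (n * α r)‖ ^ 2 ≤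
      5 * (N + 1 / δ + 1) * ∑ n ∈ range N, ‖a n‖ ^ 2 :=
  duality_principle R (range N) (fun r n => expo (n * α r)) (by positivity)
    (dual_large_sieve R α hδ hsp N) a

end BombieriVinogradov

namespace BombieriVinogradov
open Finset

lemma farey_spacing {Q q q' a a' : ℕ} (hq : q ∈ Icc 1 Q) (hq' : q' ∈ Icc 1 Q) (ha : a < q)
    (ha' : a' < q') (hc : a.Coprime q) (hc' : a'.Coprime q') (hne : (q, a) ≠ (q', a')) (k : ℤ) :
    1 / (Q : ℝ) ^ 2 ≤ |(a : ℝ) / q - (a' : ℝ) / q' - k| := by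
  rw [mem_Icc] at hq hq'
  have hqp : (0 : ℝ) < q := by exact_mod_cast hq.1
  have hqp' : (0 : ℝ) < q' := by exact_mod_cast hq'.1
  have hz : (a * q' - a' * q - k * q * q' : ℤ) ≠ 0 := by
    intro h
    have h1 : (a : ℝ) / q - (a' : ℝ) / q' = k := by
      have : (a * q' - a' * q - k * q * q' : ℝ) = 0 := by exact_mod_cast h
      field_simp; linarith
    have b1 : (a : ℝ) / q < 1 := by rw [div_lt_one hqp]; exact_mod_cast ha
    have b2 : (a' : ℝ) / q' < 1 := by rw [div_lt_one hqp']; exact_mod_cast ha'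
    have b3 : (0 : ℝ) ≤ (a : ℝ) / q := by positivity
    have b4 : (0 : ℝ) ≤ (a' : ℝ) / q' := by positivity
    have k1 : (k : ℝ) < 1 := by linarith
    have k2 : (-1 : ℝ) < k := by linarith
    have hk : k = 0 := by
      have : k < 1 := by exact_mod_cast k1
      have : -1 < k := by exact_mod_cast k2
      omega
    rw [hk] at h
    have h2 : a * q' = a' * q := by zify; linarith
    have d1 : q ∣ q' := hc.symm.dvd_of_dvd_mul_left ⟨a', by rw [h2, mul_comm]⟩
    have d2 : q' ∣ q := hc'.symm.dvd_of_dvd_mul_left ⟨a, by rw [← h2, mul_comm]⟩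
    have e := Nat.dvd_antisymm d1 d2
    subst e
    exact hne (by rw [Nat.eq_of_mul_eq_mul_right (by omega) h2])
  have h1 : (1 : ℝ) ≤ |(a * q' - a' * q - k * q * q' : ℝ)| := by
    exact_mod_cast Int.one_le_abs hz
  have h2 : (a : ℝ) / q - (a' : ℝ) / q' - k = (a * q' - a' * q - k * q * q') / (q * q') := by
    field_simp
  rw [h2, abs_div, abs_of_pos (by positivity : (0 : ℝ) < q * q')]
  have : (q * q' : ℝ) ≤ (Q : ℝ) ^ 2 := by
    rw [sq]; gcongr
    · exact hq.2
    · exact hq'.2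
  gcongr

lemma farey_large_sieve (Q N : ℕ) (hQ : 1 ≤ Q) (a : ℕ → ℂ) :
    ∑ q ∈ Icc 1 Q, ∑ b ∈ (range q).filter (·.Coprime q),
      ‖∑ n ∈ range N, a n * expo (n * ((b : ℝ) / q))‖ ^ 2 ≤
      5 * (N + Q ^ 2 + 1) * ∑ n ∈ range N, ‖a n‖ ^ 2 := by
  have hQ' : (0 : ℝ) < Q := by exact_mod_cast hQ
  have := additive_large_sieve ((Icc 1 Q).sigma fun q => (range q).filter (·.Coprime q))
    (fun p => (p.2 : ℝ) / p.1) (δ := 1 / (Q : ℝ) ^ 2) (by positivity) ?_ N a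
  · rw [sum_sigma, one_div_one_div] at this
    exact this
  · rintro ⟨q, b⟩ hr ⟨q', b'⟩ hs hne k
    simp only [mem_sigma, mem_filter, mem_range] at hr hs
    refine farey_spacing hr.1 hs.1 hr.2.1 hs.2.1 hr.2.2 hs.2.2 ?_ k
    rintro h
    simp only [Prod.mk.injEq] at h
    exact hne (by rw [h.1, h.2])

lemma char_norm_sq_units {q : ℕ} (χ : DirichletCharacter ℂ q) (u : (ZMod q)ˣ) :
    χ u * (starRingEnd ℂ) (χ u) = 1 := by
  rw [Complex.mul_conj', χ.unit_norm_eq_one u]; norm_num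

lemma char_inv_units {q : ℕ} (χ : DirichletCharacter ℂ q) (u : (ZMod q)ˣ) :
    χ⁻¹ u = (starRingEnd ℂ) (χ u) := by
  rw [← MulChar.star_eq_inv, MulChar.star_apply]; rfl

lemma primitive_inv {q : ℕ} {χ : DirichletCharacter ℂ q} (hχ : χ.IsPrimitive) : χ⁻¹.IsPrimitive := by
  rw [DirichletCharacter.isPrimitive_def, DirichletCharacter.conductor_inv]; exact hχ

section OneModulus
variable {q : ℕ} [NeZero q]

lemma sum_units_eq (f : ZMod q → ℂ) (hf : ∀ a, ¬ IsUnit a → f a = 0) :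
    ∑ a, f a = ∑ u : (ZMod q)ˣ, f u := by
  classical
  have : ∑ u : (ZMod q)ˣ, f u = ∑ a ∈ univ.image (fun u : (ZMod q)ˣ => (u : ZMod q)), f a :=
    (sum_image (by intro u _ v _ h; exact Units.ext h)).symm
  rw [this]
  symm
  refine sum_subset (subset_univ _) fun a _ ha => hf a fun hu => ha ?_
  obtain ⟨u, rfl⟩ := hu
  simp

/-- Parseval's identity on the group of Dirichlet characters. -/
lemma parseval_characters (S : (ZMod q)ˣ → ℂ) :
    ∑ χ : DirichletCharacter ℂ q, ‖∑ u : (ZMod q)ˣ, χ u * S u‖ ^ 2 =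
      q.totient * ∑ u, ‖S u‖ ^ 2 := by
  classical
  have : ((∑ χ : DirichletCharacter ℂ q, ‖∑ u : (ZMod q)ˣ, χ u * S u‖ ^ 2 : ℝ) : ℂ) =
      ((q.totient * ∑ u, ‖S u‖ ^ 2 : ℝ) : ℂ) := by
    push_cast
    simp_rw [← Complex.mul_conj', map_sum, sum_mul_sum]
    rw [sum_comm, mul_sum]
    refine sum_congr rfl fun u _ => ?_
    rw [sum_comm]
    have key : ∀ v : (ZMod q)ˣ, ∑ χ : DirichletCharacter ℂ q,
        χ u * S u * (starRingEnd ℂ) (χ v * S v) =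
        S u * (starRingEnd ℂ) (S v) * if u = v then (q.totient : ℂ) else 0 := by
      intro v
      have h := DirichletCharacter.sum_characters_eq ℂ (n := q) (((u * v⁻¹ : (ZMod q)ˣ)) : ZMod q)
      have h2 : (((u * v⁻¹ : (ZMod q)ˣ)) : ZMod q) = 1 ↔ u = v := by
        rw [Units.val_eq_one, mul_inv_eq_one]
      simp only [h2] at h
      rw [← h, mul_sum]
      refine sum_congr rfl fun χ _ => ?_
      have : χ ((u * v⁻¹ : (ZMod q)ˣ)) = χ u * (starRingEnd ℂ) (χ v) := by
        rw [Units.val_mul, map_mul, ← char_inv_units, MulChar.inv_apply, Ring.inverse_unit]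
      rw [this, map_mul]; ring
    simp_rw [key]
    simp [mul_comm]
  exact_mod_cast this

lemma gaussSum_twist {χ : DirichletCharacter ℂ q} (hχ : χ.IsPrimitive) (n : ZMod q) :
    ∑ u : (ZMod q)ˣ, χ u * ZMod.stdAddChar ((u : ZMod q) * n) =
      χ⁻¹ n * gaussSum χ ZMod.stdAddChar := by
  rw [← gaussSum_mulShift_of_isPrimitive _ hχ, gaussSum, sum_units_eq]
  · exact sum_congr rfl fun u _ => by rw [AddChar.mulShift_apply, mul_comm n]
  · intro a ha; rw [MulChar.map_nonunit _ ha, zero_mul]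

lemma norm_gaussSum_sq {χ : DirichletCharacter ℂ q} (hχ : χ.IsPrimitive) :
    ‖gaussSum χ ZMod.stdAddChar‖ ^ 2 = q := by
  classical
  have h1 : ∑ n : ZMod q, ‖∑ u : (ZMod q)ˣ, χ u * ZMod.stdAddChar ((u : ZMod q) * n)‖ ^ 2 =
      q.totient * ‖gaussSum χ ZMod.stdAddChar‖ ^ 2 := by
    simp_rw [gaussSum_twist hχ, norm_mul, mul_pow]
    rw [← sum_mul]
    congr 1
    have := sum_units_eq (q := q) (fun a => ((‖χ⁻¹ a‖ ^ 2 : ℝ) : ℂ))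
      (fun a ha => by simp [MulChar.map_nonunit _ ha])
    have h2 : ∑ a : ZMod q, ‖χ⁻¹ a‖ ^ 2 = ∑ u : (ZMod q)ˣ, ‖χ⁻¹ u‖ ^ 2 := by exact_mod_cast this
    rw [h2]
    simp_rw [DirichletCharacter.unit_norm_eq_one]
    simp [ZMod.card_units_eq_totient]
  have h2 : ((∑ n : ZMod q, ‖∑ u : (ZMod q)ˣ, χ u * ZMod.stdAddChar ((u : ZMod q) * n)‖ ^ 2 : ℝ) : ℂ)
      = ((q.totient * q : ℝ) : ℂ) := by
    push_cast
    simp_rw [← Complex.mul_conj', map_sum, sum_mul_sum]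
    rw [sum_comm]
    have key : ∀ u v : (ZMod q)ˣ, ∑ n : ZMod q, χ u * ZMod.stdAddChar ((u : ZMod q) * n) *
        (starRingEnd ℂ) (χ v * ZMod.stdAddChar ((v : ZMod q) * n)) =
        χ u * (starRingEnd ℂ) (χ v) * if u = v then (q : ℂ) else 0 := by
      intro u v
      have h := AddChar.sum_mulShift ((u : ZMod q) - (v : ZMod q)) (ZMod.isPrimitive_stdAddChar q)
      simp only [sub_eq_zero, Units.val_inj] at h
      have h' : (if u = v then (q : ℂ) else 0) = ∑ x : ZMod q, ZMod.stdAddChar (x * ((u : ZMod q) - (v : ZMod q))) := by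
        rw [h, ZMod.card]; split_ifs <;> simp
      rw [h', mul_sum]
      refine sum_congr rfl fun n _ => ?_
      rw [map_mul (starRingEnd ℂ), ← AddChar.map_neg_eq_conj,
        show n * ((u : ZMod q) - (v : ZMod q)) = (u : ZMod q) * n + -((v : ZMod q) * n) by ring,
        AddChar.map_add_eq_mul]
      ring
    have : ∀ u : (ZMod q)ˣ, ∑ n : ZMod q, ∑ v : (ZMod q)ˣ, χ u * ZMod.stdAddChar ((u : ZMod q) * n) *
        (starRingEnd ℂ) (χ v * ZMod.stdAddChar ((v : ZMod q) * n)) = q := by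
      intro u
      rw [sum_comm]
      simp_rw [key]
      simp [char_norm_sq_units]
    simp_rw [this]
    simp [ZMod.card_units_eq_totient]
  have h3 : (q.totient : ℝ) * ‖gaussSum χ ZMod.stdAddChar‖ ^ 2 = q.totient * q := by
    rw [← h1]; exact_mod_cast h2
  have : (q.totient : ℝ) ≠ 0 := by
    exact_mod_cast (Nat.totient_pos.2 (NeZero.pos q)).ne'
  exact mul_left_cancel₀ this h3

lemma stdAddChar_eq_expo (u : (ZMod q)ˣ) (n : ℕ) :
    ZMod.stdAddChar ((u : ZMod q) * (n : ZMod q)) = expo (n * (((u : ZMod q).val : ℝ) / q)) := by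
  have : (u : ZMod q) * (n : ZMod q) = (((u : ZMod q).val * n : ℤ) : ZMod q) := by
    push_cast; rw [ZMod.natCast_zmod_val]
  rw [this, ZMod.stdAddChar_coe, expo]
  congr 1; push_cast; ring

lemma sum_units_eq_sum_coprime (f : ℕ → ℝ) :
    ∑ u : (ZMod q)ˣ, f (u : ZMod q).val = ∑ b ∈ (range q).filter (·.Coprime q), f b := by
  refine sum_nbij (fun u : (ZMod q)ˣ => (u : ZMod q).val) ?_ ?_ ?_ (fun _ _ => rfl)
  · intro u _
    simp only [mem_filter, mem_range]
    exact ⟨ZMod.val_lt _, ZMod.val_coe_unit_coprime u⟩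
  · intro u _ v _ h
    exact Units.ext (ZMod.val_injective q h)
  · intro b hb
    simp only [coe_filter, mem_range, Set.mem_ofPred_eq] at hb
    refine ⟨ZMod.unitOfCoprime b hb.2, mem_coe.2 (mem_univ _), ?_⟩
    simp [ZMod.val_natCast, Nat.mod_eq_of_lt hb.1]

lemma sum_primitive_le (N : ℕ) (a : ℕ → ℂ) [DecidablePred (DirichletCharacter.IsPrimitive (R := ℂ) (n := q))] :
    (q : ℝ) / q.totient * ∑ χ : DirichletCharacter ℂ q with χ.IsPrimitive,
      ‖∑ n ∈ range N, a n * χ n‖ ^ 2 ≤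
    ∑ b ∈ (range q).filter (·.Coprime q), ‖∑ n ∈ range N, a n * expo (n * ((b : ℝ) / q))‖ ^ 2 := by
  have htot : (0 : ℝ) < q.totient := by exact_mod_cast Nat.totient_pos.2 (NeZero.pos q)
  rw [div_mul_eq_mul_div, div_le_iff₀ htot, mul_comm _ (q.totient : ℝ),
    ← sum_units_eq_sum_coprime (fun b => ‖∑ n ∈ range N, a n * expo (n * ((b : ℝ) / q))‖ ^ 2),
    ← parseval_characters (fun u : (ZMod q)ˣ => ∑ n ∈ range N, a n * expo (n * (((u : ZMod q).val : ℝ) / q)))]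
  have hinv : ∑ χ : DirichletCharacter ℂ q, ‖∑ u : (ZMod q)ˣ, χ u *
      ∑ n ∈ range N, a n * expo (n * (((u : ZMod q).val : ℝ) / q))‖ ^ 2 =
      ∑ χ : DirichletCharacter ℂ q, ‖∑ u : (ZMod q)ˣ, χ⁻¹ u *
      ∑ n ∈ range N, a n * expo (n * (((u : ZMod q).val : ℝ) / q))‖ ^ 2 :=
    (Equiv.sum_comp (Equiv.inv (DirichletCharacter ℂ q)) (fun χ => ‖∑ u : (ZMod q)ˣ, χ u *
      ∑ n ∈ range N, a n * expo (n * (((u : ZMod q).val : ℝ) / q))‖ ^ 2)).symm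
  rw [hinv, mul_sum]
  refine (sum_le_sum fun χ hχ => le_of_eq ?_).trans
    (sum_le_sum_of_subset_of_nonneg (filter_subset _ _) fun _ _ _ => by positivity)
  have hχ := (mem_filter.1 hχ).2
  refine (congrArg (· * _) (norm_gaussSum_sq (primitive_inv hχ)).symm).trans ?_
  simp only [← mul_pow, ← norm_mul]
  congr 2
  simp_rw [mul_sum]
  rw [sum_comm]
  refine sum_congr rfl fun n _ => ?_
  have := gaussSum_twist (primitive_inv hχ) (n : ZMod q)
  rw [inv_inv] at this
  calc _ = a n * (χ n * gaussSum χ⁻¹ ZMod.stdAddChar) := by ring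
    _ = _ := by
      rw [← this, mul_sum]
      exact sum_congr rfl fun u _ => by rw [stdAddChar_eq_expo]; ring

end OneModulus

open Classical in
/-- The finite set of primitive Dirichlet characters modulo `q` (empty for `q = 0`). -/
noncomputable def primChars (q : ℕ) : Finset (DirichletCharacter ℂ q) :=
  if h : q = 0 then ∅ else
    haveI : NeZero q := ⟨h⟩
    univ.filter (·.IsPrimitive)

lemma primChars_eq {q : ℕ} [NeZero q] [DecidablePred (DirichletCharacter.IsPrimitive (R := ℂ) (n := q))] :
    primChars q = univ.filter (·.IsPrimitive) := by
  rw [primChars, dif_neg (NeZero.ne q)]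
  congr

lemma mem_primChars {q : ℕ} [NeZero q] {χ : DirichletCharacter ℂ q} :
    χ ∈ primChars q ↔ χ.IsPrimitive := by
  classical
  rw [primChars_eq, mem_filter]; simp

lemma card_primChars_le (q : ℕ) : (primChars q).card ≤ q.totient := by
  classical
  rcases eq_or_ne q 0 with rfl | h
  · simp [primChars]
  have : NeZero q := ⟨h⟩
  rw [← DirichletCharacter.card_eq_totient_of_hasEnoughRootsOfUnity ℂ q, Nat.card_eq_fintype_card]
  exact card_le_univ _

/-- The multiplicative large sieve inequality. -/
theorem large_sieve (Q N : ℕ) (hQ : 1 ≤ Q) (a : ℕ → ℂ) :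
    ∑ q ∈ Icc 1 Q, (q : ℝ) / q.totient * ∑ χ ∈ primChars q, ‖∑ n ∈ range N, a n * χ n‖ ^ 2 ≤
      5 * (N + Q ^ 2 + 1) * ∑ n ∈ range N, ‖a n‖ ^ 2 := by
  classical
  refine (sum_le_sum fun q hq => ?_).trans (farey_large_sieve Q N hQ a)
  have : NeZero q := ⟨by have := (mem_Icc.1 hq).1; omega⟩
  rw [primChars_eq]
  exact sum_primitive_le N a

end BombieriVinogradov

namespace BombieriVinogradov
open Finset Complex MeasureTheory

/-- The kernel `1 / (s (s + 1))` on the vertical line `Re s = σ`. -/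
noncomputable def perronKernel (σ t : ℝ) : ℂ :=
  1 / ((σ + t * I : ℂ) * ((σ + t * I : ℂ) + 1))

lemma vertical_ne_zero {σ : ℝ} (hσ : 0 < σ) (t : ℝ) : (σ + t * I : ℂ) ≠ 0 := by
  intro h
  have := congrArg re h
  simp at this
  linarith

lemma vertical_add_one_ne_zero {σ : ℝ} (hσ : 0 < σ) (t : ℝ) : (σ + t * I : ℂ) + 1 ≠ 0 := by
  intro h
  have := congrArg re h
  simp at this
  linarith

lemma continuous_perronKernel {σ : ℝ} (hσ : 0 < σ) : Continuous (perronKernel σ) := by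
  unfold perronKernel
  refine continuous_const.div (by fun_prop) fun t => ?_
  exact mul_ne_zero (vertical_ne_zero hσ t) (vertical_add_one_ne_zero hσ t)

lemma one_add_sq_le_norm_vertical_sq {σ : ℝ} (hσ : 0 < σ) (t : ℝ) :
    1 + t ^ 2 ≤ ‖(σ + t * I : ℂ) + 1‖ ^ 2 := by
  rw [← normSq_eq_norm_sq, normSq_apply]
  simp
  nlinarith

lemma norm_perronKernel_le {σ : ℝ} (hσ : 0 < σ) (hσ1 : σ ≤ 1) (t : ℝ) :
    ‖perronKernel σ t‖ ≤ 2 / σ * (1 + t ^ 2)⁻¹ := by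
  have h1 := one_add_sq_le_norm_vertical_sq hσ t
  have h2 : σ ≤ ‖(σ + t * I : ℂ)‖ := by
    refine le_trans ?_ (re_le_norm _)
    simp
  have h3 : ‖(σ + t * I : ℂ) + 1‖ ≤ ‖(σ + t * I : ℂ)‖ + 1 := by
    simpa using norm_add_le (σ + t * I : ℂ) 1
  have h4 : 0 < 1 + t ^ 2 := by positivity
  rw [perronKernel, norm_div, norm_one, norm_mul, ← div_eq_mul_inv, div_div]
  set u := ‖(σ + t * I : ℂ)‖
  set v := ‖(σ + t * I : ℂ) + 1‖
  have hv : 0 ≤ v := norm_nonneg _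
  have h5 : σ * v ≤ 2 * u := by nlinarith
  have hv0 : 0 < v := by
    rcases hv.lt_or_eq with h | h
    · exact h
    · rw [← h] at h1; nlinarith
  have hu0 : 0 < u := hσ.trans_le h2
  rw [div_le_div_iff₀ (by positivity) (by positivity)]
  nlinarith

lemma norm_perronKernel_le' {σ : ℝ} (hσ : 1 ≤ σ) (t : ℝ) :
    ‖perronKernel σ t‖ ≤ (1 + t ^ 2)⁻¹ := by
  have h4 : 0 < 1 + t ^ 2 := by positivity
  have h1 : 1 + t ^ 2 ≤ ‖(σ + t * I : ℂ)‖ ^ 2 := by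
    rw [← normSq_eq_norm_sq, normSq_apply]
    simp
    nlinarith
  have h2 : ‖(σ + t * I : ℂ)‖ ≤ ‖(σ + t * I : ℂ) + 1‖ := by
    rw [← sq_le_sq₀ (norm_nonneg _) (norm_nonneg _), ← normSq_eq_norm_sq, ← normSq_eq_norm_sq,
      normSq_apply, normSq_apply]
    simp
    nlinarith
  rw [perronKernel, norm_div, norm_one, norm_mul, ← one_div]
  refine one_div_le_one_div_of_le h4 (h1.trans ?_)
  rw [sq]
  gcongr

lemma integrable_perronKernel {σ : ℝ} (hσ : 0 < σ) : Integrable (perronKernel σ) := by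
  rcases le_total σ 1 with h | h
  · exact (integrable_inv_one_add_sq.const_mul (2 / σ)).mono'
      (continuous_perronKernel hσ).aestronglyMeasurable
      (.of_forall (norm_perronKernel_le hσ h))
  · exact integrable_inv_one_add_sq.mono'
      (continuous_perronKernel hσ).aestronglyMeasurable
      (.of_forall (norm_perronKernel_le' h))

lemma integral_norm_perronKernel_le {σ : ℝ} (hσ : 0 < σ) (hσ1 : σ ≤ 1) :
    ∫ t, ‖perronKernel σ t‖ ≤ 2 * Real.pi / σ := by
  refine (integral_mono (integrable_perronKernel hσ).norm
    (integrable_inv_one_add_sq.const_mul (2 / σ)) (norm_perronKernel_le hσ hσ1)).trans ?_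
  rw [integral_const_mul, integral_univ_inv_one_add_sq]
  exact le_of_eq (by ring)

/-- Perron's formula with the weight `(1 - u)₊`. -/
lemma perron_formula {σ : ℝ} (hσ : 0 < σ) {u : ℝ} (hu : 0 < u) :
    ∫ t : ℝ, (u : ℂ) ^ (-(σ + t * I : ℂ)) * perronKernel σ t =
      2 * Real.pi * ((max (1 - u) 0 : ℝ) : ℂ) := by
  set f : ℝ → ℂ := fun t => (Set.Ioc 0 1).indicator (fun _ => 1 : ℝ → ℂ) t -
    (Set.Ioc 0 1).indicator (fun t => (t : ℂ) ^ (1 : ℂ) : ℝ → ℂ) t with hf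
  have hM : ∀ s : ℂ, 0 < s.re → HasMellin f s (1 / s - 1 / (s + 1)) := fun s hs => by
    have hs' : 0 < s.re + (1 : ℂ).re := by simp; linarith
    have h := hasMellin_sub (hasMellin_one_Ioc hs).1 (hasMellin_cpow_Ioc 1 hs').1
    rwa [(hasMellin_one_Ioc hs).2, (hasMellin_cpow_Ioc 1 hs').2] at h
  have hfv : ∀ t : ℝ, 0 < t → f t = ((max (1 - t) 0 : ℝ) : ℂ) := by
    intro t ht
    by_cases h : t ≤ 1
    · simp [hf, ht, h]
    · push Not at h
      simp [hf, not_le.2 h, max_eq_right (by linarith : 1 - t ≤ 0)]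
  have hmel : ∀ t : ℝ, mellin f (σ + t * I) = perronKernel σ t := by
    intro t
    rw [(hM _ (by simpa using hσ)).2, perronKernel]
    have h1 := vertical_ne_zero hσ t
    have h2 := vertical_add_one_ne_zero hσ t
    field_simp
    ring
  have := mellinInv_mellin_eq σ f hu (hM _ (by simpa using hσ)).1 ?_ ?_
  · rw [mellinInv, hfv u hu] at this
    simp_rw [hmel, smul_eq_mul] at this
    rw [← this, real_smul]
    generalize (∫ y : ℝ, (u : ℂ) ^ (-(σ + y * I : ℂ)) * perronKernel σ y) = J
    push_cast
    have : (Real.pi : ℂ) ≠ 0 := by exact_mod_cast Real.pi_ne_zero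
    field_simp
  · refine (integrable_perronKernel hσ).congr (.of_forall fun t => ?_)
    exact (hmel t).symm
  · have : ContinuousAt (fun t : ℝ => ((max (1 - t) 0 : ℝ) : ℂ)) u := by fun_prop
    refine this.congr ?_
    filter_upwards [lt_mem_nhds hu] with t ht
    exact (hfv t ht).symm

end BombieriVinogradov

namespace BombieriVinogradov
open Finset ArithmeticFunction

lemma sum_convolution (f g : ArithmeticFunction ℝ) (h : ℕ → ℂ) (Y : ℕ)
    (hh : ∀ n, Y < n → h n = 0) :
    ∑ n ∈ Ioc 0 Y, (((f * g) n : ℝ) : ℂ) * h n =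
      ∑ d ∈ Ioc 0 Y, ∑ m ∈ Ioc 0 Y, (f d : ℂ) * g m * h (d * m) := by
  simp only [mul_apply, Complex.ofReal_sum, Complex.ofReal_mul, sum_mul]
  trans ∑ x ∈ Ioc 0 Y ×ˢ Ioc 0 Y with x.1 * x.2 ≤ Y, (f x.1 : ℂ) * g x.2 * h (x.1 * x.2)
  · trans ∑ x ∈ Ioc 0 Y ×ˢ Ioc 0 Y with x.1 * x.2 ≤ Y, ∑ n ∈ Ioc 0 Y,
      if n = x.1 * x.2 then (f x.1 : ℂ) * g x.2 * h n else 0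
    · simp only [sum_sigma', ← sum_filter]
      refine sum_nbij' (fun a => ⟨a.2, a.1⟩) (fun a => ⟨a.2, a.1⟩) ?_ ?_ ?_ ?_ ?_
      · rintro ⟨n, a, b⟩
        simp only [mem_sigma, mem_Ioc, Nat.mem_divisorsAntidiagonal, mem_filter, mem_product]
        rintro ⟨⟨h1, h2⟩, h3, h4⟩
        subst h3
        have ha : 0 < a := Nat.pos_of_mul_pos_right h1
        have hb : 0 < b := Nat.pos_of_mul_pos_left h1
        refine ⟨⟨⟨⟨ha, ?_⟩, ⟨hb, ?_⟩⟩, h2⟩, ⟨h1, h2⟩, rfl⟩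
        · nlinarith
        · nlinarith
      · rintro ⟨⟨a, b⟩, n⟩
        simp only [mem_sigma, mem_Ioc, Nat.mem_divisorsAntidiagonal, mem_filter, mem_product]
        rintro ⟨_, ⟨h1, h2⟩, rfl⟩
        exact ⟨⟨h1, h2⟩, rfl, h1.ne'⟩
      · intros; rfl
      · intros; rfl
      · intros; rfl
    · refine sum_congr rfl fun x hx => ?_
      simp only [mem_filter, mem_product, mem_Ioc] at hx
      rw [sum_ite_eq', if_pos]
      rw [mem_Ioc]
      exact ⟨Nat.mul_pos hx.1.1.1 hx.1.2.1, hx.2⟩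
  · rw [sum_filter, sum_product]
    refine sum_congr rfl fun d _ => sum_congr rfl fun m _ => ?_
    split_ifs with hd
    · rfl
    · rw [hh _ (not_le.1 hd), mul_zero]

/-- Abel's inequality for an antitone nonnegative weight. -/
lemma norm_sum_mul_antitone_le (c : ℕ → ℂ) (w : ℕ → ℝ) (hw : Antitone w) (hw0 : ∀ n, 0 ≤ w n)
    {S : ℝ} (N : ℕ) (hS : ∀ k ≤ N, ‖∑ n ∈ range k, c n‖ ≤ S) :
    ‖∑ n ∈ range N, c n * w n‖ ≤ S * w 0 := by
  have hS0 : 0 ≤ S := (norm_nonneg _).trans (hS 0 (Nat.zero_le _))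
  have key : ∀ M ≤ N, ‖∑ n ∈ range M, c n * w n - (∑ n ∈ range M, c n) * w M‖ ≤
      S * (w 0 - w M) := by
    intro M
    induction M with
    | zero => simp
    | succ M ih =>
      intro hM
      have e : ∑ n ∈ range (M + 1), c n * w n - (∑ n ∈ range (M + 1), c n) * w (M + 1) =
          (∑ n ∈ range M, c n * w n - (∑ n ∈ range M, c n) * w M) +
          (∑ n ∈ range (M + 1), c n) * ((w M - w (M + 1) : ℝ) : ℂ) := by
        rw [sum_range_succ, sum_range_succ c]; push_cast; ring
      rw [e]
      refine (norm_add_le _ _).trans ?_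
      rw [norm_mul, Complex.norm_real, Real.norm_of_nonneg (sub_nonneg.2 (hw (Nat.le_succ M)))]
      have h1 := ih (by omega)
      have h2 := mul_le_mul_of_nonneg_right (hS (M + 1) hM) (sub_nonneg.2 (hw (Nat.le_succ M)))
      linarith
  have h1 := key N le_rfl
  have h2 : ‖(∑ n ∈ range N, c n) * w N‖ ≤ S * w N := by
    rw [norm_mul, Complex.norm_real, Real.norm_of_nonneg (hw0 N)]
    exact mul_le_mul_of_nonneg_right (hS N le_rfl) (hw0 N)
  calc _ = ‖(∑ n ∈ range N, c n * w n - (∑ n ∈ range N, c n) * w N) +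
        (∑ n ∈ range N, c n) * w N‖ := by ring_nf
    _ ≤ _ := norm_add_le _ _
    _ ≤ S * w 0 := by linarith

lemma norm_sum_range_character_sub_le {q : ℕ} [NeZero q] (χ : DirichletCharacter ℂ q) (M : ℕ) :
    ‖∑ n ∈ range M, χ n - (M : ℂ) * ((∑ a : ZMod q, χ a) / q)‖ ≤ 2 * q := by
  have hq : (q : ℂ) ≠ 0 := by exact_mod_cast NeZero.ne q
  have hper : ∀ k : ℕ, ∑ n ∈ range (q * k), χ n = k * ∑ a : ZMod q, χ a := by
    intro k
    induction k with
    | zero => simp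
    | succ k ih =>
      rw [mul_add, mul_one, sum_range_add, ih]
      push_cast
      rw [add_mul, one_mul]
      congr 1
      trans ∑ n ∈ range q, χ n
      · exact sum_congr rfl fun n _ => by simp
      · rw [← Fin.sum_univ_eq_sum_range (fun n => χ (n : ZMod q))]
        obtain ⟨m, rfl⟩ := Nat.exists_eq_succ_of_ne_zero (NeZero.ne q)
        refine sum_congr rfl fun n _ => ?_
        congr 1
        exact Fin.cast_val_eq_self n
  have hle : ∀ m, ‖∑ n ∈ range m, χ ((q * (M / q) + n : ℕ) : ZMod q)‖ ≤ m := by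
    intro m
    refine (norm_sum_le _ _).trans ((sum_le_sum fun n _ => χ.norm_le_one _).trans ?_)
    simp
  have hsum : ‖∑ a : ZMod q, χ a‖ ≤ q := by
    refine (norm_sum_le _ _).trans ((sum_le_sum fun n _ => χ.norm_le_one _).trans ?_)
    simp [ZMod.card]
  have e1 : ∑ n ∈ range M, χ n = (M / q : ℕ) * ∑ a : ZMod q, χ a +
      ∑ n ∈ range (M % q), χ ((q * (M / q) + n : ℕ) : ZMod q) := by
    rw [← hper, ← sum_range_add, Nat.div_add_mod]
  have e2 : (M : ℂ) = q * (M / q : ℕ) + (M % q : ℕ) := by exact_mod_cast (Nat.div_add_mod M q).symm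
  have hmod : ((M % q : ℕ) : ℝ) ≤ q := by exact_mod_cast (Nat.mod_lt _ (NeZero.pos q)).le
  have e3 : ∑ n ∈ range M, χ n - (M : ℂ) * ((∑ a : ZMod q, χ a) / q) =
      ∑ n ∈ range (M % q), χ ((q * (M / q) + n : ℕ) : ZMod q) -
        (M % q : ℕ) * ((∑ a : ZMod q, χ a) / q) := by
    rw [e1, e2]; field_simp; ring
  rw [e3]
  refine (norm_sub_le _ _).trans ?_
  rw [norm_mul, norm_div, Complex.norm_natCast, Complex.norm_natCast]
  have hq0 : (0 : ℝ) < q := by exact_mod_cast NeZero.pos q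
  have : ‖∑ a : ZMod q, χ a‖ / q ≤ 1 := by rwa [div_le_one hq0]
  have h5 : ((M % q : ℕ) : ℝ) * (‖∑ a : ZMod q, χ a‖ / q) ≤ ((M % q : ℕ) : ℝ) * 1 := by gcongr
  have := hle (M % q)
  linarith

lemma norm_sum_range_character_le {q : ℕ} [NeZero q] {χ : DirichletCharacter ℂ q} (hχ : χ ≠ 1)
    (M : ℕ) : ‖∑ n ∈ range M, χ n‖ ≤ 2 * q := by
  simpa [MulChar.sum_eq_zero_of_ne_one hχ] using norm_sum_range_character_sub_le χ M

lemma sum_inv_le_one_add_log (N : ℕ) : ∑ n ∈ Ioc 0 N, (1 : ℝ) / n ≤ 1 + Real.log N := by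
  have h := harmonic_le_one_add_log N
  rw [harmonic_eq_sum_Icc] at h
  push_cast at h
  have e : Ioc 0 N = Icc 1 N := by ext; simp; lia
  simpa [one_div, e] using h

end BombieriVinogradov

namespace BombieriVinogradov
open Finset ArithmeticFunction
open scoped ArithmeticFunction.zeta ArithmeticFunction.Moebius

/-- The part of an arithmetic function supported on `n ≤ U`. -/
noncomputable def lowPart (f : ArithmeticFunction ℝ) (U : ℕ) : ArithmeticFunction ℝ :=
  ⟨fun n => if n ≤ U then f n else 0, by simp⟩

/-- The part of an arithmetic function supported on `n > U`. -/
noncomputable def highPart (f : ArithmeticFunction ℝ) (U : ℕ) : ArithmeticFunction ℝ :=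
  ⟨fun n => if n ≤ U then 0 else f n, by simp⟩

lemma lowPart_apply (f : ArithmeticFunction ℝ) (U n : ℕ) :
    lowPart f U n = if n ≤ U then f n else 0 := rfl

lemma highPart_apply (f : ArithmeticFunction ℝ) (U n : ℕ) :
    highPart f U n = if n ≤ U then 0 else f n := rfl

lemma lowPart_add_highPart (f : ArithmeticFunction ℝ) (U : ℕ) :
    lowPart f U + highPart f U = f := by
  ext n
  rw [ArithmeticFunction.add_apply, lowPart_apply, highPart_apply]
  split_ifs <;> simp

/-- Vaughan's identity. -/
lemma vaughan_identity (U : ℕ) :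
    Λ = lowPart Λ U + lowPart (μ : ArithmeticFunction ℝ) U * log -
      lowPart (μ : ArithmeticFunction ℝ) U * lowPart Λ U * ζ +
      highPart Λ U * (ζ * highPart (μ : ArithmeticFunction ℝ) U) := by
  have h1 := lowPart_add_highPart Λ U
  have h2 := lowPart_add_highPart (μ : ArithmeticFunction ℝ) U
  have h3 := vonMangoldt_mul_zeta
  have h4 := coe_moebius_mul_coe_zeta (R := ℝ)
  linear_combination (lowPart (μ : ArithmeticFunction ℝ) U * (ζ : ArithmeticFunction ℝ) - 1) * h1 +
    lowPart (μ : ArithmeticFunction ℝ) U * h3 - highPart Λ U * h4 -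
    highPart Λ U * (ζ : ArithmeticFunction ℝ) * h2

/-- The smoothed sum `∑ f(n) χ(n) (Y - n)` over `n ≤ Y`. -/
noncomputable def smoothSum {q : ℕ} (f : ArithmeticFunction ℝ) (χ : DirichletCharacter ℂ q) (Y : ℕ) :
    ℂ := ∑ n ∈ Ioc 0 Y, (f n : ℂ) * (χ n * ((Y - n : ℕ) : ℂ))

lemma smoothSum_add {q : ℕ} (f g : ArithmeticFunction ℝ) (χ : DirichletCharacter ℂ q) (Y : ℕ) :
    smoothSum (f + g) χ Y = smoothSum f χ Y + smoothSum g χ Y := by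
  simp only [smoothSum, ArithmeticFunction.add_apply, Complex.ofReal_add, add_mul, sum_add_distrib]

lemma smoothSum_sub {q : ℕ} (f g : ArithmeticFunction ℝ) (χ : DirichletCharacter ℂ q) (Y : ℕ) :
    smoothSum (f - g) χ Y = smoothSum f χ Y - smoothSum g χ Y := by
  rw [eq_sub_iff_add_eq, ← smoothSum_add, sub_add_cancel]

lemma smoothSum_mul {q : ℕ} (f g : ArithmeticFunction ℝ) (χ : DirichletCharacter ℂ q) (Y : ℕ) :
    smoothSum (f * g) χ Y = ∑ d ∈ Ioc 0 Y, ∑ m ∈ Ioc 0 Y,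
      (f d : ℂ) * g m * (χ d * χ m * ((Y - d * m : ℕ) : ℂ)) := by
  rw [smoothSum, sum_convolution]
  · simp
  · intro n hn
    simp [Nat.sub_eq_zero_of_le hn.le]

lemma norm_smoothSum_le {q : ℕ} (f : ArithmeticFunction ℝ) (χ : DirichletCharacter ℂ q) (Y : ℕ) :
    ‖smoothSum f χ Y‖ ≤ (∑ n ∈ Ioc 0 Y, |f n|) * Y := by
  rw [smoothSum, sum_mul]
  refine (norm_sum_le _ _).trans (sum_le_sum fun n _ => ?_)
  rw [norm_mul, norm_mul, Complex.norm_real, Complex.norm_natCast, Real.norm_eq_abs]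
  have h1 := χ.norm_le_one n
  have h2 : ((Y - n : ℕ) : ℝ) ≤ Y := by exact_mod_cast Nat.sub_le _ _
  calc |f n| * (‖χ n‖ * ((Y - n : ℕ) : ℝ)) ≤ |f n| * (1 * Y) := by gcongr
    _ = _ := by ring

lemma norm_smoothSum_mul_le {q : ℕ} (f g : ArithmeticFunction ℝ) (χ : DirichletCharacter ℂ q)
    (Y : ℕ) {S : ℝ} (hS : ∀ k ≤ Y + 1, ‖∑ m ∈ range k, (g m : ℂ) * χ m‖ ≤ S) :
    ‖smoothSum (f * g) χ Y‖ ≤ (∑ n ∈ Ioc 0 Y, |f n|) * (S * Y) := by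
  rw [smoothSum_mul, sum_mul]
  refine (norm_sum_le _ _).trans (sum_le_sum fun d _ => ?_)
  have e : ∑ m ∈ Ioc 0 Y, (f d : ℂ) * g m * (χ d * χ m * ((Y - d * m : ℕ) : ℂ)) =
      (f d : ℂ) * (χ d * ∑ m ∈ range (Y + 1), ((g m : ℂ) * χ m) * (((Y - d * m : ℕ) : ℝ) : ℂ)) := by
    rw [mul_sum, mul_sum]
    trans ∑ m ∈ range (Y + 1), (f d : ℂ) * g m * (χ d * χ m * ((Y - d * m : ℕ) : ℂ))
    · refine sum_subset (fun m hm => ?_) fun m hm hm' => ?_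
      · simp at hm ⊢; lia
      · have : m = 0 := by simp at hm hm'; lia
        simp [this]
    · refine sum_congr rfl fun m _ => ?_
      push_cast; ring
  rw [e, norm_mul, norm_mul, Complex.norm_real, Real.norm_eq_abs]
  have h := norm_sum_mul_antitone_le (fun m => (g m : ℂ) * χ m) (fun m => ((Y - d * m : ℕ) : ℝ))
    (fun a b hab => by
      have : Y - d * b ≤ Y - d * a := Nat.sub_le_sub_left (Nat.mul_le_mul_left d hab) Y
      simpa using (Nat.cast_le (α := ℝ)).2 this) (fun _ => Nat.cast_nonneg _) (Y + 1) hS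
  simp only [mul_zero, Nat.sub_zero] at h
  have h1 := χ.norm_le_one d
  have hS0 : 0 ≤ S := (norm_nonneg _).trans (hS 0 (Nat.zero_le _))
  calc |f d| * (‖χ d‖ * _) ≤ |f d| * (1 * (S * Y)) := by gcongr
    _ = _ := by ring

lemma monotone_log_natCast : Monotone fun n : ℕ => Real.log n := by
  intro a b hab
  rcases Nat.eq_zero_or_pos a with rfl | ha
  · simpa using Real.log_natCast_nonneg b
  · exact Real.log_le_log (by exact_mod_cast ha) (by exact_mod_cast hab)

lemma norm_sum_range_log_mul_character_le {q : ℕ} [NeZero q] {χ : DirichletCharacter ℂ q}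
    (hχ : χ ≠ 1) (k : ℕ) :
    ‖∑ m ∈ range k, ((log m : ℝ) : ℂ) * χ m‖ ≤ 4 * q * Real.log k := by
  have h := norm_sum_mul_antitone_le (fun m => χ m) (fun m => max (Real.log k - Real.log m) 0)
    (fun a b hab => max_le_max (by have := monotone_log_natCast hab; dsimp at this; linarith) le_rfl)
    (fun _ => le_max_right _ _) k (S := 2 * q) fun j _ => norm_sum_range_character_le hχ j
  have h0 := Real.log_natCast_nonneg k
  have e : ∑ m ∈ range k, ((log m : ℝ) : ℂ) * χ m = Real.log k * ∑ m ∈ range k, χ m -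
      ∑ m ∈ range k, χ m * ((max (Real.log k - Real.log m) 0 : ℝ) : ℂ) := by
    rw [mul_sum, ← sum_sub_distrib]
    refine sum_congr rfl fun m hm => ?_
    rw [max_eq_left, log_apply]
    · push_cast; ring
    · have := monotone_log_natCast (mem_range.1 hm).le
      dsimp at this; linarith
  rw [e]
  refine (norm_sub_le _ _).trans ?_
  rw [norm_mul, Complex.norm_real, Real.norm_of_nonneg h0]
  have h2 := mul_le_mul_of_nonneg_left (norm_sum_range_character_le hχ k) h0
  simp only [Nat.cast_zero, Real.log_zero, sub_zero, max_eq_left h0] at h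
  linarith

lemma norm_sum_range_zeta_mul_character_le {q : ℕ} [NeZero q] {χ : DirichletCharacter ℂ q}
    (hχ : χ ≠ 1) (k : ℕ) :
    ‖∑ m ∈ range k, (((ζ : ArithmeticFunction ℝ) m : ℝ) : ℂ) * χ m‖ ≤ 3 * q := by
  have hq : (1 : ℝ) ≤ q := by exact_mod_cast NeZero.pos q
  rcases Nat.eq_zero_or_pos k with rfl | hk
  · simp
  have h := norm_sum_range_character_le hχ k
  have e : ∑ m ∈ range k, (((ζ : ArithmeticFunction ℝ) m : ℝ) : ℂ) * χ m =
      ∑ m ∈ range k, χ m - χ (0 : ℕ) := by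
    obtain ⟨j, rfl⟩ := Nat.exists_eq_succ_of_ne_zero hk.ne'
    rw [sum_range_succ', sum_range_succ']
    simp
  rw [e]
  refine (norm_sub_le _ _).trans ?_
  have := χ.norm_le_one ((0 : ℕ) : ZMod q)
  linarith

lemma abs_moebius_real_le (n : ℕ) : |(μ : ArithmeticFunction ℝ) n| ≤ 1 := by
  have : |(μ n : ℤ)| ≤ 1 := abs_moebius_le_one
  rw [intCoe_apply]
  exact_mod_cast this

lemma sum_abs_le_of_support {f : ArithmeticFunction ℝ} {U Y : ℕ} {c : ℝ} (hc : 0 ≤ c)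
    (h1 : ∀ n, U < n → f n = 0) (h2 : ∀ n ≤ Y, |f n| ≤ c) :
    ∑ n ∈ Ioc 0 Y, |f n| ≤ U * c := by
  calc ∑ n ∈ Ioc 0 Y, |f n| ≤ ∑ n ∈ Ioc 0 Y, if n ∈ Ioc 0 U then c else 0 := by
        refine sum_le_sum fun n hn => ?_
        rw [mem_Ioc] at hn
        split_ifs with h
        · exact h2 n hn.2
        · rw [h1 n (by simp at h; lia)]; simp
    _ = ∑ n ∈ (Ioc 0 Y).filter (· ∈ Ioc 0 U), c := by rw [sum_filter]
    _ = ((Ioc 0 Y).filter (· ∈ Ioc 0 U)).card * c := by rw [sum_const, nsmul_eq_mul]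
    _ ≤ U * c := by
        gcongr
        calc _ ≤ (Ioc 0 U).card := card_le_card fun n hn => (mem_filter.1 hn).2
          _ = U := by simp

lemma abs_convolution_le (f g : ArithmeticFunction ℝ) (n : ℕ) (hf : ∀ n, |f n| ≤ 1) :
    |(f * g) n| ≤ ∑ d ∈ n.divisors, |g d| := by
  rw [mul_apply, Nat.sum_divisorsAntidiagonal' (fun a b => f a * g b)]
  refine (abs_sum_le_sum_abs _ _).trans (sum_le_sum fun d _ => ?_)
  rw [abs_mul]
  exact mul_le_of_le_one_left (abs_nonneg _) (hf _)

lemma abs_lowPart_le (f : ArithmeticFunction ℝ) (U n : ℕ) : |lowPart f U n| ≤ |f n| := by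
  rw [lowPart_apply]; split_ifs <;> simp

lemma abs_highPart_le (f : ArithmeticFunction ℝ) (U n : ℕ) : |highPart f U n| ≤ |f n| := by
  rw [highPart_apply]; split_ifs <;> simp

lemma norm_smoothSum_vonMangoldt_le {q : ℕ} [NeZero q] {χ : DirichletCharacter ℂ q}
    (hχ : χ ≠ 1) (U Y : ℕ) :
    ‖smoothSum Λ χ Y‖ ≤ 8 * q * U ^ 2 * Y * Real.log (Y + 1) +
      ‖smoothSum (highPart Λ U * (ζ * highPart (μ : ArithmeticFunction ℝ) U)) χ Y‖ := by
  set L := Real.log (Y + 1) with hL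
  have hL0 : 0 ≤ L := Real.log_nonneg (by linarith [(Nat.cast_nonneg Y : (0:ℝ) ≤ Y)])
  have hlog : ∀ n : ℕ, n ≤ Y + 1 → Real.log n ≤ L := fun n hn => by
    simpa [hL] using monotone_log_natCast hn
  have hΛ : ∀ n : ℕ, |Λ n| ≤ Real.log n := fun n => by
    rw [abs_of_nonneg vonMangoldt_nonneg]; exact vonMangoldt_le_log
  have h1 : ‖smoothSum (lowPart Λ U) χ Y‖ ≤ U * L * Y := by
    refine (norm_smoothSum_le _ _ _).trans ?_
    gcongr
    refine sum_abs_le_of_support hL0 (fun n hn => ?_) fun n hn => ?_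
    · rw [lowPart_apply, if_neg (by lia)]
    · exact (abs_lowPart_le _ _ _).trans ((hΛ n).trans (hlog n (by lia)))
  have h2 : ‖smoothSum (lowPart (μ : ArithmeticFunction ℝ) U * log) χ Y‖ ≤
      U * 1 * (4 * q * L * Y) := by
    refine (norm_smoothSum_mul_le _ _ _ _ (S := 4 * q * L) fun k hk => ?_).trans ?_
    · refine (norm_sum_range_log_mul_character_le hχ k).trans ?_
      gcongr
      exact hlog k hk
    · gcongr
      refine sum_abs_le_of_support zero_le_one (fun n hn => ?_) fun n hn => ?_
      · rw [lowPart_apply, if_neg (by lia)]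
      · exact (abs_lowPart_le _ _ _).trans (abs_moebius_real_le n)
  have h3 : ‖smoothSum (lowPart (μ : ArithmeticFunction ℝ) U * lowPart Λ U * ζ) χ Y‖ ≤
      (U * U : ℕ) * L * (3 * q * Y) := by
    refine (norm_smoothSum_mul_le _ _ _ _ (S := 3 * q) fun k hk =>
      norm_sum_range_zeta_mul_character_le hχ k).trans ?_
    gcongr
    refine sum_abs_le_of_support hL0 (fun n hn => ?_) fun n hn => ?_
    · rw [mul_apply]
      refine sum_eq_zero fun p hp => ?_
      rw [Nat.mem_divisorsAntidiagonal] at hp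
      rw [lowPart_apply, lowPart_apply]
      by_cases ha : p.1 ≤ U
      · by_cases hb : p.2 ≤ U
        · have := Nat.mul_le_mul ha hb
          lia
        · simp [hb]
      · simp [ha]
    · refine (abs_convolution_le _ _ _ fun n =>
        (abs_lowPart_le _ _ _).trans (abs_moebius_real_le n)).trans ?_
      refine (sum_le_sum fun d _ => abs_lowPart_le _ _ _).trans ?_
      simp_rw [abs_of_nonneg vonMangoldt_nonneg]
      rw [vonMangoldt_sum]
      exact hlog n (by lia)
  have e : smoothSum Λ χ Y = smoothSum (lowPart Λ U) χ Y +
      smoothSum (lowPart (μ : ArithmeticFunction ℝ) U * log) χ Y -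
      smoothSum (lowPart (μ : ArithmeticFunction ℝ) U * lowPart Λ U * ζ) χ Y +
      smoothSum (highPart Λ U * (ζ * highPart (μ : ArithmeticFunction ℝ) U)) χ Y := by
    rw [← smoothSum_add, ← smoothSum_sub, ← smoothSum_add, ← vaughan_identity]
  rw [e]
  refine (norm_add_le _ _).trans (add_le_add_left ?_ _)
  refine (norm_sub_le _ _).trans ((add_le_add (norm_add_le _ _) le_rfl).trans ?_)
  have hU : (U : ℝ) ≤ U ^ 2 := by
    exact_mod_cast Nat.le_self_pow two_ne_zero U
  have hq : (1 : ℝ) ≤ q := by exact_mod_cast NeZero.pos q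
  have hYL : 0 ≤ Y * L := by positivity
  have g1 : U * L * Y ≤ q * U ^ 2 * (Y * L) := by
    calc U * L * Y = 1 * U * (Y * L) := by ring
      _ ≤ _ := by gcongr
  have g2 : U * 1 * (4 * q * L * Y) ≤ 4 * (q * U ^ 2 * (Y * L)) := by
    calc U * 1 * (4 * q * L * Y) = 4 * (q * U * (Y * L)) := by ring
      _ ≤ _ := by gcongr
  push_cast at h3
  calc _ ≤ _ := add_le_add (add_le_add h1 h2) h3
    _ ≤ q * U ^ 2 * (Y * L) + 4 * (q * U ^ 2 * (Y * L)) + U * U * L * (3 * q * Y) := by gcongr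
    _ = _ := by ring

end BombieriVinogradov

namespace BombieriVinogradov
open Finset ArithmeticFunction MeasureTheory
open scoped ArithmeticFunction.zeta ArithmeticFunction.Moebius

lemma card_divisors_mul_le (m n : ℕ) :
    (m * n).divisors.card ≤ m.divisors.card * n.divisors.card := by
  rw [Nat.divisors_mul]
  exact Finset.card_mul_le

lemma card_divisors_eq_sum (N : ℕ) {n : ℕ} (hn : n ∈ Ioc 0 N) :
    (n.divisors.card : ℝ) = ∑ d ∈ Ioc 0 N, if d ∣ n then 1 else 0 := by
  rw [mem_Ioc] at hn
  rw [← sum_filter, sum_const, nsmul_eq_mul, mul_one]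
  congr 2
  ext d
  rw [Nat.mem_divisors, mem_filter, mem_Ioc]
  constructor
  · rintro ⟨h, h0⟩
    exact ⟨⟨Nat.pos_of_dvd_of_pos h hn.1, (Nat.le_of_dvd hn.1 h).trans hn.2⟩, h⟩
  · rintro ⟨_, h⟩
    exact ⟨h, hn.1.ne'⟩

lemma sum_dvd_le (N : ℕ) (d : ℕ) (hd : 0 < d) (f : ℕ → ℝ) :
    ∑ n ∈ Ioc 0 N, (if d ∣ n then f n else 0) = ∑ m ∈ Ioc 0 (N / d), f (d * m) := by
  rw [← sum_filter]
  symm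
  refine sum_nbij (fun m => d * m) ?_ ?_ ?_ (fun _ _ => rfl)
  · intro m hm
    simp only [mem_Ioc, mem_filter] at hm ⊢
    refine ⟨⟨Nat.mul_pos hd hm.1, ?_⟩, dvd_mul_right _ _⟩
    calc d * m ≤ d * (N / d) := Nat.mul_le_mul_left _ hm.2
      _ ≤ N := Nat.mul_div_le _ _
  · intro a _ b _ h
    exact Nat.eq_of_mul_eq_mul_left hd h
  · intro n hn
    simp only [coe_filter, mem_Ioc, Set.mem_ofPred_eq] at hn
    obtain ⟨⟨h1, h2⟩, m, rfl⟩ := hn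
    refine ⟨m, ?_, rfl⟩
    simp only [coe_Ioc, Set.mem_Ioc]
    refine ⟨Nat.pos_of_mul_pos_left h1, ?_⟩
    rw [Nat.le_div_iff_mul_le hd]; linarith

lemma sum_card_divisors_le (N : ℕ) :
    ∑ n ∈ Ioc 0 N, (n.divisors.card : ℝ) ≤ N * (1 + Real.log N) := by
  rw [sum_congr rfl fun n hn => card_divisors_eq_sum N hn, sum_comm]
  calc ∑ d ∈ Ioc 0 N, ∑ n ∈ Ioc 0 N, (if d ∣ n then (1 : ℝ) else 0)
      ≤ ∑ d ∈ Ioc 0 N, (N : ℝ) * (1 / d) := by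
        refine sum_le_sum fun d hd => ?_
        rw [sum_dvd_le N d (mem_Ioc.1 hd).1 (fun _ => 1)]
        simp only [sum_const, Nat.card_Ioc, nsmul_eq_mul, mul_one, Nat.sub_zero]
        rw [mul_one_div]
        exact Nat.cast_div_le
    _ = N * ∑ d ∈ Ioc 0 N, (1 : ℝ) / d := by rw [mul_sum]
    _ ≤ _ := by gcongr; exact sum_inv_le_one_add_log N

lemma sum_card_divisors_div_le (N : ℕ) :
    ∑ n ∈ Ioc 0 N, (n.divisors.card : ℝ) / n ≤ (1 + Real.log N) ^ 2 := by
  have hN := Real.log_natCast_nonneg N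
  calc ∑ n ∈ Ioc 0 N, (n.divisors.card : ℝ) / n
      = ∑ d ∈ Ioc 0 N, ∑ n ∈ Ioc 0 N, (if d ∣ n then (1 : ℝ) / n else 0) := by
        rw [sum_comm]
        refine sum_congr rfl fun n hn => ?_
        rw [card_divisors_eq_sum N hn, sum_div]
        exact sum_congr rfl fun d _ => by split_ifs <;> simp
    _ ≤ ∑ d ∈ Ioc 0 N, (1 : ℝ) / d * (1 + Real.log N) := by
        refine sum_le_sum fun d hd => ?_
        rw [sum_dvd_le N d (mem_Ioc.1 hd).1 (fun n => (1 : ℝ) / n)]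
        push_cast
        have : ∀ m : ℕ, (1 : ℝ) / (d * m) = 1 / d * (1 / m) := fun m => by
          rw [one_div_mul_one_div]
        simp_rw [this]
        rw [← mul_sum]
        gcongr
        exact (sum_inv_le_one_add_log _).trans
          (add_le_add le_rfl (monotone_log_natCast (Nat.div_le_self _ _)))
    _ = (∑ d ∈ Ioc 0 N, (1 : ℝ) / d) * (1 + Real.log N) := by rw [sum_mul]
    _ ≤ (1 + Real.log N) * (1 + Real.log N) := by gcongr; exact sum_inv_le_one_add_log N
    _ = _ := by ring

lemma sum_card_divisors_sq_le (N : ℕ) :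
    ∑ n ∈ Ioc 0 N, (n.divisors.card : ℝ) ^ 2 ≤ N * (1 + Real.log N) ^ 3 := by
  have hN := Real.log_natCast_nonneg N
  calc ∑ n ∈ Ioc 0 N, (n.divisors.card : ℝ) ^ 2
      = ∑ d ∈ Ioc 0 N, ∑ n ∈ Ioc 0 N, (if d ∣ n then (n.divisors.card : ℝ) else 0) := by
        rw [sum_comm]
        refine sum_congr rfl fun n hn => ?_
        rw [sq]
        nth_rewrite 1 [card_divisors_eq_sum N hn]
        rw [sum_mul]
        exact sum_congr rfl fun d _ => by split_ifs <;> simp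
    _ ≤ ∑ d ∈ Ioc 0 N, N * (1 + Real.log N) * ((d.divisors.card : ℝ) / d) := by
        refine sum_le_sum fun d hd => ?_
        have hd0 := (mem_Ioc.1 hd).1
        rw [sum_dvd_le N d hd0 (fun n => (n.divisors.card : ℝ))]
        calc ∑ m ∈ Ioc 0 (N / d), ((d * m).divisors.card : ℝ)
            ≤ ∑ m ∈ Ioc 0 (N / d), (d.divisors.card : ℝ) * m.divisors.card := by
              refine sum_le_sum fun m _ => ?_
              exact_mod_cast card_divisors_mul_le d m
          _ = d.divisors.card * ∑ m ∈ Ioc 0 (N / d), (m.divisors.card : ℝ) := by rw [mul_sum]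
          _ ≤ d.divisors.card * (((N / d : ℕ) : ℝ) * (1 + Real.log ((N / d : ℕ) : ℝ))) := by
              gcongr
              exact sum_card_divisors_le _
          _ ≤ d.divisors.card * (((N : ℝ) / d) * (1 + Real.log N)) := by
              have h1 : 1 + Real.log ((N / d : ℕ) : ℝ) ≤ 1 + Real.log N :=
                add_le_add le_rfl (monotone_log_natCast (Nat.div_le_self _ _))
              have h2 : ((N / d : ℕ) : ℝ) ≤ (N : ℝ) / d := Nat.cast_div_le
              gcongr
          _ = _ := by ring
    _ = N * (1 + Real.log N) * ∑ d ∈ Ioc 0 N, (d.divisors.card : ℝ) / d := by rw [mul_sum]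
    _ ≤ N * (1 + Real.log N) * (1 + Real.log N) ^ 2 := by
        gcongr; exact sum_card_divisors_div_le N
    _ = _ := by ring

lemma abs_zeta_mul_highPart_le (U n : ℕ) :
    |((ζ : ArithmeticFunction ℝ) * highPart (μ : ArithmeticFunction ℝ) U) n| ≤ n.divisors.card := by
  rw [mul_comm, mul_apply, Nat.sum_divisorsAntidiagonal
    (fun a b => highPart (μ : ArithmeticFunction ℝ) U a * (ζ : ArithmeticFunction ℝ) b)]
  refine (abs_sum_le_sum_abs _ _).trans ?_
  refine (sum_le_card_nsmul _ _ 1 fun d _ => ?_).trans (by simp)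
  rw [abs_mul]
  have h1 := (abs_highPart_le _ U d).trans (abs_moebius_real_le d)
  have h2 : |(ζ : ArithmeticFunction ℝ) (n / d)| ≤ 1 := by
    rw [natCoe_apply, zeta_apply]; split_ifs <;> simp
  nlinarith [abs_nonneg (highPart (μ : ArithmeticFunction ℝ) U d)]

lemma zeta_mul_highPart_eq_zero {U n : ℕ} (hn : n ≤ U) :
    ((ζ : ArithmeticFunction ℝ) * highPart (μ : ArithmeticFunction ℝ) U) n = 0 := by
  rw [mul_apply]
  refine sum_eq_zero fun p hp => ?_
  rw [Nat.mem_divisorsAntidiagonal] at hp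
  rw [highPart_apply, if_pos, mul_zero]
  refine le_trans ?_ hn
  exact Nat.le_of_dvd (Nat.pos_of_ne_zero hp.2) ⟨p.1, by rw [← hp.1, mul_comm]⟩

/-- A bilinear form of the large sieve over a dyadic block of moduli. -/
lemma bilinear_large_sieve (Q N₁ N₂ : ℕ) (hQ : 1 ≤ Q) (a b : ℕ → ℂ) :
    ∑ q ∈ Ioc Q (2 * Q), (1 : ℝ) / q.totient * ∑ χ ∈ primChars q,
      ‖∑ n ∈ range N₁, a n * χ n‖ * ‖∑ n ∈ range N₂, b n * χ n‖ ≤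
    5 / Q * √(((N₁ + 4 * Q ^ 2 + 1) * ∑ n ∈ range N₁, ‖a n‖ ^ 2) *
      ((N₂ + 4 * Q ^ 2 + 1) * ∑ n ∈ range N₂, ‖b n‖ ^ 2)) := by
  have hQ0 : (0 : ℝ) < Q := by exact_mod_cast hQ
  set I := (Ioc Q (2 * Q)).sigma fun q => primChars q
  set A : ((q : ℕ) × DirichletCharacter ℂ q) → ℝ := fun p => ‖∑ n ∈ range N₁, a n * p.2 n‖
  set B : ((q : ℕ) × DirichletCharacter ℂ q) → ℝ := fun p => ‖∑ n ∈ range N₂, b n * p.2 n‖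
  set w : ((q : ℕ) × DirichletCharacter ℂ q) → ℝ := fun p => (p.1 : ℝ) / p.1.totient
  have hw : ∀ p, 0 ≤ w p := fun p => by positivity
  have block : ∀ (N : ℕ) (c : ℕ → ℂ), ∑ p ∈ I, w p * ‖∑ n ∈ range N, c n * p.2 n‖ ^ 2 ≤
      5 * ((N + 4 * Q ^ 2 + 1) * ∑ n ∈ range N, ‖c n‖ ^ 2) := by
    intro N c
    have h := large_sieve (2 * Q) N (by lia) c
    push_cast at h
    calc _ = ∑ q ∈ Ioc Q (2 * Q), (q : ℝ) / q.totient * ∑ χ ∈ primChars q,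
          ‖∑ n ∈ range N, c n * χ n‖ ^ 2 := by
          rw [sum_sigma]
          exact sum_congr rfl fun q _ => by rw [mul_sum]
      _ ≤ _ := sum_le_sum_of_subset_of_nonneg
          (fun q hq => by simp at hq ⊢; lia) fun _ _ _ => by positivity
      _ ≤ _ := h
      _ = _ := by ring
  have h1 : ∑ q ∈ Ioc Q (2 * Q), (1 : ℝ) / q.totient * ∑ χ ∈ primChars q,
      ‖∑ n ∈ range N₁, a n * χ n‖ * ‖∑ n ∈ range N₂, b n * χ n‖ ≤
      1 / Q * ∑ p ∈ I, (√(w p) * A p) * (√(w p) * B p) := by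
    rw [sum_sigma, mul_sum]
    refine sum_le_sum fun q hq => ?_
    rw [mul_sum, mul_sum]
    refine sum_le_sum fun χ _ => ?_
    have e : (√(w ⟨q, χ⟩) * A ⟨q, χ⟩) * (√(w ⟨q, χ⟩) * B ⟨q, χ⟩) =
        w ⟨q, χ⟩ * (A ⟨q, χ⟩ * B ⟨q, χ⟩) := by
      rw [mul_mul_mul_comm, Real.mul_self_sqrt (hw _)]
    rw [e, ← mul_assoc (1 / (Q : ℝ))]
    have hAB : 0 ≤ A ⟨q, χ⟩ * B ⟨q, χ⟩ := mul_nonneg (norm_nonneg _) (norm_nonneg _)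
    refine mul_le_mul_of_nonneg_right ?_ hAB
    have : (Q : ℝ) ≤ q := by exact_mod_cast (mem_Ioc.1 hq).1.le
    change (1 : ℝ) / q.totient ≤ 1 / Q * ((q : ℝ) / q.totient)
    rw [div_mul_div_comm, one_mul, mul_comm (Q : ℝ), ← div_div, le_div_iff₀ hQ0,
      div_mul_eq_mul_div, one_mul]
    gcongr
  refine h1.trans ?_
  have h2 := Real.sum_mul_le_sqrt_mul_sqrt I (fun p => √(w p) * A p) (fun p => √(w p) * B p)
  simp_rw [mul_pow, Real.sq_sqrt (hw _)] at h2
  calc _ ≤ 1 / (Q : ℝ) * (√(5 * ((N₁ + 4 * Q ^ 2 + 1) * ∑ n ∈ range N₁, ‖a n‖ ^ 2)) *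
        √(5 * ((N₂ + 4 * Q ^ 2 + 1) * ∑ n ∈ range N₂, ‖b n‖ ^ 2))) := by
        refine mul_le_mul_of_nonneg_left (h2.trans ?_) (by positivity)
        gcongr
        · exact block N₁ a
        · exact block N₂ b
    _ = _ := by
        rw [← Real.sqrt_mul (by positivity), mul_mul_mul_comm, Real.sqrt_mul (by norm_num),
          Real.sqrt_mul_self (by norm_num)]
        ring

end BombieriVinogradov

namespace BombieriVinogradov
open Finset Complex MeasureTheory

/-- `n ^ (-s)` on the vertical line `Re s = σ`, with value `1` at `n = 0`. -/
noncomputable def vpow (σ t : ℝ) (n : ℕ) : ℂ := exp (-(σ + t * I) * Real.log n)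

lemma continuous_vpow (σ : ℝ) (n : ℕ) : Continuous fun t => vpow σ t n := by
  unfold vpow; fun_prop

lemma norm_vpow_le {σ : ℝ} (hσ : 0 ≤ σ) (t : ℝ) (n : ℕ) : ‖vpow σ t n‖ ≤ 1 := by
  have h := Real.log_natCast_nonneg n
  rw [vpow, norm_exp, Real.exp_le_one_iff]
  generalize Real.log n = y at h
  simpa using mul_nonneg hσ h

lemma perron_natural {σ : ℝ} (hσ : 0 < σ) {Y n : ℕ} (hY : 0 < Y) (hn : 0 < n) :
    ∫ t : ℝ, exp ((σ + t * I) * Real.log Y) * vpow σ t n * perronKernel σ t =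
      2 * Real.pi / Y * ((Y - n : ℕ) : ℂ) := by
  have hY' : (0 : ℝ) < Y := by exact_mod_cast hY
  have hn' : (0 : ℝ) < n := by exact_mod_cast hn
  have hYc : (Y : ℂ) ≠ 0 := by exact_mod_cast hY.ne'
  have h := perron_formula hσ (u := n / Y) (by positivity)
  have e : ∀ t : ℝ, (((n / Y : ℝ)) : ℂ) ^ (-(σ + t * I : ℂ)) =
      exp ((σ + t * I) * Real.log Y) * vpow σ t n := by
    intro t
    rw [cpow_def_of_ne_zero (by exact_mod_cast (by positivity : (n : ℝ) / Y ≠ 0)), ← ofReal_log (by positivity),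
      Real.log_div hn'.ne' hY'.ne', vpow, ← exp_add]
    congr 1
    push_cast
    ring
  simp_rw [e] at h
  rw [h]
  have : ((max (1 - (n : ℝ) / Y) 0 : ℝ)) = ((Y - n : ℕ) : ℝ) / Y := by
    rcases le_total n Y with hle | hle
    · rw [Nat.cast_sub hle, max_eq_left]
      · field_simp
      · rw [sub_nonneg, div_le_one hY']; exact_mod_cast hle
    · rw [Nat.sub_eq_zero_of_le hle, max_eq_right]
      · simp
      · rw [sub_nonpos, one_le_div hY']; exact_mod_cast hle
  rw [this]
  push_cast
  ring

lemma integrable_perron_term {σ : ℝ} (hσ : 0 < σ) (F : ℝ → ℂ) (hF : Continuous F) {C : ℝ}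
    (hC : ∀ t, ‖F t‖ ≤ C) : Integrable fun t => F t * perronKernel σ t := by
  refine ((integrable_perronKernel hσ).norm.const_mul C).mono'
    (hF.mul (continuous_perronKernel hσ)).aestronglyMeasurable (.of_forall fun t => ?_)
  rw [norm_mul]
  gcongr
  exact hC t

lemma norm_exp_vertical (σ t y : ℝ) : ‖exp ((σ + t * I) * y)‖ = Real.exp (σ * y) := by
  rw [norm_exp]; simp

/-- Perron's formula applied to a bilinear sum. -/
lemma perron_bilinear {q : ℕ} (χ : DirichletCharacter ℂ q) {σ : ℝ} (hσ : 0 < σ) {Y : ℕ} (hY : 0 < Y)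
    (N₁ N₂ : ℕ) (a b : ℕ → ℝ) (ha : a 0 = 0) (hb : b 0 = 0) :
    ∑ m ∈ range N₁, ∑ k ∈ range N₂, (a m : ℂ) * b k * (χ m * χ k * ((Y - m * k : ℕ) : ℂ)) =
      Y / (2 * Real.pi) * ∫ t : ℝ, exp ((σ + t * I) * Real.log Y) *
        ((∑ m ∈ range N₁, (a m * vpow σ t m) * χ m) * (∑ k ∈ range N₂, (b k * vpow σ t k) * χ k)) *
          perronKernel σ t := by
  have hYc : (Y : ℂ) ≠ 0 := by exact_mod_cast hY.ne'
  have hpi : (Real.pi : ℂ) ≠ 0 := by exact_mod_cast Real.pi_ne_zero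
  have e : ∀ t : ℝ, exp ((σ + t * I) * Real.log Y) *
        ((∑ m ∈ range N₁, (a m * vpow σ t m) * χ m) * (∑ k ∈ range N₂, (b k * vpow σ t k) * χ k)) *
          perronKernel σ t = ∑ m ∈ range N₁, ∑ k ∈ range N₂, ((a m : ℂ) * b k * (χ m * χ k)) *
          (exp ((σ + t * I) * Real.log Y) * (vpow σ t m * vpow σ t k) * perronKernel σ t) := by
    intro t
    rw [sum_mul_sum, mul_sum, sum_mul]
    refine sum_congr rfl fun m _ => ?_
    rw [mul_sum, sum_mul]
    refine sum_congr rfl fun k _ => ?_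
    ring
  have h_integrable : ∀ m k : ℕ, Integrable fun t : ℝ =>
      exp ((σ + t * I) * Real.log Y) * (vpow σ t m * vpow σ t k) * perronKernel σ t := by
    intro m k
    refine integrable_perron_term hσ _ ?_ (C := Real.exp (σ * Real.log Y)) fun t => ?_
    · have := continuous_vpow σ m
      have := continuous_vpow σ k
      fun_prop
    · rw [norm_mul, norm_mul, norm_exp_vertical]
      refine mul_le_of_le_one_right (Real.exp_nonneg _) ?_
      exact mul_le_one₀ (norm_vpow_le hσ.le _ _) (norm_nonneg _) (norm_vpow_le hσ.le _ _)
  simp_rw [e]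
  rw [integral_finsetSum _ fun m _ => integrable_finsetSum _ fun k _ => (h_integrable m k).const_mul _,
    mul_sum]
  refine sum_congr rfl fun m _ => ?_
  rw [integral_finsetSum _ fun k _ => (h_integrable m k).const_mul _, mul_sum]
  refine sum_congr rfl fun k _ => ?_
  rw [integral_const_mul]
  rcases Nat.eq_zero_or_pos m with rfl | hm
  · simp [ha]
  rcases Nat.eq_zero_or_pos k with rfl | hk
  · simp [hb]
  have hv : ∀ t, vpow σ t m * vpow σ t k = vpow σ t (m * k) := by
    intro t
    rw [vpow, vpow, vpow, ← exp_add]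
    push_cast
    rw [Real.log_mul (by exact_mod_cast hm.ne') (by exact_mod_cast hk.ne')]
    congr 1
    push_cast
    ring
  simp_rw [hv]
  rw [perron_natural hσ hY (Nat.mul_pos hm hk)]
  field_simp

lemma norm_perron_bilinear_le {q : ℕ} (χ : DirichletCharacter ℂ q) {σ : ℝ} (hσ : 0 < σ) {Y : ℕ}
    (hY : 0 < Y) (N₁ N₂ : ℕ) (a b : ℕ → ℝ) (ha : a 0 = 0) (hb : b 0 = 0) :
    ‖∑ m ∈ range N₁, ∑ k ∈ range N₂, (a m : ℂ) * b k * (χ m * χ k * ((Y - m * k : ℕ) : ℂ))‖ ≤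
      Y / (2 * Real.pi) * (Real.exp (σ * Real.log Y) * ∫ t : ℝ,
        (‖∑ m ∈ range N₁, (a m * vpow σ t m) * χ m‖ * ‖∑ k ∈ range N₂, (b k * vpow σ t k) * χ k‖) *
          ‖perronKernel σ t‖) := by
  rw [perron_bilinear χ hσ hY N₁ N₂ a b ha hb, norm_mul]
  have : ‖(Y / (2 * Real.pi) : ℂ)‖ = Y / (2 * Real.pi) := by
    rw [norm_div, norm_mul, norm_natCast, norm_real, Real.norm_of_nonneg Real.pi_pos.le]
    simp
  rw [this, ← integral_const_mul]
  gcongr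
  refine (norm_integral_le_integral_norm _).trans (le_of_eq ?_)
  congr 1
  ext t
  rw [norm_mul, norm_mul, norm_mul, norm_exp_vertical]
  ring

lemma bilinear_smoothSum_le (Q N₁ N₂ Y : ℕ) (hQ : 1 ≤ Q) (hY : 2 ≤ Y) (a b : ℕ → ℝ)
    (ha : a 0 = 0) (hb : b 0 = 0) :
    ∑ q ∈ Ioc Q (2 * Q), (1 : ℝ) / q.totient * ∑ χ ∈ primChars q,
      ‖∑ m ∈ range N₁, ∑ k ∈ range N₂, (a m : ℂ) * b k * (χ m * χ k * ((Y - m * k : ℕ) : ℂ))‖ ≤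
    3 * Y * Real.log (Y + 1) * (5 / Q * √(((N₁ + 4 * Q ^ 2 + 1) * ∑ n ∈ range N₁, a n ^ 2) *
      ((N₂ + 4 * Q ^ 2 + 1) * ∑ n ∈ range N₂, b n ^ 2))) := by
  set L := Real.log (Y + 1)
  have hY' : (2 : ℝ) ≤ Y := by exact_mod_cast hY
  have hL : 1 ≤ L := by
    rw [Real.le_log_iff_exp_le (by positivity)]
    linarith [Real.exp_one_lt_d9]
  set σ := 1 / L
  have hσ : 0 < σ := by positivity
  have hσ1 : σ ≤ 1 := by rw [div_le_one (by linarith)]; exact hL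
  set Bd := 5 / (Q : ℝ) * √(((N₁ + 4 * Q ^ 2 + 1) * ∑ n ∈ range N₁, a n ^ 2) *
      ((N₂ + 4 * Q ^ 2 + 1) * ∑ n ∈ range N₂, b n ^ 2))
  set E := Y / (2 * Real.pi) * Real.exp (σ * Real.log Y)
  set A : (q : ℕ) → DirichletCharacter ℂ q → ℝ → ℝ := fun q χ t =>
    ‖∑ m ∈ range N₁, (a m * vpow σ t m) * χ m‖
  set B : (q : ℕ) → DirichletCharacter ℂ q → ℝ → ℝ := fun q χ t =>
    ‖∑ m ∈ range N₂, (b m * vpow σ t m) * χ m‖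
  have hcont : ∀ (N : ℕ) (c : ℕ → ℝ) (q : ℕ) (χ : DirichletCharacter ℂ q),
      Continuous fun t => ‖∑ m ∈ range N, (c m * vpow σ t m) * χ m‖ := by
    intro N c q χ
    have := fun m => continuous_vpow σ m
    fun_prop
  have hbd : ∀ (N : ℕ) (c : ℕ → ℝ) (q : ℕ) (χ : DirichletCharacter ℂ q) (t : ℝ),
      ‖∑ m ∈ range N, (c m * vpow σ t m) * χ m‖ ≤ ∑ m ∈ range N, |c m| := by
    intro N c q χ t
    refine (norm_sum_le _ _).trans (sum_le_sum fun m _ => ?_)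
    rw [norm_mul, norm_mul, norm_real, Real.norm_eq_abs]
    have h1 := norm_vpow_le hσ.le t m
    have h2 := χ.norm_le_one m
    calc |c m| * ‖vpow σ t m‖ * ‖χ m‖ ≤ |c m| * 1 * 1 := by gcongr
      _ = _ := by ring
  have h_integrable : ∀ (q : ℕ) (χ : DirichletCharacter ℂ q),
      Integrable fun t => (A q χ t * B q χ t) * ‖perronKernel σ t‖ := by
    intro q χ
    refine ((integrable_perronKernel hσ).norm.const_mul
      ((∑ m ∈ range N₁, |a m|) * ∑ m ∈ range N₂, |b m|)).mono'
      (((hcont N₁ a q χ).mul (hcont N₂ b q χ)).mul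
        (continuous_perronKernel hσ).norm).aestronglyMeasurable (.of_forall fun t => ?_)
    rw [Real.norm_of_nonneg (by positivity)]
    have h1 := hbd N₁ a q χ t
    have h2 := hbd N₂ b q χ t
    exact mul_le_mul_of_nonneg_right (mul_le_mul h1 h2 (norm_nonneg _)
      (sum_nonneg fun _ _ => abs_nonneg _)) (norm_nonneg _)
  have hpt : ∀ t, ∑ q ∈ Ioc Q (2 * Q), (1 : ℝ) / q.totient * ∑ χ ∈ primChars q,
      A q χ t * B q χ t ≤ Bd := by
    intro t
    refine (bilinear_large_sieve Q N₁ N₂ hQ (fun m => a m * vpow σ t m)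
      (fun m => b m * vpow σ t m)).trans ?_
    have hle : ∀ (N : ℕ) (c : ℕ → ℝ), ∑ m ∈ range N, ‖(c m : ℂ) * vpow σ t m‖ ^ 2 ≤
        ∑ m ∈ range N, c m ^ 2 := by
      intro N c
      refine sum_le_sum fun m _ => ?_
      rw [norm_mul, norm_real, Real.norm_eq_abs, mul_pow, sq_abs]
      exact mul_le_of_le_one_right (sq_nonneg _)
        (pow_le_one₀ (norm_nonneg _) (norm_vpow_le hσ.le t m))
    have h1 := hle N₁ a
    have h2 := hle N₂ b
    refine mul_le_mul_of_nonneg_left (Real.sqrt_le_sqrt (mul_le_mul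
      (mul_le_mul_of_nonneg_left h1 (by positivity)) (mul_le_mul_of_nonneg_left h2 (by positivity))
      (mul_nonneg (by positivity) (sum_nonneg fun _ _ => by positivity))
      (mul_nonneg (by positivity) (sum_nonneg fun _ _ => by positivity)))) (by positivity)
  calc _ ≤ ∑ q ∈ Ioc Q (2 * Q), (1 : ℝ) / q.totient * ∑ χ ∈ primChars q,
        E * ∫ t, (A q χ t * B q χ t) * ‖perronKernel σ t‖ := by
        gcongr with q _ χ _
        refine (norm_perron_bilinear_le χ hσ (by lia) N₁ N₂ a b ha hb).trans (le_of_eq ?_)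
        rw [← mul_assoc]
    _ = E * ∫ t, ∑ q ∈ Ioc Q (2 * Q), (1 : ℝ) / q.totient * ∑ χ ∈ primChars q,
        (A q χ t * B q χ t) * ‖perronKernel σ t‖ := by
        rw [integral_finsetSum _ fun q _ =>
          (integrable_finsetSum _ fun χ _ => h_integrable q χ).const_mul _, mul_sum]
        refine sum_congr rfl fun q _ => ?_
        rw [integral_const_mul, integral_finsetSum _ fun χ _ => h_integrable q χ, ← mul_sum]
        ring
    _ ≤ E * ∫ t, Bd * ‖perronKernel σ t‖ := by
        refine mul_le_mul_of_nonneg_left ?_ (by positivity)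
        refine integral_mono (integrable_finsetSum _ fun q _ =>
          (integrable_finsetSum _ fun χ _ => h_integrable q χ).const_mul _)
          ((integrable_perronKernel hσ).norm.const_mul _) fun t => ?_
        simp_rw [← sum_mul, ← mul_assoc, ← sum_mul]
        exact mul_le_mul_of_nonneg_right (hpt t) (norm_nonneg _)
    _ ≤ E * (Bd * (2 * Real.pi / σ)) := by
        rw [integral_const_mul]
        have := integral_norm_perronKernel_le hσ hσ1
        gcongr
    _ = Real.exp (σ * Real.log Y) * (Y * L * Bd) := by
        have : (Real.pi : ℝ) ≠ 0 := Real.pi_ne_zero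
        simp only [E, σ]
        field_simp
    _ ≤ 3 * (Y * L * Bd) := by
        have : Real.exp (σ * Real.log Y) ≤ 3 := by
          refine le_trans (Real.exp_le_exp.2 ?_) (by linarith [Real.exp_one_lt_d9] : Real.exp 1 ≤ 3)
          simp only [σ]
          rw [div_mul_eq_mul_div, one_mul, div_le_one (by linarith)]
          exact Real.log_le_log (by linarith) (by linarith)
        gcongr
    _ = _ := by ring

end BombieriVinogradov

namespace BombieriVinogradov
open Finset ArithmeticFunction
open scoped ArithmeticFunction.zeta ArithmeticFunction.Moebius

lemma smoothSum_mul_dyadic {q : ℕ} (f g : ArithmeticFunction ℝ) (χ : DirichletCharacter ℂ q) (Y : ℕ) :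
    smoothSum (f * g) χ Y = ∑ i ∈ range (Nat.log 2 Y + 1), ∑ m ∈ range (2 ^ (i + 1)),
      ∑ k ∈ range (Y / 2 ^ i + 1), ((if Nat.log 2 m = i then f m else 0 : ℝ) : ℂ) * g k *
        (χ m * χ k * ((Y - m * k : ℕ) : ℂ)) := by
  rw [smoothSum_mul]
  set T : ℕ → ℕ → ℂ := fun m k => (f m : ℂ) * g k * (χ m * χ k * ((Y - m * k : ℕ) : ℂ))
  have hT0 : ∀ k, T 0 k = 0 := fun k => by simp [T]
  have hT0' : ∀ m, T m 0 = 0 := fun m => by simp [T]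
  have hTY : ∀ m k, Y ≤ m * k → T m k = 0 := fun m k h => by simp [T, Nat.sub_eq_zero_of_le h]
  have h1 : ∀ i ∈ range (Nat.log 2 Y + 1), ∑ m ∈ range (2 ^ (i + 1)),
      ∑ k ∈ range (Y / 2 ^ i + 1), ((if Nat.log 2 m = i then f m else 0 : ℝ) : ℂ) * g k *
        (χ m * χ k * ((Y - m * k : ℕ) : ℂ)) =
      ∑ m ∈ Ioc 0 Y, if Nat.log 2 m = i then ∑ k ∈ Ioc 0 Y, T m k else 0 := by
    intro i _
    have e : ∀ m ∈ range (2 ^ (i + 1)), ∑ k ∈ range (Y / 2 ^ i + 1),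
        ((if Nat.log 2 m = i then f m else 0 : ℝ) : ℂ) * g k *
        (χ m * χ k * ((Y - m * k : ℕ) : ℂ)) =
        if Nat.log 2 m = i then ∑ k ∈ Ioc 0 Y, T m k else 0 := by
      intro m _
      split_ifs with h
      · rcases Nat.eq_zero_or_pos m with rfl | hm
        · simp [hT0]
        symm
        have hle : 2 ^ i ≤ m := by rw [← h]; exact Nat.pow_log_le_self 2 hm.ne'
        refine (sum_subset (s₂ := range (Y + 1)) (fun k hk => by
          simp only [mem_Ioc, mem_range] at *; lia) fun k _ hk => ?_).trans
          (sum_subset (s₁ := range (Y / 2 ^ i + 1)) (fun k hk => ?_) fun k _ hk => ?_).symm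
        · have : k = 0 := by simp only [mem_Ioc, mem_range] at *; lia
          rw [this, hT0']
        · have := Nat.div_le_self Y (2 ^ i)
          simp only [mem_range] at *; lia
        · apply hTY
          simp only [mem_range, not_lt] at hk
          have := Nat.lt_of_div_lt_div (a := Y) (b := k * 2 ^ i) (c := 2 ^ i)
            (by rw [Nat.mul_div_cancel _ (by positivity)]; lia)
          nlinarith [Nat.mul_le_mul_left k hle]
      · simp
    rw [sum_congr rfl e]
    have hz : ∀ m, Y ≤ m → ∑ k ∈ Ioc 0 Y, T m k = 0 := fun m hm => sum_eq_zero fun k hk =>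
      hTY m k (hm.trans (Nat.le_mul_of_pos_right m (mem_Ioc.1 hk).1))
    rw [← sum_filter, ← sum_filter]
    refine (sum_subset_zero_on_sdiff (s₁ := {m ∈ Ioc 0 Y | Nat.log 2 m = i} ∩
      {m ∈ range (2 ^ (i + 1)) | Nat.log 2 m = i}) inter_subset_right ?_ fun _ _ => rfl).symm.trans
      (sum_subset_zero_on_sdiff inter_subset_left ?_ fun _ _ => rfl)
    · intro m hm
      simp only [mem_sdiff, mem_inter, mem_filter, mem_Ioc, mem_range] at hm
      rcases Nat.eq_zero_or_pos m with rfl | h0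
      · exact sum_eq_zero fun k _ => hT0 k
      · exact hz m (by by_contra hlt; exact hm.2 ⟨⟨⟨h0, by lia⟩, hm.1.2⟩, hm.1⟩)
    · intro m hm
      simp only [mem_sdiff, mem_inter, mem_filter, mem_Ioc, mem_range] at hm
      exfalso
      refine hm.2 ⟨hm.1, ?_, hm.1.2⟩
      rw [← hm.1.2]
      exact Nat.lt_pow_succ_log_self (by norm_num) m
  rw [sum_congr rfl h1]
  refine Eq.trans ?_ sum_comm
  refine sum_congr rfl fun m hm => ?_
  rw [sum_ite_eq, if_pos]
  rw [mem_range, Nat.lt_succ_iff]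
  exact Nat.log_mono_right (mem_Ioc.1 hm).2

lemma natLog_add_one_le {n Y : ℕ} (hn : n ≤ Y) (hY : 2 ≤ Y) :
    ((Nat.log 2 n + 1 : ℕ) : ℝ) ≤ 3 * Real.log (Y + 1) := by
  have hY' : (2 : ℝ) ≤ Y := by exact_mod_cast hY
  have h1 : (2 : ℝ) ^ (Nat.log 2 Y) ≤ Y + 1 := by
    have := Nat.pow_log_le_self 2 (by lia : Y ≠ 0)
    have : ((2 ^ Nat.log 2 Y : ℕ) : ℝ) ≤ Y := by exact_mod_cast this
    push_cast at this; linarith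
  have h2 := Real.log_le_log (by positivity) h1
  rw [Real.log_pow] at h2
  have h3 := Real.log_two_gt_d9
  have h4 : (Nat.log 2 n : ℝ) ≤ Nat.log 2 Y := by exact_mod_cast Nat.log_mono_right hn
  have h5 : 1 ≤ Real.log (Y + 1) := by
    rw [Real.le_log_iff_exp_le (by positivity)]
    linarith [Real.exp_one_lt_d9]
  have h6 : (0 : ℝ) ≤ Nat.log 2 Y := by positivity
  push_cast
  nlinarith

lemma type_two_block_le (Q V Y i : ℕ) (hQ : 1 ≤ Q) (hV : 1 ≤ V) (hY : 2 ≤ Y) (hi : 2 ^ i ≤ Y) :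
    ∑ q ∈ Ioc Q (2 * Q), (1 : ℝ) / q.totient * ∑ χ ∈ primChars q,
      ‖∑ m ∈ range (2 ^ (i + 1)), ∑ k ∈ range (Y / 2 ^ i + 1),
        ((if Nat.log 2 m = i then highPart Λ (V ^ 2) m else 0 : ℝ) : ℂ) *
          ((ζ : ArithmeticFunction ℝ) * highPart (μ : ArithmeticFunction ℝ) (V ^ 2)) k *
        (χ m * χ k * ((Y - m * k : ℕ) : ℂ))‖ ≤
    660 * Real.log (Y + 1) ^ 4 * Y * (Y / Q + 2 * Y / V + Q * √Y) := by
  set L := Real.log (Y + 1) with hLdef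
  set a : ℕ → ℝ := fun m => if Nat.log 2 m = i then highPart Λ (V ^ 2) m else 0
  set b : ℕ → ℝ := fun k => ((ζ : ArithmeticFunction ℝ) *
    highPart (μ : ArithmeticFunction ℝ) (V ^ 2)) k
  have hY' : (2 : ℝ) ≤ Y := by exact_mod_cast hY
  have hQ' : (1 : ℝ) ≤ Q := by exact_mod_cast hQ
  have hV' : (1 : ℝ) ≤ V := by exact_mod_cast hV
  have hL : 1 ≤ L := by
    rw [Real.le_log_iff_exp_le (by positivity)]
    linarith [Real.exp_one_lt_d9]
  set M := 2 ^ i with hM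
  set K := Y / M with hK
  have hRHS : 0 ≤ 660 * L ^ 4 * Y * (Y / Q + 2 * Y / V + Q * √Y) := by positivity
  by_cases hc1 : 2 * M ≤ V ^ 2
  · refine le_trans (le_of_eq ?_) hRHS
    refine sum_eq_zero fun q _ => mul_eq_zero_of_right _ (sum_eq_zero fun χ _ => ?_)
    rw [norm_eq_zero]
    refine sum_eq_zero fun m hm => sum_eq_zero fun k _ => ?_
    have : m ≤ V ^ 2 := by rw [mem_range, pow_succ] at hm; lia
    simp [highPart_apply, this]
  by_cases hc2 : K ≤ V ^ 2
  · refine le_trans (le_of_eq ?_) hRHS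
    refine sum_eq_zero fun q _ => mul_eq_zero_of_right _ (sum_eq_zero fun χ _ => ?_)
    rw [norm_eq_zero]
    refine sum_eq_zero fun m _ => sum_eq_zero fun k hk => ?_
    have : k ≤ V ^ 2 := by rw [mem_range] at hk; lia
    rw [zeta_mul_highPart_eq_zero this]
    simp
  push Not at hc1 hc2
  have hMK : (M : ℝ) * K ≤ Y := by exact_mod_cast Nat.mul_div_le Y M
  have hM1 : (1 : ℝ) ≤ M := by exact_mod_cast Nat.one_le_two_pow
  have hK1 : (1 : ℝ) ≤ K := by exact_mod_cast (by lia : 1 ≤ K)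
  have hc1' : (V : ℝ) ^ 2 ≤ 2 * M := by exact_mod_cast hc1.le
  have hc2' : (V : ℝ) ^ 2 ≤ K := by exact_mod_cast hc2.le
  have hlog : ∀ n ≤ 2 * M, n ≤ Y ^ 2 := by
    intro n hn; nlinarith
  have ha2 : ∑ n ∈ range (2 ^ (i + 1)), a n ^ 2 ≤ 2 * M * (2 * L) ^ 2 := by
    have : ∀ n ∈ range (2 ^ (i + 1)), a n ^ 2 ≤ (2 * L) ^ 2 := by
      intro n hn
      have h1 : |a n| ≤ Real.log n := by
        simp only [a]
        split_ifs
        · refine (abs_highPart_le _ _ _).trans ?_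
          rw [abs_of_nonneg vonMangoldt_nonneg]
          exact vonMangoldt_le_log
        · simpa using Real.log_natCast_nonneg n
      have h2 : Real.log n ≤ 2 * L := by
        have h3 := monotone_log_natCast (hlog n (by rw [mem_range, pow_succ] at hn; lia))
        dsimp only at h3
        push_cast at h3
        rw [Real.log_pow] at h3
        have := Real.log_le_log (by linarith) (by linarith : (Y : ℝ) ≤ Y + 1)
        push_cast at h3
        linarith
      rw [← sq_abs]
      exact pow_le_pow_left₀ (abs_nonneg _) (h1.trans h2) 2
    refine (sum_le_card_nsmul _ _ _ this).trans (le_of_eq ?_)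
    rw [card_range, nsmul_eq_mul, pow_succ, ← hM]
    push_cast
    ring
  have hb2 : ∑ n ∈ range (K + 1), b n ^ 2 ≤ K * (2 * L) ^ 3 := by
    have h0 : ∑ n ∈ range (K + 1), b n ^ 2 = ∑ n ∈ Ioc 0 K, b n ^ 2 := by
      rw [range_eq_Ico, sum_eq_sum_Ico_succ_bot (by lia)]
      simp only [b, ArithmeticFunction.map_zero]
      rw [zero_pow two_ne_zero, zero_add]
      rfl
    rw [h0]
    refine (sum_le_sum fun n _ => ?_).trans ((sum_card_divisors_sq_le K).trans ?_)
    · rw [← sq_abs]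
      exact pow_le_pow_left₀ (abs_nonneg _) (abs_zeta_mul_highPart_le _ _) 2
    · have h3 := monotone_log_natCast ((Nat.div_le_self Y M).trans (Nat.le_succ Y))
      dsimp only at h3
      push_cast at h3
      have h4 := Real.log_natCast_nonneg K
      gcongr
      rw [hK, hLdef] at *
      linarith
  refine (bilinear_smoothSum_le Q (2 ^ (i + 1)) (K + 1) Y hQ hY a b (by simp [a]) (by simp [b])).trans ?_
  have hsq : √((((2 ^ (i + 1) : ℕ) : ℝ) + 4 * Q ^ 2 + 1) * (∑ n ∈ range (2 ^ (i + 1)), a n ^ 2) *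
      ((((K + 1 : ℕ) : ℝ) + 4 * Q ^ 2 + 1) * ∑ n ∈ range (K + 1), b n ^ 2)) ≤
      22 * 2 * L ^ 3 * (Y + 2 * Q * Y / V + Q ^ 2 * √Y) := by
    set V2 := (V : ℝ) ^ 2
    have hV2 : 0 < V2 := by positivity
    have hMV : (M : ℝ) ≤ Y / V2 := by
      rw [le_div_iff₀ hV2]; nlinarith
    have hKV : (K : ℝ) ≤ 2 * (Y / V2) := by
      rw [← mul_div_assoc, le_div_iff₀ hV2]; nlinarith
    have hN1 : ((2 ^ (i + 1) : ℕ) : ℝ) = 2 * M := by rw [pow_succ, ← hM]; push_cast; ring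
    rw [Real.sqrt_le_left (by positivity), hN1]
    have hQ2 : (1 : ℝ) ≤ (Q : ℝ) ^ 2 := one_le_pow₀ hQ'
    have hYV : 0 ≤ (Y : ℝ) / V2 := by positivity
    calc _ ≤ (5 * (M + (Q : ℝ) ^ 2)) * (2 * M * (2 * L) ^ 2) *
          ((6 * (K + (Q : ℝ) ^ 2)) * (K * (2 * L) ^ 3)) := by
          have e1 : (2 * (M : ℝ) + 4 * Q ^ 2 + 1) ≤ 5 * (M + (Q : ℝ) ^ 2) := by linarith
          have e2 : (((K + 1 : ℕ) : ℝ) + 4 * Q ^ 2 + 1) ≤ 6 * (K + (Q : ℝ) ^ 2) := by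
            push_cast; linarith
          have e3 : 0 ≤ ∑ n ∈ range (2 ^ (i + 1)), a n ^ 2 := sum_nonneg fun _ _ => sq_nonneg _
          have e4 : 0 ≤ ∑ n ∈ range (K + 1), b n ^ 2 := sum_nonneg fun _ _ => sq_nonneg _
          gcongr
      _ = 1920 * L ^ 5 * ((M * K) * (M * K + Q ^ 2 * (M + K) + Q ^ 4)) := by ring
      _ ≤ 1920 * L ^ 6 * (Y * (Y + Q ^ 2 * (3 * (Y / V2)) + Q ^ 4)) := by
          have e5 : L ^ 5 ≤ L ^ 6 := pow_le_pow_right₀ hL (by norm_num)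
          have e6 : (M : ℝ) + K ≤ 3 * (Y / V2) := by linarith
          gcongr
      _ ≤ 1936 * L ^ 6 * (Y * Y + (2 * Q * Y / V) ^ 2 + (Q ^ 2 * √Y) ^ 2) := by
          have e7 : (Y * (Y + Q ^ 2 * (3 * (Y / V2)) + Q ^ 4) : ℝ) ≤
              Y * Y + (2 * Q * Y / V) ^ 2 + (Q ^ 2 * √Y) ^ 2 := by
            rw [mul_pow, Real.sq_sqrt (by positivity), div_pow, mul_pow, mul_pow]
            have : (0 : ℝ) ≤ Q ^ 2 * Y ^ 2 / V2 := by positivity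
            have e8 : (Y * (Y + Q ^ 2 * (3 * (Y / V2)) + Q ^ 4) : ℝ) =
              Y * Y + 3 * (Q ^ 2 * Y ^ 2 / V2) + (Q ^ 2) ^ 2 * Y := by ring
            have e9 : (2 ^ 2 * Q ^ 2 * Y ^ 2 / V ^ 2 : ℝ) = 4 * (Q ^ 2 * Y ^ 2 / V2) := by
              simp only [V2]; ring
            rw [e8, e9]
            linarith
          have e10 : (1920 : ℝ) ≤ 1936 := by norm_num
          gcongr
      _ ≤ _ := by
          have f1 : (0 : ℝ) ≤ 2 * Q * Y / V := by positivity
          have f2 : (0 : ℝ) ≤ Q ^ 2 * √Y := by positivity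
          have f3 : (Y * Y + (2 * Q * Y / V) ^ 2 + (Q ^ 2 * √Y) ^ 2 : ℝ) ≤
              (Y + 2 * Q * Y / V + Q ^ 2 * √Y) ^ 2 := by
            nlinarith [mul_nonneg f1 f2, mul_nonneg f1 (by positivity : (0 : ℝ) ≤ Y),
              mul_nonneg f2 (by positivity : (0 : ℝ) ≤ Y)]
          calc _ ≤ 1936 * L ^ 6 * (Y + 2 * Q * Y / V + Q ^ 2 * √Y : ℝ) ^ 2 := by gcongr
            _ = _ := by ring
  refine (mul_le_mul_of_nonneg_left (mul_le_mul_of_nonneg_left hsq (by positivity))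
    (by positivity)).trans (le_of_eq ?_)
  field_simp
  ring

lemma type_two_le (Q V Y : ℕ) (hQ : 1 ≤ Q) (hV : 1 ≤ V) (hY : 2 ≤ Y) :
    ∑ q ∈ Ioc Q (2 * Q), (1 : ℝ) / q.totient * ∑ χ ∈ primChars q,
      ‖smoothSum (highPart Λ (V ^ 2) * (ζ * highPart (μ : ArithmeticFunction ℝ) (V ^ 2))) χ Y‖ ≤
    2000 * Real.log (Y + 1) ^ 5 * Y * (Y / Q + 2 * Y / V + Q * √Y) := by
  simp_rw [smoothSum_mul_dyadic]
  set F : ℕ → (q : ℕ) → DirichletCharacter ℂ q → ℂ := fun i q χ =>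
    ∑ m ∈ range (2 ^ (i + 1)), ∑ k ∈ range (Y / 2 ^ i + 1),
        ((if Nat.log 2 m = i then highPart Λ (V ^ 2) m else 0 : ℝ) : ℂ) *
          ((ζ : ArithmeticFunction ℝ) * highPart (μ : ArithmeticFunction ℝ) (V ^ 2)) k *
        (χ m * χ k * ((Y - m * k : ℕ) : ℂ))
  calc _ ≤ ∑ q ∈ Ioc Q (2 * Q), (1 : ℝ) / q.totient * ∑ χ ∈ primChars q,
        ∑ i ∈ range (Nat.log 2 Y + 1), ‖F i q χ‖ := by
        gcongr
        exact norm_sum_le _ _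
    _ = ∑ i ∈ range (Nat.log 2 Y + 1), ∑ q ∈ Ioc Q (2 * Q), (1 : ℝ) / q.totient *
        ∑ χ ∈ primChars q, ‖F i q χ‖ := by
        rw [sum_comm]
        refine sum_congr rfl fun q _ => ?_
        rw [sum_comm, mul_sum]
    _ ≤ (Nat.log 2 Y + 1 : ℕ) * (660 * Real.log (Y + 1) ^ 4 * Y * (Y / Q + 2 * Y / V + Q * √Y)) := by
        refine (sum_le_card_nsmul _ _ _ fun i hi => type_two_block_le Q V Y i hQ hV hY ?_).trans
          (le_of_eq ?_)
        · rw [mem_range, Nat.lt_succ_iff] at hi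
          exact (Nat.pow_le_pow_right (by norm_num) hi).trans (Nat.pow_log_le_self 2 (by lia))
        · rw [card_range, nsmul_eq_mul]
    _ ≤ (3 * Real.log (Y + 1)) * (660 * Real.log (Y + 1) ^ 4 * Y * (Y / Q + 2 * Y / V + Q * √Y)) := by
        have hL : 0 ≤ Real.log ((Y : ℝ) + 1) := Real.log_nonneg (by linarith [Nat.cast_nonneg (α := ℝ) Y])
        exact mul_le_mul_of_nonneg_right (natLog_add_one_le le_rfl hY) (by positivity)
    _ = 1980 * (Real.log (Y + 1) ^ 5 * Y * (Y / Q + 2 * Y / V + Q * √Y)) := by ring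
    _ ≤ 2000 * (Real.log (Y + 1) ^ 5 * Y * (Y / Q + 2 * Y / V + Q * √Y)) := by
        have hL : 0 ≤ Real.log ((Y : ℝ) + 1) := Real.log_nonneg (by linarith [Nat.cast_nonneg (α := ℝ) Y])
        have : (1980 : ℝ) ≤ 2000 := by norm_num
        gcongr
    _ = _ := by ring

/-- The mean value of smoothed prime character sums over primitive characters. -/
lemma sum_primChars_smoothSum_le (D Q V Y : ℕ) (hD : 1 ≤ D) (hQY : Q ≤ Y) (hV : 1 ≤ V)
    (hY : 2 ≤ Y) :
    ∑ q ∈ Ioc D Q, (1 : ℝ) / q.totient * ∑ χ ∈ primChars q, ‖smoothSum Λ χ Y‖ ≤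
      6000 * Real.log (Y + 1) ^ 6 * Y * (Q ^ 2 * V ^ 4 + Y / D + 2 * Y / V + Q * √Y) := by
  set L := Real.log (Y + 1) with hLdef
  have hY' : (2 : ℝ) ≤ Y := by exact_mod_cast hY
  have hL : 1 ≤ L := by
    rw [Real.le_log_iff_exp_le (by positivity)]
    linarith [Real.exp_one_lt_d9]
  set T : (q : ℕ) → DirichletCharacter ℂ q → ℂ := fun q χ =>
    smoothSum (highPart Λ (V ^ 2) * (ζ * highPart (μ : ArithmeticFunction ℝ) (V ^ 2))) χ Y
  set G : ℕ → ℝ := fun q => (1 : ℝ) / q.totient * ∑ χ ∈ primChars q, ‖T q χ‖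
  have hG : ∀ q, 0 ≤ G q := fun q => by positivity
  have h1 : ∀ q ∈ Ioc D Q, (1 : ℝ) / q.totient * ∑ χ ∈ primChars q, ‖smoothSum Λ χ Y‖ ≤
      8 * Q * V ^ 4 * Y * L + G q := by
    intro q hq
    rw [mem_Ioc] at hq
    have : NeZero q := ⟨by lia⟩
    have hφ : (0 : ℝ) < q.totient := by exact_mod_cast Nat.totient_pos.2 (by lia)
    have hb : ∀ χ ∈ primChars q, ‖smoothSum Λ χ Y‖ ≤ 8 * Q * V ^ 4 * Y * L + ‖T q χ‖ := by
      intro χ hχ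
      rw [mem_primChars] at hχ
      have hne : χ ≠ 1 := by
        rintro rfl
        rw [DirichletCharacter.isPrimitive_def, DirichletCharacter.conductor_one] at hχ
        all_goals lia
      refine (norm_smoothSum_vonMangoldt_le hne (V ^ 2) Y).trans ?_
      push_cast
      rw [← pow_mul, ← hLdef]
      have : (q : ℝ) ≤ Q := by exact_mod_cast hq.2
      gcongr
    calc _ ≤ (1 : ℝ) / q.totient * ∑ χ ∈ primChars q, (8 * Q * V ^ 4 * Y * L + ‖T q χ‖) := by
          gcongr with χ hχ; exact hb χ hχ
      _ = (primChars q).card / q.totient * (8 * Q * V ^ 4 * Y * L) + G q := by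
          rw [sum_add_distrib, sum_const, nsmul_eq_mul, mul_add]; ring
      _ ≤ 1 * (8 * Q * V ^ 4 * Y * L) + G q := by
          have : ((primChars q).card : ℝ) / q.totient ≤ 1 := by
            rw [div_le_one hφ]; exact_mod_cast card_primChars_le q
          gcongr
      _ = _ := by ring
  have hdy : ∀ j : ℕ, ∑ q ∈ Ioc D (D * 2 ^ j), G q ≤
      j * (2000 * L ^ 5 * Y * (Y / D + 2 * Y / V + (D * 2 ^ j : ℕ) / 2 * √Y)) := by
    intro j
    induction j with
    | zero => simp
    | succ j ih =>
      have hle : D ≤ D * 2 ^ j := Nat.le_mul_of_pos_right _ (by positivity)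
      have e : D * 2 ^ (j + 1) = 2 * (D * 2 ^ j) := by ring
      rw [e, ← sum_Ioc_consecutive _ hle (by lia)]
      have h2 := type_two_le (D * 2 ^ j) V Y (by lia) hV hY
      have hDj : (D : ℝ) ≤ (D * 2 ^ j : ℕ) := by exact_mod_cast hle
      have hD0 : (0 : ℝ) < D := by exact_mod_cast hD
      set R : ℝ := ((D * 2 ^ j : ℕ) : ℝ)
      have i1 : j * (2000 * L ^ 5 * Y * (Y / D + 2 * Y / V + R / 2 * √Y)) ≤
          j * (2000 * L ^ 5 * Y * (Y / D + 2 * Y / V + R * √Y)) := by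
        have : R / 2 ≤ R := by linarith
        gcongr
      have i2 : 2000 * L ^ 5 * Y * (Y / R + 2 * Y / V + R * √Y) ≤
          2000 * L ^ 5 * Y * (Y / D + 2 * Y / V + R * √Y) := by
        gcongr
      have e2 : ((2 * (D * 2 ^ j) : ℕ) : ℝ) / 2 = R := by simp [R]
      rw [e2]
      push_cast
      refine (add_le_add (ih.trans i1) (h2.trans i2)).trans (le_of_eq ?_)
      ring
  rcases Nat.lt_or_ge Q D with hQD | hDQ
  · rw [Ioc_eq_empty (by lia), sum_empty]
    positivity
  set J := Nat.log 2 (Q / D) + 1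
  have hJ1 : Q ≤ D * 2 ^ J := by
    have h3 := Nat.lt_pow_succ_log_self (b := 2) (by norm_num) (Q / D)
    have := (Nat.div_lt_iff_lt_mul (by lia)).1 h3
    rw [mul_comm]
    exact this.le
  have hJ2 : D * 2 ^ J ≤ 2 * Q := by
    have h3 := Nat.pow_log_le_self 2 (x := Q / D) (by have := Nat.div_pos hDQ (by lia); lia)
    have := (Nat.mul_le_mul_left D h3).trans (Nat.mul_div_le Q D)
    simp only [J, pow_succ]
    lia
  have hJ3 : (J : ℝ) ≤ 3 * L := natLog_add_one_le ((Nat.div_le_self _ _).trans hQY) hY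
  have hJ2' : ((D * 2 ^ J : ℕ) : ℝ) / 2 ≤ Q := by
    rw [div_le_iff₀ (by norm_num), mul_comm (Q : ℝ)]; exact_mod_cast hJ2
  calc _ ≤ ∑ q ∈ Ioc D Q, (8 * Q * V ^ 4 * Y * L + G q) := sum_le_sum h1
    _ = ((Q - D : ℕ) : ℝ) * (8 * Q * V ^ 4 * Y * L) + ∑ q ∈ Ioc D Q, G q := by
        rw [sum_add_distrib, sum_const, nsmul_eq_mul, Nat.card_Ioc]
    _ ≤ Q * (8 * Q * V ^ 4 * Y * L) + ∑ q ∈ Ioc D (D * 2 ^ J), G q := by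
        refine add_le_add ?_ (sum_le_sum_of_subset_of_nonneg (Ioc_subset_Ioc le_rfl hJ1)
          fun _ _ _ => hG _)
        have : ((Q - D : ℕ) : ℝ) ≤ Q := by exact_mod_cast Nat.sub_le Q D
        gcongr
    _ ≤ Q * (8 * Q * V ^ 4 * Y * L) +
        J * (2000 * L ^ 5 * Y * (Y / D + 2 * Y / V + (D * 2 ^ J : ℕ) / 2 * √Y)) :=
        add_le_add le_rfl (hdy J)
    _ ≤ Q * (8 * Q * V ^ 4 * Y * L ^ 6) +
        (3 * L) * (2000 * L ^ 5 * Y * (Y / D + 2 * Y / V + Q * √Y)) := by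
        have : L ≤ L ^ 6 := le_self_pow₀ hL (by norm_num)
        gcongr
    _ = L ^ 6 * Y * (8 * (Q ^ 2 * V ^ 4) + 6000 * (Y / D + 2 * Y / V + Q * √Y)) := by ring
    _ ≤ L ^ 6 * Y * (6000 * (Q ^ 2 * V ^ 4) + 6000 * (Y / D + 2 * Y / V + Q * √Y)) := by
        have : (8 : ℝ) ≤ 6000 := by norm_num
        gcongr
    _ = _ := by ring

end BombieriVinogradov

namespace BombieriVinogradov
open Finset Complex MeasureTheory Filter Asymptotics Topology

/-- The fluctuation of the partial sums of `c` beyond `N` around slope `κ`. -/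
noncomputable def tailFluct (c : ℕ → ℂ) (κ : ℂ) (N : ℕ) (t : ℝ) : ℂ :=
  if (N : ℝ) < t then ∑ n ∈ Ioc 0 ⌊t⌋₊, c n - ∑ n ∈ Ioc 0 N, c n - κ * (t - N) else 0

lemma measurable_tailFluct (c : ℕ → ℂ) (κ : ℂ) (N : ℕ) : Measurable (tailFluct c κ N) := by
  unfold tailFluct
  refine Measurable.ite measurableSet_Ioi ?_ measurable_const
  have : Measurable fun t : ℝ => ∑ n ∈ Ioc 0 ⌊t⌋₊, c n :=
    (measurable_from_top (f := fun M : ℕ => ∑ n ∈ Ioc 0 M, c n)).comp Nat.measurable_floor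
  fun_prop

lemma norm_tailFluct_le {c : ℕ → ℂ} {κ : ℂ} {B : ℝ}
    (hS : ∀ M : ℕ, ‖∑ n ∈ Ioc 0 M, c n - M * κ‖ ≤ B) (N : ℕ) (t : ℝ) :
    ‖tailFluct c κ N t‖ ≤ 2 * B + ‖κ‖ := by
  have hB : 0 ≤ B := (norm_nonneg _).trans (hS 0)
  unfold tailFluct
  split_ifs with h
  · have ht : 0 ≤ t := (Nat.cast_nonneg N).trans h.le
    have e : ∑ n ∈ Ioc 0 ⌊t⌋₊, c n - ∑ n ∈ Ioc 0 N, c n - κ * (t - N) =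
        (∑ n ∈ Ioc 0 ⌊t⌋₊, c n - (⌊t⌋₊ : ℕ) * κ) - (∑ n ∈ Ioc 0 N, c n - N * κ) -
        κ * ((t - ⌊t⌋₊ : ℝ) : ℂ) := by push_cast; ring
    rw [e]
    refine (norm_sub_le _ _).trans ?_
    have h1 := (norm_sub_le (∑ n ∈ Ioc 0 ⌊t⌋₊, c n - (⌊t⌋₊ : ℕ) * κ)
      (∑ n ∈ Ioc 0 N, c n - N * κ)).trans (add_le_add (hS _) (hS _))
    have h2 : ‖κ * ((t - ⌊t⌋₊ : ℝ) : ℂ)‖ ≤ ‖κ‖ := by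
      rw [norm_mul, norm_real]
      refine mul_le_of_le_one_right (norm_nonneg _) ?_
      rw [Real.norm_of_nonneg (sub_nonneg.2 (Nat.floor_le ht))]
      linarith [Nat.lt_floor_add_one t]
    linarith
  · simp only [norm_zero]
    positivity

lemma differentiableAt_mellin_tailFluct {c : ℕ → ℂ} {κ : ℂ} {B : ℝ}
    (hS : ∀ M : ℕ, ‖∑ n ∈ Ioc 0 M, c n - M * κ‖ ≤ B) {N : ℕ} (hN : 1 ≤ N) {s : ℂ} (hs : s.re < 0) :
    DifferentiableAt ℂ (mellin (tailFluct c κ N)) s := by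
  have hN0 : (0 : ℝ) < N := by exact_mod_cast hN
  refine mellin_differentiableAt_of_isBigO_rpow (a := 0) (b := s.re - 1) ?_ ?_ hs ?_ (by linarith)
  · refine LocallyIntegrable.locallyIntegrableOn ?_ _
    refine (locallyIntegrable_const (2 * B + ‖κ‖)).mono
      (measurable_tailFluct c κ N).aestronglyMeasurable (.of_forall fun t => ?_)
    exact (norm_tailFluct_le hS N t).trans (Real.le_norm_self _)
  · simp only [neg_zero, Real.rpow_zero]
    exact isBigO_of_le' (c := 2 * B + ‖κ‖) _ fun t => by simpa using norm_tailFluct_le hS N t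
  · refine EventuallyEq.trans_isBigO (f₂ := fun _ => (0 : ℂ)) ?_ (isBigO_zero _ _)
    filter_upwards [Ioo_mem_nhdsGT hN0] with t ht
    exact if_neg (not_lt.2 ht.2.le)

lemma mellin_tailFluct (c : ℕ → ℂ) (κ : ℂ) (N : ℕ) (s : ℂ) :
    mellin (tailFluct c κ N) (-s) =
      ∫ t in Set.Ioi (N : ℝ), (t : ℂ) ^ (-s - 1) * tailFluct c κ N t := by
  rw [mellin]
  refine setIntegral_eq_of_subset_of_forall_sdiff_eq_zero measurableSet_Ioi
    (Set.Ioi_subset_Ioi (Nat.cast_nonneg N)) fun t ht => ?_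
  rw [tailFluct, if_neg (by simpa using ht.2)]
  simp

lemma norm_mellin_tailFluct_le {c : ℕ → ℂ} {κ : ℂ} {B : ℝ}
    (hS : ∀ M : ℕ, ‖∑ n ∈ Ioc 0 M, c n - M * κ‖ ≤ B) {N : ℕ} (hN : 1 ≤ N) {s : ℂ} (hs : 0 < s.re) :
    ‖mellin (tailFluct c κ N) (-s)‖ ≤ (2 * B + ‖κ‖) * ((N : ℝ) ^ (-s.re) / s.re) := by
  have hN0 : (0 : ℝ) < N := by exact_mod_cast hN
  rw [mellin_tailFluct]
  have h1 : ∫ t in Set.Ioi (N : ℝ), t ^ (-s.re - 1) = (N : ℝ) ^ (-s.re) / s.re := by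
    rw [integral_Ioi_rpow_of_lt (by linarith) hN0]
    rw [sub_add_cancel, neg_div_neg_eq]
  rw [← h1, ← integral_const_mul]
  refine norm_integral_le_of_norm_le
    ((integrableOn_Ioi_rpow_of_lt (by linarith) hN0).const_mul _) ?_
  filter_upwards [ae_restrict_mem measurableSet_Ioi] with t ht
  have ht0 : 0 < t := hN0.trans ht
  rw [norm_mul, norm_cpow_eq_rpow_re_of_pos ht0, mul_comm]
  simp only [sub_re, neg_re, one_re]
  gcongr
  exact norm_tailFluct_le hS N t

lemma LSeries_eq_sum_add_mellin {c : ℕ → ℂ} {κ : ℂ} {B : ℝ} (hc : ∀ n, ‖c n‖ ≤ 1)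
    (hS : ∀ M : ℕ, ‖∑ n ∈ Ioc 0 M, c n - M * κ‖ ≤ B) {N : ℕ} (hN : 1 ≤ N) {s : ℂ} (hs : 1 < s.re) :
    (s - 1) * LSeries c s = (s - 1) * ∑ n ∈ Ioc 0 N, c n * (n : ℂ) ^ (-s) + κ * (N : ℂ) ^ (1 - s) +
      (s - 1) * s * mellin (tailFluct c κ N) (-s) := by
  have hN0 : (0 : ℝ) < N := by exact_mod_cast hN
  have hs1 : s - 1 ≠ 0 := by
    intro h; rw [sub_eq_zero] at h; rw [h] at hs; simp at hs
  have hs0 : s ≠ 0 := by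
    rintro rfl; simp at hs; linarith
  set c₁ : ℕ → ℂ := fun n => if n ≤ N then c n else 0
  set c₂ : ℕ → ℂ := fun n => if n ≤ N then 0 else c n
  have hc1 : ∀ n, ‖c₁ n‖ ≤ 1 := fun n => by
    simp only [c₁]; split_ifs; exacts [hc n, by simp]
  have hc2 : ∀ n, ‖c₂ n‖ ≤ 1 := fun n => by
    simp only [c₂]; split_ifs; exacts [by simp, hc n]
  have hsum : ∀ f : ℕ → ℂ, (∀ n, ‖f n‖ ≤ 1) → LSeriesSummable f s := fun f hf =>
    LSeriesSummable_of_bounded_of_one_lt_re (fun n _ => hf n) hs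
  have hcc : c = c₁ + c₂ := by
    ext n; simp only [c₁, c₂, Pi.add_apply]; split_ifs <;> simp
  have h1 : LSeries c₁ s = ∑ n ∈ Ioc 0 N, c n * (n : ℂ) ^ (-s) := by
    rw [LSeries, tsum_eq_sum (s := Ioc 0 N)]
    · refine sum_congr rfl fun n hn => ?_
      rw [mem_Ioc] at hn
      rw [LSeries.term_of_ne_zero (by lia), cpow_neg, div_eq_mul_inv]
      simp only [c₁, if_pos hn.2]
    · intro n hn
      rw [mem_Ioc] at hn
      rcases Nat.eq_zero_or_pos n with rfl | h0
      · simp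
      · rw [LSeries.term_of_ne_zero (by lia)]
        simp only [c₁, if_neg (by lia : ¬ n ≤ N), zero_div]
  have hpart : ∀ t : ℝ, 0 ≤ t → ∑ k ∈ Icc 1 ⌊t⌋₊, c₂ k =
      if (N : ℝ) < t then tailFluct c κ N t + κ * (t - N) else 0 := by
    intro t ht
    have e0 : Icc 1 ⌊t⌋₊ = Ioc 0 ⌊t⌋₊ := rfl
    rw [e0]
    split_ifs with h
    · have hNt : N ≤ ⌊t⌋₊ := Nat.le_floor h.le
      rw [tailFluct, if_pos h, ← sum_Ioc_consecutive c (Nat.zero_le N) hNt,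
        ← sum_Ioc_consecutive c₂ (Nat.zero_le N) hNt]
      have e1 : ∑ i ∈ Ioc 0 N, c₂ i = 0 := sum_eq_zero fun i hi => if_pos (mem_Ioc.1 hi).2
      have e2 : ∑ i ∈ Ioc N ⌊t⌋₊, c₂ i = ∑ i ∈ Ioc N ⌊t⌋₊, c i := sum_congr rfl fun i hi =>
        if_neg (not_le.2 (mem_Ioc.1 hi).1)
      rw [e1, e2]
      ring
    · refine sum_eq_zero fun i hi => if_pos ?_
      have : (i : ℝ) ≤ t := (Nat.le_floor_iff ht).1 (mem_Ioc.1 hi).2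
      exact_mod_cast this.trans (not_lt.1 h)
  have h2 : LSeries c₂ s = s * ∫ t in Set.Ioi (1 : ℝ), (∑ k ∈ Icc 1 ⌊t⌋₊, c₂ k) * t ^ (-(s + 1)) := by
    refine LSeries_eq_mul_integral c₂ zero_le_one hs (hsum _ hc2) ?_
    simp only [Real.rpow_one]
    refine isBigO_of_le _ fun n => ?_
    refine (norm_sum_le_of_le _ fun k _ => hc2 k).trans ?_
    simp
  have h3 : ∫ t in Set.Ioi (1 : ℝ), (∑ k ∈ Icc 1 ⌊t⌋₊, c₂ k) * (t : ℂ) ^ (-(s + 1)) =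
      ∫ t in Set.Ioi (N : ℝ), ((t : ℂ) ^ (-s - 1) * tailFluct c κ N t +
        κ * ((t : ℂ) ^ (-s) - N * (t : ℂ) ^ (-s - 1))) := by
    have hN1 : (1 : ℝ) ≤ N := by exact_mod_cast hN
    rw [setIntegral_eq_of_subset_of_forall_sdiff_eq_zero measurableSet_Ioi
      (Set.Ioi_subset_Ioi hN1) fun t ht => ?_]
    · refine setIntegral_congr_fun measurableSet_Ioi fun t ht => ?_
      have ht0 : (0 : ℝ) < t := hN0.trans ht
      have htc : (t : ℂ) ≠ 0 := by exact_mod_cast ht0.ne'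
      rw [hpart t ht0.le, if_pos (Set.mem_Ioi.1 ht), neg_add, ← sub_eq_add_neg]
      have : (t : ℂ) ^ (-s) = t * (t : ℂ) ^ (-s - 1) := by
        rw [cpow_sub _ _ htc, cpow_one]; field_simp
      rw [this]
      ring
    · have h0 : (0 : ℝ) ≤ t := zero_le_one.trans (le_of_lt ht.1)
      rw [hpart t h0, if_neg (by simpa using ht.2), zero_mul]
  have i1 : IntegrableOn (fun t : ℝ => (t : ℂ) ^ (-s - 1)) (Set.Ioi (N : ℝ)) :=
    integrableOn_Ioi_cpow_of_lt (by simp; linarith) hN0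
  have i2 : IntegrableOn (fun t : ℝ => (t : ℂ) ^ (-s)) (Set.Ioi (N : ℝ)) :=
    integrableOn_Ioi_cpow_of_lt (by simp; linarith) hN0
  have i3 : IntegrableOn (fun t : ℝ => (t : ℂ) ^ (-s - 1) * tailFluct c κ N t)
      (Set.Ioi (N : ℝ)) :=
    Integrable.mul_bdd (c := 2 * B + ‖κ‖) i1 (measurable_tailFluct c κ N).aestronglyMeasurable
      (.of_forall fun t => norm_tailFluct_le hS N t)
  have hNc : (N : ℂ) ≠ 0 := by exact_mod_cast hN0.ne'
  have h4 : ∫ t in Set.Ioi (N : ℝ), κ * ((t : ℂ) ^ (-s) - N * (t : ℂ) ^ (-s - 1)) =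
      κ * ((N : ℂ) ^ (1 - s) / (s * (s - 1))) := by
    rw [integral_const_mul, integral_sub i2 (i1.const_mul _), integral_const_mul,
      integral_Ioi_cpow_of_lt (by simp; linarith) hN0, integral_Ioi_cpow_of_lt (by simp; linarith) hN0]
    congr 1
    have e1 : (N : ℂ) ^ (-s - 1 + 1) = (N : ℂ) ^ (1 - s) / N := by
      rw [sub_add_cancel, sub_eq_add_neg, cpow_add _ _ hNc, cpow_one]; field_simp
    have e2 : -s + 1 = 1 - s := by ring
    push_cast
    rw [e1, e2]
    have hs1' : 1 - s ≠ 0 := by rw [← neg_sub]; exact neg_ne_zero.2 hs1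
    have e3 : -s - 1 + 1 = -s := by ring
    rw [e3]
    field_simp
    ring
  have i4 : IntegrableOn (fun t : ℝ => κ * ((t : ℂ) ^ (-s) - N * (t : ℂ) ^ (-s - 1)))
      (Set.Ioi (N : ℝ)) := (i2.sub (i1.const_mul _)).const_mul κ
  rw [hcc, LSeries_add (hsum _ hc1) (hsum _ hc2), ← hcc, h1, h2, h3, integral_add i3 i4, h4, mellin_tailFluct]
  field_simp
  ring

/-- Analytic continuation of the truncated representation of a Dirichlet series. -/
lemma continuation_eq_sum_add_mellin {c : ℕ → ℂ} {κ : ℂ} {B : ℝ} (hc : ∀ n, ‖c n‖ ≤ 1)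
    (hS : ∀ M : ℕ, ‖∑ n ∈ Ioc 0 M, c n - M * κ‖ ≤ B) {H : ℂ → ℂ} (hH : Differentiable ℂ H)
    (hHL : ∀ s : ℂ, 1 < s.re → H s = (s - 1) * LSeries c s) {N : ℕ} (hN : 1 ≤ N) {s : ℂ}
    (hs : 0 < s.re) :
    H s = (s - 1) * ∑ n ∈ Ioc 0 N, c n * (n : ℂ) ^ (-s) + κ * (N : ℂ) ^ (1 - s) +
      (s - 1) * s * mellin (tailFluct c κ N) (-s) := by
  set U : Set ℂ := {s | 0 < s.re}
  have hU : IsOpen U := isOpen_lt continuous_const continuous_re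
  have hUc : IsPreconnected U := (convex_halfSpace_re_gt 0).isPreconnected
  have hd : DifferentiableOn ℂ (fun s : ℂ => (s - 1) * ∑ n ∈ Ioc 0 N, c n * (n : ℂ) ^ (-s) +
      κ * (N : ℂ) ^ (1 - s) + (s - 1) * s * mellin (tailFluct c κ N) (-s)) U := by
    intro z hz
    refine DifferentiableAt.differentiableWithinAt ?_
    have h1 : DifferentiableAt ℂ (fun s => mellin (tailFluct c κ N) (-s)) z :=
      (differentiableAt_mellin_tailFluct hS hN (s := -z) (by simpa [U] using hz)).comp z
        differentiable_neg.differentiableAt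
    have h2 : DifferentiableAt ℂ (fun s : ℂ => ∑ n ∈ Ioc 0 N, c n * (n : ℂ) ^ (-s)) z := by
      refine DifferentiableAt.fun_sum fun n hn => ?_
      have : (n : ℂ) ≠ 0 := by exact_mod_cast (mem_Ioc.1 hn).1.ne'
      exact ((differentiableAt_id.neg).const_cpow (Or.inl this)).const_mul _
    have h3 : DifferentiableAt ℂ (fun s : ℂ => (N : ℂ) ^ (1 - s)) z := by
      have : (N : ℂ) ≠ 0 := by exact_mod_cast (by lia : N ≠ 0)
      exact (differentiableAt_id.const_sub 1).const_cpow (Or.inl this)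
    fun_prop
  refine (hH.differentiableOn.analyticOnNhd hU).eqOn_of_preconnected_of_eventuallyEq
    (hd.analyticOnNhd hU) hUc (z₀ := 2) (by simp [U]) ?_ hs
  have : {z : ℂ | 1 < z.re} ∈ 𝓝 (2 : ℂ) :=
    (isOpen_lt continuous_const continuous_re).mem_nhds (by simp)
  filter_upwards [this] with z hz
  rw [hHL z hz, LSeries_eq_sum_add_mellin hc hS hN hz]

end BombieriVinogradov

namespace BombieriVinogradov
open Finset Complex MeasureTheory Filter Asymptotics Topology DirichletCharacter

/-- The mean value of a Dirichlet character. -/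
noncomputable def charMean {q : ℕ} [NeZero q] (χ : DirichletCharacter ℂ q) : ℂ :=
  (∑ a, χ a) / q

lemma charMean_of_ne_one {q : ℕ} [NeZero q] {χ : DirichletCharacter ℂ q} (hχ : χ ≠ 1) :
    charMean χ = 0 := by
  rw [charMean, MulChar.sum_eq_zero_of_ne_one hχ, zero_div]

lemma norm_charMean_le {q : ℕ} [NeZero q] (χ : DirichletCharacter ℂ q) : ‖charMean χ‖ ≤ 1 := by
  have hq : (0 : ℝ) < q := by exact_mod_cast NeZero.pos q
  rw [charMean, norm_div, norm_natCast, div_le_one hq]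
  refine (norm_sum_le_of_le _ fun a _ => χ.norm_le_one a).trans ?_
  simp

lemma norm_sum_Ioc_character_sub_le {q : ℕ} [NeZero q] (χ : DirichletCharacter ℂ q) (M : ℕ) :
    ‖∑ n ∈ Ioc 0 M, χ n - M * charMean χ‖ ≤ 4 * q := by
  have h := norm_sum_range_character_sub_le χ (M + 1)
  have hq : (1 : ℝ) ≤ q := by exact_mod_cast NeZero.pos q
  have e : ∑ n ∈ Ioc 0 M, χ n - M * charMean χ =
      (∑ n ∈ range (M + 1), χ n - (M + 1 : ℕ) * charMean χ) - (χ 0 - charMean χ) := by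
    rw [range_eq_Ico, sum_eq_sum_Ico_succ_bot (by lia)]
    have : Ico (0 + 1) (M + 1) = Ioc 0 M := rfl
    rw [this]
    push_cast
    ring
  rw [e]
  have h1 := norm_sub_le (χ 0) (charMean χ)
  have h2 := norm_charMean_le χ
  have h3 := χ.norm_le_one 0
  have h4 := norm_sub_le (∑ n ∈ range (M + 1), χ n - (M + 1 : ℕ) * charMean χ) (χ 0 - charMean χ)
  rw [charMean] at *
  linarith

/-- An entire function agreeing with `(s - 1) * L(s, χ)` away from `1`. -/
lemma exists_differentiable_sub_one_mul_LFunction {q : ℕ} [NeZero q] (χ : DirichletCharacter ℂ q) :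
    ∃ H : ℂ → ℂ, Differentiable ℂ H ∧ ∀ s ≠ 1, H s = (s - 1) * LFunction χ s := by
  by_cases hχ : χ = 1
  · subst hχ
    exact ⟨_, differentiable_LFunctionTrivChar₁ q, fun s hs => Function.update_of_ne hs _ _⟩
  · refine ⟨fun s => (s - 1) * LFunction χ s, ?_, fun _ _ => rfl⟩
    have := differentiable_LFunction hχ
    fun_prop

lemma LFunction_eq_sum_add_mellin {q : ℕ} [NeZero q] (χ : DirichletCharacter ℂ q) {N : ℕ}
    (hN : 1 ≤ N) {s : ℂ} (hs : 0 < s.re) (hs1 : s ≠ 1) :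
    LFunction χ s = ∑ n ∈ Ioc 0 N, χ n * (n : ℂ) ^ (-s) +
      charMean χ * ((N : ℂ) ^ (1 - s) / (s - 1)) +
        s * mellin (tailFluct (fun n => χ n) (charMean χ) N) (-s) := by
  obtain ⟨H, hH, hHL⟩ := exists_differentiable_sub_one_mul_LFunction χ
  have h := continuation_eq_sum_add_mellin (c := fun n => χ n) (κ := charMean χ) (B := 4 * q)
    (fun n => χ.norm_le_one n) (fun M => norm_sum_Ioc_character_sub_le χ M) hH (fun s hs => by
      rw [hHL s (by rintro rfl; simp at hs), LFunction_eq_LSeries χ hs]) hN hs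
  rw [hHL s hs1] at h
  have h1 : s - 1 ≠ 0 := sub_ne_zero.2 hs1
  apply mul_left_cancel₀ h1
  rw [h]
  field_simp

lemma one_add_log_le_rpow {N : ℕ} (hN : 1 ≤ N) {η : ℝ} (hη : 0 < η) (hη' : η ≤ 1) :
    (1 + Real.log N) ≤ 2 / η * (N : ℝ) ^ η := by
  have h1 := Real.log_le_rpow_div (Nat.cast_nonneg N) hη
  have h2 : 1 ≤ (N : ℝ) ^ η := Real.one_le_rpow (by exact_mod_cast hN) hη.le
  have h3 : 1 ≤ (N : ℝ) ^ η / η := by rw [le_div_iff₀ hη]; linarith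
  calc _ ≤ (N : ℝ) ^ η / η + (N : ℝ) ^ η / η := add_le_add h3 h1
    _ = _ := by ring

lemma norm_LFunction_sub_le {q : ℕ} [NeZero q] {χ : DirichletCharacter ℂ q} {η : ℝ} (hη : 0 < η)
    (hη' : η ≤ 1 / 4) {N : ℕ} (hN : 1 ≤ N) {s : ℂ} (hs : 1 - η ≤ s.re) (hNs : q * ‖s‖ ≤ N)
    (hs1 : s ≠ 1) :
    ‖LFunction χ s‖ ≤ 15 / η * (N : ℝ) ^ (2 * η) + ‖charMean χ‖ * ((N : ℝ) ^ η / ‖s - 1‖) := by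
  have hs0 : 3 / 4 ≤ s.re := by linarith
  have hN1 : (1 : ℝ) ≤ N := by exact_mod_cast hN
  have hN0 : (0 : ℝ) < N := by linarith
  have hq : (1 : ℝ) ≤ q := by exact_mod_cast NeZero.pos q
  rw [LFunction_eq_sum_add_mellin χ hN (by linarith) hs1]
  have hNη : 1 ≤ (N : ℝ) ^ η := Real.one_le_rpow hN1 hη.le
  have h1 : ‖∑ n ∈ Ioc 0 N, χ n * (n : ℂ) ^ (-s)‖ ≤ (N : ℝ) ^ η * (2 / η * (N : ℝ) ^ η) := by
    calc _ ≤ ∑ n ∈ Ioc 0 N, (N : ℝ) ^ η * ((1 : ℝ) / n) := by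
          refine norm_sum_le_of_le _ fun n hn => ?_
          rw [mem_Ioc] at hn
          have hn0 : (1 : ℝ) ≤ n := by exact_mod_cast hn.1
          have hnN : (n : ℝ) ≤ N := by exact_mod_cast hn.2
          rw [norm_mul, ← ofReal_natCast, norm_cpow_eq_rpow_re_of_pos (by linarith)]
          calc _ ≤ 1 * (n : ℝ) ^ (-s).re := by gcongr; exact χ.norm_le_one n
            _ ≤ (n : ℝ) ^ (η - 1) := by
                rw [one_mul]
                exact Real.rpow_le_rpow_of_exponent_le hn0 (by simp; linarith)
            _ = (n : ℝ) ^ η * ((1 : ℝ) / n) := by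
                rw [Real.rpow_sub (by linarith), Real.rpow_one]; ring
            _ ≤ _ := by gcongr
      _ = (N : ℝ) ^ η * ∑ n ∈ Ioc 0 N, (1 : ℝ) / n := by rw [mul_sum]
      _ ≤ (N : ℝ) ^ η * (2 / η * (N : ℝ) ^ η) := by
          gcongr
          exact (sum_inv_le_one_add_log N).trans (one_add_log_le_rpow hN hη (by linarith))
  have h2 : ‖charMean χ * ((N : ℂ) ^ (1 - s) / (s - 1))‖ ≤
      ‖charMean χ‖ * ((N : ℝ) ^ η / ‖s - 1‖) := by
    rw [norm_mul, norm_div, ← ofReal_natCast, norm_cpow_eq_rpow_re_of_pos hN0]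
    gcongr
    simp; linarith
  have h3 : ‖s * mellin (tailFluct (fun n => χ n) (charMean χ) N) (-s)‖ ≤ 12 * (N : ℝ) ^ η := by
    rw [norm_mul]
    calc _ ≤ ‖s‖ * ((2 * (4 * q) + ‖charMean χ‖) * ((N : ℝ) ^ (-s.re) / s.re)) := by
          gcongr
          exact norm_mellin_tailFluct_le (fun M => norm_sum_Ioc_character_sub_le χ M) hN
            (by linarith)
      _ ≤ ‖s‖ * ((9 * q) * ((N : ℝ) ^ (η - 1) / (3 / 4))) := by
          have := norm_charMean_le χ
          gcongr
          · linarith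
          · linarith
      _ = 12 * (N : ℝ) ^ η * ((q * ‖s‖) / N) := by
          rw [Real.rpow_sub hN0, Real.rpow_one]; ring
      _ ≤ 12 * (N : ℝ) ^ η * 1 := by
          gcongr
          rwa [div_le_one hN0]
      _ = _ := by ring
  have h4 : (N : ℝ) ^ (2 * η) = (N : ℝ) ^ η * (N : ℝ) ^ η := by
    rw [← Real.rpow_add hN0]; ring_nf
  have h5 : 12 * (N : ℝ) ^ η ≤ 13 / η * ((N : ℝ) ^ η * (N : ℝ) ^ η) := by
    have : 12 ≤ 13 / η := by rw [le_div_iff₀ hη]; linarith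
    have h6 : (N : ℝ) ^ η ≤ (N : ℝ) ^ η * (N : ℝ) ^ η := le_mul_of_one_le_left (by positivity) hNη
    gcongr
  refine (norm_add₃_le).trans ?_
  rw [h4]
  calc _ ≤ (N : ℝ) ^ η * (2 / η * (N : ℝ) ^ η) + ‖charMean χ‖ * ((N : ℝ) ^ η / ‖s - 1‖) +
        13 / η * ((N : ℝ) ^ η * (N : ℝ) ^ η) := add_le_add (add_le_add h1 h2) (h3.trans h5)
    _ = _ := by ring

lemma norm_LFunction_le {q : ℕ} [NeZero q] {χ : DirichletCharacter ℂ q} (hχ : χ ≠ 1) {η : ℝ}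
    (hη : 0 < η) (hη' : η ≤ 1 / 4) {N : ℕ} (hN : 1 ≤ N) {s : ℂ} (hs : 1 - η ≤ s.re)
    (hNs : q * ‖s‖ < N) : ‖LFunction χ s‖ ≤ 15 / η * (N : ℝ) ^ (2 * η) := by
  have key : ∀ z : ℂ, 1 - η ≤ z.re → q * ‖z‖ ≤ N → z ≠ 1 →
      ‖LFunction χ z‖ ≤ 15 / η * (N : ℝ) ^ (2 * η) := by
    intro z h1 h2 h3
    have := norm_LFunction_sub_le (χ := χ) hη hη' hN h1 h2 h3
    rwa [charMean_of_ne_one hχ, norm_zero, zero_mul, add_zero] at this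
  by_cases h1 : s = 1
  · subst h1
    have hc : Tendsto (fun z => ‖LFunction χ z‖) (𝓝[≠] 1) (𝓝 ‖LFunction χ 1‖) :=
      ((differentiable_LFunction hχ).continuous.norm.tendsto 1).mono_left nhdsWithin_le_nhds
    refine le_of_tendsto hc ?_
    have h2 : ∀ᶠ z : ℂ in 𝓝 1, 1 - η < z.re :=
      (isOpen_lt continuous_const continuous_re).mem_nhds (by simpa using hη)
    have h3 : ∀ᶠ z : ℂ in 𝓝 1, q * ‖z‖ < N :=
      (isOpen_lt (by fun_prop) continuous_const).mem_nhds hNs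
    filter_upwards [nhdsWithin_le_nhds h2, nhdsWithin_le_nhds h3, self_mem_nhdsWithin]
      with z h4 h5 h6 using key z h4.le h5.le h6
  · exact key s hs hNs.le h1

/-- The analytic conductor at height `t`. -/
noncomputable def cond (q : ℕ) (t : ℝ) : ℝ := q * (|t| + 4)

lemma one_le_cond (q : ℕ) [NeZero q] (t : ℝ) : 1 ≤ cond q t := by
  have hq : (1 : ℝ) ≤ q := by exact_mod_cast NeZero.pos q
  have := abs_nonneg t
  unfold cond
  nlinarith

lemma exists_nat_near_cond (q : ℕ) [NeZero q] (t : ℝ) :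
    ∃ N : ℕ, 1 ≤ N ∧ q * (|t| + 3) < N ∧ (N : ℝ) ≤ cond q t := by
  have hq : (1 : ℝ) ≤ q := by exact_mod_cast NeZero.pos q
  have ht := abs_nonneg t
  refine ⟨⌊q * (|t| + 3)⌋₊ + 1, by lia, ?_, ?_⟩
  · push_cast; exact Nat.lt_floor_add_one _
  · push_cast
    have := Nat.floor_le (by positivity : 0 ≤ q * (|t| + 3))
    unfold cond
    linarith

lemma norm_iteratedDeriv_LFunction_le {q : ℕ} [NeZero q] (χ : DirichletCharacter ℂ q) {η : ℝ}
    (hη : 0 < η) (hη' : η ≤ 1 / 4) {s : ℂ} (hs : 1 ≤ s.re) (hs' : s.re ≤ 2)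
    (h : χ ≠ 1 ∨ 1 / 2 ≤ |s.im|) (j : ℕ) :
    ‖iteratedDeriv j (LFunction χ) s‖ ≤ j.factorial * (19 / η * cond q s.im ^ (2 * η)) / η ^ j := by
  obtain ⟨N, hN, hN1, hN2⟩ := exists_nat_near_cond q s.im
  have hNr : (1 : ℝ) ≤ N := by exact_mod_cast hN
  have hq : (1 : ℝ) ≤ q := by exact_mod_cast NeZero.pos q
  have hne : ∀ z ∈ Metric.closedBall s η, χ ≠ 1 ∨ 1 / 4 ≤ ‖z - 1‖ := by
    intro z hz
    refine h.imp_right fun h => ?_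
    rw [mem_closedBall_iff_norm] at hz
    have h1 := (abs_im_le_norm (z - s)).trans hz
    have h2 := abs_im_le_norm (z - 1)
    have h3 : |s.im| ≤ |z.im| + |z.im - s.im| := by
      have := abs_sub_abs_le_abs_sub s.im z.im
      rw [abs_sub_comm] at this; linarith
    simp only [sub_im, one_im, sub_zero] at h1 h2
    linarith
  have hdc : DiffContOnCl ℂ (LFunction χ) (Metric.ball s η) := by
    refine DifferentiableOn.diffContOnCl fun z hz => ?_
    rw [closure_ball _ hη.ne'] at hz
    refine (differentiableAt_LFunction χ z ?_).differentiableWithinAt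
    rcases hne z hz with h | h
    · exact Or.inr h
    · left; rintro rfl; simp at h; linarith
  refine norm_iteratedDeriv_le_of_forall_mem_sphere_norm_le j hη hdc fun z hz => ?_
  have hz' : ‖z - s‖ = η := by simpa using hz
  have hre : 1 - η ≤ z.re := by
    have := (abs_re_le_norm (z - s)).trans hz'.le
    rw [sub_re] at this
    linarith [(abs_le.1 this).1]
  have hnorm : q * ‖z‖ < N := by
    refine lt_of_le_of_lt ?_ hN1
    gcongr
    have h1 := norm_add_le (z - s) s
    rw [sub_add_cancel] at h1
    have h2 := norm_le_abs_re_add_abs_im s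
    rw [abs_of_nonneg (by linarith)] at h2
    linarith
  have hpow : (N : ℝ) ^ (2 * η) ≤ cond q s.im ^ (2 * η) := by gcongr
  rcases hne z (Metric.sphere_subset_closedBall hz) with h | h
  · calc _ ≤ 15 / η * (N : ℝ) ^ (2 * η) := norm_LFunction_le h hη hη' hN hre hnorm
      _ ≤ 19 / η * cond q s.im ^ (2 * η) := by gcongr; norm_num
  · calc _ ≤ 15 / η * (N : ℝ) ^ (2 * η) + ‖charMean χ‖ * ((N : ℝ) ^ η / ‖z - 1‖) :=
          norm_LFunction_sub_le hη hη' hN hre hnorm.le (by rintro rfl; simp at h; linarith)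
      _ ≤ 15 / η * (N : ℝ) ^ (2 * η) + 1 * ((N : ℝ) ^ (2 * η) / (1 / 4)) := by
          have := norm_charMean_le χ
          gcongr
          linarith
      _ = (15 / η + 4) * (N : ℝ) ^ (2 * η) := by ring
      _ ≤ 19 / η * cond q s.im ^ (2 * η) := by
          gcongr
          have : 4 ≤ 4 / η := by rw [le_div_iff₀ hη]; linarith
          calc 15 / η + 4 ≤ 15 / η + 4 / η := by linarith
            _ = 19 / η := by ring

end BombieriVinogradov

namespace BombieriVinogradov
open Finset Complex Filter Topology DirichletCharacter

lemma norm_LSeries_le {c : ℕ → ℂ} (hc : ∀ n, ‖c n‖ ≤ 1) {s : ℂ} (hs : 1 < s.re) (hs' : s.re ≤ 2) :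
    ‖LSeries c s‖ ≤ 2 / (s.re - 1) := by
  have h0 : 0 < s.re - 1 := by linarith
  have hsum : Summable fun n : ℕ => 1 / (n : ℝ) ^ s.re := Real.summable_one_div_nat_rpow.2 hs
  have hle : ∀ n : ℕ, ‖LSeries.term c s n‖ ≤ 1 / (n : ℝ) ^ s.re := by
    intro n
    rcases Nat.eq_zero_or_pos n with rfl | hn
    · simp; positivity
    · rw [LSeries.norm_term_eq, if_neg hn.ne']
      gcongr
      exact hc n
  have h1 := ZetaAsymptotics.zeta_limit_aux1 hs
  have h2 : 0 ≤ ZetaAsymptotics.termTSum s.re :=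
    tsum_nonneg fun n => ZetaAsymptotics.term_nonneg _ _
  have h3 : ∑' n : ℕ, 1 / (n : ℝ) ^ s.re = ∑' n : ℕ, 1 / (n + 1 : ℝ) ^ s.re := by
    rw [hsum.tsum_eq_zero_add]
    have : (0 : ℝ) ^ s.re = 0 := Real.zero_rpow (by linarith)
    simp [this]
  calc ‖LSeries c s‖ ≤ ∑' n : ℕ, 1 / (n : ℝ) ^ s.re := tsum_of_norm_bounded hsum.hasSum hle
    _ ≤ 1 + 1 / (s.re - 1) := by rw [h3]; nlinarith
    _ ≤ 1 / (s.re - 1) + 1 / (s.re - 1) := by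
        gcongr
        rw [le_div_iff₀ h0]; linarith
    _ = _ := by ring

lemma norm_LFunction_of_one_lt_le {q : ℕ} [NeZero q] (χ : DirichletCharacter ℂ q) {s : ℂ}
    (hs : 1 < s.re) (hs' : s.re ≤ 2) : ‖LFunction χ s‖ ≤ 2 / (s.re - 1) := by
  rw [LFunction_eq_LSeries χ hs]
  exact norm_LSeries_le (fun n => χ.norm_le_one n) hs hs'

lemma le_norm_LFunction_of_one_lt {q : ℕ} [NeZero q] (χ : DirichletCharacter ℂ q) {s : ℂ}
    (hs : 1 < s.re) (hs' : s.re ≤ 2) : (s.re - 1) / 2 ≤ ‖LFunction χ s‖ := by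
  have h0 : 0 < s.re - 1 := by linarith
  have h := DirichletCharacter.LSeries.mul_mu_eq_one χ hs
  rw [← LFunction_eq_LSeries χ hs] at h
  have h1 : ‖LSeries ((fun n : ℕ => χ n) * fun n => (ArithmeticFunction.moebius n : ℂ)) s‖ ≤
      2 / (s.re - 1) := by
    refine norm_LSeries_le (fun n => ?_) hs hs'
    rw [Pi.mul_apply, norm_mul]
    refine mul_le_one₀ (χ.norm_le_one n) (norm_nonneg _) ?_
    rw [norm_intCast]
    exact_mod_cast ArithmeticFunction.abs_moebius_le_one
  have h2 : ‖LFunction χ s‖ * ‖LSeries ((fun n : ℕ => χ n) *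
      fun n => (ArithmeticFunction.moebius n : ℂ)) s‖ = 1 := by
    rw [← norm_mul]
    exact (congrArg norm h).trans norm_one
  have h3 : 1 ≤ ‖LFunction χ s‖ * (2 / (s.re - 1)) := by
    exact h2.symm.le.trans (mul_le_mul_of_nonneg_left h1 (norm_nonneg _))
  rw [mul_div_assoc', le_div_iff₀ h0] at h3
  linarith

/-- A quantitative form of the nonvanishing of `L(s, χ)` on the line `re s = 1`. -/
lemma le_norm_LFunction_of_bounds {q : ℕ} [NeZero q] (χ : DirichletCharacter ℂ q) {t K : ℝ}
    (hK : 1 ≤ K) (ht : χ ≠ 1 ∨ t ≠ 0)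
    (h2 : ∀ x : ℝ, 0 < x → x ≤ 1 → ‖LFunction (χ ^ 2) (1 + x + 2 * I * t)‖ ≤ K)
    (hd : ∀ x : ℝ, 0 ≤ x → x ≤ 1 → ‖deriv (LFunction χ) (1 + x + I * t)‖ ≤ K)
    {x : ℝ} (hx : 0 < x) (hx1 : x ≤ 1) :
    1 / (256 * K ^ 7) ≤ ‖LFunction χ (1 + x + I * t)‖ := by
  have hK0 : 0 < K := by linarith
  have key : ∀ x : ℝ, 0 < x → x ≤ 1 → x ^ 3 / (8 * K) ≤ ‖LFunction χ (1 + x + I * t)‖ ^ 4 := by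
    intro x hx hx1
    have h1 := norm_LFunction_product_ge_one χ hx t
    have h3 : ‖LFunctionTrivChar q (1 + x)‖ ≤ 2 / x := by
      have := norm_LFunction_of_one_lt_le (1 : DirichletCharacter ℂ q) (s := 1 + x)
        (by simpa using hx) (by simp; linarith)
      simpa using this
    rw [norm_mul, norm_mul, norm_pow, norm_pow] at h1
    rw [div_le_iff₀ (by positivity)]
    have h4 : (1 : ℝ) ≤ (2 / x) ^ 3 * ‖LFunction χ (1 + x + I * t)‖ ^ 4 * K := by
      refine h1.le.trans ?_
      gcongr
      exact h2 x hx hx1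
    calc x ^ 3 ≤ x ^ 3 * ((2 / x) ^ 3 * ‖LFunction χ (1 + x + I * t)‖ ^ 4 * K) :=
          le_mul_of_one_le_right (by positivity) h4
      _ = _ := by field_simp; ring
  set u : ℝ := 1 / (4 * K ^ 2) with hu
  have hu0 : 0 < u := by positivity
  have hu1 : u ≤ 1 := by
    rw [hu, div_le_one (by positivity)]
    nlinarith
  have big : ∀ x : ℝ, u ^ 4 ≤ x → x ≤ 1 → u ^ 3 / (2 * K) ≤ ‖LFunction χ (1 + x + I * t)‖ := by
    intro x h1 h3
    have hx : 0 < x := lt_of_lt_of_le (by positivity) h1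
    refine le_of_pow_le_pow_left₀ (n := 4) (by norm_num) (norm_nonneg _) (le_trans ?_ (key x hx h3))
    calc (u ^ 3 / (2 * K)) ^ 4 = (u ^ 4) ^ 3 / (16 * K ^ 4) := by ring
      _ ≤ x ^ 3 / (8 * K) := by
          gcongr
          · norm_num
          · exact le_self_pow₀ hK (by norm_num)
  have hfin : u ^ 3 / (4 * K) = 1 / (256 * K ^ 7) := by rw [hu]; field_simp; ring
  rw [← hfin]
  rcases le_total (u ^ 4) x with h | h
  · refine le_trans ?_ (big x h hx1)
    gcongr
    norm_num
  · have h4 : u ^ 4 ≤ 1 := pow_le_one₀ hu0.le hu1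
    have h5 := big (u ^ 4) le_rfl h4
    have h6 : ‖LFunction χ (1 + (u ^ 4 : ℝ) + I * t) - LFunction χ (1 + x + I * t)‖ ≤
        K * (u ^ 4 - x) := by
      have hder : ∀ y ∈ Set.Icc x (u ^ 4), HasDerivWithinAt
          (fun y : ℝ => LFunction χ (1 + y + I * t)) (deriv (LFunction χ) (1 + y + I * t))
          (Set.Icc x (u ^ 4)) y := by
        intro y hy
        have h7 : DifferentiableAt ℂ (LFunction χ) (1 + y + I * t) := by
          refine differentiableAt_LFunction χ _ ?_
          rcases ht with h | h
          · exact Or.inr h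
          · left
            intro h8
            have := congrArg im h8
            simp at this
            exact h this
        have h8 : HasDerivAt (fun y : ℝ => (1 + y + I * t : ℂ)) 1 y := by
          have := (HasDerivAt.ofReal_comp (hasDerivAt_id y))
          simpa using (this.const_add (1 : ℂ)).add_const (I * t)
        have := h7.hasDerivAt.scomp y h8
        rw [one_smul] at this
        exact this.hasDerivWithinAt
      have := norm_image_sub_le_of_norm_deriv_le_segment' hder (C := K) (fun y hy =>
        hd y (hx.le.trans hy.1) (hy.2.le.trans h4)) (u ^ 4) ⟨h, le_rfl⟩
      exact this
    have h7 := norm_le_norm_add_norm_sub' (LFunction χ (1 + (u ^ 4 : ℝ) + I * t))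
      (LFunction χ (1 + x + I * t))
    have h8 : K * (u ^ 4 - x) ≤ u ^ 3 / (4 * K) := by
      calc K * (u ^ 4 - x) ≤ K * u ^ 4 := by gcongr; linarith
        _ = u ^ 3 * (K * u) := by ring
        _ = u ^ 3 / (4 * K) := by rw [hu]; field_simp
    have h9 : u ^ 3 / (2 * K) = u ^ 3 / (4 * K) + u ^ 3 / (4 * K) := by ring
    linarith

end BombieriVinogradov

namespace BombieriVinogradov
open Finset Complex Filter Topology
open scoped ComplexOrder

lemma exists_taylor_of_nonneg {a : ℕ → ℂ} (ha : 0 ≤ a) (ha1 : a 1 = 1)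
    (habs : LSeries.abscissaOfAbsConv a < (2 : ℝ)) {g : ℂ → ℂ} (hg : Differentiable ℂ g) {κ : ℂ}
    (hgL : ∀ s : ℂ, 1 < s.re → LSeries a s = g s + κ * (s - 1)⁻¹) :
    ∃ b : ℕ → ℝ, (∀ k, 0 ≤ b k) ∧ 1 ≤ b 0 ∧
      ∀ k, (k.factorial : ℂ)⁻¹ * iteratedDeriv k g 2 = (-1) ^ k * (b k - κ) := by
  have h2 : ((2 : ℝ) : ℂ) = 2 := by norm_num
  refine ⟨fun k => ((k.factorial : ℂ)⁻¹ * ((-1) ^ k * iteratedDeriv k (LSeries a) 2)).re,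
    fun k => ?_, ?_, fun k => ?_⟩
  · have h := LSeries.iteratedDeriv_alternating ha habs k
    rw [h2] at h
    have h3 : (0 : ℂ) ≤ (k.factorial : ℂ)⁻¹ := by positivity
    exact (Complex.le_def.1 (mul_nonneg h3 h)).1
  · have hs : Summable (LSeries.term a (2 : ℝ)) :=
      LSeriesSummable_of_abscissaOfAbsConv_lt_re (by simpa using habs)
    have h3 : (1 : ℂ) ≤ LSeries a (2 : ℝ) := by
      have := hs.le_tsum 1 (fun n _ => LSeries.term_nonneg (ha n) 2)
      rw [LSeries.term_of_ne_zero one_ne_zero, ha1] at this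
      simpa using! this
    have h4 := (Complex.le_def.1 h3).1
    rw [h2] at h4
    simpa using h4
  · have h := LSeries.iteratedDeriv_alternating ha habs k
    rw [h2] at h
    have h3 : (0 : ℂ) ≤ (k.factorial : ℂ)⁻¹ := by positivity
    have h5 := (Complex.le_def.1 (mul_nonneg h3 h)).2
    have h6 : ((((k.factorial : ℂ)⁻¹ * ((-1) ^ k * iteratedDeriv k (LSeries a) 2)).re : ℝ) : ℂ) =
        (k.factorial : ℂ)⁻¹ * ((-1) ^ k * iteratedDeriv k (LSeries a) 2) :=
      Complex.ext (by simp) (by simpa using h5)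
    rw [h6]
    have h7 : LSeries a =ᶠ[𝓝 2] fun s => g s + κ * (s - 1)⁻¹ := by
      have : ∀ᶠ s : ℂ in 𝓝 2, 1 < s.re :=
        (isOpen_lt continuous_const continuous_re).mem_nhds (by norm_num)
      filter_upwards [this] with s hs using hgL s hs
    have hinv : ContDiffAt ℂ k (fun s : ℂ => (s - 1)⁻¹) 2 :=
      (contDiffAt_id.sub contDiffAt_const).inv (by norm_num)
    have h8 : iteratedDeriv k (LSeries a) 2 = iteratedDeriv k g 2 + κ * ((-1) ^ k * k.factorial) := by
      rw [h7.iteratedDeriv_eq]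
      have e1 : iteratedDeriv k (fun s : ℂ => (s - 1)⁻¹) 2 = (-1) ^ k * k.factorial := by
        have := congrFun (iteratedDeriv_comp_sub_const (n := k) (f := (Inv.inv : ℂ → ℂ)) (1 : ℂ)) 2
        rw [this, iteratedDeriv_eq_iterate, iter_deriv_inv]
        norm_num
      rw [iteratedDeriv_fun_add (hg.contDiff.contDiffAt) (contDiffAt_const.mul hinv),
        iteratedDeriv_const_mul_field, e1]
    rw [h8]
    have hk : (k.factorial : ℂ) ≠ 0 := by exact_mod_cast k.factorial_ne_zero
    have h9 : ((-1 : ℂ) ^ k) * (-1) ^ k = 1 := by rw [← mul_pow]; simp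
    field_simp
    linear_combination (-(iteratedDeriv k g 2) - κ * k.factorial * (-1) ^ k) * h9

/-- Estermann's inequality for a Dirichlet series with nonnegative coefficients and a simple pole
at `1`. -/
lemma estermann {a : ℕ → ℂ} (ha : 0 ≤ a) (ha1 : a 1 = 1)
    (habs : LSeries.abscissaOfAbsConv a < (2 : ℝ)) {g : ℂ → ℂ} (hg : Differentiable ℂ g) {κ : ℂ}
    (hgL : ∀ s : ℂ, 1 < s.re → LSeries a s = g s + κ * (s - 1)⁻¹) {M : ℝ}
    (hM : ∀ s ∈ Metric.sphere (2 : ℂ) (4 / 3), ‖g s‖ ≤ M) :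
    ∃ l : ℝ, 0 ≤ l ∧ κ = l ∧ ∀ β : ℝ, 7 / 8 < β → β < 1 → ∃ r : ℝ, g β = r ∧
      ∀ K : ℕ, 1 ≤ K → 7 * M * (27 / 32) ^ K ≤ 1 / 2 →
        1 / 2 + l / (1 - β) - l * (2 - β) ^ K / (1 - β) ≤ r := by
  obtain ⟨b, hb, hb0, hbk⟩ := exists_taylor_of_nonneg ha ha1 habs hg hgL
  have hM0 : 0 ≤ M := by
    refine (norm_nonneg _).trans (hM (2 + (4 / 3 : ℝ)) ?_)
    rw [mem_sphere_iff_norm, add_sub_cancel_left, Complex.norm_real]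
    norm_num
  have hcoef : ∀ k, ‖(b k : ℂ) - κ‖ ≤ M * (3 / 4) ^ k := by
    intro k
    have h1 := norm_iteratedDeriv_le_of_forall_mem_sphere_norm_le k (by norm_num)
      hg.diffContOnCl hM
    have h2 : ‖(b k : ℂ) - κ‖ = ‖(k.factorial : ℂ)⁻¹ * iteratedDeriv k g 2‖ := by
      rw [hbk, norm_mul, norm_pow, norm_neg, norm_one, one_pow, one_mul]
    have hk : (0 : ℝ) < k.factorial := by exact_mod_cast k.factorial_pos
    rw [h2, norm_mul, norm_inv, norm_natCast, inv_mul_le_iff₀ hk]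
    refine h1.trans (le_of_eq ?_)
    rw [show (3 / 4 : ℝ) = (4 / 3)⁻¹ by norm_num, inv_pow]
    field_simp
  have hlim : Tendsto (fun k => (b k : ℂ)) atTop (𝓝 κ) := by
    rw [tendsto_iff_norm_sub_tendsto_zero]
    refine squeeze_zero (fun _ => norm_nonneg _) hcoef ?_
    have := (tendsto_pow_atTop_nhds_zero_of_lt_one (r := (3 / 4 : ℝ)) (by norm_num)
      (by norm_num)).const_mul M
    simpa using this
  have hre : Tendsto b atTop (𝓝 κ.re) := by
    simpa using! (continuous_re.tendsto κ).comp hlim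
  have him : κ.im = 0 := by
    have h := (continuous_im.tendsto κ).comp hlim
    have h' : Tendsto (fun _ : ℕ => (0 : ℝ)) atTop (𝓝 κ.im) := by simpa [Function.comp_def] using h
    exact tendsto_nhds_unique h' tendsto_const_nhds
  have hκ : κ = (κ.re : ℝ) := Complex.ext (by simp) (by simpa using him)
  refine ⟨κ.re, ge_of_tendsto' hre hb, hκ, fun β hβ hβ1 => ?_⟩
  set l := κ.re
  have hcoef' : ∀ k, |b k - l| ≤ M * (3 / 4) ^ k := by
    intro k
    have := hcoef k
    rwa [hκ, ← ofReal_sub, Complex.norm_real, Real.norm_eq_abs] at this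
  have hsum : HasSum (fun k => (((b k - l) * (2 - β) ^ k : ℝ) : ℂ)) (g β) := by
    have h := hasSum_taylorSeries_of_entire hg 2 (β : ℂ)
    refine h.congr_fun ?_ |> fun h => h
    intro k
    have h1 := hbk k
    rw [smul_eq_mul, smul_eq_mul, mul_left_comm, h1, hκ]
    have : ((β : ℂ) - 2) ^ k = (-1) ^ k * (2 - β) ^ k := by rw [← mul_pow]; ring
    rw [this]
    have h9 : ((-1 : ℂ) ^ k) * (-1) ^ k = 1 := by rw [← mul_pow]; simp
    push_cast
    linear_combination (-(b k - l : ℂ) * (2 - β) ^ k) * h9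
  have hgr : g β = ((g β).re : ℝ) := by
    refine Complex.ext (by simp) ?_
    have := hasSum_im hsum
    simp only [ofReal_im] at this ⊢
    exact this.unique hasSum_zero
  refine ⟨(g β).re, hgr, fun K hK hKM => ?_⟩
  have hsum' : HasSum (fun k => (b k - l) * (2 - β) ^ k) (g β).re := by
    simpa only [ofReal_re] using hasSum_re hsum
  have hb1 : 0 < 1 - β := by linarith
  have hl0 : 0 ≤ l := ge_of_tendsto' hre hb
  rw [← hsum'.tsum_eq, ← hsum'.summable.sum_add_tsum_nat_add K]
  have head : 1 - l * (((2 - β) ^ K - 1) / (1 - β)) ≤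
      ∑ k ∈ range K, (b k - l) * (2 - β) ^ k := by
    have hg : ∑ k ∈ range K, (2 - β) ^ k = ((2 - β) ^ K - 1) / (1 - β) := by
      rw [geom_sum_eq (by linarith)]
      congr 1
      ring
    have : ∑ k ∈ range K, (b k - l) * (2 - β) ^ k =
        ∑ k ∈ range K, b k * (2 - β) ^ k - l * ∑ k ∈ range K, (2 - β) ^ k := by
      rw [mul_sum, ← sum_sub_distrib]
      exact sum_congr rfl fun k _ => by ring
    rw [this, hg]
    gcongr
    refine le_trans ?_ (single_le_sum (f := fun k => b k * (2 - β) ^ k) (fun k _ => ?_)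
      (mem_range.2 hK))
    · simpa using hb0
    · exact mul_nonneg (hb k) (pow_nonneg (by linarith) k)
  have tail : -(1 / 2) ≤ ∑' k, (b (k + K) - l) * (2 - β) ^ (k + K) := by
    have hgeo := (hasSum_geometric_of_lt_one (r := (27 / 32 : ℝ)) (by norm_num)
      (by norm_num)).mul_left (M * (27 / 32) ^ K)
    have hb : ∀ k, ‖(b (k + K) - l) * (2 - β) ^ (k + K)‖ ≤ M * (27 / 32) ^ K * (27 / 32) ^ k := by
      intro k
      rw [norm_mul, Real.norm_eq_abs, norm_pow, Real.norm_eq_abs,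
        abs_of_nonneg (show (0 : ℝ) ≤ 2 - β by linarith)]
      calc _ ≤ M * (3 / 4) ^ (k + K) * (9 / 8) ^ (k + K) := by
            gcongr
            · exact pow_nonneg (by linarith) _
            · exact hcoef' _
            · linarith
            · linarith
        _ = M * (27 / 32) ^ K * (27 / 32) ^ k := by
            rw [mul_assoc, ← mul_pow, mul_assoc, ← pow_add]; norm_num [add_comm]
    have h := tsum_of_norm_bounded hgeo hb
    rw [Real.norm_eq_abs] at h
    have h3 := (abs_le.1 h).1
    have h4 : 0 ≤ M * (27 / 32) ^ K := by positivity
    have h5 : (1 - 27 / 32 : ℝ)⁻¹ = 32 / 5 := by norm_num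
    rw [h5] at h3
    linarith
  have e : 1 / 2 + l / (1 - β) - l * (2 - β) ^ K / (1 - β) =
      1 - l * (((2 - β) ^ K - 1) / (1 - β)) + -(1 / 2) := by ring
  rw [e]
  exact add_le_add head tail

end BombieriVinogradov

namespace BombieriVinogradov
open Finset Complex DirichletCharacter
open scoped ComplexOrder

/-- The derivation `f ↦ f · log` on arithmetic functions. -/
noncomputable def logDerivation (u : ArithmeticFunction ℂ) : ArithmeticFunction ℂ :=
  ⟨fun n => (Real.log n : ℂ) * u n, by simp⟩

lemma logDerivation_apply (u : ArithmeticFunction ℂ) (n : ℕ) :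
    logDerivation u n = (Real.log n : ℂ) * u n := rfl

lemma logDerivation_mul (u v : ArithmeticFunction ℂ) :
    logDerivation (u * v) = logDerivation u * v + u * logDerivation v := by
  ext n
  rw [ArithmeticFunction.add_apply]
  simp only [logDerivation_apply, ArithmeticFunction.mul_apply, mul_sum, ← sum_add_distrib]
  refine sum_congr rfl fun p hp => ?_
  obtain ⟨h1, h2⟩ := Nat.mem_divisorsAntidiagonal.1 hp
  have hp1 : p.1 ≠ 0 := by rintro h; simp [h] at h1; exact h2 h1.symm
  have hp2 : p.2 ≠ 0 := by rintro h; simp [h] at h1; exact h2 h1.symm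
  rw [← h1, Nat.cast_mul, Real.log_mul (by exact_mod_cast hp1) (by exact_mod_cast hp2)]
  push_cast
  ring

lemma nonneg_of_logDerivation_eq_mul {P W : ArithmeticFunction ℂ} (h : logDerivation P = W * P)
    (h1 : P 1 = 1) (hW : ∀ n, 0 ≤ W n) (hW1 : W 1 = 0) (n : ℕ) : 0 ≤ P n := by
  induction n using Nat.strong_induction_on with
  | _ n ih =>
    rcases Nat.lt_or_ge n 2 with hn | hn
    · interval_cases n
      · simp
      · rw [h1]; exact zero_le_one
    · have h2 : (Real.log n : ℂ) * P n = (W * P) n := by rw [← h]; rfl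
      have h3 : 0 ≤ (W * P) n := by
        rw [ArithmeticFunction.mul_apply]
        refine sum_nonneg fun p hp => ?_
        obtain ⟨hp1, hp2⟩ := Nat.mem_divisorsAntidiagonal.1 hp
        by_cases hd : p.1 = 1
        · rw [hd, hW1, zero_mul]
        · refine mul_nonneg (hW _) (ih _ ?_)
          have h4 : p.1 ≠ 0 := by rintro h; simp [h] at hp1; exact hp2 hp1.symm
          have h5 : p.2 ≠ 0 := by rintro h; simp [h] at hp1; exact hp2 hp1.symm
          rw [← hp1]
          exact lt_mul_left (by lia) (by lia)
      have h6 : (0 : ℝ) < Real.log n := Real.log_pos (by exact_mod_cast hn)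
      rw [← h2] at h3
      rw [Complex.le_def, re_ofReal_mul, im_ofReal_mul] at h3
      refine Complex.le_def.2 ⟨(mul_nonneg_iff_of_pos_left h6).1 h3.1, ?_⟩
      exact (mul_eq_zero.1 h3.2.symm).resolve_left h6.ne' |>.symm

/-- A Dirichlet character as an arithmetic function. -/
noncomputable def charArith {q : ℕ} (χ : DirichletCharacter ℂ q) : ArithmeticFunction ℂ :=
  ⟨fun n => if n = 0 then 0 else χ n, by simp⟩

/-- A Dirichlet character times the von Mangoldt function, as an arithmetic function. -/
noncomputable def charMangoldt {q : ℕ} (χ : DirichletCharacter ℂ q) : ArithmeticFunction ℂ :=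
  ⟨fun n => (ArithmeticFunction.vonMangoldt n : ℂ) * χ n, by simp⟩

lemma charArith_apply {q : ℕ} (χ : DirichletCharacter ℂ q) {n : ℕ} (hn : n ≠ 0) :
    charArith χ n = χ n := if_neg hn

lemma charMangoldt_apply {q : ℕ} (χ : DirichletCharacter ℂ q) (n : ℕ) :
    charMangoldt χ n = (ArithmeticFunction.vonMangoldt n : ℂ) * χ n := rfl

lemma logDerivation_charArith {q : ℕ} (χ : DirichletCharacter ℂ q) :
    logDerivation (charArith χ) = charMangoldt χ * charArith χ := by
  ext n
  rcases eq_or_ne n 0 with rfl | hn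
  · simp
  rw [logDerivation_apply, charArith_apply χ hn, ArithmeticFunction.mul_apply]
  have : ∀ p ∈ n.divisorsAntidiagonal, charMangoldt χ p.1 * charArith χ p.2 = (ArithmeticFunction.vonMangoldt p.1 : ℂ) * χ n := by
    intro p hp
    obtain ⟨h1, h2⟩ := Nat.mem_divisorsAntidiagonal.1 hp
    have hp2 : p.2 ≠ 0 := by rintro h; simp [h] at h1; exact h2 h1.symm
    rw [charArith_apply χ hp2, charMangoldt_apply, ← h1, Nat.cast_mul, map_mul, mul_assoc]
  rw [sum_congr rfl this, ← sum_mul, Nat.sum_divisorsAntidiagonal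
    (fun i _ => (ArithmeticFunction.vonMangoldt i : ℂ)), ← ArithmeticFunction.vonMangoldt_sum]
  push_cast
  rfl

/-- The coefficients of a product of Dirichlet `L`-series. -/
noncomputable def prodArith {q : ℕ} (l : List (DirichletCharacter ℂ q)) : ArithmeticFunction ℂ :=
  (l.map charArith).prod

lemma prodArith_cons {q : ℕ} (χ : DirichletCharacter ℂ q) (l : List (DirichletCharacter ℂ q)) :
    prodArith (χ :: l) = charArith χ * prodArith l := by simp [prodArith]

lemma logDerivation_prodArith {q : ℕ} (l : List (DirichletCharacter ℂ q)) :
    logDerivation (prodArith l) = (l.map charMangoldt).sum * prodArith l := by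
  induction l with
  | nil =>
    ext n
    by_cases hn : n = 1
    · simp [prodArith, logDerivation, hn]
    · simp [prodArith, logDerivation, ArithmeticFunction.one_apply_ne hn]
  | cons χ l ih =>
    rw [prodArith_cons, logDerivation_mul, ih, logDerivation_charArith, List.map_cons,
      List.sum_cons]
    ring

lemma prodArith_one {q : ℕ} (l : List (DirichletCharacter ℂ q)) : prodArith l 1 = 1 := by
  induction l with
  | nil => simp [prodArith]
  | cons χ l ih => rw [prodArith_cons, ArithmeticFunction.mul_apply_one, ih, charArith_apply χ one_ne_zero]; simp

lemma sum_map_charMangoldt_apply {q : ℕ} (l : List (DirichletCharacter ℂ q)) (n : ℕ) :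
    (l.map charMangoldt).sum n =
      (ArithmeticFunction.vonMangoldt n : ℂ) * (l.map fun χ => χ n).sum := by
  induction l with
  | nil => simp
  | cons χ l ih =>
    rw [List.map_cons, List.sum_cons, ArithmeticFunction.add_apply, ih, List.map_cons,
      List.sum_cons, mul_add]
    rfl

lemma prodArith_nonneg {q : ℕ} {l : List (DirichletCharacter ℂ q)}
    (hl : ∀ n : ℕ, 0 ≤ (l.map fun χ => χ n).sum) (n : ℕ) : 0 ≤ prodArith l n := by
  refine nonneg_of_logDerivation_eq_mul (logDerivation_prodArith l) (prodArith_one l)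
    (fun n => ?_) ?_ n
  · rw [sum_map_charMangoldt_apply]
    refine mul_nonneg ?_ (hl n)
    exact_mod_cast ArithmeticFunction.vonMangoldt_nonneg
  · rw [sum_map_charMangoldt_apply]; simp

lemma LSeries_prodArith {q : ℕ} [NeZero q] (l : List (DirichletCharacter ℂ q)) {s : ℂ}
    (hs : 1 < s.re) : LSeriesSummable (prodArith l) s ∧
      LSeries (prodArith l) s = (l.map fun χ => LFunction χ s).prod := by
  induction l with
  | nil =>
    have h : (fun n => prodArith ([] : List (DirichletCharacter ℂ q)) n) = LSeries.delta := by
      ext n; simp [prodArith, ArithmeticFunction.one_apply, LSeries.delta]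
    constructor
    · change LSeriesSummable (fun n => prodArith ([] : List (DirichletCharacter ℂ q)) n) s
      rw [h]
      refine summable_of_ne_finset_zero (s := {1}) fun n hn => ?_
      rcases eq_or_ne n 0 with rfl | h0
      · simp
      · rw [LSeries.term_of_ne_zero h0, LSeries.delta, if_neg (by simpa using hn), zero_div]
    · change LSeries (fun n => prodArith ([] : List (DirichletCharacter ℂ q)) n) s = _
      rw [h, LSeries_delta]
      simp
  | cons χ l ih =>
    have hc : ∀ {n : ℕ}, n ≠ 0 → charArith χ n = χ n := fun {n} hn => charArith_apply χ hn
    have hχ : LSeriesSummable (charArith χ) s :=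
      (LSeriesSummable_congr s hc).2 (LSeriesSummable_of_one_lt_re χ hs)
    have e : LSeries (charArith χ) s = LFunction χ s := by
      rw [LFunction_eq_LSeries χ hs]
      exact LSeries_congr hc s
    rw [prodArith_cons]
    refine ⟨ArithmeticFunction.LSeriesSummable_mul hχ ih.1, ?_⟩
    rw [ArithmeticFunction.LSeries_mul' hχ ih.1, e, ih.2]
    simp

end BombieriVinogradov

namespace BombieriVinogradov
open Finset Complex DirichletCharacter
open scoped ComplexOrder

lemma norm_LFunction_sphere_le {q : ℕ} [NeZero q] (χ : DirichletCharacter ℂ q) {s : ℂ}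
    (hs : s ∈ Metric.sphere (2 : ℂ) (4 / 3)) : ‖LFunction χ s‖ ≤ 50 * q := by
  have hq : (1 : ℝ) ≤ q := by exact_mod_cast NeZero.pos q
  rw [mem_sphere_iff_norm] at hs
  have h1 : 2 / 3 ≤ s.re := by
    have := (abs_re_le_norm (s - 2)).trans hs.le
    rw [sub_re] at this
    have := (abs_le.1 this).1
    norm_num at this
    linarith
  have h2 : ‖s‖ ≤ 10 / 3 := by
    have := norm_add_le (s - 2) 2
    rw [sub_add_cancel, hs] at this
    norm_num at this
    linarith
  have h3 : 1 / 3 ≤ ‖s - 1‖ := by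
    have := norm_sub_le (s - 1) 1
    rw [show s - 1 - 1 = s - 2 by ring, hs, norm_one] at this
    linarith
  have hs1 : s ≠ 1 := by rintro rfl; norm_num at h3
  rw [LFunction_eq_sum_add_mellin χ le_rfl (by linarith) hs1]
  have h4 := norm_mellin_tailFluct_le (fun M => norm_sum_Ioc_character_sub_le χ M) le_rfl
    (s := s) (by linarith)
  have h5 := norm_charMean_le χ
  refine (norm_add₃_le).trans ?_
  have e1 : ‖∑ n ∈ (Ioc 0 1 : Finset ℕ), χ (n : ℕ) * ((n : ℕ) : ℂ) ^ (-s)‖ ≤ 1 := by simp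
  have e2 : ‖charMean χ * (((1 : ℕ) : ℂ) ^ (1 - s) / (s - 1))‖ ≤ 3 := by
    rw [norm_mul, norm_div]
    simp only [Nat.cast_one, one_cpow, norm_one]
    calc ‖charMean χ‖ * (1 / ‖s - 1‖) ≤ 1 * (1 / (1 / 3 : ℝ)) := by gcongr
      _ = 3 := by norm_num
  have e3 : ‖s * mellin (tailFluct (fun n => χ n) (charMean χ) 1) (-s)‖ ≤ 45 * q := by
    rw [norm_mul]
    calc _ ≤ 10 / 3 * ((2 * (4 * q) + ‖charMean χ‖) * (((1 : ℕ) : ℝ) ^ (-s.re) / s.re)) := by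
          gcongr
      _ ≤ 10 / 3 * ((9 * q) * (1 / (2 / 3))) := by
          rw [Nat.cast_one, Real.one_rpow]
          gcongr
          linarith
      _ = 45 * q := by ring
  linarith

/-- `(s - 1) L(s, χ₀) ∏ L(s, χ)`, with its removable singularity removed. -/
noncomputable def prodLFunction {q : ℕ} [NeZero q] (l : List (DirichletCharacter ℂ q)) (s : ℂ) :
    ℂ :=
  LFunctionTrivChar₁ q s * (l.map fun χ => LFunction χ s).prod

lemma differentiable_prodLFunction {q : ℕ} [NeZero q] {l : List (DirichletCharacter ℂ q)}
    (hl : ∀ χ ∈ l, χ ≠ 1) : Differentiable ℂ (prodLFunction l) := by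
  refine (differentiable_LFunctionTrivChar₁ q).mul ?_
  induction l with
  | nil => simp
  | cons χ l ih =>
    simp only [List.map_cons, List.prod_cons]
    exact (differentiable_LFunction (hl χ (by simp))).mul (ih fun ψ hψ => hl ψ (by simp [hψ]))

lemma norm_list_prod_le {q : ℕ} [NeZero q] (l : List (DirichletCharacter ℂ q)) {s : ℂ} {K : ℝ}
    (hK : ∀ χ : DirichletCharacter ℂ q, ‖LFunction χ s‖ ≤ K) :
    ‖(l.map fun χ => LFunction χ s).prod‖ ≤ K ^ l.length := by
  have hK0 : 0 ≤ K := (norm_nonneg _).trans (hK 1)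
  induction l with
  | nil => simp
  | cons χ l ih =>
    rw [List.map_cons, List.prod_cons, norm_mul, List.length_cons, pow_succ']
    gcongr
    exact hK χ

lemma prodLFunction_of_ne_one {q : ℕ} [NeZero q] (l : List (DirichletCharacter ℂ q)) {s : ℂ}
    (hs : s ≠ 1) :
    prodLFunction l s = (s - 1) * (((1 : DirichletCharacter ℂ q) :: l).map
      fun χ => LFunction χ s).prod := by
  have : LFunctionTrivChar₁ q s = (s - 1) * LFunctionTrivChar q s := Function.update_of_ne hs _ _
  rw [prodLFunction, this, List.map_cons, List.prod_cons, mul_assoc]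

lemma norm_prodLFunction_sphere_le {q : ℕ} [NeZero q] {l : List (DirichletCharacter ℂ q)}
    (hl3 : l.length ≤ 3) {s : ℂ} (hs : s ∈ Metric.sphere (2 : ℂ) (4 / 3)) :
    ‖prodLFunction l s‖ ≤ 7 / 3 * (50 * q) ^ 4 := by
  have hq : (1 : ℝ) ≤ q := by exact_mod_cast NeZero.pos q
  have hb := fun χ : DirichletCharacter ℂ q => norm_LFunction_sphere_le χ hs
  rw [mem_sphere_iff_norm] at hs
  have hs1 : s ≠ 1 := by rintro rfl; norm_num at hs
  rw [prodLFunction_of_ne_one l hs1, norm_mul]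
  have h1 : ‖s - 1‖ ≤ 7 / 3 := by
    have := norm_add_le (s - 2) 1
    rw [show s - 2 + 1 = s - 1 by ring, hs, norm_one] at this
    linarith
  have h2 : ‖(((1 : DirichletCharacter ℂ q) :: l).map fun χ => LFunction χ s).prod‖ ≤
      (50 * q) ^ 4 := by
    refine (norm_list_prod_le _ hb).trans ?_
    exact pow_le_pow_right₀ (by linarith) (by rw [List.length_cons]; lia)
  gcongr

lemma norm_prodLFunction_one_le {q : ℕ} [NeZero q] (l : List (DirichletCharacter ℂ q)) :
    ‖prodLFunction l 1‖ ≤ (l.map fun χ => ‖LFunction χ 1‖).prod := by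
  have h1 : ‖LFunctionTrivChar₁ q 1‖ ≤ 1 := by
    rw [LFunctionTrivChar₁, Function.update_self, norm_prod]
    refine prod_le_one (fun _ _ => norm_nonneg _) fun p hp => ?_
    have hp1 : (1 : ℝ) ≤ p := by exact_mod_cast (Nat.prime_of_mem_primeFactors hp).one_le
    have : (1 - (p : ℂ)⁻¹) = ((1 - (p : ℝ)⁻¹ : ℝ) : ℂ) := by push_cast; rfl
    rw [this, Complex.norm_real, Real.norm_eq_abs, abs_le]
    have h2 : (p : ℝ)⁻¹ ≤ 1 := inv_le_one_of_one_le₀ hp1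
    have h3 : 0 ≤ (p : ℝ)⁻¹ := by positivity
    constructor <;> linarith
  rw [prodLFunction, norm_mul]
  have h2 : ‖(l.map fun χ => LFunction χ 1).prod‖ = (l.map fun χ => ‖LFunction χ 1‖).prod := by
    induction l with
    | nil => simp
    | cons χ l ih => simp [ih]
  rw [← h2]
  exact mul_le_of_le_one_left (norm_nonneg _) h1

lemma exists_pow_bound {M : ℝ} (hM : 1 ≤ M) {β : ℝ} (hβ : 7 / 8 < β) (hβ1 : β < 1) :
    ∃ K : ℕ, 1 ≤ K ∧ 7 * M * (27 / 32) ^ K ≤ 1 / 2 ∧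
      (2 - β) ^ K ≤ 3 * (14 * M) ^ (7 * (1 - β)) := by
  have h0 : 0 < Real.log (14 * M) := Real.log_pos (by linarith)
  refine ⟨⌈7 * Real.log (14 * M)⌉₊, Nat.one_le_ceil_iff.2 (by linarith), ?_, ?_⟩
  · set K := ⌈7 * Real.log (14 * M)⌉₊
    have hK : 7 * Real.log (14 * M) ≤ K := Nat.le_ceil _
    have h1 : (27 / 32 : ℝ) ≤ Real.exp (-(5 / 32)) := by
      have := Real.add_one_le_exp (-(5 / 32 : ℝ)); linarith
    have h2 : (27 / 32 : ℝ) ^ K ≤ (14 * M)⁻¹ := by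
      calc (27 / 32 : ℝ) ^ K ≤ Real.exp (-(5 / 32)) ^ K := by gcongr
        _ = Real.exp (K * (-(5 / 32))) := by rw [Real.exp_nat_mul]
        _ ≤ Real.exp (-Real.log (14 * M)) := by
            rw [Real.exp_le_exp]; linarith
        _ = _ := by rw [Real.exp_neg, Real.exp_log (by linarith)]
    calc 7 * M * (27 / 32) ^ K ≤ 7 * M * (14 * M)⁻¹ := by gcongr
      _ = 1 / 2 := by field_simp; norm_num
  · set K := ⌈7 * Real.log (14 * M)⌉₊
    have hK : (K : ℝ) ≤ 7 * Real.log (14 * M) + 1 := (Nat.ceil_lt_add_one (by linarith)).le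
    have h1 : 2 - β ≤ Real.exp (1 - β) := by have := Real.add_one_le_exp (1 - β); linarith
    calc (2 - β) ^ K ≤ Real.exp (1 - β) ^ K := by
          have : 0 ≤ 2 - β := by linarith
          gcongr
      _ = Real.exp (K * (1 - β)) := by rw [Real.exp_nat_mul]
      _ ≤ Real.exp (1 + Real.log (14 * M) * (7 * (1 - β))) := by
          rw [Real.exp_le_exp]
          have : (K : ℝ) * (1 - β) ≤ (7 * Real.log (14 * M) + 1) * (1 - β) := by
            have : 0 ≤ 1 - β := by linarith
            gcongr
          linarith
      _ = Real.exp 1 * (14 * M) ^ (7 * (1 - β)) := by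
          rw [Real.exp_add, Real.rpow_def_of_pos (by linarith)]
      _ ≤ _ := by
          gcongr
          exact Real.exp_one_lt_three.le

lemma exists_real_prodLFunction {q : ℕ} [NeZero q] {l : List (DirichletCharacter ℂ q)}
    (hl : ∀ χ ∈ l, χ ≠ 1) (hl3 : l.length ≤ 3)
    (hpos : ∀ n : ℕ, 0 ≤ (((1 : DirichletCharacter ℂ q) :: l).map fun χ => χ n).sum) :
    0 ≤ (prodLFunction l 1).re ∧ (prodLFunction l 1).im = 0 ∧
    ∀ β : ℝ, 7 / 8 < β → β < 1 → (prodLFunction l β).im = 0 ∧ (0 ≤ (prodLFunction l β).re →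
      (1 - β) / (6 * (196 * 50 ^ 4)) * (q : ℝ) ^ (-(28 * (1 - β))) ≤
        (l.map fun χ => ‖LFunction χ 1‖).prod) := by
  have hq : (1 : ℝ) ≤ q := by exact_mod_cast NeZero.pos q
  have hH := differentiable_prodLFunction hl
  set M : ℝ := 14 * (50 * q) ^ 4 with hMdef
  have hdsl : Differentiable ℂ (dslope (prodLFunction l) 1) := fun z =>
    (((Complex.differentiableOn_dslope (s := Set.univ) Filter.univ_mem).2
      hH.differentiableOn) z (Set.mem_univ z)).differentiableAt Filter.univ_mem
  have hg : ∀ s : ℂ, s ≠ 1 → dslope (prodLFunction l) 1 s =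
      (prodLFunction l s - prodLFunction l 1) * (s - 1)⁻¹ := by
    intro s hs
    rw [dslope_of_ne _ hs, slope_def_field, div_eq_mul_inv]
  have hκ : ‖prodLFunction l 1‖ ≤ 7 / 3 * (50 * q) ^ 4 := by
    refine norm_le_of_forall_mem_frontier_norm_le (U := Metric.ball (2 : ℂ) (4 / 3))
      Metric.isBounded_ball hH.diffContOnCl (fun z hz => ?_) ?_
    · rw [frontier_ball _ (by norm_num)] at hz
      exact norm_prodLFunction_sphere_le hl3 hz
    · refine subset_closure ?_
      rw [mem_ball_iff_norm]; norm_num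
  obtain ⟨l0, hl0, hκl, hest⟩ := estermann (a := prodArith ((1 : DirichletCharacter ℂ q) :: l))
    (prodArith_nonneg hpos) (prodArith_one _) (by
      refine lt_of_le_of_lt (LSeries.abscissaOfAbsConv_le_of_forall_lt_LSeriesSummable
        (x := 1) fun y hy => (LSeries_prodArith _ (by simpa using hy)).1) ?_
      exact_mod_cast (by norm_num : (1 : ℝ) < 2)) hdsl (κ := prodLFunction l 1) (M := M) (fun s hs => by
      have hs1 : s ≠ 1 := by rintro rfl; simp at hs
      have : s - 1 ≠ 0 := sub_ne_zero.2 hs1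
      rw [(LSeries_prodArith _ hs).2, hg s hs1, prodLFunction_of_ne_one l hs1]
      field_simp
      ring) (fun s hs => by
      have h1 := norm_prodLFunction_sphere_le hl3 hs
      rw [mem_sphere_iff_norm] at hs
      have h3 : 1 / 3 ≤ ‖s - 1‖ := by
        have := norm_sub_le (s - 1) 1
        rw [show s - 1 - 1 = s - 2 by ring, hs, norm_one] at this
        linarith
      have hs1 : s ≠ 1 := by rintro rfl; norm_num at h3
      rw [hg s hs1, norm_mul, norm_inv]
      calc _ ≤ (7 / 3 * (50 * (q : ℝ)) ^ 4 + 7 / 3 * (50 * (q : ℝ)) ^ 4) * (1 / 3)⁻¹ := by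
            gcongr
            exact (norm_sub_le _ _).trans (add_le_add h1 hκ)
        _ = M := by rw [hMdef]; ring)
  refine ⟨by rw [hκl]; simpa using hl0, by rw [hκl]; simp, fun β hβ hβ1 => ?_⟩
  have hM1 : 1 ≤ M := by
    have : 1 ≤ (50 * q : ℝ) ^ 4 := one_le_pow₀ (by linarith)
    linarith
  obtain ⟨r, hr, hr'⟩ := hest β hβ hβ1
  obtain ⟨K, hK, hK1, hK2⟩ := exists_pow_bound hM1 hβ hβ1
  have h5 := hr' K hK hK1
  have hb : 0 < 1 - β := by linarith
  have hβne : (β : ℂ) ≠ 1 := by exact_mod_cast hβ1.ne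
  have h6 : prodLFunction l β = ((l0 - (1 - β) * r : ℝ) : ℂ) := by
    have h7 := hg β hβne
    rw [hr, hκl] at h7
    have h8 : (β : ℂ) - 1 ≠ 0 := sub_ne_zero.2 hβne
    rw [eq_mul_inv_iff_mul_eq₀ h8] at h7
    push_cast
    linear_combination -h7
  refine ⟨by rw [h6, ofReal_im], fun hre => ?_⟩
  rw [h6, ofReal_re] at hre
  have h7 : (1 - β) / 2 ≤ l0 * (2 - β) ^ K := by
    have h8 : (1 - β) * (1 / 2 + l0 / (1 - β) - l0 * (2 - β) ^ K / (1 - β)) ≤ (1 - β) * r := by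
      gcongr
    have h9 : (1 - β) * (1 / 2 + l0 / (1 - β) - l0 * (2 - β) ^ K / (1 - β)) =
        (1 - β) / 2 + l0 - l0 * (2 - β) ^ K := by field_simp
    linarith
  have h8 : (2 - β) ^ K ≤ 3 * ((196 * 50 ^ 4) * (q : ℝ) ^ (28 * (1 - β))) := by
    refine hK2.trans ?_
    have e : 14 * M = (196 * 50 ^ 4) * (q : ℝ) ^ (4 : ℝ) := by
      rw [hMdef]; norm_cast; push_cast; ring
    rw [e, Real.mul_rpow (by norm_num) (by positivity), ← Real.rpow_mul (by linarith)]
    have e2 : (4 : ℝ) * (7 * (1 - β)) = 28 * (1 - β) := by ring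
    rw [e2]
    gcongr
    calc (196 * 50 ^ 4 : ℝ) ^ (7 * (1 - β)) ≤ (196 * 50 ^ 4 : ℝ) ^ (1 : ℝ) :=
          Real.rpow_le_rpow_of_exponent_le (by norm_num) (by linarith)
      _ = _ := Real.rpow_one _
  have h9 : l0 ≤ (l.map fun χ => ‖LFunction χ 1‖).prod := by
    refine le_trans ?_ (norm_prodLFunction_one_le l)
    rw [hκl, Complex.norm_real]
    exact le_abs_self _
  refine le_trans ?_ h9
  rw [Real.rpow_neg (by linarith)]
  have hqp : 0 < (q : ℝ) ^ (28 * (1 - β)) := by positivity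
  rw [← div_eq_mul_inv, div_le_iff₀ hqp, div_le_iff₀ (by norm_num)]
  have h10 : (1 - β) / 2 ≤ l0 * (3 * ((196 * 50 ^ 4) * (q : ℝ) ^ (28 * (1 - β)))) :=
    h7.trans (by gcongr)
  linarith

end BombieriVinogradov

namespace BombieriVinogradov
open Finset Complex DirichletCharacter
open scoped ComplexOrder

lemma quadratic_character_apply {q : ℕ} {χ : DirichletCharacter ℂ q} (h : χ ^ 2 = 1)
    (u : ZMod q) :
    ((1 : DirichletCharacter ℂ q) u = 0 ∧ χ u = 0) ∨
      ((1 : DirichletCharacter ℂ q) u = 1 ∧ (χ u = 1 ∨ χ u = -1)) := by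
  by_cases hu : IsUnit u
  · refine Or.inr ⟨MulChar.one_apply hu, mul_self_eq_one_iff.1 ?_⟩
    rw [← sq, ← MulChar.pow_apply' χ two_ne_zero, h, MulChar.one_apply hu]
  · exact Or.inl ⟨MulChar.map_nonunit _ hu, MulChar.map_nonunit _ hu⟩

lemma sum_single_nonneg {q : ℕ} {χ : DirichletCharacter ℂ q} (h : χ ^ 2 = 1) (n : ℕ) :
    0 ≤ (([(1 : DirichletCharacter ℂ q), χ]).map fun χ => χ n).sum := by
  simp only [List.map_cons, List.map_nil, List.sum_cons, List.sum_nil]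
  rcases quadratic_character_apply h (n : ZMod q) with ⟨h1, h2⟩ | ⟨h1, h2 | h2⟩ <;>
    rw [h1, h2] <;> norm_num

lemma sum_triple_nonneg {q : ℕ} {χ ψ : DirichletCharacter ℂ q} (h : χ ^ 2 = 1) (h' : ψ ^ 2 = 1)
    (n : ℕ) :
    0 ≤ (([(1 : DirichletCharacter ℂ q), χ, ψ, χ * ψ]).map fun χ => χ n).sum := by
  simp only [List.map_cons, List.map_nil, List.sum_cons, List.sum_nil, MulChar.mul_apply]
  rcases quadratic_character_apply h (n : ZMod q) with ⟨h1, h2⟩ | ⟨h1, h2 | h2⟩ <;>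
  rcases quadratic_character_apply h' (n : ZMod q) with ⟨h1', h2'⟩ | ⟨h1', h2' | h2'⟩ <;>
    first
    | (rw [h1, h2, h2']; norm_num; done)
    | (rw [h1] at h1'; norm_num at h1')

lemma LFunctionTrivChar₁_ne_zero (q : ℕ) [NeZero q] {β : ℝ} (hβ : 0 < β)
    (hz : riemannZeta₁ β ≠ 0) : LFunctionTrivChar₁ q β ≠ 0 := by
  by_cases h1 : (β : ℂ) = 1
  · rw [h1]; exact LFunctionTrivChar₁_apply_one_ne_zero q
  · have h2 : (β : ℂ) - 1 ≠ 0 := sub_ne_zero.2 h1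
    have : LFunctionTrivChar₁ q β = (β - 1) * LFunctionTrivChar q β :=
      Function.update_of_ne h1 _ _
    rw [this, LFunctionTrivChar_eq_mul_riemannZeta h1, riemannZeta_eq_inv_sub_mul h1]
    refine mul_ne_zero h2 (mul_ne_zero (prod_ne_zero_iff.2 fun p hp => ?_)
      (mul_ne_zero (inv_ne_zero h2) hz))
    have hp1 : (1 : ℝ) < p := by exact_mod_cast (Nat.prime_of_mem_primeFactors hp).one_lt
    intro h
    have h3 : ‖(p : ℂ) ^ (-(β : ℂ))‖ = 1 := by rw [← sub_eq_zero.1 h, norm_one]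
    rw [show (p : ℂ) = ((p : ℝ) : ℂ) by simp, norm_cpow_eq_rpow_re_of_pos (by linarith)] at h3
    have h4 : (p : ℝ) ^ (-(β : ℂ)).re < 1 :=
      Real.rpow_lt_one_of_one_lt_of_neg hp1 (by simpa using hβ)
    linarith

lemma norm_LFunction_one_le {q : ℕ} [NeZero q] {χ : DirichletCharacter ℂ q} (hχ : χ ≠ 1) {η : ℝ}
    (hη : 0 < η) (hη' : η ≤ 1 / 4) : ‖LFunction χ 1‖ ≤ 30 / η * (q : ℝ) ^ (2 * η) := by
  have hq : (1 : ℝ) ≤ q := by exact_mod_cast NeZero.pos q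
  refine (norm_LFunction_le hχ hη hη' (N := q + 1) (by lia) (s := 1) (by simp; linarith)
    (by simp)).trans ?_
  have h1 : ((q + 1 : ℕ) : ℝ) ≤ 2 * q := by push_cast; linarith
  calc 15 / η * ((q + 1 : ℕ) : ℝ) ^ (2 * η) ≤ 15 / η * (2 * (q : ℝ)) ^ (2 * η) := by gcongr
    _ = 15 / η * ((2 : ℝ) ^ (2 * η) * (q : ℝ) ^ (2 * η)) := by
        rw [Real.mul_rpow (by norm_num) (by linarith)]
    _ ≤ 15 / η * ((2 : ℝ) ^ (1 : ℝ) * (q : ℝ) ^ (2 * η)) := by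
        gcongr
        · norm_num
        · linarith
    _ = _ := by rw [Real.rpow_one]; ring

lemma norm_LFunction_changeLevel_one_le {d m : ℕ} [NeZero d] [NeZero m]
    {χ : DirichletCharacter ℂ d} (hχ : χ ≠ 1) :
    ‖LFunction (changeLevel (dvd_mul_left d m) χ) 1‖ ≤ 2 ^ m * ‖LFunction χ 1‖ := by
  rw [LFunction_changeLevel (dvd_mul_left d m) χ (Or.inl hχ), norm_mul, mul_comm]
  gcongr
  rw [norm_prod]
  have hm : m ≠ 0 := NeZero.ne m
  calc ∏ p ∈ (m * d).primeFactors, ‖1 - χ p * (p : ℂ) ^ (-(1 : ℂ))‖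
      ≤ ∏ p ∈ (m * d).primeFactors, (if p ∈ m.primeFactors then (2 : ℝ) else 1) := by
        refine prod_le_prod (fun _ _ => norm_nonneg _) fun p hp => ?_
        have hp' := Nat.prime_of_mem_primeFactors hp
        split_ifs with h
        · have h1 : ‖χ p * (p : ℂ) ^ (-(1 : ℂ))‖ ≤ 1 := by
            rw [norm_mul, Complex.cpow_neg_one, norm_inv, Complex.norm_natCast]
            have hp1 : (1 : ℝ) ≤ p := by exact_mod_cast hp'.one_le
            exact mul_le_one₀ (χ.norm_le_one _) (by positivity) (inv_le_one_of_one_le₀ hp1)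
          have := norm_sub_le 1 (χ p * (p : ℂ) ^ (-(1 : ℂ)))
          rw [norm_one] at this
          linarith
        · have hpm : ¬ p ∣ m := fun hd => h (Nat.mem_primeFactors.2 ⟨hp', hd, hm⟩)
          have hpd : p ∣ d := (hp'.dvd_mul.1 (Nat.dvd_of_mem_primeFactors hp)).resolve_left hpm
          have : χ p = 0 := by
            refine MulChar.map_nonunit _ fun hu => ?_
            rw [ZMod.isUnit_iff_coprime] at hu
            exact hp'.one_lt.ne' (Nat.eq_one_of_dvd_coprimes hu dvd_rfl hpd)
          simp [this]
    _ = 2 ^ ((m * d).primeFactors.filter (· ∈ m.primeFactors)).card := by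
        rw [prod_ite, prod_const, prod_const_one, mul_one]
    _ ≤ 2 ^ m := by
        refine pow_le_pow_right₀ (by norm_num) ?_
        calc _ ≤ (Icc 1 m).card := by
              refine card_le_card fun p hp => ?_
              have := (mem_filter.1 hp).2
              exact mem_Icc.2 ⟨(Nat.prime_of_mem_primeFactors this).one_le,
                Nat.le_of_dvd (Nat.pos_of_ne_zero hm) (Nat.dvd_of_mem_primeFactors this)⟩
          _ = m := by simp

lemma exists_riemannZeta₁_ne_zero (δ : ℝ) (hδ : 0 < δ) : ∃ ε : ℝ, 0 < ε ∧ ε ≤ δ ∧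
    ∀ β : ℝ, 1 - ε < β → β ≤ 1 → riemannZeta₁ β ≠ 0 := by
  obtain ⟨r, hr, h⟩ := Metric.eventually_nhds_iff.1 riemannZeta₁_ne_zero_of_near_one
  refine ⟨min r δ, lt_min hr hδ, min_le_right _ _, fun β h1 h2 => h ?_⟩
  have h3 := min_le_left r δ
  rw [dist_eq_norm, show (β : ℂ) - 1 = ((β - 1 : ℝ) : ℂ) by push_cast; rfl, Complex.norm_real,
    Real.norm_eq_abs, abs_lt]
  constructor <;> linarith

lemma siegel_of_forall_ne_zero {ε : ℝ} (hε : 0 < ε) (hε1 : ε ≤ 1 / 16)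
    (hz : ∀ β : ℝ, 1 - ε < β → β ≤ 1 → riemannZeta₁ β ≠ 0)
    {q : ℕ} [NeZero q] {χ : DirichletCharacter ℂ q} (hχ : χ ≠ 1) (h2 : χ ^ 2 = 1)
    (hL : ∀ β : ℝ, 1 - ε < β → β < 1 → LFunction χ β ≠ 0) :
    ε / 2 / (6 * (196 * 50 ^ 4)) * (q : ℝ) ^ (-(14 * ε)) ≤ ‖LFunction χ 1‖ := by
  have hmem : ∀ ψ ∈ [χ], ψ ≠ 1 := by simpa using hχ
  obtain ⟨h0, hi, h⟩ := exists_real_prodLFunction hmem (by simp) (sum_single_nonneg h2)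
  obtain ⟨-, h3⟩ := h (1 - ε / 2) (by linarith) (by linarith)
  have hne : ∀ β : ℝ, 1 - ε < β → β ≤ 1 → (prodLFunction [χ] β).re ≠ 0 := by
    intro β hβ hβ1 hre
    have him : (prodLFunction [χ] β).im = 0 := by
      rcases hβ1.lt_or_eq with h4 | rfl
      · exact (h β (by linarith) h4).1
      · simpa using hi
    have h5 : prodLFunction [χ] β = 0 := Complex.ext hre him
    rw [prodLFunction, List.map_singleton, List.prod_singleton, mul_eq_zero] at h5
    refine h5.elim (LFunctionTrivChar₁_ne_zero q (by linarith) (hz β hβ hβ1)) ?_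
    rcases hβ1.lt_or_eq with h4 | rfl
    · exact hL β hβ h4
    · simpa using LFunction_apply_one_ne_zero hχ
  have h4 : 0 ≤ (prodLFunction [χ] ((1 - ε / 2 : ℝ) : ℂ)).re := by
    by_contra! hneg
    have hc : Continuous fun x : ℝ => (prodLFunction [χ] x).re :=
      continuous_re.comp ((differentiable_prodLFunction hmem).continuous.comp continuous_ofReal)
    obtain ⟨y, hy, hy0⟩ := intermediate_value_Icc (show 1 - ε / 2 ≤ 1 by linarith)
      hc.continuousOn (show (0 : ℝ) ∈ Set.Icc _ _ from ⟨hneg.le, by simpa using h0⟩)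
    exact hne y (by linarith [hy.1]) hy.2 hy0
  have h5 := h3 h4
  rw [List.map_singleton, List.prod_singleton] at h5
  convert h5 using 3
  · ring
  · ring

lemma siegel_of_zero {ε η : ℝ} (hε1 : ε ≤ 1 / 16) (hη : 0 < η)
    (hη' : η ≤ 1 / 4) {d m : ℕ} [NeZero d] [NeZero m] {χ : DirichletCharacter ℂ m}
    (hχ : χ ≠ 1) (h2 : χ ^ 2 = 1) {β : ℝ} (hβ : 1 - ε < β) (hβ1 : β < 1)
    (hL : LFunction χ β = 0) {ψ : DirichletCharacter ℂ d} (hψ : ψ ≠ 1) (hψ2 : ψ ^ 2 = 1) :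
    (1 - β) / (6 * (196 * 50 ^ 4)) * ((m * d : ℕ) : ℝ) ^ (-(28 * ε)) ≤
      (30 / η * ((m * d : ℕ) : ℝ) ^ (2 * η)) ^ 2 * (2 ^ m * ‖LFunction ψ 1‖) := by
  set χ' := changeLevel (dvd_mul_right m d) χ with hχ'
  set ψ' := changeLevel (dvd_mul_left d m) ψ with hψ'
  have : NeZero (m * d) := inferInstance
  have hχ'1 : χ' ≠ 1 := by
    rw [hχ', ← map_one (changeLevel (R := ℂ) (dvd_mul_right m d))]
    exact (changeLevel_injective _).ne hχ
  have hψ'1 : ψ' ≠ 1 := by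
    rw [hψ', ← map_one (changeLevel (R := ℂ) (dvd_mul_left d m))]
    exact (changeLevel_injective _).ne hψ
  have hχ'2 : χ' ^ 2 = 1 := by rw [hχ', ← map_pow, h2, map_one]
  have hψ'2 : ψ' ^ 2 = 1 := by rw [hψ', ← map_pow, hψ2, map_one]
  have hq : (1 : ℝ) ≤ ((m * d : ℕ) : ℝ) := by exact_mod_cast NeZero.pos (m * d)
  have hL' : LFunction χ' β = 0 := by
    rw [hχ', LFunction_changeLevel _ _ (Or.inl hχ), hL, zero_mul]
  have hb : ‖LFunction ψ' 1‖ ≤ 2 ^ m * ‖LFunction ψ 1‖ := norm_LFunction_changeLevel_one_le hψ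
  set K : ℝ := 30 / η * ((m * d : ℕ) : ℝ) ^ (2 * η) with hK
  have hK1 : 1 ≤ K := by
    have h3 : 1 ≤ 30 / η := by rw [le_div_iff₀ hη]; linarith
    have h4 : 1 ≤ ((m * d : ℕ) : ℝ) ^ (2 * η) := Real.one_le_rpow hq (by linarith)
    exact one_le_mul_of_one_le_of_one_le h3 h4
  have hlow : (1 - β) / (6 * (196 * 50 ^ 4)) * ((m * d : ℕ) : ℝ) ^ (-(28 * ε)) ≤
      (1 - β) / (6 * (196 * 50 ^ 4)) * ((m * d : ℕ) : ℝ) ^ (-(28 * (1 - β))) := by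
    have : 0 ≤ 1 - β := by linarith
    gcongr
    linarith
  refine hlow.trans ?_
  by_cases hprod : χ' * ψ' = 1
  · have heq : ψ' = χ' := by
      have h3 : χ' * ψ' = χ' * χ' := by rw [hprod, ← sq, hχ'2]
      exact mul_left_cancel h3
    obtain ⟨-, -, h⟩ := exists_real_prodLFunction (l := [χ']) (by simpa using hχ'1) (by simp)
      (sum_single_nonneg hχ'2)
    have h3 := (h β (by linarith) hβ1).2 (by simp [prodLFunction, hL'])
    rw [List.map_singleton, List.prod_singleton, ← heq] at h3
    refine (h3.trans hb).trans (le_mul_of_one_le_left (by positivity) ?_)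
    exact one_le_pow₀ hK1
  · obtain ⟨-, -, h⟩ := exists_real_prodLFunction (l := [χ', ψ', χ' * ψ'])
      (by simpa using ⟨hχ'1, hψ'1, hprod⟩) (by simp) (sum_triple_nonneg hχ'2 hψ'2)
    have h3 := (h β (by linarith) hβ1).2 (by simp [prodLFunction, hL'])
    simp only [List.map_cons, List.map_nil, List.prod_cons, List.prod_nil, mul_one] at h3
    refine h3.trans ?_
    have h4 := norm_LFunction_one_le hχ'1 hη hη'
    have h5 := norm_LFunction_one_le hprod hη hη'
    calc ‖LFunction χ' 1‖ * (‖LFunction ψ' 1‖ * ‖LFunction (χ' * ψ') 1‖)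
        ≤ K * ((2 ^ m * ‖LFunction ψ 1‖) * K) := by gcongr
      _ = _ := by ring

theorem siegel {ε : ℝ} (hε : 0 < ε) : ∃ c : ℝ, 0 < c ∧ ∀ (q : ℕ) [NeZero q]
    (χ : DirichletCharacter ℂ q), χ ≠ 1 → χ ^ 2 = 1 → c * (q : ℝ) ^ (-ε) ≤ ‖LFunction χ 1‖ := by
  obtain ⟨δ, hδ, hδ1, hz⟩ := exists_riemannZeta₁_ne_zero (min (ε / 56) (1 / 16)) (by positivity)
  have hδε : δ ≤ ε / 56 := hδ1.trans (min_le_left _ _)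
  have hδ16 : δ ≤ 1 / 16 := hδ1.trans (min_le_right _ _)
  by_cases hcase : ∀ (q : ℕ) [NeZero q] (χ : DirichletCharacter ℂ q), χ ≠ 1 → χ ^ 2 = 1 →
      ∀ β : ℝ, 1 - δ < β → β < 1 → LFunction χ β ≠ 0
  · refine ⟨δ / 2 / (6 * (196 * 50 ^ 4)), by positivity, fun q _ χ hχ hχ2 => ?_⟩
    have hq : (1 : ℝ) ≤ q := by exact_mod_cast NeZero.pos q
    refine le_trans ?_ (siegel_of_forall_ne_zero hδ hδ16 hz hχ hχ2 (hcase q χ hχ hχ2))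
    gcongr
    linarith
  · push Not at hcase
    obtain ⟨m, _, χ, hχ, hχ2, β, hβ, hβ1, hL⟩ := hcase
    set η := min (ε / 8) (1 / 4)
    have hη : 0 < η := by positivity
    have hη8 : η ≤ ε / 8 := min_le_left _ _
    have hm : (1 : ℝ) ≤ m := by exact_mod_cast NeZero.pos m
    have hb : 0 < 1 - β := by linarith
    refine ⟨(1 - β) / (6 * (196 * 50 ^ 4)) / ((30 / η) ^ 2 * 2 ^ m) * (m : ℝ) ^ (-ε),
      by positivity, fun q _ ψ hψ hψ2 => ?_⟩
    have hq : (1 : ℝ) ≤ q := by exact_mod_cast NeZero.pos q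
    have h := siegel_of_zero hδ16 hη (min_le_right _ _) hχ hχ2 hβ hβ1 hL hψ hψ2
    have hmq : (1 : ℝ) ≤ ((m * q : ℕ) : ℝ) := by exact_mod_cast NeZero.pos (m * q)
    have hmq0 : (0 : ℝ) < ((m * q : ℕ) : ℝ) := by linarith
    have e1 : (m : ℝ) ^ (-ε) * (q : ℝ) ^ (-ε) = ((m * q : ℕ) : ℝ) ^ (-ε) := by
      rw [Nat.cast_mul, Real.mul_rpow (by linarith) (by linarith)]
    have e2 : ((m * q : ℕ) : ℝ) ^ (-ε) * (((m * q : ℕ) : ℝ) ^ (2 * η)) ^ 2 ≤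
        ((m * q : ℕ) : ℝ) ^ (-(28 * δ)) := by
      rw [← Real.rpow_natCast, ← Real.rpow_mul hmq0.le, ← Real.rpow_add hmq0]
      refine Real.rpow_le_rpow_of_exponent_le hmq ?_
      push_cast
      linarith
    rw [mul_assoc, e1, div_mul_eq_mul_div, div_le_iff₀ (by positivity)]
    have hP : 0 < (((m * q : ℕ) : ℝ) ^ (2 * η)) ^ 2 := by positivity
    refine le_of_mul_le_mul_right ?_ hP
    calc (1 - β) / (6 * (196 * 50 ^ 4)) * ((m * q : ℕ) : ℝ) ^ (-ε) *
          (((m * q : ℕ) : ℝ) ^ (2 * η)) ^ 2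
        = (1 - β) / (6 * (196 * 50 ^ 4)) * (((m * q : ℕ) : ℝ) ^ (-ε) *
          (((m * q : ℕ) : ℝ) ^ (2 * η)) ^ 2) := by ring
      _ ≤ (1 - β) / (6 * (196 * 50 ^ 4)) * ((m * q : ℕ) : ℝ) ^ (-(28 * δ)) := by gcongr
      _ ≤ _ := h
      _ = _ := by ring

end BombieriVinogradov

namespace BombieriVinogradov
open Finset Complex DirichletCharacter

lemma le_norm_LFunction_of_sq {q : ℕ} [NeZero q] (χ : DirichletCharacter ℂ q) {η R : ℝ}
    (hη : 0 < η) (hη' : η ≤ 1 / 4) (hR : 0 < R) (hR1 : R ≤ 1) {s : ℂ} (hs : 1 < s.re)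
    (hs' : s.re ≤ 2) (h1 : χ ≠ 1 ∨ 1 / 2 ≤ |s.im|) (h2 : χ ^ 2 ≠ 1 ∨ R ≤ |s.im|) :
    R ^ 7 / (256 * (31 / η ^ 2) ^ 7) * cond q s.im ^ (-(14 * η)) ≤ ‖LFunction χ s‖ := by
  have hq : (1 : ℝ) ≤ q := by exact_mod_cast NeZero.pos q
  set t := s.im with ht
  have hc1 := one_le_cond q t
  have hc0 : 0 < cond q t := by linarith
  set P := cond q t ^ (2 * η) with hP
  have hP1 : 1 ≤ P := Real.one_le_rpow hc1 (by linarith)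
  set K := 31 / (η ^ 2 * R) * P with hK
  have hη1 : η ^ 2 ≤ η := by nlinarith
  have hKP : ∀ a b : ℝ, a ≤ 31 / (η ^ 2 * R) → b ≤ a * P → b ≤ K := fun a b ha hb =>
    hb.trans (mul_le_mul_of_nonneg_right ha (by linarith))
  have hK1 : 1 ≤ K := by
    refine hKP 1 1 ?_ (by linarith)
    rw [le_div_iff₀ (by positivity)]
    nlinarith
  have hsq : ∀ x : ℝ, 0 < x → x ≤ 1 → ‖LFunction (χ ^ 2) (1 + x + 2 * I * t)‖ ≤ K := by
    intro x hx hx1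
    have hre : (1 + x + 2 * I * t : ℂ).re = 1 + x := by simp
    have him : (1 + x + 2 * I * t : ℂ).im = 2 * t := by simp
    set z : ℂ := 1 + x + 2 * I * t with hz
    have hz1 : z ≠ 1 := by
      intro h; rw [h] at hre; simp at hre; linarith
    have hzn : ‖z‖ ≤ 2 + 2 * |t| := by
      refine (norm_le_abs_re_add_abs_im z).trans ?_
      rw [hre, him, abs_mul, abs_of_nonneg (show (0 : ℝ) ≤ 1 + x by linarith), abs_two]
      linarith
    obtain ⟨N, hNdef⟩ : ∃ N : ℕ, N = ⌊2 * (q : ℝ) * (|t| + 1)⌋₊ + 1 := ⟨_, rfl⟩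
    have hN : 2 * (q : ℝ) * (|t| + 1) < N := by
      rw [hNdef]; push_cast; exact Nat.lt_floor_add_one _
    have hN2 : (N : ℝ) ≤ 2 * cond q t := by
      have h3 := Nat.floor_le (show 0 ≤ 2 * (q : ℝ) * (|t| + 1) by positivity)
      rw [hNdef, cond]
      push_cast
      nlinarith
    have hNz : (q : ℝ) * ‖z‖ < N := lt_of_le_of_lt (by nlinarith) hN
    have hN1 : (1 : ℝ) ≤ N := by exact_mod_cast (show 1 ≤ N by lia)
    have hNP : (N : ℝ) ^ (2 * η) ≤ 2 * P := by
      calc (N : ℝ) ^ (2 * η) ≤ (2 * cond q t) ^ (2 * η) := by gcongr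
        _ = (2 : ℝ) ^ (2 * η) * P := by rw [Real.mul_rpow (by norm_num) hc0.le]
        _ ≤ (2 : ℝ) ^ (1 : ℝ) * P := by
            gcongr
            · norm_num
            · linarith
        _ = 2 * P := by rw [Real.rpow_one]
    have key : ‖LFunction (χ ^ 2) z‖ ≤ 15 / η * (N : ℝ) ^ (2 * η) + (N : ℝ) ^ η / (2 * R) := by
      rcases h2 with h2 | h2
      · refine (norm_LFunction_le h2 hη hη' (by lia) (by rw [hre]; linarith) hNz).trans ?_
        have : 0 ≤ (N : ℝ) ^ η / (2 * R) := by positivity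
        linarith
      · refine (norm_LFunction_sub_le hη hη' (by lia) (by rw [hre]; linarith) hNz.le hz1).trans ?_
        have h3 : 2 * R ≤ ‖z - 1‖ := by
          have := abs_im_le_norm (z - 1)
          rw [sub_im, him, one_im, sub_zero, abs_mul, abs_two] at this
          linarith
        have h4 := norm_charMean_le (χ ^ 2)
        gcongr
        calc ‖charMean (χ ^ 2)‖ * ((N : ℝ) ^ η / ‖z - 1‖) ≤ 1 * ((N : ℝ) ^ η / (2 * R)) := by
              gcongr
          _ = _ := one_mul _
    refine hKP (15 / η * 2 + 1 / (2 * R) * 2) _ ?_ (key.trans ?_)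
    · have e1 : 15 / η * 2 ≤ 30 / (η ^ 2 * R) := by
        rw [div_mul_eq_mul_div, show (15 : ℝ) * 2 = 30 by norm_num]
        have : η ^ 2 * R ≤ η := by nlinarith
        gcongr
      have e2 : 1 / (2 * R) * 2 ≤ 1 / (η ^ 2 * R) := by
        rw [show 1 / (2 * R) * 2 = 1 / R by field_simp]
        have : η ^ 2 * R ≤ R := by nlinarith
        gcongr
      calc _ ≤ 30 / (η ^ 2 * R) + 1 / (η ^ 2 * R) := add_le_add e1 e2
        _ = _ := by ring
    · have hNη : (N : ℝ) ^ η ≤ (N : ℝ) ^ (2 * η) :=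
        Real.rpow_le_rpow_of_exponent_le hN1 (by linarith)
      calc _ ≤ 15 / η * (2 * P) + (2 * P) / (2 * R) := by
            gcongr
            exact hNη.trans hNP
        _ = _ := by ring
  have hd : ∀ x : ℝ, 0 ≤ x → x ≤ 1 → ‖deriv (LFunction χ) (1 + x + I * t)‖ ≤ K := by
    intro x hx hx1
    have hre : (1 + x + I * t : ℂ).re = 1 + x := by simp
    have him : (1 + x + I * t : ℂ).im = t := by simp
    have h3 := norm_iteratedDeriv_LFunction_le χ hη hη' (s := 1 + x + I * t)
      (by rw [hre]; linarith) (by rw [hre]; linarith) (by rwa [him]) 1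
    rw [iteratedDeriv_one, him] at h3
    refine hKP (19 / η ^ 2) _ ?_ (h3.trans (le_of_eq ?_))
    · have : η ^ 2 * R ≤ η ^ 2 := by nlinarith
      gcongr
      norm_num
    · rw [Nat.factorial_one, ← hP]; push_cast; field_simp
  have ht0 : χ ≠ 1 ∨ t ≠ 0 := h1.imp_right fun h h0 => by rw [h0, abs_zero] at h; linarith
  have h4 := le_norm_LFunction_of_bounds χ hK1 ht0 hsq hd (x := s.re - 1) (by linarith)
    (by linarith)
  have e : (1 + (s.re - 1 : ℝ) + I * t : ℂ) = s := by
    apply Complex.ext <;> simp [ht]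
  rw [e] at h4
  refine le_trans (le_of_eq ?_) h4
  have e2 : cond q t ^ (-(14 * η)) = (P ^ 7)⁻¹ := by
    rw [hP, ← Real.rpow_natCast, ← Real.rpow_mul hc0.le, ← Real.rpow_neg hc0.le]
    congr 1; push_cast; ring
  rw [e2, hK]
  field_simp

lemma le_norm_LFunction_near_one {ε : ℝ} (hε : 0 < ε) (hε' : ε ≤ 1 / 2) :
    ∃ ρ c : ℝ, 0 < ρ ∧ ρ ≤ 1 ∧ 0 < c ∧ ∀ (q : ℕ) [NeZero q] (χ : DirichletCharacter ℂ q), χ ≠ 1 →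
      χ ^ 2 = 1 → ∀ s : ℂ, 1 < s.re → s.re ≤ 2 → ‖s - 1‖ ≤ ρ * (q : ℝ) ^ (-(2 * ε)) →
      c * (q : ℝ) ^ (-ε) ≤ ‖LFunction χ s‖ := by
  obtain ⟨c, hc, h⟩ := siegel hε
  set D : ℝ := 19 / (ε / 2) ^ 2 * 5 with hD
  have hD0 : 0 < D := by positivity
  refine ⟨min 1 (c / (2 * D)), c / 2, by positivity, min_le_left _ _, by positivity,
    fun q _ χ hχ hχ2 s hs hs' hss => ?_⟩
  have hq : (1 : ℝ) ≤ q := by exact_mod_cast NeZero.pos q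
  have hq0 : (0 : ℝ) < q := by linarith
  have h1 := h q χ hχ hχ2
  have hs1 : ‖s - 1‖ ≤ 1 := by
    refine hss.trans (mul_le_one₀ (min_le_left _ _) (by positivity) ?_)
    exact Real.rpow_le_one_of_one_le_of_nonpos hq (by linarith)
  set S : Set ℂ := {z | 1 ≤ z.re} ∩ ({z | z.re ≤ 2} ∩ Metric.closedBall 1 1) with hS
  have hconv : Convex ℝ S := (convex_halfSpace_re_ge 1).inter
    ((convex_halfSpace_re_le 2).inter (convex_closedBall _ _))
  have hderiv : ∀ z ∈ S, ‖deriv (LFunction χ) z‖ ≤ D * (q : ℝ) ^ ε := by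
    rintro z ⟨hz1, hz2, hz3⟩
    have h3 := norm_iteratedDeriv_LFunction_le χ (show 0 < ε / 2 by linarith) (by linarith)
      (s := z) hz1 hz2 (Or.inl hχ) 1
    rw [iteratedDeriv_one, show 2 * (ε / 2) = ε by ring] at h3
    rw [mem_closedBall_iff_norm] at hz3
    have h4 : |z.im| ≤ 1 := by
      have := abs_im_le_norm (z - 1)
      rw [sub_im, one_im, sub_zero] at this
      linarith
    have h5 : cond q z.im ^ ε ≤ 5 * (q : ℝ) ^ ε := by
      calc cond q z.im ^ ε ≤ (5 * (q : ℝ)) ^ ε := by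
            have := one_le_cond q z.im
            gcongr
            rw [cond]; nlinarith
        _ = (5 : ℝ) ^ ε * (q : ℝ) ^ ε := Real.mul_rpow (by norm_num) hq0.le
        _ ≤ (5 : ℝ) ^ (1 : ℝ) * (q : ℝ) ^ ε := by
            gcongr
            · norm_num
            · linarith
        _ = _ := by rw [Real.rpow_one]
    calc _ ≤ _ := h3
      _ ≤ ((1 : ℕ).factorial : ℝ) * (19 / (ε / 2) * (5 * (q : ℝ) ^ ε)) / (ε / 2) ^ 1 := by gcongr
      _ = _ := by rw [hD, Nat.factorial_one]; push_cast; ring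
  have h6 : ‖LFunction χ s - LFunction χ 1‖ ≤ D * (q : ℝ) ^ ε * ‖s - 1‖ := by
    refine hconv.norm_image_sub_le_of_norm_deriv_le
      (fun z _ => differentiableAt_LFunction χ z (Or.inr hχ)) hderiv ?_ ?_
    · simp [hS]
    · exact ⟨hs.le, hs', mem_closedBall_iff_norm.2 hs1⟩
  have h7 : D * (q : ℝ) ^ ε * ‖s - 1‖ ≤ c / 2 * (q : ℝ) ^ (-ε) := by
    calc _ ≤ D * (q : ℝ) ^ ε * (c / (2 * D) * (q : ℝ) ^ (-(2 * ε))) := by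
          gcongr
          refine hss.trans ?_
          gcongr
          exact min_le_right _ _
      _ = c / 2 * ((q : ℝ) ^ ε * (q : ℝ) ^ (-(2 * ε))) := by field_simp
      _ = _ := by rw [← Real.rpow_add hq0]; ring_nf
  have h8 := norm_sub_norm_le (LFunction χ 1) (LFunction χ s)
  rw [norm_sub_rev] at h8
  linarith

theorem le_norm_LFunction {ε : ℝ} (hε : 0 < ε) : ∃ c : ℝ, 0 < c ∧ ∀ (q : ℕ) [NeZero q]
    (χ : DirichletCharacter ℂ q) (s : ℂ), 1 < s.re → s.re ≤ 2 → (χ ≠ 1 ∨ 1 / 2 ≤ |s.im|) →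
    c * cond q s.im ^ (-ε) ≤ ‖LFunction χ s‖ := by
  set δ := min ε 1 / 56 with hδdef
  have hδ : 0 < δ := by positivity
  have hδε : 56 * δ ≤ ε := by rw [hδdef]; linarith [min_le_left ε 1]
  have hδ1 : 56 * δ ≤ 1 := by rw [hδdef]; linarith [min_le_right ε 1]
  obtain ⟨ρ, c₁, hρ, hρ1, hc₁, h⟩ := le_norm_LFunction_near_one hδ (by linarith)
  set c₂ : ℝ := (ρ / 2) ^ 7 / (256 * (31 / δ ^ 2) ^ 7)
  have hc₂ : 0 < c₂ := by positivity
  refine ⟨min c₂ (min c₁ (ρ / 4)), by positivity, fun q _ χ s hs hs' h1 => ?_⟩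
  have hq : (1 : ℝ) ≤ q := by exact_mod_cast NeZero.pos q
  have hq0 : (0 : ℝ) < q := by linarith
  have hcond := one_le_cond q s.im
  have hqc : (q : ℝ) ≤ cond q s.im := by
    rw [cond]; nlinarith [abs_nonneg s.im]
  have hpow : ∀ a : ℝ, 0 ≤ a → a ≤ ε → cond q s.im ^ (-ε) ≤ (q : ℝ) ^ (-a) := by
    intro a ha hae
    calc cond q s.im ^ (-ε) ≤ cond q s.im ^ (-a) :=
          Real.rpow_le_rpow_of_exponent_le hcond (by linarith)
      _ ≤ _ := Real.rpow_le_rpow_of_nonpos hq0 hqc (by linarith)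
  set R := ρ / 2 * (q : ℝ) ^ (-(2 * δ)) with hR
  have hR0 : 0 < R := by positivity
  have hqle : (q : ℝ) ^ (-(2 * δ)) ≤ 1 := Real.rpow_le_one_of_one_le_of_nonpos hq (by linarith)
  have hRle : R ≤ 1 / 2 := by
    calc R ≤ 1 / 2 * 1 := by rw [hR]; gcongr
      _ = _ := mul_one _
  by_cases h2 : χ ^ 2 ≠ 1 ∨ R ≤ |s.im|
  · have h3 := le_norm_LFunction_of_sq χ hδ (by linarith) hR0 (by linarith) hs hs' h1 h2
    refine le_trans ?_ h3
    have e1 : R ^ 7 / (256 * (31 / δ ^ 2) ^ 7) = c₂ * (q : ℝ) ^ (-(14 * δ)) := by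
      have : ((q : ℝ) ^ (-(2 * δ))) ^ 7 = (q : ℝ) ^ (-(14 * δ)) := by
        rw [← Real.rpow_natCast, ← Real.rpow_mul hq0.le]; congr 1; push_cast; ring
      rw [hR, mul_pow, this]; ring
    rw [e1, mul_assoc]
    have e2 : cond q s.im ^ (-ε) ≤ (q : ℝ) ^ (-(14 * δ)) * cond q s.im ^ (-(14 * δ)) := by
      calc cond q s.im ^ (-ε) ≤ cond q s.im ^ (-(14 * δ) + -(14 * δ)) :=
            Real.rpow_le_rpow_of_exponent_le hcond (by linarith)
        _ = cond q s.im ^ (-(14 * δ)) * cond q s.im ^ (-(14 * δ)) :=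
            Real.rpow_add (by linarith) _ _
        _ ≤ _ := by
            gcongr ?_ * _
            exact Real.rpow_le_rpow_of_nonpos hq0 hqc (by linarith)
    gcongr
    exact min_le_left _ _
  · push Not at h2
    have hχ : χ ≠ 1 := h1.resolve_right (by linarith [h2.2])
    by_cases h3 : R ≤ s.re - 1
    · refine le_trans ?_ (le_norm_LFunction_of_one_lt χ hs hs')
      calc _ ≤ ρ / 4 * (q : ℝ) ^ (-(2 * δ)) := by
            gcongr
            · exact (min_le_right _ _).trans (min_le_right _ _)
            · exact hpow _ (by linarith) (by linarith)
        _ = R / 2 := by rw [hR]; ring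
        _ ≤ _ := by linarith
    · push Not at h3
      have h4 : ‖s - 1‖ ≤ ρ * (q : ℝ) ^ (-(2 * δ)) := by
        refine (norm_le_abs_re_add_abs_im _).trans ?_
        rw [sub_re, sub_im, one_re, one_im, sub_zero,
          abs_of_nonneg (show (0 : ℝ) ≤ s.re - 1 by linarith)]
        have e : ρ * (q : ℝ) ^ (-(2 * δ)) = R + R := by rw [hR]; ring
        rw [e]
        linarith [h2.2]
      refine le_trans ?_ (h q χ hχ h2.1 s hs hs' h4)
      gcongr
      · exact (min_le_right _ _).trans (min_le_left _ _)
      · exact hpow _ hδ.le (by linarith)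

end BombieriVinogradov

namespace BombieriVinogradov
open Finset Complex DirichletCharacter

lemma exists_norm_iteratedDeriv_le (k : ℕ) : ∃ c : ℝ, 0 ≤ c ∧ ∀ (L F : ℂ → ℂ) (U : Set ℂ) (s : ℂ)
    (M : ℝ), IsOpen U → DifferentiableOn ℂ L U → DifferentiableOn ℂ F U → s ∈ U →
    (∀ z ∈ U, F z * L z = -deriv L z) → 1 ≤ M → 1 ≤ M * ‖L s‖ →
    (∀ j ≤ k + 1, ‖iteratedDeriv j L s‖ ≤ M) → ‖iteratedDeriv k F s‖ ≤ c * M ^ (2 * k + 2) := by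
  induction k using Nat.strong_induction_on with
  | _ k ih =>
  choose! c hc0 hc using ih
  have hc0' : ∀ i ∈ range k, 0 ≤ (k.choose i : ℝ) * c i := fun i hi =>
    mul_nonneg (Nat.cast_nonneg _) (hc0 i (mem_range.1 hi))
  refine ⟨1 + ∑ i ∈ range k, (k.choose i : ℝ) * c i, by linarith [sum_nonneg hc0'],
    fun L F U s M hU hL hF hs hFL hM hLM hj => ?_⟩
  have hLc : ContDiffAt ℂ k L s := (hL.contDiffOn hU).contDiffAt (hU.mem_nhds hs)
  have hFc : ContDiffAt ℂ k F s := (hF.contDiffOn hU).contDiffAt (hU.mem_nhds hs)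
  have h1 : iteratedDeriv k (fun z => F z * L z) s = -iteratedDeriv (k + 1) L s := by
    rw [iteratedDeriv_succ', ← iteratedDeriv_fun_neg]
    refine Filter.EventuallyEq.iteratedDeriv_eq k ?_
    filter_upwards [hU.mem_nhds hs] with z hz using hFL z hz
  rw [iteratedDeriv_fun_mul hFc hLc, sum_range_succ, Nat.choose_self, Nat.sub_self,
    iteratedDeriv_zero, Nat.cast_one, one_mul] at h1
  have h2 : ‖iteratedDeriv k F s‖ * ‖L s‖ ≤
      (1 + ∑ i ∈ range k, (k.choose i : ℝ) * c i) * M ^ (2 * k + 1) := by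
    rw [← norm_mul, eq_sub_of_add_eq' h1]
    refine (norm_sub_le _ _).trans ?_
    rw [norm_neg, add_mul, one_mul]
    refine add_le_add ((hj _ le_rfl).trans (le_self_pow₀ hM (by lia))) ?_
    refine (norm_sum_le _ _).trans ?_
    rw [sum_mul]
    refine sum_le_sum fun i hi => ?_
    have hi' := mem_range.1 hi
    rw [norm_mul, norm_mul, Complex.norm_natCast]
    have h3 := hc i hi' L F U s M hU hL hF hs hFL hM hLM (fun j hj' => hj j (by lia))
    have h4 := hj (k - i) (by lia)
    have h5 := hc0 i hi'
    calc (k.choose i : ℝ) * ‖iteratedDeriv i F s‖ * ‖iteratedDeriv (k - i) L s‖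
        ≤ (k.choose i : ℝ) * (c i * M ^ (2 * i + 2)) * M := by gcongr
      _ = (k.choose i : ℝ) * c i * M ^ (2 * i + 3) := by ring
      _ ≤ _ := mul_le_mul_of_nonneg_left (pow_le_pow_right₀ hM (by lia)) (hc0' i hi)
  calc ‖iteratedDeriv k F s‖ ≤ ‖iteratedDeriv k F s‖ * (M * ‖L s‖) :=
        le_mul_of_one_le_right (norm_nonneg _) hLM
    _ = ‖iteratedDeriv k F s‖ * ‖L s‖ * M := by ring
    _ ≤ _ := mul_le_mul_of_nonneg_right h2 (by linarith)
    _ = _ := by ring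

/-- The coefficients of the negated logarithmic derivative of `L(s, χ)`. -/
noncomputable def twistMangoldt {q : ℕ} (χ : DirichletCharacter ℂ q) (n : ℕ) : ℂ :=
  χ n * (ArithmeticFunction.vonMangoldt n : ℂ)

lemma isOpen_one_lt_re : IsOpen {s : ℂ | 1 < s.re} := isOpen_lt continuous_const continuous_re

lemma abscissaOfAbsConv_le_one {a : ℕ → ℂ} (h : ∀ s : ℂ, 1 < s.re → LSeriesSummable a s) :
    LSeries.abscissaOfAbsConv a ≤ 1 := by
  have := LSeries.abscissaOfAbsConv_le_of_forall_lt_LSeriesSummable (f := a)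
    (x := 1) fun y hy => h y (by simpa using hy)
  simpa using this

lemma norm_LSeries_logMul_eq {a : ℕ → ℂ} (h : ∀ s : ℂ, 1 < s.re → LSeriesSummable a s)
    {F : ℂ → ℂ} {U : Set ℂ} (hU : IsOpen U) (hU1 : ∀ z ∈ U, 1 < z.re)
    (hF : ∀ z ∈ U, LSeries a z = F z) (k : ℕ) {s : ℂ} (hs : s ∈ U) :
    ‖LSeries (LSeries.logMul^[k] a) s‖ = ‖iteratedDeriv k F s‖ := by
  have h1 := LSeries_iteratedDeriv k (lt_of_le_of_lt (abscissaOfAbsConv_le_one h)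
    (show (1 : EReal) < s.re by exact_mod_cast hU1 s hs))
  have h2 : iteratedDeriv k (LSeries a) s = iteratedDeriv k F s := by
    refine Filter.EventuallyEq.iteratedDeriv_eq k ?_
    filter_upwards [hU.mem_nhds hs] with z hz using hF z hz
  rw [← h2, h1, norm_mul, norm_pow, norm_neg, norm_one, one_pow, one_mul]

lemma LSeriesSummable_twistMangoldt {q : ℕ} (χ : DirichletCharacter ℂ q) {s : ℂ} (hs : 1 < s.re) :
    LSeriesSummable (twistMangoldt χ) s := LSeriesSummable_twist_vonMangoldt χ hs

lemma LSeries_twistMangoldt {q : ℕ} [NeZero q] (χ : DirichletCharacter ℂ q) {s : ℂ}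
    (hs : 1 < s.re) :
    LSeries (twistMangoldt χ) s = -deriv (LFunction χ) s / LFunction χ s := by
  have h1 := LSeries_twist_vonMangoldt_eq χ hs
  rw [← LFunction_eq_LSeries χ hs] at h1
  have h2 : deriv (LSeries fun n : ℕ => χ n) s = deriv (LFunction χ) s := by
    refine Filter.EventuallyEq.deriv_eq ?_
    filter_upwards [isOpen_one_lt_re.mem_nhds hs] with z hz
    exact (LFunction_eq_LSeries χ hz).symm
  rw [h2] at h1
  exact h1

lemma exists_norm_LSeries_twistMangoldt_le (k : ℕ) : ∃ C : ℝ, 0 < C ∧ ∀ (q : ℕ) [NeZero q]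
    (χ : DirichletCharacter ℂ q) (s : ℂ), 1 < s.re → s.re ≤ 2 → (χ ≠ 1 ∨ 1 / 2 ≤ |s.im|) →
    ‖LSeries (LSeries.logMul^[k] (twistMangoldt χ)) s‖ ≤ C * cond q s.im ^ (1 / 2 : ℝ) := by
  obtain ⟨c, hc0, hc⟩ := exists_norm_iteratedDeriv_le k
  set ε : ℝ := 1 / (4 * (k + 1)) with hε
  have hε0 : 0 < ε := by positivity
  have hε1 : ε ≤ 1 / 4 := by
    rw [hε]
    gcongr
    linarith [(Nat.cast_nonneg k : (0 : ℝ) ≤ k)]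
  obtain ⟨c', hc', hlow⟩ := le_norm_LFunction hε0
  set η := ε / 2 with hη
  have hη0 : 0 < η := by positivity
  set C₁ : ℝ := max (1 / c') ((k + 1).factorial * (19 / η) / η ^ (k + 1)) with hC₁
  have hfac : 1 ≤ (k + 1).factorial * (19 / η) / η ^ (k + 1) := by
    have h1 : (1 : ℝ) ≤ (k + 1).factorial := by exact_mod_cast Nat.factorial_pos _
    have h2 : 1 ≤ 19 / η := by rw [le_div_iff₀ hη0]; linarith
    have h3 : η ^ (k + 1) ≤ 1 := pow_le_one₀ hη0.le (by linarith)
    rw [le_div_iff₀ (by positivity), one_mul]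
    exact h3.trans (one_le_mul_of_one_le_of_one_le h1 h2)
  have hC1 : 1 ≤ C₁ := hfac.trans (le_max_right _ _)
  refine ⟨(c + 1) * C₁ ^ (2 * k + 2), by positivity, fun q _ χ s hs hs' h1 => ?_⟩
  have hcond := one_le_cond q s.im
  have hP1 : 1 ≤ cond q s.im ^ ε := Real.one_le_rpow hcond hε0.le
  have hLne : LFunction χ s ≠ 0 :=
    LFunction_ne_zero_of_one_le_re χ (Or.inr (by rintro rfl; simp at hs)) hs.le
  have hset : IsOpen {s : ℂ | 1 < s.re} := isOpen_one_lt_re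
  have hsne : ∀ z ∈ {s : ℂ | 1 < s.re}, z ≠ 1 := by
    rintro z hz rfl; simp at hz
  have hLd : DifferentiableOn ℂ (LFunction χ) {s : ℂ | 1 < s.re} := fun z hz =>
    (differentiableAt_LFunction χ z (Or.inl (hsne z hz))).differentiableWithinAt
  have hLne' : ∀ z ∈ {s : ℂ | 1 < s.re}, LFunction χ z ≠ 0 := fun z hz =>
    LFunction_ne_zero_of_one_le_re χ (Or.inr (hsne z hz)) (le_of_lt hz)
  rw [norm_LSeries_logMul_eq (fun s hs => LSeriesSummable_twistMangoldt χ hs) hset (fun z hz => hz)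
    (fun z hz => LSeries_twistMangoldt χ hz) k hs]
  have hmain := hc (LFunction χ) (fun z => -deriv (LFunction χ) z / LFunction χ z) _ s
    (C₁ * cond q s.im ^ ε) hset hLd ((hLd.deriv hset).neg.div hLd hLne') hs
    (fun z hz => div_mul_cancel₀ _ (hLne' z hz)) (one_le_mul_of_one_le_of_one_le hC1 hP1) ?_ ?_
  · refine hmain.trans ?_
    have e : (cond q s.im ^ ε) ^ (2 * k + 2) = cond q s.im ^ (1 / 2 : ℝ) := by
      rw [← Real.rpow_natCast, ← Real.rpow_mul (by linarith)]
      congr 1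
      rw [hε]; push_cast; field_simp; ring
    rw [mul_pow, e, ← mul_assoc]
    gcongr
    linarith
  · have h2 := hlow q χ s hs hs' h1
    rw [Real.rpow_neg (by linarith)] at h2
    calc 1 = 1 / c' * cond q s.im ^ ε * (c' * (cond q s.im ^ ε)⁻¹) := by field_simp
      _ ≤ _ := by
          gcongr
          exact le_max_left _ _
  · intro j hj
    refine (norm_iteratedDeriv_LFunction_le χ hη0 (by linarith) hs.le hs' h1 j).trans ?_
    rw [show 2 * η = ε by rw [hη]; ring, ← mul_assoc, mul_div_right_comm]
    gcongr
    refine le_trans ?_ (le_max_right _ _)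
    have h2 : (j.factorial : ℝ) ≤ (k + 1).factorial := by exact_mod_cast Nat.factorial_le hj
    have h3 : η ^ (k + 1) ≤ η ^ j := pow_le_pow_of_le_one hη0.le (by linarith) hj
    gcongr

/-- The coefficients of the negated logarithmic derivative of `ζ`, minus those of `ζ`. -/
noncomputable def mangoldtError (n : ℕ) : ℂ := (ArithmeticFunction.vonMangoldt n : ℂ) - 1

lemma LSeriesSummable_mangoldtError {s : ℂ} (hs : 1 < s.re) : LSeriesSummable mangoldtError s :=
  (ArithmeticFunction.LSeriesSummable_vonMangoldt hs).sub (LSeriesSummable_one_iff.2 hs)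

lemma LSeries_mangoldtError {s : ℂ} (hs : 1 < s.re) :
    LSeries mangoldtError s = -deriv riemannZeta s / riemannZeta s - riemannZeta s := by
  have h : mangoldtError = (fun n => (ArithmeticFunction.vonMangoldt n : ℂ)) - 1 := rfl
  rw [h, LSeries_sub (ArithmeticFunction.LSeriesSummable_vonMangoldt hs)
    (LSeriesSummable_one_iff.2 hs), LSeries_one_eq_riemannZeta hs,
    ArithmeticFunction.LSeries_vonMangoldt_eq_deriv_riemannZeta_div hs]

lemma riemannZeta₁_ne_zero {s : ℂ} (hs : 1 ≤ s.re) : riemannZeta₁ s ≠ 0 := by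
  by_cases h1 : s = 1
  · rw [h1]; exact riemannZeta₁_ne_zero_of_near_one.self_of_nhds
  · intro h
    refine riemannZeta_ne_zero_of_one_le_re hs ?_
    rw [riemannZeta_eq_inv_sub_mul h1, h, mul_zero]

lemma LSeries_mangoldtError_eq {s : ℂ} (hs : 1 < s.re) :
    LSeries mangoldtError s = -deriv riemannZeta₁ s / riemannZeta₁ s - riemannZeta₀ s := by
  have h1 : ∀ z : ℂ, 1 < z.re → z ≠ 1 := by rintro z hz rfl; simp at hz
  have hs1 : s - 1 ≠ 0 := sub_ne_zero.2 (h1 s hs)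
  have h2 : deriv riemannZeta s =
      -((s - 1) ^ 2)⁻¹ * riemannZeta₁ s + (s - 1)⁻¹ * deriv riemannZeta₁ s := by
    have e : deriv riemannZeta s = deriv (fun z => (z - 1)⁻¹ * riemannZeta₁ z) s := by
      refine Filter.EventuallyEq.deriv_eq ?_
      filter_upwards [isOpen_one_lt_re.mem_nhds hs] with z hz
      exact riemannZeta_eq_inv_sub_mul (h1 z hz)
    rw [e]
    have h3 : HasDerivAt (fun z : ℂ => (z - 1)⁻¹) (-1 / (s - 1) ^ 2) s :=
      ((hasDerivAt_id s).sub_const 1).inv hs1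
    refine (h3.mul (differentiable_riemannZeta₁ s).hasDerivAt).deriv.trans ?_
    ring
  have h4 := riemannZeta₁_ne_zero hs.le
  rw [LSeries_mangoldtError hs, h2]
  nth_rw 2 [riemannZeta_eq_inv_sub_add (h1 s hs)]
  rw [riemannZeta_eq_inv_sub_mul (h1 s hs)]
  field_simp
  ring

lemma exists_norm_LSeries_mangoldtError_le (k : ℕ) : ∃ C : ℝ, 0 < C ∧ ∀ s : ℂ, 1 < s.re →
    s.re ≤ 2 → ‖LSeries (LSeries.logMul^[k] mangoldtError) s‖ ≤ C * cond 1 s.im ^ (1 / 2 : ℝ) := by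
  obtain ⟨C₁, hC₁, h1⟩ := exists_norm_LSeries_twistMangoldt_le k
  set η : ℝ := 1 / 4 with hη
  set C₂ : ℝ := k.factorial * (19 / η) / η ^ k
  have hC₂ : 0 < C₂ := by positivity
  set U : Set ℂ := {s | riemannZeta₁ s ≠ 0}
  have hU : IsOpen U := isOpen_ne_fun differentiable_riemannZeta₁.continuous continuous_const
  have hR1 : DifferentiableOn ℂ riemannZeta₁ U := differentiable_riemannZeta₁.differentiableOn
  have hF : DifferentiableOn ℂ (fun s => -deriv riemannZeta₁ s / riemannZeta₁ s - riemannZeta₀ s)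
      U := ((hR1.deriv hU).neg.div hR1 fun z hz => hz).sub
        differentiable_riemannZeta₀.differentiableOn
  have hcont : ContinuousOn (iteratedDeriv k fun s => -deriv riemannZeta₁ s / riemannZeta₁ s -
      riemannZeta₀ s) U := by
    rw [iteratedDeriv_eq_iterate]
    exact ((hF.analyticOnNhd hU).iterated_deriv k).continuousOn
  have hcomp : IsCompact (Set.Icc (1 : ℝ) 2 ×ℂ Set.Icc (-1 : ℝ) 1) := isCompact_Icc.reProdIm isCompact_Icc
  obtain ⟨C₃, hC₃⟩ := hcomp.exists_bound_of_continuousOn (hcont.mono fun z hz =>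
    riemannZeta₁_ne_zero (Complex.mem_reProdIm.1 hz).1.1)
  refine ⟨C₁ + C₂ + |C₃|, by positivity, fun s hs hs' => ?_⟩
  have hcond := one_le_cond 1 s.im
  have hP1 : 1 ≤ cond 1 s.im ^ (1 / 2 : ℝ) := Real.one_le_rpow hcond (by norm_num)
  by_cases ht : 1 / 2 ≤ |s.im|
  · have e : mangoldtError = twistMangoldt (1 : DirichletCharacter ℂ 1) - 1 := by
      funext n
      have : (1 : DirichletCharacter ℂ 1) (n : ZMod 1) = 1 := MulChar.one_apply (isUnit_of_subsingleton _)
      simp [mangoldtError, twistMangoldt, this]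
    have e2 : ∀ k, LSeries.logMul^[k] mangoldtError =
        LSeries.logMul^[k] (twistMangoldt (1 : DirichletCharacter ℂ 1)) - LSeries.logMul^[k] 1 := by
      intro k
      induction k with
      | zero => exact e
      | succ k ih =>
        rw [Function.iterate_succ_apply', Function.iterate_succ_apply', Function.iterate_succ_apply',
          ih]
        funext n
        simp only [LSeries.logMul, Pi.sub_apply]
        ring
    have hab : ∀ a : ℕ → ℂ, (∀ s : ℂ, 1 < s.re → LSeriesSummable a s) →
        ∀ k, LSeriesSummable (LSeries.logMul^[k] a) s := by
      intro a ha k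
      refine LSeriesSummable_of_abscissaOfAbsConv_lt_re ?_
      have : ∀ k, LSeries.abscissaOfAbsConv (LSeries.logMul^[k] a) ≤ 1 := by
        intro k
        induction k with
        | zero => exact abscissaOfAbsConv_le_one ha
        | succ k ih =>
          rw [Function.iterate_succ_apply', LSeries.abscissaOfAbsConv_logMul]
          exact ih
      exact lt_of_le_of_lt (this k) (show (1 : EReal) < s.re by exact_mod_cast hs)
    rw [e2 k, LSeries_sub (hab _ (fun s hs => LSeriesSummable_twistMangoldt _ hs) k)
      (hab _ (fun s hs => LSeriesSummable_one_iff.2 hs) k)]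
    refine (norm_sub_le _ _).trans ?_
    have h2 := h1 1 1 s hs hs' (Or.inr ht)
    rw [norm_LSeries_logMul_eq (a := 1) (fun s hs => LSeriesSummable_one_iff.2 hs)
      isOpen_one_lt_re (fun z hz => hz) (F := LFunction (1 : DirichletCharacter ℂ 1))
      (fun z hz => by rw [LSeries_one_eq_riemannZeta hz, LFunction_modOne_eq]) k hs]
    have h3 := norm_iteratedDeriv_LFunction_le (1 : DirichletCharacter ℂ 1) (show 0 < η by norm_num)
      le_rfl hs.le hs' (Or.inr ht) k
    rw [show 2 * η = 1 / 2 by norm_num] at h3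
    have e3 : (k.factorial : ℝ) * (19 / η * cond 1 s.im ^ (1 / 2 : ℝ)) / η ^ k =
      C₂ * cond 1 s.im ^ (1 / 2 : ℝ) := by ring
    rw [e3] at h3
    have : 0 ≤ |C₃| * cond 1 s.im ^ (1 / 2 : ℝ) := by positivity
    linarith
  · push Not at ht
    rw [norm_LSeries_logMul_eq (fun s hs => LSeriesSummable_mangoldtError hs) isOpen_one_lt_re
      (fun z hz => hz) (fun z hz => LSeries_mangoldtError_eq hz) k hs]
    have h4 := (abs_lt.1 ht)
    have h5 := hC₃ s (Complex.mem_reProdIm.2 ⟨⟨hs.le, hs'⟩, ⟨by linarith [h4.1], by linarith [h4.2]⟩⟩)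
    calc _ ≤ C₃ := h5
      _ ≤ |C₃| * 1 := by rw [mul_one]; exact le_abs_self _
      _ ≤ (C₁ + C₂ + |C₃|) * cond 1 s.im ^ (1 / 2 : ℝ) := by
          gcongr
          linarith

end BombieriVinogradov

namespace BombieriVinogradov
open Finset Complex MeasureTheory

lemma LSeries_term_eq_vpow (b : ℕ → ℂ) (σ t : ℝ) {n : ℕ} (hn : n ≠ 0) :
    LSeries.term b (σ + t * I) n = b n * vpow σ t n := by
  have hn0 : (n : ℂ) ≠ 0 := by exact_mod_cast hn
  rw [LSeries.term_of_ne_zero hn, div_eq_mul_inv, ← cpow_neg, cpow_def_of_ne_zero hn0, vpow,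
    natCast_log]
  congr 2
  ring

lemma perron_LSeries {b : ℕ → ℂ} {σ : ℝ} (hσ : 1 ≤ σ) (hb : LSeriesSummable b σ) {Y : ℕ}
    (hY : 0 < Y) :
    ∫ t : ℝ, exp ((σ + t * I) * Real.log Y) * LSeries b (σ + t * I) * perronKernel σ t =
      2 * Real.pi / Y * ∑ n ∈ Ioc 0 Y, b n * ((Y - n : ℕ) : ℂ) := by
  have hσ0 : 0 < σ := by linarith
  set F : ℕ → ℝ → ℂ := fun n t =>
    exp ((σ + t * I) * Real.log Y) * LSeries.term b (σ + t * I) n * perronKernel σ t with hF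
  have hF0 : F 0 = fun _ => 0 := by funext t; simp [hF]
  have hFn : ∀ n : ℕ, n ≠ 0 → F n = fun t : ℝ =>
      b n * (exp ((σ + t * I) * Real.log Y) * vpow σ t n * perronKernel σ t) := by
    intro n hn; funext t; simp only [hF]; rw [LSeries_term_eq_vpow b σ t hn]; ring
  have h_integrable : ∀ n, Integrable (F n) := by
    intro n
    by_cases hn : n = 0
    · rw [hn, hF0]; exact integrable_zero _ _ _
    · rw [hFn n hn]
      refine (integrable_perron_term hσ0 _ ?_ (C := Real.exp (σ * Real.log Y) * 1) fun t => ?_).const_mul _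
      · exact (by fun_prop : Continuous fun t : ℝ =>
          exp ((σ + t * I) * Real.log Y)).mul (continuous_vpow σ n)
      · rw [norm_mul, norm_exp_vertical]
        gcongr
        exact norm_vpow_le hσ0.le t n
  have hnorm : ∀ n t, ‖F n t‖ = ‖LSeries.term b σ n‖ *
      (Real.exp (σ * Real.log Y) * ‖perronKernel σ t‖) := by
    intro n t
    have h1 : ‖LSeries.term b (σ + t * I) n‖ = ‖LSeries.term b σ n‖ := by
      rw [LSeries.norm_term_eq, LSeries.norm_term_eq]; simp
    rw [hF, norm_mul, norm_mul, norm_exp_vertical, h1]; ring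
  have hsum : Summable fun n => ∫ t, ‖F n t‖ := by
    simp_rw [hnorm, integral_const_mul]
    exact (Summable.norm hb).mul_right _
  have h1 := integral_tsum_of_summable_integral_norm h_integrable hsum
  have h2 : ∀ t : ℝ, ∑' n, F n t =
      exp ((σ + t * I) * Real.log Y) * LSeries b (σ + t * I) * perronKernel σ t := by
    intro t; simp only [hF]; rw [tsum_mul_right, tsum_mul_left]; rfl
  simp_rw [h2] at h1
  rw [← h1, tsum_eq_sum (s := Ioc 0 Y), mul_sum]
  · refine sum_congr rfl fun n hn => ?_
    have hn0 := (mem_Ioc.1 hn).1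
    rw [hFn n hn0.ne', integral_const_mul, perron_natural hσ0 hY hn0]
    ring
  · intro n hn
    by_cases hn0 : n = 0
    · rw [hn0, hF0]; simp
    · have hYn : Y - n = 0 := by
        rw [mem_Ioc, not_and, not_le] at hn
        have := hn (Nat.pos_of_ne_zero hn0); lia
      rw [hFn n hn0, integral_const_mul, perron_natural hσ0 hY (Nat.pos_of_ne_zero hn0), hYn]
      simp

lemma sqrt_weight_le (t : ℝ) :
    (|t| + 4) ^ (1 / 2 : ℝ) * (1 + t ^ 2)⁻¹ ≤ 4 * (1 + ‖t‖ ^ 2) ^ (-(3 / 2 : ℝ) / 2) := by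
  have h0 : 0 < 1 + t ^ 2 := by positivity
  have h1 : (|t| + 4) ^ (1 / 2 : ℝ) ≤ 4 * (1 + t ^ 2) ^ (1 / 4 : ℝ) := by
    have h2 : |t| + 4 ≤ 16 * (1 + t ^ 2) ^ (1 / 2 : ℝ) := by
      rw [← Real.sqrt_eq_rpow]
      have h3 : |t| ≤ √(1 + t ^ 2) := by
        rw [← Real.sqrt_sq_eq_abs]; exact Real.sqrt_le_sqrt (by linarith)
      have h4 : 1 ≤ √(1 + t ^ 2) := Real.one_le_sqrt.2 (by nlinarith)
      linarith
    calc (|t| + 4) ^ (1 / 2 : ℝ) ≤ (16 * (1 + t ^ 2) ^ (1 / 2 : ℝ)) ^ (1 / 2 : ℝ) := by gcongr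
      _ = (16 : ℝ) ^ (1 / 2 : ℝ) * (1 + t ^ 2) ^ (1 / 4 : ℝ) := by
          rw [Real.mul_rpow (by norm_num) (by positivity), ← Real.rpow_mul h0.le]; norm_num
      _ = _ := by
          rw [← Real.sqrt_eq_rpow, show (16 : ℝ) = 4 ^ 2 by norm_num, Real.sqrt_sq (by norm_num)]
  rw [Real.norm_eq_abs, sq_abs]
  calc _ ≤ 4 * (1 + t ^ 2) ^ (1 / 4 : ℝ) * (1 + t ^ 2)⁻¹ := by gcongr
    _ = 4 * ((1 + t ^ 2) ^ (1 / 4 : ℝ) * (1 + t ^ 2) ^ (-1 : ℝ)) := by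
        rw [Real.rpow_neg_one]; ring
    _ = _ := by rw [← Real.rpow_add h0]; norm_num

lemma exists_norm_smooth_sum_le : ∃ C : ℝ, 0 < C ∧ ∀ (b : ℕ → ℂ) (B : ℝ), 0 ≤ B →
    (∀ s : ℂ, 1 < s.re → LSeriesSummable b s) →
    (∀ s : ℂ, 1 < s.re → s.re ≤ 2 → ‖LSeries b s‖ ≤ B * (|s.im| + 4) ^ (1 / 2 : ℝ)) →
    ∀ Y : ℕ, ‖∑ n ∈ Ioc 0 Y, b n * ((Y - n : ℕ) : ℂ)‖ ≤ C * B * (Y : ℝ) ^ 2 := by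
  have h_integrable : Integrable fun t : ℝ => 4 * (1 + ‖t‖ ^ 2) ^ (-(3 / 2 : ℝ) / 2) :=
    (integrable_rpow_neg_one_add_norm_sq (by rw [Module.finrank_self]; norm_num)).const_mul 4
  set J := ∫ t : ℝ, 4 * (1 + ‖t‖ ^ 2) ^ (-(3 / 2 : ℝ) / 2) with hJ
  have hJ0 : 0 ≤ J := integral_nonneg fun t => by positivity
  refine ⟨3 * (J + 1), by positivity, fun b B hB hb hbd Y => ?_⟩
  rcases Nat.eq_zero_or_pos Y with rfl | hY
  · simp
  have hY1 : (1 : ℝ) ≤ Y := by exact_mod_cast hY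
  have hlog : 0 ≤ Real.log Y := Real.log_nonneg hY1
  set lam := max 1 (Real.log Y)
  have hlam : 1 ≤ lam := le_max_left _ _
  set σ := 1 + 1 / lam with hσ
  have hσ1 : 1 < σ := by have : 0 < 1 / lam := by positivity
                         linarith
  have hσ2 : σ ≤ 2 := by
    have : 1 / lam ≤ 1 := by rw [div_le_iff₀ (by linarith)]; linarith
    linarith
  have hexp : Real.exp (σ * Real.log Y) ≤ 3 * Y := by
    have h1 : σ * Real.log Y ≤ Real.log Y + 1 := by
      rw [hσ, add_mul, one_mul]
      have : 1 / lam * Real.log Y ≤ 1 := by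
        rw [div_mul_eq_mul_div, one_mul, div_le_one (by linarith)]
        exact le_max_right _ _
      linarith
    calc _ ≤ Real.exp (Real.log Y + 1) := Real.exp_le_exp.2 h1
      _ = Y * Real.exp 1 := by rw [Real.exp_add, Real.exp_log (by linarith)]
      _ ≤ Y * 3 := by gcongr; exact Real.exp_one_lt_three.le
      _ = _ := mul_comm _ _
  have key := perron_LSeries hσ1.le (hb σ (by simpa using hσ1)) hY
  have hle : ‖∫ t : ℝ, exp ((σ + t * I) * Real.log Y) * LSeries b (σ + t * I) * perronKernel σ t‖
      ≤ ∫ t : ℝ, 3 * Y * B * (4 * (1 + ‖t‖ ^ 2) ^ (-(3 / 2 : ℝ) / 2)) := by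
    refine norm_integral_le_of_norm_le (h_integrable.const_mul _) (Filter.Eventually.of_forall fun t => ?_)
    have h1 := hbd (σ + t * I) (by simpa using hσ1) (by simpa using hσ2)
    have him : (σ + t * I : ℂ).im = t := by simp
    rw [him] at h1
    have h2 := norm_perronKernel_le' hσ1.le t
    rw [norm_mul, norm_mul, norm_exp_vertical]
    calc _ ≤ (3 * (Y : ℝ)) * (B * (|t| + 4) ^ (1 / 2 : ℝ)) * (1 + t ^ 2)⁻¹ := by gcongr
      _ = 3 * Y * B * ((|t| + 4) ^ (1 / 2 : ℝ) * (1 + t ^ 2)⁻¹) := by ring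
      _ ≤ _ := mul_le_mul_of_nonneg_left (sqrt_weight_le t) (by positivity)
  rw [integral_const_mul, ← hJ, key, norm_mul] at hle
  have h3 : ‖(2 * Real.pi / Y : ℂ)‖ = 2 * Real.pi / Y := by
    rw [show (2 * Real.pi / Y : ℂ) = ((2 * Real.pi / Y : ℝ) : ℂ) by push_cast; rfl,
      Complex.norm_real, Real.norm_eq_abs, abs_of_nonneg (by positivity)]
  rw [h3, div_mul_eq_mul_div, div_le_iff₀ (by linarith)] at hle
  set T := ‖∑ n ∈ Ioc 0 Y, b n * ((Y - n : ℕ) : ℂ)‖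
  have hT : 0 ≤ T := norm_nonneg _
  calc T ≤ 2 * Real.pi * T := le_mul_of_one_le_left hT (by linarith [Real.pi_gt_three])
    _ ≤ 3 * Y * B * J * Y := hle
    _ = 3 * J * B * (Y : ℝ) ^ 2 := by ring
    _ ≤ _ := by gcongr; linarith

/-- Differencing a smoothed sum. -/
lemma norm_sum_le_of_smooth {b : ℕ → ℂ} {C D : ℝ} {Y h : ℕ} (hh : 0 < h) (hhY : h ≤ Y)
    (hC : 0 ≤ C) (hT : ∀ M : ℕ, ‖∑ n ∈ Ioc 0 M, b n * ((M - n : ℕ) : ℂ)‖ ≤ C * (M : ℝ) ^ 2)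
    (hb : ∀ n, 1 ≤ n → n ≤ 2 * Y → ‖b n‖ ≤ D) {M : ℕ} (hM : M ≤ Y) :
    ‖∑ n ∈ Ioc 0 M, b n‖ ≤ 5 * C * (Y : ℝ) ^ 2 / h + h * D := by
  have hh0 : (0 : ℝ) < h := by exact_mod_cast hh
  have hD : 0 ≤ D := (norm_nonneg _).trans (hb 1 le_rfl (by lia))
  have hsplit : ∑ n ∈ Ioc 0 (M + h), b n * ((M + h - n : ℕ) : ℂ) =
      ∑ n ∈ Ioc 0 M, b n * ((M - n : ℕ) : ℂ) + h * ∑ n ∈ Ioc 0 M, b n +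
        ∑ n ∈ Ioc M (M + h), b n * ((M + h - n : ℕ) : ℂ) := by
    rw [← sum_Ioc_consecutive _ (Nat.zero_le M) (Nat.le_add_right M h), mul_sum,
      ← sum_add_distrib]
    congr 1
    refine sum_congr rfl fun n hn => ?_
    have := (mem_Ioc.1 hn).2
    rw [show M + h - n = (M - n) + h by lia]
    push_cast; ring
  have htail : ‖∑ n ∈ Ioc M (M + h), b n * ((M + h - n : ℕ) : ℂ)‖ ≤ h * (h * D) := by
    refine (norm_sum_le _ _).trans ?_
    calc _ ≤ ∑ n ∈ Ioc M (M + h), (h * D : ℝ) := by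
          refine sum_le_sum fun n hn => ?_
          have hn' := mem_Ioc.1 hn
          rw [norm_mul, Complex.norm_natCast, mul_comm]
          have h1 := hb n (by lia) (by lia)
          have h2 : ((M + h - n : ℕ) : ℝ) ≤ h := by exact_mod_cast (by lia : M + h - n ≤ h)
          gcongr
      _ = _ := by rw [sum_const, Nat.card_Ioc, nsmul_eq_mul]; simp
  have h1 : (h : ℂ) * ∑ n ∈ Ioc 0 M, b n = ∑ n ∈ Ioc 0 (M + h), b n * ((M + h - n : ℕ) : ℂ) -
      ∑ n ∈ Ioc 0 M, b n * ((M - n : ℕ) : ℂ) -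
        ∑ n ∈ Ioc M (M + h), b n * ((M + h - n : ℕ) : ℂ) := by rw [hsplit]; ring
  have h2 : h * ‖∑ n ∈ Ioc 0 M, b n‖ ≤ 5 * C * (Y : ℝ) ^ 2 + h * (h * D) := by
    rw [← Complex.norm_natCast h, ← norm_mul, h1, Complex.norm_natCast]
    refine (norm_sub_le _ _).trans (add_le_add ((norm_sub_le _ _).trans ?_) htail)
    refine (add_le_add (hT _) (hT _)).trans ?_
    have h3 : ((M + h : ℕ) : ℝ) ≤ 2 * Y := by exact_mod_cast (by lia : M + h ≤ 2 * Y)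
    have h4 : (M : ℝ) ≤ Y := by exact_mod_cast hM
    calc _ ≤ C * (2 * (Y : ℝ)) ^ 2 + C * (Y : ℝ) ^ 2 := by gcongr
      _ = _ := by ring
  rw [← mul_le_mul_iff_of_pos_left hh0]
  refine h2.trans (le_of_eq ?_)
  field_simp

lemma logMul_iterate_apply (a : ℕ → ℂ) (k n : ℕ) :
    LSeries.logMul^[k] a n = (Real.log n : ℂ) ^ k * a n := by
  induction k with
  | zero => simp
  | succ k ih => rw [Function.iterate_succ_apply', LSeries.logMul, ih, pow_succ, natCast_log]; ring

lemma LSeriesSummable_logMul_iterate {a : ℕ → ℂ} (ha : ∀ s : ℂ, 1 < s.re → LSeriesSummable a s)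
    (k : ℕ) {s : ℂ} (hs : 1 < s.re) : LSeriesSummable (LSeries.logMul^[k] a) s := by
  have h1 : LSeries.abscissaOfAbsConv (LSeries.logMul^[k] a) ≤ 1 := by
    induction k with
    | zero => exact abscissaOfAbsConv_le_one ha
    | succ k ih => rw [Function.iterate_succ_apply', LSeries.abscissaOfAbsConv_logMul]; exact ih
  exact LSeriesSummable_of_abscissaOfAbsConv_lt_re (h1.trans_lt (by exact_mod_cast hs))

lemma log_pow_le_factorial_mul {Y : ℝ} (hY : 1 ≤ Y) (m : ℕ) :
    Real.log Y ^ m ≤ m.factorial * Y := by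
  have h := Real.pow_div_factorial_le_exp (x := Real.log Y) (Real.log_nonneg hY) m
  rw [Real.exp_log (by linarith), div_le_iff₀ (by positivity)] at h
  linarith

/-- A Tauberian theorem: bounds for high derivatives of a Dirichlet series close to the line
`re s = 1` give logarithmic savings in the partial sums of the coefficients. -/
lemma tauberian (m : ℕ) : ∃ C : ℝ, 0 < C ∧ ∀ (a : ℕ → ℂ) (B : ℝ) (Y : ℕ), 0 ≤ B → 3 ≤ Y →
    (∀ n : ℕ, 1 ≤ n → ‖a n‖ ≤ Real.log n + 1) →
    (∀ s : ℂ, 1 < s.re → LSeriesSummable a s) →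
    (∀ s : ℂ, 1 < s.re → s.re ≤ 2 →
      ‖LSeries (LSeries.logMul^[2 * m] a) s‖ ≤ B * (|s.im| + 4) ^ (1 / 2 : ℝ)) →
    ∀ M ≤ Y, ‖∑ n ∈ Ioc 0 M, a n‖ ≤ C * (1 + B) * Y * Real.log Y / Real.log Y ^ m := by
  obtain ⟨C0, hC0, hsm⟩ := exists_norm_smooth_sum_le
  set K : ℝ := 5 * C0 + (m.factorial + 1) * 3 ^ (2 * m + 1) with hK
  have hK0 : 0 < K := by positivity
  refine ⟨2 * m.factorial * 2 ^ m + 2 * K * 4 ^ m, by positivity,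
    fun a B Y hB hY ha hsa hbd M hM => ?_⟩
  have hY3 : (3 : ℝ) ≤ Y := by exact_mod_cast hY
  have hY0 : (0 : ℝ) < Y := by linarith
  set ℓ := Real.log Y with hℓ
  have hℓ1 : 1 ≤ ℓ := by
    rw [hℓ, Real.le_log_iff_exp_le hY0]
    linarith [Real.exp_one_lt_three]
  have hℓ0 : 0 < ℓ := by linarith
  set b := LSeries.logMul^[2 * m] a with hb
  have hbn : ∀ n : ℕ, b n = (Real.log n : ℂ) ^ (2 * m) * a n := logMul_iterate_apply a _
  have hbnorm : ∀ n : ℕ, ‖b n‖ = Real.log n ^ (2 * m) * ‖a n‖ := by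
    intro n
    rw [hbn, norm_mul, norm_pow, Complex.norm_real, Real.norm_eq_abs,
      abs_of_nonneg (Real.log_natCast_nonneg n)]
  set h := ⌈Y / ℓ ^ m⌉₊ with hh
  have hh0 : 0 < h := Nat.ceil_pos.2 (by positivity)
  have hhY : h ≤ Y := by
    rw [hh, Nat.ceil_le, div_le_iff₀ (by positivity)]
    exact le_mul_of_one_le_right hY0.le (one_le_pow₀ hℓ1)
  have hh1 : Y / ℓ ^ m ≤ h := Nat.le_ceil _
  have hh2 : (h : ℝ) ≤ (m.factorial + 1) * (Y / ℓ ^ m) := by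
    have h1 : (h : ℝ) < Y / ℓ ^ m + 1 := Nat.ceil_lt_add_one (by positivity)
    have h2 : 1 ≤ m.factorial * (Y / ℓ ^ m) := by
      rw [← mul_div_assoc, one_le_div (by positivity)]
      exact log_pow_le_factorial_mul (by linarith) m
    linarith
  have hD : ∀ n, 1 ≤ n → n ≤ 2 * Y → ‖b n‖ ≤ (3 * ℓ) ^ (2 * m + 1) := by
    intro n hn hn2
    have hn0 : (0 : ℝ) < n := by exact_mod_cast hn
    have h1 : Real.log n ≤ 2 * ℓ := by
      have h2 : (n : ℝ) ≤ Y ^ 2 := by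
        have : (n : ℝ) ≤ 2 * Y := by exact_mod_cast hn2
        nlinarith
      calc Real.log n ≤ Real.log ((Y : ℝ) ^ 2) := Real.log_le_log hn0 h2
        _ = _ := by rw [Real.log_pow]; push_cast; rfl
    have hl0 := Real.log_natCast_nonneg n
    rw [hbnorm, pow_succ]
    have h3 := ha n hn
    gcongr
    · linarith
    · linarith
  set S := K * (1 + B) * Y * ℓ ^ (m + 1) with hS
  have hsum : ∀ N ≤ Y, ‖∑ n ∈ Ioc 0 N, b n‖ ≤ S := by
    intro N hN
    refine (norm_sum_le_of_smooth hh0 hhY (by positivity : 0 ≤ C0 * B)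
      (hsm b B hB (fun s hs => LSeriesSummable_logMul_iterate hsa _ hs) hbd) hD hN).trans ?_
    have hhR : (0 : ℝ) < h := by exact_mod_cast hh0
    have e1 : 5 * (C0 * B) * (Y : ℝ) ^ 2 / h ≤ 5 * C0 * (1 + B) * Y * ℓ ^ (m + 1) := by
      have : (Y : ℝ) ≤ ℓ ^ m * h := by
        rw [div_le_iff₀ (by positivity)] at hh1; linarith
      rw [div_le_iff₀ hhR]
      calc 5 * (C0 * B) * (Y : ℝ) ^ 2 = 5 * (C0 * B) * Y * Y := by ring
        _ ≤ 5 * (C0 * (1 + B)) * Y * (ℓ ^ m * h) := by gcongr; linarith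
        _ ≤ 5 * (C0 * (1 + B)) * Y * (ℓ ^ (m + 1) * h) := by gcongr; lia
        _ = _ := by ring
    have e2 : (h : ℝ) * (3 * ℓ) ^ (2 * m + 1) ≤
        (m.factorial + 1) * 3 ^ (2 * m + 1) * (1 + B) * Y * ℓ ^ (m + 1) := by
      calc _ ≤ (m.factorial + 1) * (Y / ℓ ^ m) * (3 * ℓ) ^ (2 * m + 1) := by gcongr
        _ = (m.factorial + 1) * 3 ^ (2 * m + 1) * 1 * Y * ℓ ^ (m + 1) := by
            rw [mul_pow]; field_simp; ring
        _ ≤ _ := by gcongr; linarith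
    calc _ ≤ _ := add_le_add e1 e2
      _ = S := by rw [hS, hK]; ring
  have htriv : ∀ N ≤ Y.sqrt, ‖∑ n ∈ Ioc 0 N, a n‖ ≤
      2 * m.factorial * 2 ^ m * (1 + B) * Y * ℓ / ℓ ^ m := by
    intro N hN
    have hsq : (Y.sqrt : ℝ) ≤ √Y := Real.nat_sqrt_le_real_sqrt
    have h1 : ‖∑ n ∈ Ioc 0 N, a n‖ ≤ √Y * (2 * ℓ) := by
      refine (norm_sum_le _ _).trans ?_
      calc _ ≤ ∑ n ∈ Ioc 0 N, (2 * ℓ) := by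
            refine sum_le_sum fun n hn => (ha n (mem_Ioc.1 hn).1).trans ?_
            have h2 : (n : ℝ) ≤ Y := by
              exact_mod_cast ((mem_Ioc.1 hn).2.trans hN).trans (Nat.sqrt_le_self Y)
            have := Real.log_le_log (by exact_mod_cast (mem_Ioc.1 hn).1) h2
            linarith
        _ = N * (2 * ℓ) := by rw [sum_const, Nat.card_Ioc, nsmul_eq_mul]; simp
        _ ≤ _ := by
            have : (N : ℝ) ≤ Y.sqrt := by exact_mod_cast hN
            gcongr; linarith
    refine h1.trans ?_
    have hs1 : 1 ≤ √(Y : ℝ) := Real.one_le_sqrt.2 (by linarith)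
    have h3 := log_pow_le_factorial_mul hs1 m
    rw [Real.log_sqrt hY0.le, ← hℓ, div_pow, div_le_iff₀ (by positivity)] at h3
    rw [le_div_iff₀ (by positivity)]
    calc √Y * (2 * ℓ) * ℓ ^ m ≤ √Y * (2 * ℓ) * (m.factorial * √Y * 2 ^ m) := by gcongr
      _ = 2 * m.factorial * 2 ^ m * 1 * (√Y * √Y) * ℓ := by ring
      _ = 2 * m.factorial * 2 ^ m * 1 * Y * ℓ := by rw [Real.mul_self_sqrt hY0.le]
      _ ≤ _ := by gcongr; linarith
  have hfin : (2 * m.factorial * 2 ^ m + 2 * K * 4 ^ m) * (1 + B) * Y * ℓ / ℓ ^ m =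
      2 * m.factorial * 2 ^ m * (1 + B) * Y * ℓ / ℓ ^ m +
        2 * K * 4 ^ m * (1 + B) * Y * ℓ / ℓ ^ m := by ring
  have hpos2 : 0 ≤ 2 * K * 4 ^ m * (1 + B) * Y * ℓ / ℓ ^ m := by positivity
  rw [hfin]
  rcases le_or_gt M Y.sqrt with hMs | hMs
  · linarith [htriv M hMs]
  set y0 := Y.sqrt with hy0
  rw [← sum_Ioc_consecutive _ (Nat.zero_le y0) hMs.le]
  refine (norm_add_le _ _).trans (add_le_add (htriv y0 le_rfl) ?_)
  set w : ℕ → ℝ := fun i => (Real.log ((i + y0 + 1 : ℕ) : ℝ) ^ (2 * m))⁻¹ with hw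
  have hy0pos : 1 ≤ y0 := Nat.sqrt_pos.2 (by lia)
  have hlogpos : ∀ i : ℕ, 0 < Real.log ((i + y0 + 1 : ℕ) : ℝ) := fun i =>
    Real.log_pos (by exact_mod_cast (by lia : 1 < i + y0 + 1))
  have hwanti : Antitone w := by
    intro i j hij
    simp only [hw]
    have := hlogpos i
    gcongr
  have hw0 : ∀ i, 0 ≤ w i := fun i => by have := hlogpos i; simp only [hw]; positivity
  have hshift : ∀ k : ℕ, ∀ f : ℕ → ℂ,
      ∑ i ∈ range k, f (i + y0 + 1) = ∑ n ∈ Ioc y0 (y0 + k), f n := by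
    intro k f
    rw [← Finset.Ico_add_one_add_one_eq_Ioc, Finset.sum_Ico_eq_sum_range]
    rw [show y0 + k + 1 - (y0 + 1) = k by lia]
    exact sum_congr rfl fun i _ => by rw [show i + y0 + 1 = y0 + 1 + i by ring]
  have habel := norm_sum_mul_antitone_le (fun i => b (i + y0 + 1)) w hwanti hw0 (M - y0)
    (S := 2 * S) (by
      intro k hk
      rw [hshift k b]
      have e : ∑ n ∈ Ioc y0 (y0 + k), b n = ∑ n ∈ Ioc 0 (y0 + k), b n - ∑ n ∈ Ioc 0 y0, b n := by
        rw [← sum_Ioc_consecutive _ (Nat.zero_le y0) (Nat.le_add_right y0 k)]; ring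
      rw [e]
      refine (norm_sub_le _ _).trans ?_
      linarith [hsum (y0 + k) (by lia), hsum y0 (by lia)])
  have hterm : ∀ i, b (i + y0 + 1) * (w i : ℂ) = a (i + y0 + 1) := by
    intro i
    have h0 : (Real.log ((i + y0 + 1 : ℕ) : ℝ) : ℂ) ≠ 0 := by exact_mod_cast (hlogpos i).ne'
    rw [hbn, hw]
    push_cast [-Complex.natCast_log] at h0 ⊢
    field_simp
  simp_rw [hterm] at habel
  rw [hshift (M - y0) a, show y0 + (M - y0) = M by lia] at habel
  refine habel.trans ?_
  have hw0le : w 0 ≤ 4 ^ m / ℓ ^ (2 * m) := by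
    have h1 : ℓ / 2 ≤ Real.log ((0 + y0 + 1 : ℕ) : ℝ) := by
      rw [hℓ, ← Real.log_sqrt hY0.le]
      refine Real.log_le_log (by positivity) ?_
      rw [Real.sqrt_le_left (by positivity)]
      have := Nat.lt_succ_sqrt Y
      rw [← hy0] at this
      exact_mod_cast (by rw [pow_two, zero_add]; exact this.le : Y ≤ (0 + y0 + 1) ^ 2)
    simp only [hw]
    calc _ ≤ ((ℓ / 2) ^ (2 * m))⁻¹ := by gcongr
      _ = _ := by rw [div_pow, inv_div, pow_mul 2]; norm_num
  calc 2 * S * w 0 ≤ 2 * S * (4 ^ m / ℓ ^ (2 * m)) := by gcongr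
    _ = _ := by rw [hS, two_mul m, pow_add ℓ m m, pow_succ]; field_simp

end BombieriVinogradov

namespace BombieriVinogradov
open Finset Complex

lemma sum_mul_sub_eq_sum_range (f : ℕ → ℂ) (Y : ℕ) :
    ∑ n ∈ Ioc 0 Y, f n * ((Y - n : ℕ) : ℂ) = ∑ M ∈ range Y, ∑ n ∈ Ioc 0 M, f n := by
  induction Y with
  | zero => simp
  | succ Y ih =>
    rw [sum_range_succ, ← ih, ← sum_add_distrib, ← Finset.insert_Ioc_right_eq_Ioc_add_one (by lia),
      sum_insert (by simp)]
    simp only [Nat.sub_self, Nat.cast_zero, mul_zero, zero_add]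
    refine sum_congr rfl fun n hn => ?_
    have := (mem_Ioc.1 hn).2
    rw [show Y + 1 - n = (Y - n) + 1 by lia]
    push_cast; ring

lemma norm_sum_mul_sub_le {f : ℕ → ℂ} {Y : ℕ} {S : ℝ}
    (h : ∀ M ≤ Y, ‖∑ n ∈ Ioc 0 M, f n‖ ≤ S) :
    ‖∑ n ∈ Ioc 0 Y, f n * ((Y - n : ℕ) : ℂ)‖ ≤ Y * S := by
  rw [sum_mul_sub_eq_sum_range]
  refine (norm_sum_le _ _).trans ?_
  calc _ ≤ ∑ M ∈ range Y, S := sum_le_sum fun M hM => h M (mem_range.1 hM).le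
    _ = _ := by rw [sum_const, card_range, nsmul_eq_mul]

lemma norm_mangoldtError_le (n : ℕ) : ‖mangoldtError n‖ ≤ Real.log n + 1 := by
  have h1 : ‖mangoldtError n‖ ≤ ‖(ArithmeticFunction.vonMangoldt n : ℂ)‖ + ‖(1 : ℂ)‖ :=
    norm_sub_le _ _
  rw [Complex.norm_real, Real.norm_eq_abs, abs_of_nonneg ArithmeticFunction.vonMangoldt_nonneg,
    norm_one] at h1
  linarith [ArithmeticFunction.vonMangoldt_le_log (n := n)]

lemma norm_twistMangoldt_le {q : ℕ} (χ : DirichletCharacter ℂ q) (n : ℕ) :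
    ‖twistMangoldt χ n‖ ≤ Real.log n := by
  rw [twistMangoldt, norm_mul, Complex.norm_real, Real.norm_eq_abs,
    abs_of_nonneg ArithmeticFunction.vonMangoldt_nonneg]
  calc _ ≤ 1 * ArithmeticFunction.vonMangoldt n :=
        mul_le_mul_of_nonneg_right (χ.norm_le_one _) ArithmeticFunction.vonMangoldt_nonneg
    _ ≤ _ := by rw [one_mul]; exact ArithmeticFunction.vonMangoldt_le_log

lemma one_le_log {Y : ℝ} (hY : 3 ≤ Y) : 1 ≤ Real.log Y := by
  rw [Real.le_log_iff_exp_le (by linarith)]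
  linarith [Real.exp_one_lt_three]

lemma exists_norm_sum_mangoldtError_le (K : ℕ) : ∃ C : ℝ, 0 < C ∧ ∀ Y : ℕ, 3 ≤ Y → ∀ M ≤ Y,
    ‖∑ n ∈ Ioc 0 M, mangoldtError n‖ ≤ C * Y / Real.log Y ^ K := by
  obtain ⟨C, hC, h⟩ := tauberian (K + 1)
  obtain ⟨C', hC', h'⟩ := exists_norm_LSeries_mangoldtError_le (2 * (K + 1))
  refine ⟨C * (1 + C'), by positivity, fun Y hY M hM => ?_⟩
  have hl : 0 < Real.log Y := Real.log_pos (by exact_mod_cast (by lia : 1 < Y))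
  refine (h mangoldtError C' Y hC'.le hY (fun n _ => norm_mangoldtError_le n)
    (fun s hs => LSeriesSummable_mangoldtError hs) (fun s hs hs2 => ?_) M hM).trans_eq ?_
  · simpa [cond] using h' s hs hs2
  · rw [pow_succ]; field_simp

/-- A smoothed form of the Siegel–Walfisz theorem. -/
lemma exists_norm_smoothSum_le (K N : ℕ) : ∃ C : ℝ, 0 < C ∧ ∀ (q : ℕ) [NeZero q]
    (χ : DirichletCharacter ℂ q) (Y : ℕ), χ ≠ 1 → 3 ≤ Y → (q : ℝ) ≤ Real.log Y ^ N →
    ‖smoothSum ArithmeticFunction.vonMangoldt χ Y‖ ≤ C * (Y : ℝ) ^ 2 / Real.log Y ^ K := by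
  obtain ⟨C, hC, h⟩ := tauberian (K + N + 1)
  obtain ⟨C', hC', h'⟩ := exists_norm_LSeries_twistMangoldt_le (2 * (K + N + 1))
  refine ⟨C * (1 + C'), by positivity, fun q _ χ Y hχ hY hq => ?_⟩
  have hl1 : 1 ≤ Real.log Y := one_le_log (by exact_mod_cast hY)
  have hl : 0 < Real.log Y := by linarith
  have hq1 : (1 : ℝ) ≤ q := by exact_mod_cast NeZero.one_le
  have hS : ∀ M ≤ Y, ‖∑ n ∈ Ioc 0 M, twistMangoldt χ n‖ ≤ C * (1 + C') * Y / Real.log Y ^ K := by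
    intro M hM
    refine (h (twistMangoldt χ) (C' * (q : ℝ) ^ (1 / 2 : ℝ)) Y (by positivity) hY
      (fun n hn => (norm_twistMangoldt_le χ n).trans (by linarith))
      (fun s hs => LSeriesSummable_twistMangoldt χ hs) (fun s hs hs2 => ?_) M hM).trans ?_
    · refine (h' q χ s hs hs2 (Or.inl hχ)).trans_eq ?_
      rw [cond, Real.mul_rpow (by positivity) (by positivity), mul_assoc]
    · have e1 : (q : ℝ) ^ (1 / 2 : ℝ) ≤ Real.log Y ^ N := by
        refine le_trans ?_ hq
        calc (q : ℝ) ^ (1 / 2 : ℝ) ≤ (q : ℝ) ^ (1 : ℝ) :=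
              Real.rpow_le_rpow_of_exponent_le hq1 (by norm_num)
          _ = q := Real.rpow_one _
      have e2 : 1 ≤ Real.log Y ^ N := one_le_pow₀ hl1
      calc _ ≤ C * (Real.log Y ^ N + C' * Real.log Y ^ N) * Y * Real.log Y /
            Real.log Y ^ (K + N + 1) := by gcongr
        _ = _ := by rw [pow_succ, pow_add]; field_simp
  have e : smoothSum ArithmeticFunction.vonMangoldt χ Y =
      ∑ n ∈ Ioc 0 Y, twistMangoldt χ n * ((Y - n : ℕ) : ℂ) := by
    rw [smoothSum]
    exact sum_congr rfl fun n _ => by rw [twistMangoldt]; ring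
  rw [e]
  refine (norm_sum_mul_sub_le hS).trans_eq ?_
  ring

end BombieriVinogradov

namespace BombieriVinogradov
open Finset Complex

lemma norm_smoothSum_trivial {q : ℕ} (χ : DirichletCharacter ℂ q) (Y : ℕ) :
    ‖smoothSum ArithmeticFunction.vonMangoldt χ Y‖ ≤ (Y : ℝ) ^ 2 * Real.log Y := by
  refine (norm_smoothSum_le _ _ _).trans ?_
  have h : ∑ n ∈ Ioc 0 Y, |ArithmeticFunction.vonMangoldt n| ≤ Y * Real.log Y := by
    calc _ ≤ ∑ n ∈ Ioc 0 Y, Real.log Y := by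
          refine sum_le_sum fun n hn => ?_
          rw [abs_of_nonneg ArithmeticFunction.vonMangoldt_nonneg]
          exact ArithmeticFunction.vonMangoldt_le_log.trans
            (monotone_log_natCast (mem_Ioc.1 hn).2)
      _ = _ := by rw [sum_const, Nat.card_Ioc, nsmul_eq_mul]; simp
  calc _ ≤ (Y * Real.log Y) * (Y : ℝ) := by gcongr
    _ = _ := by ring

lemma sum_primChars_le_of_le {q : ℕ} {F : DirichletCharacter ℂ q → ℝ} {S : ℝ} (hq : 0 < q)
    (hS : 0 ≤ S) (h : ∀ χ ∈ primChars q, F χ ≤ S) :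
    (1 : ℝ) / q.totient * ∑ χ ∈ primChars q, F χ ≤ S := by
  have hφ : (0 : ℝ) < q.totient := by exact_mod_cast Nat.totient_pos.2 hq
  rw [div_mul_eq_mul_div, one_mul, div_le_iff₀ hφ]
  calc _ ≤ ∑ χ ∈ primChars q, S := sum_le_sum h
    _ = #(primChars q) * S := by rw [sum_const, nsmul_eq_mul]
    _ ≤ q.totient * S := by gcongr; exact_mod_cast card_primChars_le q
    _ = _ := mul_comm _ _

lemma log_pow_le_mul_sqrt {Z : ℝ} (hZ : 1 ≤ Z) (m : ℕ) :
    Real.log Z ^ m ≤ 2 ^ m * m.factorial * √Z := by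
  have h3 := log_pow_le_factorial_mul (Real.one_le_sqrt.2 hZ) m
  rw [Real.log_sqrt (by linarith), div_pow, div_le_iff₀ (by positivity)] at h3
  linarith

lemma exists_sum_primChars_smoothSum_le (K : ℕ) : ∃ C : ℝ, 0 < C ∧ ∃ B Z₀ : ℕ, ∀ Z ≥ Z₀, ∀ Y ≤ Z,
    ∀ Q : ℕ, Q * Real.log Z ^ B ≤ √Z →
    ∑ d ∈ Ioc 1 Q, (1 : ℝ) / d.totient *
      ∑ ψ ∈ primChars d, ‖smoothSum ArithmeticFunction.vonMangoldt ψ Y‖ ≤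
        C * (Z : ℝ) ^ 2 / Real.log Z ^ K := by
  set N := K + 6 with hN
  obtain ⟨C₁, hC₁, hSW⟩ := exists_norm_smoothSum_le (N + K) (2 * N)
  set C₂ : ℝ := 2 ^ (K + 1) * (K + 1).factorial with hC₂
  set C₃ : ℝ := 6000 * 64 * 8 with hC₃
  refine ⟨C₂ + C₁ * 2 ^ (N + K) + C₃, by positivity, 3 * N, ⌈Real.exp 4⌉₊, fun Z hZ Y hY Q hQ => ?_⟩
  have hZe : Real.exp 4 ≤ Z := (Nat.le_ceil _).trans (by exact_mod_cast hZ)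
  have hZ0 : (0 : ℝ) < Z := (Real.exp_pos 4).trans_le hZe
  have hZ1 : (1 : ℝ) ≤ Z := le_trans (Real.one_le_exp (by norm_num : (0:ℝ) ≤ 4)) hZe
  set ℓ := Real.log Z with hℓ
  have hℓ4 : 4 ≤ ℓ := by rwa [hℓ, Real.le_log_iff_exp_le hZ0]
  have hℓ0 : 0 < ℓ := by linarith
  have hℓ1 : 1 ≤ ℓ := by linarith
  have hYZ : (Y : ℝ) ≤ Z := by exact_mod_cast hY
  have hQ1 : (Q : ℝ) ≤ √Z / ℓ ^ (3 * N) := by rwa [le_div_iff₀ (by positivity)]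
  have hQ2 : (Q : ℝ) ≤ √Z := by
    refine hQ1.trans (div_le_self (Real.sqrt_nonneg _) (one_le_pow₀ hℓ1))
  have hsum0 : ∀ d : ℕ, 0 ≤ (1 : ℝ) / d.totient *
      ∑ ψ ∈ primChars d, ‖smoothSum ArithmeticFunction.vonMangoldt ψ Y‖ := fun d => by positivity
  have hp1 : 0 ≤ C₂ * (Z : ℝ) ^ 2 / ℓ ^ K := by positivity
  have hp2 : 0 ≤ C₁ * 2 ^ (N + K) * (Z : ℝ) ^ 2 / ℓ ^ K := by positivity
  have hp3 : 0 ≤ C₃ * (Z : ℝ) ^ 2 / ℓ ^ K := by positivity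
  have hsplit : (C₂ + C₁ * 2 ^ (N + K) + C₃) * (Z : ℝ) ^ 2 / ℓ ^ K = C₂ * (Z : ℝ) ^ 2 / ℓ ^ K +
      C₁ * 2 ^ (N + K) * (Z : ℝ) ^ 2 / ℓ ^ K + C₃ * (Z : ℝ) ^ 2 / ℓ ^ K := by ring
  rw [hsplit]
  have hss : √(Z : ℝ) * √Z = Z := Real.mul_self_sqrt hZ0.le
  rcases le_or_gt (Y : ℝ) (√Z) with hYs | hYs
  · have h1 : ∀ d ∈ Ioc 1 Q, (1 : ℝ) / d.totient *
        ∑ ψ ∈ primChars d, ‖smoothSum ArithmeticFunction.vonMangoldt ψ Y‖ ≤ Z * ℓ := by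
      intro d hd
      refine sum_primChars_le_of_le (by have := (mem_Ioc.1 hd).1; lia) (by positivity) fun χ _ => ?_
      refine (norm_smoothSum_trivial χ Y).trans ?_
      have hlog : Real.log Y ≤ ℓ := monotone_log_natCast hY
      have hl0 := Real.log_natCast_nonneg Y
      calc _ ≤ (√(Z : ℝ)) ^ 2 * ℓ := by gcongr
        _ = _ := by rw [Real.sq_sqrt hZ0.le]
    have h2 := sum_le_sum h1
    rw [sum_const, nsmul_eq_mul, Nat.card_Ioc] at h2
    have h3 : ((Q - 1 : ℕ) : ℝ) ≤ √Z := le_trans (by exact_mod_cast Nat.sub_le Q 1) hQ2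
    have h4 : ((Q - 1 : ℕ) : ℝ) * (Z * ℓ) ≤ C₂ * (Z : ℝ) ^ 2 / ℓ ^ K := by
      rw [le_div_iff₀ (by positivity)]
      calc _ ≤ √Z * (Z * ℓ) * ℓ ^ K := by gcongr
        _ = √Z * Z * ℓ ^ (K + 1) := by ring
        _ ≤ √Z * Z * (C₂ * √Z) := by gcongr; exact log_pow_le_mul_sqrt hZ1 (K + 1)
        _ = C₂ * Z * (√Z * √Z) := by ring
        _ = _ := by rw [hss]; ring
    linarith
  have hY0 : (0 : ℝ) < Y := (Real.sqrt_nonneg _).trans_lt hYs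
  have hlY : ℓ / 2 ≤ Real.log Y := by
    rw [hℓ, ← Real.log_sqrt hZ0.le]
    exact Real.log_le_log (Real.sqrt_pos.2 hZ0) hYs.le
  have hY3 : 3 ≤ Y := by
    have h1 : Real.exp 2 ≤ Y := by
      rw [← Real.le_log_iff_exp_le hY0]; linarith
    have h2 := Real.add_one_le_exp (2 : ℝ)
    have h3 : (3 : ℝ) ≤ Y := by linarith
    exact_mod_cast h3
  obtain ⟨D, hD⟩ : ∃ D : ℕ, D = ⌊ℓ ^ N⌋₊ := ⟨_, rfl⟩
  have hDle : (D : ℝ) ≤ ℓ ^ N := by rw [hD]; exact Nat.floor_le (by positivity)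
  have hD1 : 1 ≤ D := by rw [hD]; exact Nat.floor_pos.2 (one_le_pow₀ hℓ1)
  have hDge : ℓ ^ N ≤ 2 * D := by
    have h1 := Nat.lt_floor_add_one (ℓ ^ N)
    rw [← hD] at h1
    have : (1 : ℝ) ≤ D := by exact_mod_cast hD1
    linarith
  have hcover : ∑ d ∈ Ioc 1 Q, (1 : ℝ) / d.totient *
      ∑ ψ ∈ primChars d, ‖smoothSum ArithmeticFunction.vonMangoldt ψ Y‖ ≤
      ∑ d ∈ Ioc 1 D, (1 : ℝ) / d.totient *
        ∑ ψ ∈ primChars d, ‖smoothSum ArithmeticFunction.vonMangoldt ψ Y‖ +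
      ∑ d ∈ Ioc D Q, (1 : ℝ) / d.totient *
        ∑ ψ ∈ primChars d, ‖smoothSum ArithmeticFunction.vonMangoldt ψ Y‖ := by
    rw [← sum_union (disjoint_left.2 fun d h1 h2 => by
      have := mem_Ioc.1 h1; have := mem_Ioc.1 h2; lia)]
    refine sum_le_sum_of_subset_of_nonneg (fun d hd => ?_) fun d _ _ => hsum0 d
    have := mem_Ioc.1 hd
    rw [mem_union, mem_Ioc, mem_Ioc]
    lia
  have hsmall : ∑ d ∈ Ioc 1 D, (1 : ℝ) / d.totient *
      ∑ ψ ∈ primChars d, ‖smoothSum ArithmeticFunction.vonMangoldt ψ Y‖ ≤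
      C₁ * 2 ^ (N + K) * (Z : ℝ) ^ 2 / ℓ ^ K := by
    have h1 : ∀ d ∈ Ioc 1 D, (1 : ℝ) / d.totient *
        ∑ ψ ∈ primChars d, ‖smoothSum ArithmeticFunction.vonMangoldt ψ Y‖ ≤
        C₁ * (Z : ℝ) ^ 2 / (ℓ / 2) ^ (N + K) := by
      intro d hd
      have hd' := mem_Ioc.1 hd
      have : NeZero d := ⟨by lia⟩
      refine sum_primChars_le_of_le (by lia) (by positivity) fun χ hχ => ?_
      have hχ1 : χ ≠ 1 := by
        rintro rfl
        have h2 := mem_primChars.1 hχ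
        rw [DirichletCharacter.isPrimitive_def, DirichletCharacter.conductor_one] at h2
        lia
      have hdl : (d : ℝ) ≤ Real.log Y ^ (2 * N) := by
        have h2 : (d : ℝ) ≤ D := by exact_mod_cast hd'.2
        calc (d : ℝ) ≤ ℓ ^ N := h2.trans hDle
          _ ≤ ((Real.log Y) ^ 2) ^ N := by
              gcongr
              nlinarith
          _ = _ := by rw [pow_mul]
      refine (hSW d χ Y hχ1 hY3 hdl).trans ?_
      gcongr
    refine (sum_le_sum h1).trans ?_
    rw [sum_const, nsmul_eq_mul, Nat.card_Ioc]
    have h3 : ((D - 1 : ℕ) : ℝ) ≤ ℓ ^ N := le_trans (by exact_mod_cast Nat.sub_le D 1) hDle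
    calc _ ≤ ℓ ^ N * (C₁ * (Z : ℝ) ^ 2 / (ℓ / 2) ^ (N + K)) := by gcongr
      _ = _ := by rw [div_pow, pow_add ℓ N K]; field_simp
  have hlarge : ∑ d ∈ Ioc D Q, (1 : ℝ) / d.totient *
      ∑ ψ ∈ primChars d, ‖smoothSum ArithmeticFunction.vonMangoldt ψ Y‖ ≤
      C₃ * (Z : ℝ) ^ 2 / ℓ ^ K := by
    have hQY : Q ≤ Y := by exact_mod_cast hQ2.trans hYs.le
    refine (sum_primChars_smoothSum_le D Q D Y hD1 hQY hD1 (by lia)).trans ?_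
    have hlog : Real.log (Y + 1) ≤ 2 * ℓ := by
      have h1 : (Y : ℝ) + 1 ≤ (Z : ℝ) ^ 2 := by
        have : (2 : ℝ) ≤ Z := by exact_mod_cast (by lia : 2 ≤ Z)
        nlinarith
      calc _ ≤ Real.log ((Z : ℝ) ^ 2) := Real.log_le_log (by linarith) h1
        _ = _ := by rw [Real.log_pow]; push_cast; rfl
    have hlog0 : 0 ≤ Real.log ((Y : ℝ) + 1) := Real.log_nonneg (by linarith)
    have hDpos : (0 : ℝ) < D := by exact_mod_cast hD1
    have hYD : (Y : ℝ) / D ≤ 2 * (Z / ℓ ^ N) := by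
      rw [div_le_iff₀ hDpos]
      calc (Y : ℝ) ≤ Z / ℓ ^ N * ℓ ^ N := by rw [div_mul_cancel₀ _ (by positivity)]; exact hYZ
        _ ≤ Z / ℓ ^ N * (2 * D) := by gcongr
        _ = _ := by ring
    have t1 : (Q : ℝ) ^ 2 * (D : ℝ) ^ 4 ≤ Z / ℓ ^ N := by
      calc _ ≤ (√Z / ℓ ^ (3 * N)) ^ 2 * (ℓ ^ N) ^ 4 := by gcongr
        _ = √Z * √Z / (ℓ ^ N) ^ 2 := by
            rw [show 3 * N = N * 3 by ring, pow_mul ℓ N 3]; field_simp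
        _ ≤ _ := by
            rw [hss]
            gcongr
            exact le_self_pow₀ (one_le_pow₀ hℓ1) (by norm_num)
    have t4 : (Q : ℝ) * √(Y : ℝ) ≤ Z / ℓ ^ N := by
      calc _ ≤ √Z / ℓ ^ (3 * N) * √Z := by gcongr
        _ = Z / ℓ ^ (3 * N) := by rw [div_mul_eq_mul_div, hss]
        _ ≤ _ := by gcongr; lia
    have t : (Q : ℝ) ^ 2 * (D : ℝ) ^ 4 + Y / D + 2 * Y / D + Q * √(Y : ℝ) ≤ 8 * (Z / ℓ ^ N) := by
      rw [mul_div_assoc]; linarith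
    calc _ ≤ 6000 * (2 * ℓ) ^ 6 * Z * (8 * (Z / ℓ ^ N)) := by gcongr
      _ = C₃ * (Z : ℝ) ^ 2 / ℓ ^ K := by rw [hC₃, hN, pow_add ℓ]; field_simp; norm_num
  linarith

end BombieriVinogradov

namespace BombieriVinogradov
open Finset Complex

lemma inv_card_add_one_le_prod (s : Finset ℕ) (hs : ∀ p ∈ s, 2 ≤ p) :
    ((#s : ℝ) + 1)⁻¹ ≤ ∏ p ∈ s, (1 - (p : ℝ)⁻¹) := by
  induction s using Finset.induction_on_max with
  | empty => simp
  | insert a s hmax ih =>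
    have hnot : a ∉ s := fun h => lt_irrefl _ (hmax a h)
    have hsub : s ⊆ Ico 2 a := fun p hp =>
      mem_Ico.2 ⟨hs p (mem_insert_of_mem hp), hmax p hp⟩
    have hcard := card_le_card hsub
    rw [Nat.card_Ico] at hcard
    have ha2 := hs a (mem_insert_self a s)
    have hca : (#s : ℝ) + 2 ≤ a := by exact_mod_cast (by lia : #s + 2 ≤ a)
    have ih' := ih fun p hp => hs p (mem_insert_of_mem hp)
    rw [prod_insert hnot, card_insert_of_notMem hnot]
    push_cast
    have h1 : 1 - ((#s : ℝ) + 2)⁻¹ ≤ 1 - (a : ℝ)⁻¹ := by gcongr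
    have h2 : 0 ≤ 1 - ((#s : ℝ) + 2)⁻¹ := by
      rw [sub_nonneg]; exact inv_le_one_of_one_le₀ (by linarith [(Nat.cast_nonneg #s : (0:ℝ) ≤ _)])
    calc ((#s : ℝ) + 1 + 1)⁻¹ = (1 - ((#s : ℝ) + 2)⁻¹) * ((#s : ℝ) + 1)⁻¹ := by field_simp; ring
      _ ≤ _ := by gcongr; exact h2.trans h1

lemma card_primeFactors_le_two_mul_log {n : ℕ} (hn : 0 < n) :
    (#n.primeFactors : ℝ) ≤ 2 * Real.log n := by
  have h1 : 2 ^ #n.primeFactors ≤ n :=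
    (pow_card_le_prod n.primeFactors id 2 fun p hp => (Nat.prime_of_mem_primeFactors hp).two_le).trans
      (Nat.le_of_dvd hn (Nat.prod_primeFactors_dvd n))
  have h2 : (2 : ℝ) ^ #n.primeFactors ≤ n := by exact_mod_cast h1
  have h3 := Real.log_le_log (by positivity) h2
  rw [Real.log_pow] at h3
  nlinarith [Real.log_two_gt_d9, (Nat.cast_nonneg #n.primeFactors : (0:ℝ) ≤ _)]

lemma one_div_totient_le {n : ℕ} (hn : 0 < n) :
    (1 : ℝ) / n.totient ≤ (2 * Real.log n + 1) * (1 / n) := by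
  have hn0 : (0 : ℝ) < n := by exact_mod_cast hn
  have hφ : (0 : ℝ) < n.totient := by exact_mod_cast Nat.totient_pos.2 hn
  have h1 : (n.totient : ℝ) = n * ∏ p ∈ n.primeFactors, (1 - (p : ℝ)⁻¹) := by
    have := congrArg (fun z : ℚ => (z : ℝ)) (Nat.totient_eq_mul_prod_factors n)
    push_cast at this
    exact this
  have h2 := inv_card_add_one_le_prod n.primeFactors
    fun p hp => (Nat.prime_of_mem_primeFactors hp).two_le
  have h3 := card_primeFactors_le_two_mul_log hn
  have hl := Real.log_natCast_nonneg n
  have h4 : (2 * Real.log n + 1)⁻¹ ≤ ∏ p ∈ n.primeFactors, (1 - (p : ℝ)⁻¹) := by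
    refine le_trans ?_ h2
    gcongr
  rw [mul_one_div, div_le_div_iff₀ hφ hn0, one_mul, h1]
  calc (n : ℝ) = n * ((2 * Real.log n + 1) * (2 * Real.log n + 1)⁻¹) := by
        rw [mul_inv_cancel₀ (by positivity), mul_one]
    _ ≤ n * ((2 * Real.log n + 1) * ∏ p ∈ n.primeFactors, (1 - (p : ℝ)⁻¹)) := by gcongr
    _ = _ := by ring

lemma sum_one_div_totient_le (Q : ℕ) :
    ∑ q ∈ Ioc 0 Q, (1 : ℝ) / q.totient ≤ (2 * Real.log Q + 1) * (1 + Real.log Q) := by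
  have hl := Real.log_natCast_nonneg Q
  calc _ ≤ ∑ q ∈ Ioc 0 Q, (2 * Real.log Q + 1) * (1 / q) := by
        refine sum_le_sum fun q hq => (one_div_totient_le (mem_Ioc.1 hq).1).trans ?_
        gcongr
        · exact_mod_cast (mem_Ioc.1 hq).1
        · exact (mem_Ioc.1 hq).2
    _ ≤ _ := by
        rw [← mul_sum]
        gcongr
        exact sum_inv_le_one_add_log Q

lemma sum_one_div_totient_filter_dvd_le {d : ℕ} (hd : 0 < d) (Q : ℕ) :
    ∑ q ∈ Ioc 0 Q with d ∣ q, (1 : ℝ) / q.totient ≤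
      (1 : ℝ) / d.totient * ∑ k ∈ Ioc 0 Q, (1 : ℝ) / k.totient := by
  have hsub : {q ∈ Ioc 0 Q | d ∣ q} ⊆ (Ioc 0 Q).image fun k => d * k := by
    intro q hq
    obtain ⟨hq1, k, rfl⟩ := mem_filter.1 hq
    have hq2 := mem_Ioc.1 hq1
    have hk : 0 < k := Nat.pos_of_mul_pos_left hq2.1
    exact mem_image.2 ⟨k, mem_Ioc.2 ⟨hk, (Nat.le_mul_of_pos_left k hd).trans hq2.2⟩, rfl⟩
  refine (sum_le_sum_of_subset_of_nonneg hsub fun _ _ _ => by positivity).trans ?_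
  rw [sum_image fun x _ y _ h => Nat.eq_of_mul_eq_mul_left hd h, mul_sum]
  refine sum_le_sum fun k hk => ?_
  have hk0 := (mem_Ioc.1 hk).1
  have h1 : (0 : ℝ) < d.totient := by exact_mod_cast Nat.totient_pos.2 hd
  have h2 : (0 : ℝ) < k.totient := by exact_mod_cast Nat.totient_pos.2 hk0
  rw [one_div_mul_one_div]
  gcongr
  exact_mod_cast Nat.totient_super_multiplicative d k

lemma sum_vonMangoldt_not_coprime_le {q : ℕ} (hq : 0 < q) (Y : ℕ) :
    ∑ n ∈ Ioc 0 Y with ¬ n.Coprime q, ArithmeticFunction.vonMangoldt n ≤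
      4 * Real.log q * Real.log Y ^ 2 := by
  have hlY := Real.log_natCast_nonneg Y
  have hlq := Real.log_natCast_nonneg q
  set T := ((q.primeFactors ×ˢ Ioc 0 (Nat.log 2 Y)).image fun x : ℕ × ℕ => x.1 ^ x.2) with hT
  have h1 : ∑ n ∈ Ioc 0 Y with ¬ n.Coprime q, ArithmeticFunction.vonMangoldt n ≤
      ∑ n ∈ T, Real.log Y := by
    have h2 : ∑ n ∈ Ioc 0 Y with ¬ n.Coprime q, ArithmeticFunction.vonMangoldt n =
        ∑ n ∈ (Ioc 0 Y).filter (fun n => ¬ n.Coprime q ∧ IsPrimePow n),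
          ArithmeticFunction.vonMangoldt n := by
      rw [← filter_filter]
      symm
      refine sum_filter_of_ne fun n _ hn => ArithmeticFunction.vonMangoldt_ne_zero_iff.1 hn
    rw [h2]
    calc _ ≤ ∑ n ∈ (Ioc 0 Y).filter (fun n => ¬ n.Coprime q ∧ IsPrimePow n), Real.log Y := by
          refine sum_le_sum fun n hn => ArithmeticFunction.vonMangoldt_le_log.trans
            (monotone_log_natCast (mem_Ioc.1 (mem_filter.1 hn).1).2)
      _ ≤ _ := by
          refine sum_le_sum_of_subset_of_nonneg (fun n hn => ?_) fun _ _ _ => hlY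
          obtain ⟨hn1, hn2, hn3⟩ := mem_filter.1 hn
          have hnY := mem_Ioc.1 hn1
          obtain ⟨p, k, hp, hk, rfl⟩ := (isPrimePow_nat_iff _).1 hn3
          have hpq : p ∣ q := by
            by_contra h
            exact hn2 (((Nat.Prime.coprime_iff_not_dvd hp).2 h).pow_left k)
          refine mem_image.2 ⟨(p, k), mem_product.2 ⟨Nat.mem_primeFactors.2 ⟨hp, hpq, hq.ne'⟩,
            mem_Ioc.2 ⟨hk, ?_⟩⟩, rfl⟩
          refine Nat.le_log_of_pow_le (by norm_num) ?_
          exact (Nat.pow_le_pow_left hp.two_le k).trans hnY.2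
  refine h1.trans ?_
  rw [sum_const, nsmul_eq_mul]
  have h3 : (#T : ℝ) ≤ #q.primeFactors * (Nat.log 2 Y : ℕ) := by
    have : #T ≤ #q.primeFactors * Nat.log 2 Y := by
      refine card_image_le.trans ?_
      rw [card_product, Nat.card_Ioc, Nat.sub_zero]
    exact_mod_cast this
  have h4 : ((Nat.log 2 Y : ℕ) : ℝ) ≤ 2 * Real.log Y := by
    refine (Real.natLog_le_logb Y 2).trans ?_
    rw [Real.logb, div_le_iff₀ (Real.log_pos (by norm_num))]
    push_cast
    nlinarith [Real.log_two_gt_d9]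
  have h5 := card_primeFactors_le_two_mul_log hq
  calc _ ≤ (2 * Real.log q) * (2 * Real.log Y) * Real.log Y := by
        gcongr
        exact h3.trans (by gcongr)
    _ = _ := by ring

lemma norm_smoothSum_changeLevel_sub_le {d q : ℕ} (hq : 0 < q) (h : d ∣ q)
    (ψ : DirichletCharacter ℂ d) (Y : ℕ) :
    ‖smoothSum ArithmeticFunction.vonMangoldt (DirichletCharacter.changeLevel h ψ) Y -
      smoothSum ArithmeticFunction.vonMangoldt ψ Y‖ ≤ Y * (4 * Real.log q * Real.log Y ^ 2) := by
  have hterm : ∀ n ∈ Ioc 0 Y, ‖(ArithmeticFunction.vonMangoldt n : ℂ) *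
      (DirichletCharacter.changeLevel h ψ n * ((Y - n : ℕ) : ℂ)) -
      (ArithmeticFunction.vonMangoldt n : ℂ) * (ψ n * ((Y - n : ℕ) : ℂ))‖ ≤
      if ¬ n.Coprime q then Y * ArithmeticFunction.vonMangoldt n else 0 := by
    intro n hn
    by_cases hc : n.Coprime q
    · have h1 := DirichletCharacter.changeLevel_eq_cast_of_dvd' (χ := ψ) (hm := h) (a := (n : ℤ))
        (Nat.isCoprime_iff_coprime.2 hc)
      rw [Int.cast_natCast, Int.cast_natCast] at h1
      rw [h1]; simp [hc]
    · have h1 : DirichletCharacter.changeLevel h ψ (n : ZMod q) = 0 :=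
        MulChar.map_nonunit _ (by rwa [ZMod.isUnit_iff_coprime])
      rw [h1, if_pos hc, zero_mul, mul_zero, zero_sub, norm_neg, norm_mul, norm_mul,
        Complex.norm_natCast, Complex.norm_real, Real.norm_eq_abs,
        abs_of_nonneg ArithmeticFunction.vonMangoldt_nonneg]
      have h2 : ((Y - n : ℕ) : ℝ) ≤ Y := by exact_mod_cast Nat.sub_le Y n
      have h3 := ψ.norm_le_one n
      have h4 := ArithmeticFunction.vonMangoldt_nonneg (n := n)
      calc _ ≤ ArithmeticFunction.vonMangoldt n * (1 * (Y : ℝ)) := by gcongr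
        _ = _ := by ring
  rw [smoothSum, smoothSum, ← sum_sub_distrib]
  refine (norm_sum_le _ _).trans ((sum_le_sum hterm).trans ?_)
  rw [← sum_filter, ← mul_sum]
  gcongr
  exact sum_vonMangoldt_not_coprime_le hq Y

/-- Grouping the nonprincipal characters modulo `q` by the primitive characters inducing them. -/
lemma sum_ne_one_le_sum_primChars {q : ℕ} [NeZero q] {G : DirichletCharacter ℂ q → ℝ}
    {F : (d : ℕ) → DirichletCharacter ℂ d → ℝ} (hF : ∀ d χ, 0 ≤ F d χ)
    (hG : ∀ d (h : d ∣ q) (ψ : DirichletCharacter ℂ d),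
      G (DirichletCharacter.changeLevel h ψ) ≤ F d ψ) :
    ∑ χ with χ ≠ 1, G χ ≤ ∑ d ∈ Ioc 1 q with d ∣ q, ∑ ψ ∈ primChars d, F d ψ := by
  classical
  set i : DirichletCharacter ℂ q → (Σ d, DirichletCharacter ℂ d) :=
    fun χ => ⟨χ.conductor, χ.primitiveCharacter⟩ with hi
  set g : (Σ d, DirichletCharacter ℂ d) → DirichletCharacter ℂ q :=
    fun p => if h : p.1 ∣ q then DirichletCharacter.changeLevel h p.2 else 1 with hg
  have hgi : ∀ χ, g (i χ) = χ := by
    intro χ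
    simp only [hg, hi]
    rw [dif_pos χ.conductor_dvd_level]
    exact χ.changeLevel_primitiveCharacter
  have hinj : Function.Injective i := Function.LeftInverse.injective hgi
  rw [← sum_sigma {d ∈ Ioc 1 q | d ∣ q} primChars fun p => F p.1 p.2]
  calc _ ≤ ∑ χ : DirichletCharacter ℂ q with χ ≠ 1, F (i χ).1 (i χ).2 := by
        refine sum_le_sum fun χ _ => ?_
        have := hG χ.conductor χ.conductor_dvd_level χ.primitiveCharacter
        rwa [χ.changeLevel_primitiveCharacter] at this
    _ = ∑ p ∈ ({χ : DirichletCharacter ℂ q | χ ≠ 1} : Finset _).image i, F p.1 p.2 :=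
        (sum_image (f := fun p : (Σ d, DirichletCharacter ℂ d) => F p.1 p.2)
          fun x _ y _ h => hinj h).symm
    _ ≤ _ := by
        refine sum_le_sum_of_subset_of_nonneg (fun p hp => ?_) fun p _ _ => hF _ _
        obtain ⟨χ, hχ, rfl⟩ := mem_image.1 hp
        have hχ1 : χ ≠ 1 := (mem_filter.1 hχ).2
        have hc0 : χ.conductor ≠ 0 := χ.conductor_ne_zero
        have hc1 : χ.conductor ≠ 1 := fun h => hχ1 ((χ.eq_one_iff_conductor_eq_one).2 h)
        have : NeZero χ.conductor := ⟨hc0⟩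
        refine mem_sigma.2 ⟨mem_filter.2 ⟨mem_Ioc.2 ⟨?_, ?_⟩, χ.conductor_dvd_level⟩, ?_⟩
        · simp only [hi]; lia
        · exact Nat.le_of_dvd (NeZero.pos q) χ.conductor_dvd_level
        · exact mem_primChars.2 χ.primitiveCharacter_isPrimitive

end BombieriVinogradov

namespace BombieriVinogradov
open Finset Complex

/-- The smoothed sum of the von Mangoldt function over an arithmetic progression. -/
noncomputable def smoothAP (q a Y : ℕ) : ℝ :=
  ∑ n ∈ Ioc 0 Y with n ≡ a [MOD q], ArithmeticFunction.vonMangoldt n * ((Y - n : ℕ) : ℝ)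

lemma totient_mul_smoothAP {q a : ℕ} [NeZero q] (ha : a.Coprime q) (Y : ℕ) :
    (q.totient : ℂ) * (smoothAP q a Y : ℂ) = ∑ χ : DirichletCharacter ℂ q,
      χ (a : ZMod q)⁻¹ * smoothSum ArithmeticFunction.vonMangoldt χ Y := by
  have hu : IsUnit (a : ZMod q) := (ZMod.isUnit_iff_coprime a q).2 ha
  simp only [smoothSum, mul_sum]
  rw [sum_comm, smoothAP, sum_filter]
  push_cast
  rw [mul_sum]
  refine sum_congr rfl fun n _ => ?_
  have h := DirichletCharacter.sum_char_inv_mul_char_eq ℂ hu (n : ZMod q)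
  have h1 : ∑ χ : DirichletCharacter ℂ q, χ (a : ZMod q)⁻¹ *
      ((ArithmeticFunction.vonMangoldt n : ℂ) * (χ n * ((Y - n : ℕ) : ℂ))) =
      (ArithmeticFunction.vonMangoldt n : ℂ) * ((Y - n : ℕ) : ℂ) *
        ∑ χ : DirichletCharacter ℂ q, χ (a : ZMod q)⁻¹ * χ n := by
    rw [mul_sum]; exact sum_congr rfl fun χ _ => by ring
  rw [h1, h]
  have hiff : (a : ZMod q) = n ↔ n ≡ a [MOD q] := by
    rw [ZMod.natCast_eq_natCast_iff]; exact ⟨Nat.ModEq.symm, Nat.ModEq.symm⟩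
  by_cases hc : n ≡ a [MOD q]
  · rw [if_pos hc, if_pos (hiff.2 hc)]; push_cast; ring
  · rw [if_neg hc, if_neg (mt hiff.1 hc)]; simp

/-- The error term in the smoothed prime number theorem. -/
noncomputable def smoothPsiError (Y : ℕ) : ℝ :=
  ‖smoothSum ArithmeticFunction.vonMangoldt (1 : DirichletCharacter ℂ 1) Y - (Y : ℂ) ^ 2 / 2‖

lemma abs_smoothAP_sub_le {q a : ℕ} (hq : 0 < q) (ha : a.Coprime q) (Y : ℕ) :
    |smoothAP q a Y - (Y : ℝ) ^ 2 / 2 / q.totient| ≤ 1 / q.totient * smoothPsiError Y +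
      Y * (4 * Real.log q * Real.log Y ^ 2) + 1 / q.totient * ∑ d ∈ Ioc 1 q with d ∣ q,
        ∑ ψ ∈ primChars d, ‖smoothSum ArithmeticFunction.vonMangoldt ψ Y‖ := by
  have : NeZero q := ⟨hq.ne'⟩
  classical
  have hφ : (0 : ℝ) < q.totient := by exact_mod_cast Nat.totient_pos.2 hq
  set E : ℝ := Y * (4 * Real.log q * Real.log Y ^ 2) with hE
  set R : ℝ := ∑ d ∈ Ioc 1 q with d ∣ q,
        ∑ ψ ∈ primChars d, ‖smoothSum ArithmeticFunction.vonMangoldt ψ Y‖ with hR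
  have hu : IsUnit (a : ZMod q)⁻¹ := by
    have hu : IsUnit (a : ZMod q) := (ZMod.isUnit_iff_coprime a q).2 ha
    exact IsUnit.of_mul_eq_one _ (ZMod.inv_mul_of_unit _ hu)
  have h1 := totient_mul_smoothAP ha Y
  rw [← add_sum_erase _ _ (mem_univ (1 : DirichletCharacter ℂ q)), MulChar.one_apply hu,
    one_mul] at h1
  have hprinc : ‖smoothSum ArithmeticFunction.vonMangoldt (1 : DirichletCharacter ℂ q) Y -
      smoothSum ArithmeticFunction.vonMangoldt (1 : DirichletCharacter ℂ 1) Y‖ ≤ E := by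
    have := norm_smoothSum_changeLevel_sub_le hq (one_dvd q) (1 : DirichletCharacter ℂ 1) Y
    rwa [DirichletCharacter.changeLevel_one] at this
  have hset : (univ.erase (1 : DirichletCharacter ℂ q)) =
      ({χ : DirichletCharacter ℂ q | χ ≠ 1} : Finset _) := by
    ext χ; simp
  have hnon : ∑ χ ∈ univ.erase (1 : DirichletCharacter ℂ q),
      (‖smoothSum ArithmeticFunction.vonMangoldt χ Y‖ - E) ≤ R := by
    rw [hset, hR]
    refine sum_ne_one_le_sum_primChars
      (F := fun d ψ => ‖smoothSum ArithmeticFunction.vonMangoldt ψ Y‖) (fun _ _ => norm_nonneg _)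
      fun d h ψ => ?_
    have h2 := norm_smoothSum_changeLevel_sub_le hq h ψ Y
    have h3 := norm_sub_norm_le (smoothSum ArithmeticFunction.vonMangoldt
      (DirichletCharacter.changeLevel h ψ) Y) (smoothSum ArithmeticFunction.vonMangoldt ψ Y)
    linarith
  have hcard : ((#(univ.erase (1 : DirichletCharacter ℂ q)) : ℕ) : ℝ) = q.totient - 1 := by
    rw [card_erase_of_mem (mem_univ _), card_univ, ← Nat.card_eq_fintype_card,
      DirichletCharacter.card_eq_totient_of_hasEnoughRootsOfUnity ℂ q,
      Nat.cast_sub (Nat.totient_pos.2 hq), Nat.cast_one]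
  rw [sum_sub_distrib, sum_const, nsmul_eq_mul, hcard] at hnon
  have hrest : ‖∑ χ ∈ univ.erase (1 : DirichletCharacter ℂ q),
      χ (a : ZMod q)⁻¹ * smoothSum ArithmeticFunction.vonMangoldt χ Y‖ ≤
      ∑ χ ∈ univ.erase (1 : DirichletCharacter ℂ q),
        ‖smoothSum ArithmeticFunction.vonMangoldt χ Y‖ := by
    refine norm_sum_le_of_le _ fun χ _ => ?_
    rw [norm_mul]
    exact mul_le_of_le_one_left (norm_nonneg _) (χ.norm_le_one _)
  have hmain : q.totient * |smoothAP q a Y - (Y : ℝ) ^ 2 / 2 / q.totient| ≤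
      smoothPsiError Y + q.totient * E + R := by
    have h4 : (q.totient : ℝ) * |smoothAP q a Y - (Y : ℝ) ^ 2 / 2 / q.totient| =
        ‖(q.totient : ℂ) * (smoothAP q a Y : ℂ) - (Y : ℂ) ^ 2 / 2‖ := by
      have e (z : ℝ) : q.totient * |z| = |q.totient * z| := by rw [abs_mul, abs_of_pos hφ]
      rw [e, mul_sub, mul_div_cancel₀ _ hφ.ne', ← Real.norm_eq_abs, ← Complex.norm_real]
      push_cast
      rfl
    rw [h4, h1]
    set W := ∑ χ ∈ univ.erase (1 : DirichletCharacter ℂ q),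
      χ (a : ZMod q)⁻¹ * smoothSum ArithmeticFunction.vonMangoldt χ Y
    set A := smoothSum ArithmeticFunction.vonMangoldt (1 : DirichletCharacter ℂ q) Y
    set A' := smoothSum ArithmeticFunction.vonMangoldt (1 : DirichletCharacter ℂ 1) Y with hA'
    have h5 : ‖A + W - (Y : ℂ) ^ 2 / 2‖ ≤ ‖A' - (Y : ℂ) ^ 2 / 2‖ + ‖A - A'‖ + ‖W‖ := by
      rw [show A + W - (Y : ℂ) ^ 2 / 2 = (A' - (Y : ℂ) ^ 2 / 2) + (A - A') + W by ring]
      exact norm_add₃_le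
    have h6 : smoothPsiError Y = ‖A' - (Y : ℂ) ^ 2 / 2‖ := rfl
    linarith
  rw [mul_comm, ← le_div_iff₀ hφ] at hmain
  refine hmain.trans_eq ?_
  field_simp

lemma sum_sum_dvd_le (Q : ℕ) {F : ℕ → ℝ} (hF : ∀ d, 0 ≤ F d) :
    ∑ q ∈ Ioc 0 Q, (1 : ℝ) / q.totient * ∑ d ∈ Ioc 1 q with d ∣ q, F d ≤
      (∑ k ∈ Ioc 0 Q, (1 : ℝ) / k.totient) * ∑ d ∈ Ioc 1 Q, (1 : ℝ) / d.totient * F d := by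
  have h1 : ∀ q ∈ Ioc 0 Q, (1 : ℝ) / q.totient * ∑ d ∈ Ioc 1 q with d ∣ q, F d =
      ∑ d ∈ Ioc 1 Q, if d ∣ q then (1 : ℝ) / q.totient * F d else 0 := by
    intro q hq
    have hq' := mem_Ioc.1 hq
    rw [← sum_filter, mul_sum]
    refine sum_congr ?_ fun _ _ => rfl
    ext d
    simp only [mem_filter, mem_Ioc]
    refine ⟨fun h => ⟨⟨h.1.1, h.1.2.trans hq'.2⟩, h.2⟩,
      fun h => ⟨⟨h.1.1, Nat.le_of_dvd hq'.1 h.2⟩, h.2⟩⟩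
  rw [sum_congr rfl h1, sum_comm, mul_sum]
  refine sum_le_sum fun d hd => ?_
  rw [← sum_filter, ← sum_mul]
  have h2 := sum_one_div_totient_filter_dvd_le (by have := (mem_Ioc.1 hd).1; lia : 0 < d) Q
  calc _ ≤ (1 : ℝ) / d.totient * (∑ k ∈ Ioc 0 Q, (1 : ℝ) / k.totient) * F d :=
        mul_le_mul_of_nonneg_right h2 (hF d)
    _ = _ := by ring

lemma exists_smoothPsiError_le (K : ℕ) : ∃ C : ℝ, 0 < C ∧ ∀ Z ≥ 3, ∀ Y ≤ Z,
    smoothPsiError Y ≤ C * (Z : ℝ) ^ 2 / Real.log Z ^ K := by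
  obtain ⟨C, hC, h⟩ := exists_norm_sum_mangoldtError_le K
  refine ⟨C + K.factorial, by positivity, fun Z hZ Y hY => ?_⟩
  have hZ3 : (3 : ℝ) ≤ Z := by exact_mod_cast hZ
  have hl : 0 < Real.log Z := by linarith [one_le_log hZ3]
  have hYZ : (Y : ℝ) ≤ Z := by exact_mod_cast hY
  have h1 := norm_sum_mul_sub_le fun M (hM : M ≤ Y) => h Z hZ M (hM.trans hY)
  have h2 : ∑ n ∈ Ioc 0 Y, (1 : ℂ) * ((Y - n : ℕ) : ℂ) = (Y : ℂ) ^ 2 / 2 - (Y : ℂ) / 2 := by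
    rw [sum_mul_sub_eq_sum_range fun _ => 1]
    simp only [sum_const, Nat.card_Ioc, nsmul_eq_mul, mul_one, Nat.sub_zero]
    clear h1 hY hYZ
    induction Y with
    | zero => simp
    | succ Y ih => rw [sum_range_succ, ih]; push_cast; ring
  have h3 : smoothSum ArithmeticFunction.vonMangoldt (1 : DirichletCharacter ℂ 1) Y -
      (Y : ℂ) ^ 2 / 2 = ∑ n ∈ Ioc 0 Y, mangoldtError n * ((Y - n : ℕ) : ℂ) - (Y : ℂ) / 2 := by
    have h4 : smoothSum ArithmeticFunction.vonMangoldt (1 : DirichletCharacter ℂ 1) Y =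
        ∑ n ∈ Ioc 0 Y, mangoldtError n * ((Y - n : ℕ) : ℂ) +
          ∑ n ∈ Ioc 0 Y, (1 : ℂ) * ((Y - n : ℕ) : ℂ) := by
      rw [smoothSum, ← sum_add_distrib]
      refine sum_congr rfl fun n _ => ?_
      rw [MulChar.one_apply (isUnit_of_subsingleton _), mangoldtError]
      ring
    rw [h4, h2]; ring
  have h5 := log_pow_le_factorial_mul (by linarith : (1 : ℝ) ≤ Z) K
  have h6 : ‖(Y : ℂ) / 2‖ = Y / 2 := by rw [norm_div, Complex.norm_natCast]; norm_num
  have h7 : (Y : ℝ) / 2 ≤ K.factorial * (Z : ℝ) ^ 2 / Real.log Z ^ K := by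
    rw [le_div_iff₀ (by positivity)]
    calc (Y : ℝ) / 2 * Real.log Z ^ K ≤ Z * (K.factorial * Z) := by gcongr; linarith
      _ = _ := by ring
  have h8 : (Y : ℝ) * (C * Z / Real.log Z ^ K) ≤ C * (Z : ℝ) ^ 2 / Real.log Z ^ K := by
    calc _ ≤ (Z : ℝ) * (C * Z / Real.log Z ^ K) := by gcongr
      _ = _ := by ring
  rw [smoothPsiError, h3]
  refine (norm_sub_le _ _).trans ?_
  rw [h6]
  calc _ ≤ C * (Z : ℝ) ^ 2 / Real.log Z ^ K + K.factorial * (Z : ℝ) ^ 2 / Real.log Z ^ K := by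
        linarith
    _ = _ := by ring

/-- The Bombieri–Vinogradov theorem for smoothed sums at a fixed point. -/
lemma exists_sum_abs_smoothAP_sub_le (K : ℕ) : ∃ C : ℝ, 0 < C ∧ ∃ B Z₀ : ℕ, ∀ Z ≥ Z₀, ∀ Y ≤ Z,
    ∀ Q : ℕ, Q * Real.log Z ^ B ≤ √Z → ∀ a : ℕ → ℕ, (∀ q, (a q).Coprime q) →
    ∑ q ∈ Ioc 0 Q, |smoothAP q (a q) Y - (Y : ℝ) ^ 2 / 2 / q.totient| ≤
      C * (Z : ℝ) ^ 2 / Real.log Z ^ K := by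
  obtain ⟨C₁, hC₁, h₁⟩ := exists_smoothPsiError_le (K + 2)
  obtain ⟨C₂, hC₂, B, Z₀, h₂⟩ := exists_sum_primChars_smoothSum_le (K + 2)
  set C₃ : ℝ := 4 * (2 ^ (K + 3) * (K + 3).factorial) with hC₃
  refine ⟨6 * C₁ + C₃ + 6 * C₂, by positivity, B, max Z₀ 3, fun Z hZ Y hY Q hQ a ha => ?_⟩
  have hZ₀ : Z₀ ≤ Z := (le_max_left _ _).trans hZ
  have hZn3 : 3 ≤ Z := (le_max_right _ _).trans hZ
  have hZ3 : (3 : ℝ) ≤ Z := by exact_mod_cast hZn3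
  have hP := h₁ Z hZn3 Y hY
  have hF := h₂ Z hZ₀ Y hY Q hQ
  set ℓ := Real.log Z with hℓ
  have hℓ1 : 1 ≤ ℓ := one_le_log hZ3
  have hℓ0 : 0 < ℓ := by linarith
  have hYZ : (Y : ℝ) ≤ Z := by exact_mod_cast hY
  have hQs : (Q : ℝ) ≤ √Z :=
    (le_mul_of_one_le_right (Nat.cast_nonneg Q) (one_le_pow₀ hℓ1)).trans hQ
  have hss : √(Z : ℝ) * √Z = Z := Real.mul_self_sqrt (by linarith)
  have hQZ : Q ≤ Z := by
    have h1 : 1 ≤ √(Z : ℝ) := Real.one_le_sqrt.2 (by linarith)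
    exact_mod_cast (by nlinarith : (Q : ℝ) ≤ Z)
  have hlQ : Real.log Q ≤ ℓ := monotone_log_natCast hQZ
  have hlQ0 := Real.log_natCast_nonneg Q
  have hlY : Real.log Y ≤ ℓ := monotone_log_natCast hY
  have hlY0 := Real.log_natCast_nonneg Y
  have hφ : ∑ k ∈ Ioc 0 Q, (1 : ℝ) / k.totient ≤ 6 * ℓ ^ 2 := by
    refine (sum_one_div_totient_le Q).trans ?_
    calc _ ≤ (2 * ℓ + 1) * (1 + ℓ) := by gcongr
      _ ≤ _ := by nlinarith
  have hφ0 : 0 ≤ ∑ k ∈ Ioc 0 Q, (1 : ℝ) / k.totient := sum_nonneg fun _ _ => by positivity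
  have hterm : ∑ q ∈ Ioc 0 Q, |smoothAP q (a q) Y - (Y : ℝ) ^ 2 / 2 / q.totient| ≤
      ∑ q ∈ Ioc 0 Q, ((1 : ℝ) / q.totient * smoothPsiError Y +
        Y * (4 * Real.log q * Real.log Y ^ 2) + (1 : ℝ) / q.totient * ∑ d ∈ Ioc 1 q with d ∣ q,
          ∑ ψ ∈ primChars d, ‖smoothSum ArithmeticFunction.vonMangoldt ψ Y‖) :=
    sum_le_sum fun q hq => abs_smoothAP_sub_le (mem_Ioc.1 hq).1 (ha q) Y
  rw [sum_add_distrib, sum_add_distrib, ← sum_mul] at hterm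
  have hP0 : 0 ≤ smoothPsiError Y := norm_nonneg _
  have e1 : (∑ k ∈ Ioc 0 Q, (1 : ℝ) / k.totient) * smoothPsiError Y ≤
      6 * C₁ * (Z : ℝ) ^ 2 / ℓ ^ K := by
    calc _ ≤ 6 * ℓ ^ 2 * (C₁ * (Z : ℝ) ^ 2 / ℓ ^ (K + 2)) := by gcongr
      _ = _ := by rw [pow_add]; field_simp
  have e2 : ∑ q ∈ Ioc 0 Q, (Y : ℝ) * (4 * Real.log q * Real.log Y ^ 2) ≤
      C₃ * (Z : ℝ) ^ 2 / ℓ ^ K := by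
    have h3 : ∀ q ∈ Ioc 0 Q, (Y : ℝ) * (4 * Real.log q * Real.log Y ^ 2) ≤ Z * (4 * ℓ * ℓ ^ 2) := by
      intro q hq
      have h4 : Real.log q ≤ ℓ := (monotone_log_natCast (mem_Ioc.1 hq).2).trans hlQ
      have h5 := Real.log_natCast_nonneg q
      gcongr
    refine (sum_le_sum h3).trans ?_
    rw [sum_const, nsmul_eq_mul, Nat.card_Ioc, Nat.sub_zero, le_div_iff₀ (by positivity)]
    calc _ ≤ √Z * (Z * (4 * ℓ * ℓ ^ 2)) * ℓ ^ K := by gcongr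
      _ = 4 * √Z * Z * ℓ ^ (K + 3) := by ring
      _ ≤ 4 * √Z * Z * (2 ^ (K + 3) * (K + 3).factorial * √Z) := by
          gcongr; exact log_pow_le_mul_sqrt (by linarith) (K + 3)
      _ = C₃ * Z * (√Z * √Z) := by ring
      _ = _ := by rw [hss]; ring
  have e3 := sum_sum_dvd_le Q
    (F := fun d => ∑ ψ ∈ primChars d, ‖smoothSum ArithmeticFunction.vonMangoldt ψ Y‖)
    fun d => sum_nonneg fun _ _ => norm_nonneg _
  have e4 : (∑ k ∈ Ioc 0 Q, (1 : ℝ) / k.totient) * ∑ d ∈ Ioc 1 Q, (1 : ℝ) / d.totient *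
      ∑ ψ ∈ primChars d, ‖smoothSum ArithmeticFunction.vonMangoldt ψ Y‖ ≤
      6 * C₂ * (Z : ℝ) ^ 2 / ℓ ^ K := by
    calc _ ≤ 6 * ℓ ^ 2 * (C₂ * (Z : ℝ) ^ 2 / ℓ ^ (K + 2)) := by
          refine mul_le_mul hφ hF (sum_nonneg fun _ _ => by positivity) (by positivity)
      _ = _ := by rw [pow_add]; field_simp
  calc _ ≤ _ := hterm
    _ ≤ 6 * C₁ * (Z : ℝ) ^ 2 / ℓ ^ K + C₃ * (Z : ℝ) ^ 2 / ℓ ^ K + 6 * C₂ * (Z : ℝ) ^ 2 / ℓ ^ K :=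
        add_le_add (add_le_add e1 e2) (e3.trans e4)
    _ = _ := by ring

end BombieriVinogradov

namespace BombieriVinogradov
open Finset

/-- The Chebyshev function of an arithmetic progression. -/
noncomputable def psiAP (q a M : ℕ) : ℝ :=
  ∑ n ∈ Ioc 0 M with n ≡ a [MOD q], ArithmeticFunction.vonMangoldt n

lemma psiAP_nonneg (q a M : ℕ) : 0 ≤ psiAP q a M :=
  sum_nonneg fun _ _ => ArithmeticFunction.vonMangoldt_nonneg

lemma monotone_psiAP (q a : ℕ) : Monotone (psiAP q a) := fun _ _ h =>
  sum_le_sum_of_subset_of_nonneg (filter_subset_filter _ (Ioc_subset_Ioc_right h))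
    fun _ _ _ => ArithmeticFunction.vonMangoldt_nonneg

lemma smoothAP_succ (q a Y : ℕ) : smoothAP q a (Y + 1) = smoothAP q a Y + psiAP q a Y := by
  have h : Ioc 0 (Y + 1) = insert (Y + 1) (Ioc 0 Y) := by ext; simp; lia
  rw [smoothAP, smoothAP, psiAP, sum_filter, sum_filter, sum_filter, h,
    sum_insert (by simp), Nat.sub_self, Nat.cast_zero, mul_zero, ite_self, zero_add,
    ← sum_add_distrib]
  refine sum_congr rfl fun n hn => ?_
  rw [Nat.succ_sub (mem_Ioc.1 hn).2]
  split_ifs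
  · push_cast; ring
  · simp

lemma mul_psiAP_le (q a Y h : ℕ) : h * psiAP q a Y ≤ smoothAP q a (Y + h) - smoothAP q a Y := by
  induction h with
  | zero => simp
  | succ h ih =>
    rw [← add_assoc, smoothAP_succ]
    have := monotone_psiAP q a (Nat.le_add_right Y h)
    push_cast
    linarith

lemma le_mul_psiAP (q a Y h : ℕ) :
    smoothAP q a (Y + h) - smoothAP q a Y ≤ h * psiAP q a (Y + h) := by
  induction h with
  | zero => simp
  | succ h ih =>
    rw [← add_assoc, smoothAP_succ]
    have h1 := monotone_psiAP q a (Nat.le_succ (Y + h))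
    have h2 : (h : ℝ) * psiAP q a (Y + h) ≤ h * psiAP q a (Y + h + 1) := by gcongr
    push_cast
    linarith

lemma abs_psiAP_sub_le {q a M h : ℕ} (hq : 0 < q) (hh : 0 < h) {E : ℝ}
    (hE : ∀ i ≤ M / h + 2, |smoothAP q a (i * h) - ((i * h : ℕ) : ℝ) ^ 2 / 2 / q.totient| ≤ E) :
    |psiAP q a M - M / q.totient| ≤ 3 / 2 * h * (1 / q.totient) + 2 * E / h := by
  have hφ : (0 : ℝ) < q.totient := by exact_mod_cast Nat.totient_pos.2 hq
  have hh' : (0 : ℝ) < h := by exact_mod_cast hh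
  obtain ⟨j, hj⟩ : ∃ j, j = M / h := ⟨_, rfl⟩
  rw [← hj] at hE
  have hlo : j * h ≤ M := by rw [hj]; exact Nat.div_mul_le_self M h
  have hhi : M ≤ (j + 1) * h := by
    rw [hj, mul_comm]; exact (Nat.lt_mul_div_succ M hh).le
  have hlo' : (j : ℝ) * h ≤ M := by exact_mod_cast hlo
  have hhi' : (M : ℝ) ≤ (j + 1) * h := by exact_mod_cast hhi
  have hE0 : 0 ≤ E := (abs_nonneg _).trans (hE 0 (Nat.zero_le _))
  rw [abs_le]
  constructor
  · have h1 : ((M : ℝ) - 3 / 2 * h) / q.totient * h - 2 * E ≤ h * psiAP q a M := by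
      rcases Nat.eq_zero_or_pos j with h0 | h0
      · have h2 : ((M : ℝ) - 3 / 2 * h) / q.totient * h ≤ 0 := by
          refine mul_nonpos_of_nonpos_of_nonneg (div_nonpos_of_nonpos_of_nonneg ?_ hφ.le) hh'.le
          rw [h0] at hhi'
          push_cast at hhi'
          linarith
        have := mul_nonneg hh'.le (psiAP_nonneg q a M)
        linarith
      · obtain ⟨k, rfl⟩ : ∃ k, j = k + 1 := ⟨j - 1, by lia⟩
        have h2 := le_mul_psiAP q a (k * h) h
        rw [← Nat.succ_mul, Nat.succ_eq_add_one] at h2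
        have h3 : (h : ℝ) * psiAP q a ((k + 1) * h) ≤ h * psiAP q a M := by
          gcongr; exact monotone_psiAP q a hlo
        have h4 := (abs_le.1 (hE k (by lia))).2
        have h5 := (abs_le.1 (hE (k + 1) (by lia))).1
        have h6 : ((M : ℝ) - 3 / 2 * h) / q.totient * h ≤
            (((k + 1) * h : ℕ) : ℝ) ^ 2 / 2 / q.totient -
              ((k * h : ℕ) : ℝ) ^ 2 / 2 / q.totient := by
          rw [← sub_div, div_mul_eq_mul_div]
          gcongr
          push_cast at hhi' ⊢
          nlinarith
        linarith
    have h2 : psiAP q a M - M / q.totient + (3 / 2 * h * (1 / q.totient) + 2 * E / h) =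
        (h * psiAP q a M - (((M : ℝ) - 3 / 2 * h) / q.totient * h - 2 * E)) / h := by
      field_simp; ring
    have h3 : 0 ≤ (h * psiAP q a M - (((M : ℝ) - 3 / 2 * h) / q.totient * h - 2 * E)) / h :=
      div_nonneg (sub_nonneg.2 h1) hh'.le
    linarith
  · have h1 : h * psiAP q a M ≤ ((M : ℝ) + 3 / 2 * h) / q.totient * h + 2 * E := by
      have h2 := mul_psiAP_le q a ((j + 1) * h) h
      rw [← Nat.succ_mul, Nat.succ_eq_add_one] at h2
      have h3 : (h : ℝ) * psiAP q a M ≤ h * psiAP q a ((j + 1) * h) := by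
        gcongr; exact monotone_psiAP q a hhi
      have h4 := (abs_le.1 (hE (j + 1) (by lia))).1
      have h5 := (abs_le.1 (hE (j + 1 + 1) (by lia))).2
      have h6 : (((j + 1 + 1) * h : ℕ) : ℝ) ^ 2 / 2 / q.totient -
            (((j + 1) * h : ℕ) : ℝ) ^ 2 / 2 / q.totient ≤
          ((M : ℝ) + 3 / 2 * h) / q.totient * h := by
        rw [← sub_div, div_mul_eq_mul_div]
        gcongr
        push_cast
        nlinarith
      linarith
    have h2 : (3 / 2 * h * (1 / q.totient) + 2 * E / h) - (psiAP q a M - M / q.totient) =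
        ((((M : ℝ) + 3 / 2 * h) / q.totient * h + 2 * E) - h * psiAP q a M) / h := by
      field_simp; ring
    have h3 : 0 ≤ ((((M : ℝ) + 3 / 2 * h) / q.totient * h + 2 * E) - h * psiAP q a M) / h :=
      div_nonneg (sub_nonneg.2 h1) hh'.le
    linarith

lemma sum_one_div_totient_le_log_sq {Q Z : ℕ} (hQ : Q ≤ Z) (hZ : 3 ≤ Z) :
    ∑ k ∈ Ioc 0 Q, (1 : ℝ) / k.totient ≤ 6 * Real.log Z ^ 2 := by
  have hℓ := one_le_log (show (3 : ℝ) ≤ Z by exact_mod_cast hZ)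
  have hlQ : Real.log Q ≤ Real.log Z := monotone_log_natCast hQ
  have hlQ0 := Real.log_natCast_nonneg Q
  refine (sum_one_div_totient_le Q).trans ?_
  calc _ ≤ (2 * Real.log Z + 1) * (1 + Real.log Z) := by gcongr
    _ ≤ _ := by nlinarith

lemma two_le_log {Z : ℝ} (hZ : 9 ≤ Z) : 2 ≤ Real.log Z := by
  rw [Real.le_log_iff_exp_le (by linarith)]
  have h1 := Real.exp_one_lt_d9
  have h2 : Real.exp 2 = Real.exp 1 * Real.exp 1 := by rw [← Real.exp_add]; norm_num
  have h3 := Real.exp_pos 1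
  rw [h2]
  nlinarith

/-- The Bombieri–Vinogradov theorem for the Chebyshev function. -/
lemma exists_sum_abs_psiAP_sub_le (K : ℕ) : ∃ C : ℝ, 0 < C ∧ ∃ B Z₀ : ℕ, ∀ Z ≥ Z₀,
    ∀ Q : ℕ, Q * Real.log Z ^ B ≤ √Z → ∀ a M : ℕ → ℕ, (∀ q, (a q).Coprime q) →
    (∀ q, 3 * M q ≤ Z) →
    ∑ q ∈ Ioc 0 Q, |psiAP q (a q) (M q) - (M q : ℝ) / q.totient| ≤
      C * Z / Real.log Z ^ K := by
  obtain ⟨C, hC, B, Z₁, h₁⟩ := exists_sum_abs_smoothAP_sub_le (3 * K + 4)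
  set c : ℕ := 2 ^ (K + 2) * (K + 2).factorial with hc
  refine ⟨9 + 16 * C, by positivity, B, max Z₁ (max 9 (c ^ 2)), fun Z hZ Q hQ a M ha hM => ?_⟩
  have hZ₁ : Z₁ ≤ Z := (le_max_left _ _).trans hZ
  have hZ9 : 9 ≤ Z := (le_max_left _ _).trans ((le_max_right _ _).trans hZ)
  have hZc : c ^ 2 ≤ Z := (le_max_right _ _).trans ((le_max_right _ _).trans hZ)
  have hZ9' : (9 : ℝ) ≤ Z := by exact_mod_cast hZ9
  have hℓ2 := two_le_log hZ9'
  have hL := log_pow_le_mul_sqrt (by linarith : (1 : ℝ) ≤ Z) (K + 2)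
  have hS := fun Y hY => h₁ Z hZ₁ Y hY Q hQ a ha
  have hQs : (Q : ℝ) ≤ √Z :=
    (le_mul_of_one_le_right (Nat.cast_nonneg Q) (one_le_pow₀ (by linarith))).trans hQ
  have hss : √(Z : ℝ) * √Z = Z := Real.mul_self_sqrt (by linarith)
  have hs1 : 1 ≤ √(Z : ℝ) := Real.one_le_sqrt.2 (by linarith)
  have hQZ : Q ≤ Z := by exact_mod_cast (by nlinarith : (Q : ℝ) ≤ Z)
  have hφ := sum_one_div_totient_le_log_sq hQZ (by lia)
  have hcs : (c : ℝ) ≤ √Z := Real.le_sqrt_of_sq_le (by exact_mod_cast hZc)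
  have hLZ : Real.log Z ^ (K + 2) ≤ Z := by
    refine hL.trans ?_
    calc (2 : ℝ) ^ (K + 2) * (K + 2).factorial * √Z = c * √Z := by rw [hc]; push_cast; ring
      _ ≤ √Z * √Z := by gcongr
      _ = Z := hss
  set ℓ := Real.log Z with hℓ
  have hℓ0 : 0 < ℓ := by linarith
  have hZ0 : (0 : ℝ) < Z := by linarith
  have hD : 0 < ℓ ^ (K + 2) := by positivity
  have hD4 : 4 ≤ ℓ ^ (K + 2) := by
    calc (4 : ℝ) = 2 ^ 2 := by norm_num
      _ ≤ ℓ ^ 2 := by gcongr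
      _ ≤ ℓ ^ (K + 2) := pow_le_pow_right₀ (by linarith) (by lia)
  obtain ⟨h, hh⟩ : ∃ h : ℕ, h = ⌊(Z : ℝ) / ℓ ^ (K + 2)⌋₊ := ⟨_, rfl⟩
  have hh1 : (h : ℝ) ≤ Z / ℓ ^ (K + 2) := by
    rw [hh]; exact Nat.floor_le (by positivity)
  have hh2 : (Z : ℝ) / ℓ ^ (K + 2) < h + 1 := by
    rw [hh]; exact Nat.lt_floor_add_one _
  have hhp : 0 < h := by
    rw [hh]; exact Nat.floor_pos.2 ((one_le_div hD).2 hLZ)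
  have hh' : (1 : ℝ) ≤ h := by exact_mod_cast hhp
  have hhZ : (Z : ℝ) ≤ 2 * h * ℓ ^ (K + 2) := by
    rw [div_lt_iff₀ hD] at hh2
    nlinarith
  have h3h : 3 * h ≤ Z := by
    have : (h : ℝ) ≤ Z / 4 := hh1.trans (by gcongr)
    exact_mod_cast (by linarith : 3 * (h : ℝ) ≤ Z)
  obtain ⟨J, hJ⟩ : ∃ J : ℕ, J = Z / h := ⟨_, rfl⟩
  have hJh : J * h ≤ Z := by rw [hJ]; exact Nat.div_mul_le_self Z h
  have hJ1 : ((J + 1 : ℕ) : ℝ) ≤ 2 * Z / h := by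
    rw [le_div_iff₀ (by linarith)]
    have : (J + 1) * h ≤ 2 * Z := by rw [add_mul]; lia
    exact_mod_cast this
  have hq : ∀ q ∈ Ioc 0 Q, |psiAP q (a q) (M q) - (M q : ℝ) / q.totient| ≤
      3 / 2 * h * (1 / q.totient) + 2 * (∑ i ∈ range (J + 1),
        |smoothAP q (a q) (i * h) - ((i * h : ℕ) : ℝ) ^ 2 / 2 / q.totient|) / h := by
    intro q hq
    refine abs_psiAP_sub_le (mem_Ioc.1 hq).1 hhp fun i hi => ?_
    refine single_le_sum (f := fun i => |smoothAP q (a q) (i * h) -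
      ((i * h : ℕ) : ℝ) ^ 2 / 2 / q.totient|) (fun _ _ => abs_nonneg _) (mem_range_succ_iff.2 ?_)
    rw [hJ, Nat.le_div_iff_mul_le hhp]
    have h1 := Nat.div_mul_le_self (M q) h
    have h2 : i * h ≤ (M q / h + 2) * h := Nat.mul_le_mul_right _ hi
    have h3 := hM q
    rw [add_mul] at h2
    lia
  have hsum : ∑ q ∈ Ioc 0 Q, ∑ i ∈ range (J + 1),
      |smoothAP q (a q) (i * h) - ((i * h : ℕ) : ℝ) ^ 2 / 2 / q.totient| ≤
      2 * Z / h * (C * (Z : ℝ) ^ 2 / ℓ ^ (3 * K + 4)) := by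
    rw [sum_comm]
    calc _ ≤ ∑ i ∈ range (J + 1), C * (Z : ℝ) ^ 2 / ℓ ^ (3 * K + 4) := by
          refine sum_le_sum fun i hi => hS (i * h) (le_trans ?_ hJh)
          exact Nat.mul_le_mul_right _ (mem_range_succ_iff.1 hi)
      _ = ((J + 1 : ℕ) : ℝ) * (C * (Z : ℝ) ^ 2 / ℓ ^ (3 * K + 4)) := by
          rw [sum_const, card_range, nsmul_eq_mul]
      _ ≤ _ := by gcongr
  refine (sum_le_sum hq).trans ?_
  rw [sum_add_distrib, ← mul_sum, ← sum_div, ← mul_sum]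
  have e1 : 3 / 2 * (h : ℝ) * ∑ k ∈ Ioc 0 Q, (1 : ℝ) / k.totient ≤ 9 * Z / ℓ ^ K := by
    calc _ ≤ 3 / 2 * (Z / ℓ ^ (K + 2)) * (6 * ℓ ^ 2) := by gcongr
      _ = _ := by rw [pow_add]; field_simp; norm_num
  have e2 : 2 * (2 * Z / h * (C * (Z : ℝ) ^ 2 / ℓ ^ (3 * K + 4))) / h ≤ 16 * C * Z / ℓ ^ K := by
    have h1 : (Z : ℝ) ^ 2 ≤ 4 * h ^ 2 * ℓ ^ (2 * K + 4) := by
      calc (Z : ℝ) ^ 2 ≤ (2 * h * ℓ ^ (K + 2)) ^ 2 := by gcongr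
        _ = _ := by ring
    rw [div_le_div_iff₀ (by positivity) (by positivity)]
    calc _ = 4 * C * Z / h * (Z : ℝ) ^ 2 * ℓ ^ K / ℓ ^ (3 * K + 4) := by field_simp; norm_num
      _ ≤ 4 * C * Z / h * (4 * h ^ 2 * ℓ ^ (2 * K + 4)) * ℓ ^ K / ℓ ^ (3 * K + 4) := by gcongr
      _ = 16 * C * Z * h * (ℓ ^ (3 * K + 4) / ℓ ^ (3 * K + 4)) := by
          field_simp; ring
      _ = _ := by rw [div_self (by positivity), mul_one]
  calc _ ≤ 9 * Z / ℓ ^ K + 16 * C * Z / ℓ ^ K := by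
        refine add_le_add e1 (le_trans ?_ e2)
        gcongr
    _ = _ := by ring

end BombieriVinogradov

namespace BombieriVinogradov
open Finset

/-- The weight `1 / log t`, frozen to the left of `2`. -/
noncomputable def invLog (t : ℝ) : ℝ := 1 / Real.log (max t 2)

lemma log_max_two_pos (t : ℝ) : 0 < Real.log (max t 2) :=
  Real.log_pos (lt_of_lt_of_le (by norm_num) (le_max_right t 2))

lemma antitone_invLog : Antitone invLog := fun s t h =>
  one_div_le_one_div_of_le (log_max_two_pos s)
    (Real.log_le_log (by positivity) (max_le_max_right 2 h))

lemma invLog_nonneg (t : ℝ) : 0 ≤ invLog t := (one_div_pos.2 (log_max_two_pos t)).le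

lemma invLog_le (t : ℝ) : invLog t ≤ 3 / 2 := by
  have h1 : Real.log 2 ≤ Real.log (max t 2) := Real.log_le_log (by norm_num) (le_max_right t 2)
  have h2 := Real.log_two_gt_d9
  rw [invLog, div_le_iff₀ (log_max_two_pos t)]
  linarith

lemma li_eq_integral_invLog {y : ℝ} (hy : 2 ≤ y) : li y = ∫ t in (2 : ℝ)..y, invLog t := by
  refine intervalIntegral.integral_congr fun t ht => ?_
  rw [Set.uIcc_of_le hy] at ht
  simp only [invLog, max_eq_left ht.1]

lemma integral_invLog_nonneg {u v : ℝ} (h : u ≤ v) : 0 ≤ ∫ t in u..v, invLog t :=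
  intervalIntegral.integral_nonneg h fun t _ => invLog_nonneg t

lemma integral_invLog_le {u v : ℝ} (h : u ≤ v) : ∫ t in u..v, invLog t ≤ 3 / 2 * (v - u) := by
  have h1 := intervalIntegral.integral_mono_on h (antitone_invLog.intervalIntegrable (μ := MeasureTheory.volume))
    (intervalIntegrable_const (c := (3 / 2 : ℝ))) fun t _ => invLog_le t
  rw [intervalIntegral.integral_const, smul_eq_mul] at h1
  linarith

lemma abs_sum_invLog_sub_li_le {y : ℝ} (hy : 2 ≤ y) :
    |∑ n ∈ Ioc 0 ⌊y⌋₊, invLog n - li y| ≤ 3 := by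
  obtain ⟨M, hM⟩ : ∃ M : ℕ, M = ⌊y⌋₊ := ⟨_, rfl⟩
  have hM2 : 2 ≤ M := by rw [hM]; exact Nat.le_floor (by exact_mod_cast hy)
  have hMy : (M : ℝ) ≤ y := by rw [hM]; exact Nat.floor_le (by linarith)
  have hyM : y ≤ M + 1 := by rw [hM]; exact (Nat.lt_floor_add_one y).le
  rw [← hM, li_eq_integral_invLog hy, ← intervalIntegral.integral_add_adjacent_intervals
    (b := (M : ℝ)) antitone_invLog.intervalIntegrable antitone_invLog.intervalIntegrable]
  have h1 := integral_invLog_nonneg hMy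
  have h2 := integral_invLog_le hMy
  have h3 := AntitoneOn.integral_le_sum_Ico hM2 (antitone_invLog.antitoneOn _)
  have h4 := AntitoneOn.sum_le_integral_Ico hM2 (antitone_invLog.antitoneOn _)
  have h5 : ∑ n ∈ Ico 2 M, invLog n ≤ ∑ n ∈ Ioc 0 M, invLog n :=
    sum_le_sum_of_subset_of_nonneg (fun n hn => by simp at hn ⊢; lia)
      fun _ _ _ => invLog_nonneg _
  have h6 : ∑ n ∈ Ioc 0 M, invLog n =
      invLog 1 + invLog 2 + ∑ n ∈ Ico 2 M, invLog ((n + 1 : ℕ) : ℝ) := by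
    rw [sum_Ico_add' (fun n : ℕ => invLog n) 2 M 1,
      show Ioc 0 M = insert 1 (insert 2 (Ico (2 + 1) (M + 1))) by ext; simp; lia,
      sum_insert (by simp), sum_insert (by simp), ← add_assoc]
    simp
  have h7 := invLog_le 1
  have h8 := invLog_le 2
  push_cast at h3 h4
  rw [abs_le]
  constructor
  · linarith
  · push_cast at h6
    linarith

lemma primePiMod_eq {y : ℝ} (hy : 0 ≤ y) (q a : ℕ) :
    primePiMod y q a = #{n ∈ Ioc 0 ⌊y⌋₊ | n.Prime ∧ n ≡ a [MOD q]} := by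
  rw [primePiMod, ← Set.ncard_coe_finset]
  congr 1
  ext p
  simp only [Set.mem_ofPred_eq, coe_filter, mem_Ioc, Nat.le_floor_iff hy]
  exact ⟨fun h => ⟨⟨h.1.pos, h.2.1⟩, h.1, h.2.2⟩, fun h => ⟨h.2.1, h.1.2, h.2.2⟩⟩

lemma abs_sum_vonMangoldt_invLog_sub_le {y : ℝ} (hy : 2 ≤ y) (q a : ℕ) :
    |∑ n ∈ Ioc 0 ⌊y⌋₊ with n ≡ a [MOD q], ArithmeticFunction.vonMangoldt n * invLog n -
      primePiMod y q a| ≤ 3 * √y * Real.log y := by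
  have h1 : (primePiMod y q a : ℝ) = ∑ n ∈ Ioc 0 ⌊y⌋₊ with n ≡ a [MOD q],
      if n.Prime then 1 else 0 := by
    rw [primePiMod_eq (by linarith), ← sum_filter, filter_filter, sum_const, nsmul_one]
    simp only [and_comm]
  have h2 : Chebyshev.psi y - Chebyshev.theta y = ∑ n ∈ Ioc 0 ⌊y⌋₊,
      (ArithmeticFunction.vonMangoldt n - if n.Prime then Real.log n else 0) := by
    rw [Chebyshev.psi, Chebyshev.theta, sum_filter, sum_sub_distrib]
  have h3 : ∀ n : ℕ, 0 ≤ ArithmeticFunction.vonMangoldt n - if n.Prime then Real.log n else 0 := by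
    intro n
    split_ifs with hp
    · rw [ArithmeticFunction.vonMangoldt_apply_prime hp, sub_self]
    · simp [ArithmeticFunction.vonMangoldt_nonneg]
  have h4 : ∀ n : ℕ, |ArithmeticFunction.vonMangoldt n * invLog n - if n.Prime then 1 else 0| ≤
      3 / 2 * (ArithmeticFunction.vonMangoldt n - if n.Prime then Real.log n else 0) := by
    intro n
    split_ifs with hp
    · have h2 : (2 : ℝ) ≤ n := by exact_mod_cast hp.two_le
      have h5 : Real.log n ≠ 0 := (Real.log_pos (by linarith)).ne'
      rw [ArithmeticFunction.vonMangoldt_apply_prime hp, invLog, max_eq_left h2,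
        mul_one_div_cancel h5]
      simp
    · have h5 : (0 : ℝ) ≤ ArithmeticFunction.vonMangoldt n :=
        ArithmeticFunction.vonMangoldt_nonneg
      rw [sub_zero, sub_zero, abs_of_nonneg (mul_nonneg h5 (invLog_nonneg _)), mul_comm]
      exact mul_le_mul_of_nonneg_right (invLog_le _) h5
  have h5 := Chebyshev.psi_sub_theta_le (by linarith : 1 ≤ y)
  rw [h1, ← sum_sub_distrib]
  calc _ ≤ ∑ n ∈ Ioc 0 ⌊y⌋₊ with n ≡ a [MOD q],
        3 / 2 * (ArithmeticFunction.vonMangoldt n - if n.Prime then Real.log n else 0) :=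
      (abs_sum_le_sum_abs _ _).trans (sum_le_sum fun n _ => h4 n)
    _ ≤ ∑ n ∈ Ioc 0 ⌊y⌋₊,
        3 / 2 * (ArithmeticFunction.vonMangoldt n - if n.Prime then Real.log n else 0) :=
      sum_le_sum_of_subset_of_nonneg (filter_subset _ _)
        fun n _ _ => mul_nonneg (by norm_num) (h3 n)
    _ = 3 / 2 * (Chebyshev.psi y - Chebyshev.theta y) := by rw [h2, mul_sum]
    _ ≤ _ := by linarith

lemma abs_sum_sub_mul_invLog_le (q a M : ℕ) {E : ℝ}
    (hE : ∀ k ≤ M, |psiAP q a k - k / q.totient| ≤ E) :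
    |∑ n ∈ Ioc 0 M with n ≡ a [MOD q], ArithmeticFunction.vonMangoldt n * invLog n -
      (∑ n ∈ Ioc 0 M, invLog n) / q.totient| ≤ 3 / 2 * E := by
  set f : ℕ → ℝ := fun n => (if n ≡ a [MOD q] then ArithmeticFunction.vonMangoldt n else 0) -
    1 / q.totient with hf
  have hshift (g : ℕ → ℝ) (k : ℕ) : ∑ n ∈ Ioc 0 k, g n = ∑ n ∈ range k, g (n + 1) := by
    rw [range_eq_Ico, sum_Ico_add' g 0 k 1]
    refine sum_congr ?_ fun _ _ => rfl
    ext; simp; lia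
  have h1 : ∀ k ≤ M, ‖∑ n ∈ range k, ((f (n + 1) : ℝ) : ℂ)‖ ≤ E := by
    intro k hk
    rw [← Complex.ofReal_sum, Complex.norm_real, Real.norm_eq_abs, ← hshift f k]
    refine (le_of_eq ?_).trans (hE k hk)
    rw [hf, sum_sub_distrib, psiAP, sum_filter, sum_const, nsmul_eq_mul, Nat.card_Ioc]
    simp [div_eq_mul_inv]
  have h2 := norm_sum_mul_antitone_le (fun n => ((f (n + 1) : ℝ) : ℂ))
    (fun n => invLog ((n + 1 : ℕ) : ℝ))
    (fun m n h => antitone_invLog (by exact_mod_cast Nat.succ_le_succ h))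
    (fun n => invLog_nonneg _) M h1
  have h3 : ∑ n ∈ Ioc 0 M with n ≡ a [MOD q], ArithmeticFunction.vonMangoldt n * invLog n -
      (∑ n ∈ Ioc 0 M, invLog n) / q.totient = ∑ n ∈ Ioc 0 M, f n * invLog n := by
    rw [sum_filter, sum_div, ← sum_sub_distrib]
    refine sum_congr rfl fun n _ => ?_
    simp only [hf]
    split_ifs <;> ring
  have hE0 : 0 ≤ E := (abs_nonneg _).trans (hE 0 (Nat.zero_le _))
  rw [h3, hshift, ← Real.norm_eq_abs, ← Complex.norm_real]
  push_cast at h2 ⊢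
  refine h2.trans ?_
  rw [mul_comm]
  exact mul_le_mul_of_nonneg_right (invLog_le _) hE0

lemma abs_primePiMod_sub_le {q a : ℕ} (hq : 0 < q) {y E : ℝ} (hy : 2 ≤ y)
    (hE : ∀ k ≤ ⌊y⌋₊, |psiAP q a k - k / q.totient| ≤ E) :
    |(primePiMod y q a : ℝ) - li y / q.totient| ≤
      3 / 2 * E + 3 * √y * Real.log y + 3 := by
  have hφ : (1 : ℝ) ≤ q.totient := by exact_mod_cast Nat.totient_pos.2 hq
  have h1 := abs_sum_vonMangoldt_invLog_sub_le hy q a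
  have h2 := abs_sum_sub_mul_invLog_le q a _ hE
  have h3 : |(∑ n ∈ Ioc 0 ⌊y⌋₊, invLog n) / q.totient - li y / q.totient| ≤ 3 := by
    rw [← sub_div, abs_div, abs_of_pos (by linarith : (0 : ℝ) < q.totient)]
    exact (div_le_self (abs_nonneg _) hφ).trans (abs_sum_invLog_sub_li_le hy)
  rw [abs_le] at *
  constructor <;> linarith [h1.1, h1.2, h2.1, h2.2, h3.1, h3.2]

lemma abs_primePiMod_sub_le_trivial {q a : ℕ} (hq : 0 < q) {y : ℝ} (hy : 2 ≤ y) :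
    |(primePiMod y q a : ℝ) - li y / q.totient| ≤ 3 / 2 * y := by
  have hφ : (1 : ℝ) ≤ q.totient := by exact_mod_cast Nat.totient_pos.2 hq
  have h1 : (primePiMod y q a : ℝ) ≤ y := by
    rw [primePiMod_eq (by linarith)]
    have h2 := card_filter_le (Ioc 0 ⌊y⌋₊) fun n => n.Prime ∧ n ≡ a [MOD q]
    rw [Nat.card_Ioc, Nat.sub_zero] at h2
    exact (Nat.cast_le.2 h2).trans (Nat.floor_le (by linarith))
  have h2 : (0 : ℝ) ≤ primePiMod y q a := Nat.cast_nonneg _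
  have h3 := integral_invLog_nonneg hy
  have h4 := integral_invLog_le hy
  rw [← li_eq_integral_invLog hy] at h3 h4
  have h5 : li y / q.totient ≤ li y := div_le_self h3 hφ
  have h6 : 0 ≤ li y / q.totient := by positivity
  rw [abs_le]
  constructor <;> linarith

end BombieriVinogradov

namespace BombieriVinogradov
open Finset

/-- The Bombieri–Vinogradov theorem for large `x`, with an integral power of the logarithm. -/
lemma exists_sum_abs_primePiMod_sub_le (K : ℕ) : ∃ B : ℕ, 0 < B ∧ ∃ C : ℝ, 0 < C ∧
    ∃ x₀ : ℝ, 4 ≤ x₀ ∧ ∀ x ≥ x₀, ∀ Q : ℕ, Q * Real.log x ^ B ≤ √x → ∀ (a : ℕ → ℕ) (y : ℕ → ℝ),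
    (∀ q, (a q).Coprime q) → (∀ q, 2 ≤ y q ∧ y q ≤ x) →
    ∑ q ∈ Ioc 0 Q, |(primePiMod (y q) q (a q) : ℝ) - li (y q) / q.totient| ≤
      C * x / Real.log x ^ K := by
  obtain ⟨C, hC, B, Z₀, h⟩ := exists_sum_abs_psiAP_sub_le K
  refine ⟨B + (K + 1), by lia, 6 * C + 6, by positivity,
    max (Real.exp (2 ^ B)) (max 4 Z₀), (le_max_left _ _).trans (le_max_right _ _),
    fun x hx Q hQ a y ha hy => ?_⟩
  have hx1 : Real.exp (2 ^ B) ≤ x := (le_max_left _ _).trans hx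
  have hx4 : 4 ≤ x := (le_max_left _ _).trans ((le_max_right _ _).trans hx)
  have hxZ : (Z₀ : ℝ) ≤ x := (le_max_right _ _).trans ((le_max_right _ _).trans hx)
  have hx0 : 0 < x := by linarith
  have hℓB : 2 ^ B ≤ Real.log x := (Real.le_log_iff_exp_le hx0).2 hx1
  obtain ⟨Z, hZ⟩ : ∃ Z : ℕ, Z = ⌈3 * x⌉₊ := ⟨_, rfl⟩
  have hZ1 : 3 * x ≤ Z := by rw [hZ]; exact Nat.le_ceil _
  have hZ2 : (Z : ℝ) ≤ 4 * x := by
    rw [hZ]; linarith [Nat.ceil_lt_add_one (show (0 : ℝ) ≤ 3 * x by positivity)]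
  have hZ₀ : Z₀ ≤ Z := by exact_mod_cast (by linarith : (Z₀ : ℝ) ≤ Z)
  have hlZ1 : Real.log x ≤ Real.log Z := Real.log_le_log hx0 (by linarith)
  have hlZ2 : Real.log Z ≤ 2 * Real.log x := by
    calc Real.log Z ≤ Real.log (x ^ 2) := Real.log_le_log (by linarith) (by nlinarith)
      _ = _ := by rw [Real.log_pow]; norm_num
  have hlx : Real.log x ≤ x := (Real.log_le_sub_one_of_pos hx0).trans (by linarith)
  have hss : √x * √x = x := Real.mul_self_sqrt hx0.le
  have hs1 : 1 ≤ √x := Real.one_le_sqrt.2 (by linarith)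
  set ℓ := Real.log x with hℓ
  have hℓ1 : 1 ≤ ℓ := le_trans (one_le_pow₀ (by norm_num)) hℓB
  have hQZ : Q * Real.log Z ^ B ≤ √(Z : ℝ) := by
    calc Q * Real.log Z ^ B ≤ Q * (2 * ℓ) ^ B := by gcongr
      _ = Q * (ℓ ^ B * 2 ^ B) := by rw [mul_pow]; ring
      _ ≤ Q * (ℓ ^ B * ℓ ^ (K + 1)) := by
          gcongr
          exact hℓB.trans (le_self_pow₀ hℓ1 (by lia))
      _ = Q * ℓ ^ (B + (K + 1)) := by rw [pow_add ℓ B (K + 1)]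
      _ ≤ √x := hQ
      _ ≤ √(Z : ℝ) := Real.sqrt_le_sqrt (by linarith)
  have hQl : Q * ℓ ^ (K + 1) ≤ √x := by
    exact (mul_le_mul_of_nonneg_left (pow_le_pow_right₀ hℓ1 (Nat.le_add_left _ B))
      (Nat.cast_nonneg Q)).trans hQ
  choose M hM hMmax using fun q => exists_max_image (range (⌊y q⌋₊ + 1))
    (fun k => |psiAP q (a q) k - (k : ℝ) / q.totient|) ⟨0, by simp⟩
  have hMZ : ∀ q, 3 * M q ≤ Z := by
    intro q
    have h1 : (M q : ℝ) ≤ y q := (Nat.le_floor_iff (by linarith [(hy q).1])).1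
      (mem_range_succ_iff.1 (hM q))
    have h2 := (hy q).2
    exact_mod_cast (by linarith : 3 * (M q : ℝ) ≤ Z)
  have hE := h Z hZ₀ Q hQZ a M ha hMZ
  have hterm : ∑ q ∈ Ioc 0 Q, |(primePiMod (y q) q (a q) : ℝ) - li (y q) / q.totient| ≤
      ∑ q ∈ Ioc 0 Q, (3 / 2 * |psiAP q (a q) (M q) - (M q : ℝ) / q.totient| + 6 * √x * ℓ) := by
    refine sum_le_sum fun q hq => ?_
    have h1 := abs_primePiMod_sub_le (mem_Ioc.1 hq).1 (hy q).1
      fun k hk => hMmax q k (mem_range_succ_iff.2 hk)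
    have h2 : √(y q) * Real.log (y q) ≤ √x * ℓ := by
      have h3 : 0 ≤ Real.log (y q) := Real.log_nonneg (by linarith [(hy q).1])
      have h4 : Real.log (y q) ≤ ℓ := Real.log_le_log (by linarith [(hy q).1]) (hy q).2
      have h5 : √(y q) ≤ √x := Real.sqrt_le_sqrt (hy q).2
      gcongr
    have h3 : 1 ≤ √x * ℓ := one_le_mul_of_one_le_of_one_le hs1 hℓ1
    linarith
  refine hterm.trans ?_
  rw [sum_add_distrib, ← mul_sum, sum_const, nsmul_eq_mul, Nat.card_Ioc, Nat.sub_zero]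
  have e1 : C * Z / Real.log Z ^ K ≤ C * (4 * x) / ℓ ^ K := by gcongr
  have e2 : Q * (6 * √x * ℓ) ≤ 6 * x / ℓ ^ K := by
    rw [le_div_iff₀ (by positivity)]
    calc Q * (6 * √x * ℓ) * ℓ ^ K = 6 * √x * (Q * ℓ ^ (K + 1)) := by rw [pow_succ]; ring
      _ ≤ 6 * √x * √x := by gcongr
      _ = 6 * x := by rw [mul_assoc, hss]
  calc _ ≤ 3 / 2 * (C * (4 * x) / ℓ ^ K) + 6 * x / ℓ ^ K := by
        gcongr
        exact hE.trans e1
    _ = _ := by ring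

end BombieriVinogradov

theorem bombieri_vinogradov :
    ∀ A : ℝ, 0 < A → ∃ B : ℝ, 0 < B ∧ ∃ C : ℝ, 0 < C ∧
      ∀ x : ℝ, 2 ≤ x →
        ∀ (a : ℕ → ℕ) (y : ℕ → ℝ),
          (∀ q, Nat.Coprime (a q) q) → (∀ q, 2 ≤ y q ∧ y q ≤ x) →
            ∑ q ∈ Finset.Icc 1 ⌊x ^ ((1:ℝ)/2) * Real.log x ^ (-B)⌋₊,
              |(primePiMod (y q) q (a q) : ℝ) - li (y q) / (Nat.totient q : ℝ)|
            ≤ C * x * Real.log x ^ (-A) := by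
  intro A hA
  obtain ⟨B, hB, C, hC, x₀, hx₀, h⟩ :=
    BombieriVinogradov.exists_sum_abs_primePiMod_sub_le ⌈A⌉₊
  have hL2 : 0 < Real.log 2 := Real.log_pos (by norm_num)
  have hL0 : 0 < Real.log x₀ := Real.log_pos (by linarith)
  set C' : ℝ := √x₀ * Real.log 2 ^ (-(B : ℝ)) * (3 / 2) * Real.log x₀ ^ A with hC'
  refine ⟨B, by exact_mod_cast hB, C + C', by positivity, fun x hx a y ha hy => ?_⟩
  have hx0 : 0 < x := by linarith
  have hℓ : 0 < Real.log x := Real.log_pos (by linarith)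
  rw [← Real.sqrt_eq_rpow, show Finset.Icc 1 ⌊√x * Real.log x ^ (-(B : ℝ))⌋₊ =
    Finset.Ioc 0 ⌊√x * Real.log x ^ (-(B : ℝ))⌋₊ by ext; simp; lia]
  have hQ : (⌊√x * Real.log x ^ (-(B : ℝ))⌋₊ : ℝ) ≤ √x * Real.log x ^ (-(B : ℝ)) :=
    Nat.floor_le (by positivity)
  generalize ⌊√x * Real.log x ^ (-(B : ℝ))⌋₊ = Q at hQ ⊢
  rcases le_or_gt x₀ x with hxx | hxx
  · have hQ' : Q * Real.log x ^ B ≤ √x := by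
      rw [Real.rpow_neg hℓ.le, Real.rpow_natCast, ← div_eq_mul_inv] at hQ
      rwa [← le_div_iff₀ (by positivity)]
    have h1 := h x hxx Q hQ' a y ha hy
    have hℓ1 : 1 ≤ Real.log x := by
      linarith [BombieriVinogradov.one_le_log (by linarith : 3 ≤ x)]
    have h2 : (Real.log x ^ ⌈A⌉₊)⁻¹ ≤ Real.log x ^ (-A) := by
      rw [← Real.rpow_natCast, ← Real.rpow_neg hℓ.le]
      exact Real.rpow_le_rpow_of_exponent_le hℓ1 (neg_le_neg (Nat.le_ceil A))
    calc _ ≤ C * x * (Real.log x ^ ⌈A⌉₊)⁻¹ := by rw [← div_eq_mul_inv]; exact h1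
      _ ≤ (C + C') * x * Real.log x ^ (-A) := by
        gcongr
        exact le_add_of_nonneg_right (by positivity)
  · have h1 : ∀ q ∈ Finset.Ioc 0 Q,
        |(primePiMod (y q) q (a q) : ℝ) - li (y q) / (Nat.totient q : ℝ)| ≤ 3 / 2 * x := by
      intro q hq
      have h2 := BombieriVinogradov.abs_primePiMod_sub_le_trivial (a := a q)
        (Finset.mem_Ioc.1 hq).1 (hy q).1
      linarith [(hy q).2]
    have h2 : Real.log x ^ (-(B : ℝ)) ≤ Real.log 2 ^ (-(B : ℝ)) :=
      Real.rpow_le_rpow_of_nonpos hL2 (Real.log_le_log (by norm_num) hx) (by simp)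
    have h3 : Real.log x₀ ^ (-A) ≤ Real.log x ^ (-A) :=
      Real.rpow_le_rpow_of_nonpos hℓ (Real.log_le_log hx0 hxx.le) (by linarith)
    have h4 : Real.log x₀ ^ A * Real.log x₀ ^ (-A) = 1 := by
      rw [← Real.rpow_add hL0, add_neg_cancel, Real.rpow_zero]
    calc _ ≤ Q * (3 / 2 * x) := by
          refine (Finset.sum_le_sum h1).trans_eq ?_
          rw [Finset.sum_const, nsmul_eq_mul, Nat.card_Ioc, Nat.sub_zero]
      _ ≤ √x₀ * Real.log 2 ^ (-(B : ℝ)) * (3 / 2 * x) := by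
          gcongr
          exact hQ.trans (by gcongr)
      _ = C' * x * Real.log x₀ ^ (-A) := by
          rw [hC', ← mul_one (√x₀ * Real.log 2 ^ (-(B : ℝ)) * (3 / 2 * x)), ← h4]; ring
      _ ≤ (C + C') * x * Real.log x ^ (-A) := by
          gcongr
          exact le_add_of_nonneg_left hC.le
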